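/- Let S be a rational set in the plane and let L be a line in ℝ². If infinitely many points of S lie on L, then all but at most 4 points of S lie on L; that is, the set S \ L has at most 4 elements. -/

import Mathlib

section

open WeierstrassCurve Affine

/-- The curve `y² = x (x - e) (x - e')`. -/
def splitCurve (e e' : ℚ) : WeierstrassCurve.Affine ℚ := ⟨0, -(e + e'), 0, e * e', 0⟩

section splitCurve

variable {e e' : ℚ}

theorem splitCurve_isElliptic (h : e ≠ 0) (h' : e' ≠ 0) (hne : e ≠ e') :
    (splitCurve e e').IsElliptic := by
  refine ⟨?_⟩
  have : (splitCurve e e').Δ = 16 * (e * e' * (e - e')) ^ 2 := by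
    simp only [splitCurve, WeierstrassCurve.Δ, WeierstrassCurve.b₂, WeierstrassCurve.b₄,
      WeierstrassCurve.b₆, WeierstrassCurve.b₈]
    ring
  rw [this, isUnit_iff_ne_zero]
  have := sub_ne_zero.mpr hne
  positivity

theorem splitCurve_equation {x y : ℚ} :
    (splitCurve e e').Equation x y ↔ y ^ 2 = x * (x - e) * (x - e') := by
  rw [equation_iff]
  simp only [splitCurve]
  constructor <;> intro h <;> linear_combination h

theorem splitCurve_some_add_some {x₁ x₂ y₁ y₂ : ℚ} (h₁ : (splitCurve e e').Nonsingular x₁ y₁)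
    (h₂ : (splitCurve e e').Nonsingular x₂ y₂) (hx : x₁ ≠ x₂) :
    ∃ x y h, Point.some x₁ y₁ h₁ + Point.some x₂ y₂ h₂ = Point.some (W' := splitCurve e e') x y h ∧
      x = ((y₁ - y₂) / (x₁ - x₂)) ^ 2 + (e + e') - x₁ - x₂ := by
  refine ⟨_, _, _, Point.add_of_X_ne hx, ?_⟩
  rw [slope_of_X_ne hx]
  simp only [addX, splitCurve]
  ring

theorem splitCurve_some_add_self {x y : ℚ} (h : (splitCurve e e').Nonsingular x y) (hy : y ≠ 0) :
    ∃ x' y' h', Point.some x y h + Point.some x y h = Point.some (W' := splitCurve e e') x' y' h' ∧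
      x' = ((3 * x ^ 2 - 2 * (e + e') * x + e * e') / (2 * y)) ^ 2 + (e + e') - 2 * x ∧
      y' = -((3 * x ^ 2 - 2 * (e + e') * x + e * e') / (2 * y) * (x' - x) + y) := by
  have hn : y ≠ (splitCurve e e').negY x y := by
    simp only [negY, splitCurve]
    intro h0
    apply hy
    linarith
  refine ⟨_, _, _, Point.add_self_of_Y_ne hn, ?_, ?_⟩
  · rw [slope_of_Y_ne rfl hn]
    simp only [addX, splitCurve, negY]
    ring
  · rw [slope_of_Y_ne rfl hn]
    simp only [addX, addY, negAddY, splitCurve, negY]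
    ring

theorem splitCurve_neg_some {x y : ℚ} (h : (splitCurve e e').Nonsingular x y) :
    ∃ h', -Point.some x y h = Point.some (W' := splitCurve e e') x (-y) h' := by
  have : (splitCurve e e').negY x y = -y := by simp [negY, splitCurve]
  have h' : (splitCurve e e').Nonsingular x (-y) := by
    rw [← this]; exact (nonsingular_neg x y).mpr h
  refine ⟨h', ?_⟩
  rw [Point.neg_some]
  congr 1

theorem addSubMap_splitCurve_eval (s t u : ℚ) :
    (fun i => (addSubMap (splitCurve e e') i).eval ![s, t, u]) =
      ![s ^ 2 - 2 * (e * e') * s * u + (e * e') ^ 2 * u ^ 2,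
        2 * t * s - 4 * (e + e') * s * u + 2 * (e * e') * t * u, t ^ 2 - 4 * s * u] := by
  ext i
  fin_cases i <;> (simp [addSubMap, splitCurve, WeierstrassCurve.b₂, WeierstrassCurve.b₄,
    WeierstrassCurve.b₆, WeierstrassCurve.b₈]; try ring)

/-- The polynomial map underlying the parallelogram law, on pairs of points. -/
theorem splitCurve_addSubMap_sym2x [(splitCurve e e').IsElliptic] (P Q : (splitCurve e e').Point) :
    ∃ c : ℚ, c ≠ 0 ∧ (fun i => (addSubMap (splitCurve e e') i).eval (P.sym2x Q)) =
      c • (P + Q).sym2x (P - Q) := by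
  have hself : ∀ P : (splitCurve e e').Point, ∃ c : ℚ, c ≠ 0 ∧
      (fun i => (addSubMap (splitCurve e e') i).eval (P.sym2x P)) = c • (P + P).sym2x (P - P) := by
    rintro (_ | ⟨x, y, h⟩)
    · refine ⟨1, one_ne_zero, ?_⟩
      rw [← Point.zero_def, add_zero, sub_zero, Point.sym2x_zero_zero, addSubMap_splitCurve_eval]
      ext i
      fin_cases i <;> simp
    · have heq := splitCurve_equation.mp h.1
      by_cases hy : y = 0
      · have h2 : Point.some x y h + Point.some x y h = 0 := by
          obtain ⟨h', h''⟩ := splitCurve_neg_some h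
          rw [← eq_neg_iff_add_eq_zero, h'']
          congr 1
          simp [hy]
        have hne : 3 * x ^ 2 - 2 * (e + e') * x + e * e' ≠ 0 := by
          have := ((nonsingular_iff x y).mp h).2
          simp only [splitCurve, hy] at this
          rcases this with h0 | h0
          · intro h1; apply h0; linear_combination -h1
          · simp at h0
        have hsq : (x ^ 2 - e * e') ^ 2 = (3 * x ^ 2 - 2 * (e + e') * x + e * e') ^ 2 := by
          have : x * (x - e) * (x - e') = 0 := by rw [← heq, hy]; ring
          linear_combination (-(8 * x - 4 * (e + e'))) * this
        refine ⟨(x ^ 2 - e * e') ^ 2, by rw [hsq]; positivity, ?_⟩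
        have h0 : x * (x - e) * (x - e') = 0 := by rw [← heq, hy]; ring
        rw [h2, sub_self, Point.sym2x_zero_zero, Point.sym2x_some_some, addSubMap_splitCurve_eval]
        ext i
        fin_cases i <;> simp
        · ring
        · linear_combination 4 * h0
        · ring
      · obtain ⟨x', y', h', hadd, hx', -⟩ := splitCurve_some_add_self h hy
        refine ⟨4 * y ^ 2, by positivity, ?_⟩
        rw [hadd, sub_self, Point.sym2x_some_zero, Point.sym2x_some_some, addSubMap_splitCurve_eval]
        have hx'' : x' * (4 * y ^ 2) = (x ^ 2 - e * e') ^ 2 := by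
          rw [hx']
          field_simp
          linear_combination (-(32 * x - 16 * (e + e'))) * heq
        ext i
        fin_cases i <;> simp
        · linear_combination -hx''
        · linear_combination -4 * heq
        · ring
  rcases P with _ | ⟨x₁, y₁, h₁⟩
  · refine ⟨1, one_ne_zero, ?_⟩
    rw [← Point.zero_def, zero_add, zero_sub, Point.sym2x_neg_right]
    rcases Q with _ | ⟨x₂, y₂, h₂⟩
    · rw [← Point.zero_def, Point.sym2x_zero_zero, addSubMap_splitCurve_eval]
      ext i
      fin_cases i <;> simp
    · rw [Point.sym2x_zero_some, Point.sym2x_some_some, addSubMap_splitCurve_eval]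
      ext i
      fin_cases i <;> simp <;> ring
  rcases Q with _ | ⟨x₂, y₂, h₂⟩
  · refine ⟨1, one_ne_zero, ?_⟩
    rw [← Point.zero_def, add_zero, sub_zero, Point.sym2x_some_zero, Point.sym2x_some_some,
      addSubMap_splitCurve_eval]
    ext i
    fin_cases i <;> simp <;> ring
  by_cases hx : x₁ = x₂
  · rcases Point.X_eq_iff.mp hx with h | h
    · exact h ▸ hself _
    · obtain ⟨c, hc, hc'⟩ := hself (Point.some x₁ y₁ h₁)
      refine ⟨c, hc, ?_⟩
      have h' : Point.some x₂ y₂ h₂ = -Point.some x₁ y₁ h₁ := by rw [h, neg_neg]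
      rw [h', Point.sym2x_neg_right, hc', sub_neg_eq_add, ← sub_eq_add_neg,
        Point.sym2x_comm (_ + _)]
  · have e1 := splitCurve_equation.mp h₁.1
    have e2 := splitCurve_equation.mp h₂.1
    obtain ⟨x, y, h, hadd, hX⟩ := splitCurve_some_add_some h₁ h₂ hx
    obtain ⟨h₂', hneg⟩ := splitCurve_neg_some h₂
    obtain ⟨x', y', h', hadd', hX'⟩ := splitCurve_some_add_some h₁ h₂' hx
    have hd := sub_ne_zero.mpr hx
    have hd2 := pow_ne_zero 2 hd
    refine ⟨(x₁ - x₂) ^ 2, hd2, ?_⟩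
    rw [sub_eq_add_neg (Point.some x₁ y₁ h₁), hneg, hadd, hadd', Point.sym2x_some_some,
      Point.sym2x_some_some, addSubMap_splitCurve_eval]
    have hX1 : x * (x₁ - x₂) ^ 2 = (y₁ - y₂) ^ 2 + (e + e' - x₁ - x₂) * (x₁ - x₂) ^ 2 := by
      rw [hX]; field_simp; ring
    have hX2 : x' * (x₁ - x₂) ^ 2 = (y₁ + y₂) ^ 2 + (e + e' - x₁ - x₂) * (x₁ - x₂) ^ 2 := by
      rw [hX']; field_simp; ring
    have hsum : (x₁ - x₂) ^ 2 * (x + x') =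
        2 * (x₁ * x₂ + e * e') * (x₁ + x₂) - 4 * (e + e') * x₁ * x₂ := by
      linear_combination hX1 + hX2 + 2 * e1 + 2 * e2
    have hprod : (x₁ - x₂) ^ 2 * (x * x') = (x₁ * x₂ - e * e') ^ 2 := by
      apply mul_left_cancel₀ hd2
      have : (x₁ - x₂) ^ 2 * ((x₁ - x₂) ^ 2 * (x * x')) =
        (x * (x₁ - x₂) ^ 2) * (x' * (x₁ - x₂) ^ 2) := by ring
      rw [this, hX1, hX2]
      have : ((y₁ - y₂) ^ 2 + (e + e' - x₁ - x₂) * (x₁ - x₂) ^ 2) *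
          ((y₁ + y₂) ^ 2 + (e + e' - x₁ - x₂) * (x₁ - x₂) ^ 2) =
          (y₁ ^ 2 - y₂ ^ 2) ^ 2 + (e + e' - x₁ - x₂) * (x₁ - x₂) ^ 2 * (2 * y₁ ^ 2 + 2 * y₂ ^ 2) +
          ((e + e' - x₁ - x₂) * (x₁ - x₂) ^ 2) ^ 2 := by ring
      rw [this, e1, e2]
      ring
    ext i
    fin_cases i
    · simp
      linear_combination -hprod
    · simp
      linear_combination -hsum
    · simp
      ring

/-- The naive logarithmic height of the `x`-coordinate of a point. -/
noncomputable def xHeight (P : (splitCurve e e').Point) : ℝ := Height.logHeight P.xRep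

theorem xHeight_nonneg (P : (splitCurve e e').Point) : 0 ≤ xHeight P := Height.logHeight_nonneg _

theorem xHeight_some {x y : ℚ} (h : (splitCurve e e').Nonsingular x y) :
    xHeight (Point.some x y h) = Height.logHeight₁ x := by
  rw [xHeight, Point.xRep_some, Height.logHeight₁_eq_logHeight]

theorem exists_xHeight_parallelogram [(splitCurve e e').IsElliptic] :
    ∃ C : ℝ, ∀ P Q : (splitCurve e e').Point,
      |xHeight (P + Q) + xHeight (P - Q) - 2 * (xHeight P + xHeight Q)| ≤ C := by
  obtain ⟨C₁, h₁⟩ := abs_logHeight_addSubMap_sub_two_mul_logHeight_le (splitCurve e e')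
  obtain ⟨C₂, h₂⟩ := Height.abs_logHeight_sym2_sub_le ℚ
  have hsym : ∀ P Q : (splitCurve e e').Point,
      |Height.logHeight (P.sym2x Q) - (xHeight P + xHeight Q)| ≤ C₂ := by
    intro P Q
    have hv : ∀ R : (splitCurve e e').Point, ![R.xRep 0, R.xRep 1] = R.xRep := by
      intro R; ext i; fin_cases i <;> rfl
    have := h₂ (a := P.xRep 0) (b := P.xRep 1) (c := Q.xRep 0) (d := Q.xRep 1)
      (by rw [hv]; exact Point.xRep_ne_zero P) (by rw [hv]; exact Point.xRep_ne_zero Q)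
    rw [hv, hv] at this
    exact this
  refine ⟨C₁ + 3 * C₂, fun P Q => ?_⟩
  obtain ⟨c, hc, hc'⟩ := splitCurve_addSubMap_sym2x P Q
  have h3 := h₁ (P.sym2x Q)
  rw [hc', Height.logHeight_smul_eq_logHeight _ hc] at h3
  have h4 := hsym P Q
  have h5 := hsym (P + Q) (P - Q)
  rw [abs_le] at *
  constructor <;> linarith [h3.1, h3.2, h4.1, h4.2, h5.1, h5.2]

instance : Northcott (xHeight (e := e) (e' := e')) where
  finite_le B := by
    have hfin := NumberField.finite_setOfPred_logHeight₁_le ℚ B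
    have hsub : {P : (splitCurve e e').Point | xHeight P ≤ B} ⊆
        Point.xRep ⁻¹' (insert ![1, 0] ((fun x : ℚ => ![x, 1]) '' {x : ℚ | Height.logHeight₁ x ≤ B})) := by
      rintro (_ | ⟨x, y, h⟩) hP
      · left; rfl
      · right
        exact ⟨x, by simpa [xHeight_some] using hP, (Point.xRep_some h).symm⟩
    refine Set.Finite.subset (Set.Finite.preimage' ((hfin.image _).insert _) fun v _ => ?_) hsub
    by_cases hv : ∃ P : (splitCurve e e').Point, P.xRep = v
    · obtain ⟨P, rfl⟩ := hv
      refine Set.Finite.subset (Set.toFinite {P, -P}) fun Q hQ => ?_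
      exact Point.xRep_eq_xRep_iff.mp hQ
    · refine Set.Finite.subset Set.finite_empty fun Q hQ => (hv ⟨Q, hQ⟩).elim

end splitCurve

theorem isSquare_of_pos_of_even_padicValRat {x : ℚ} (hx : 0 < x)
    (h : ∀ p : ℕ, p.Prime → Even (padicValRat p x)) : IsSquare x := by
  obtain ⟨n, hn⟩ : ∃ n : ℕ, (n : ℚ) = x.num * x.den := ⟨(x.num * x.den).toNat, by
    have : (0 : ℤ) ≤ x.num * x.den := by have := Rat.num_pos.mpr hx; positivity
    have h2 := Int.toNat_of_nonneg this
    exact_mod_cast h2⟩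
  have hxn : x * (x.den : ℚ) ^ 2 = n := by
    rw [hn]; nth_rewrite 1 [← Rat.num_div_den x]; field_simp
  have hden : (x.den : ℚ) ≠ 0 := by simp
  have hn0 : n ≠ 0 := by
    rintro rfl
    have : 0 < x * (x.den : ℚ) ^ 2 := by positivity
    simp [hxn] at this
  have hsq : IsSquare n := by
    obtain ⟨a, b, ha, hb, hab, has⟩ := Nat.sq_mul_squarefree_of_pos (Nat.pos_of_ne_zero hn0)
    by_cases ha1 : a = 1
    · exact ⟨b, by rw [← hab, ha1]; ring⟩
    · exfalso
      obtain ⟨p, hp, hpa⟩ := Nat.exists_prime_and_dvd ha1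
      have : Fact p.Prime := ⟨hp⟩
      have h1 : padicValNat p a = 1 := by
        refine le_antisymm ?_ (one_le_padicValNat_of_dvd ha.ne' hpa)
        have := (Nat.squarefree_iff_factorization_le_one ha.ne').mp has p
        rwa [Nat.factorization_def _ hp] at this
      have h2 := congrArg (padicValRat p) hxn
      have hb0 : (b : ℚ) ≠ 0 := by exact_mod_cast hb.ne'
      have ha0 : (a : ℚ) ≠ 0 := by exact_mod_cast ha.ne'
      rw [padicValRat.mul hx.ne' (pow_ne_zero 2 hden), padicValRat.pow, ← hab] at h2
      push_cast at h2
      rw [padicValRat.mul (pow_ne_zero 2 hb0) ha0, padicValRat.pow] at h2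
      simp only [padicValRat.of_nat, h1] at h2
      obtain ⟨t, ht⟩ := h p hp
      push_cast at h2
      omega
  obtain ⟨m, hm⟩ := hsq
  refine ⟨m / x.den, ?_⟩
  field_simp
  rw [hxn, hm]; push_cast; ring

theorem even_padicValRat_of_isSquare_mul {p : ℕ} [Fact p.Prime] {u v w : ℚ} (hu : u ≠ 0)
    (hv : v ≠ 0) (hw : w ≠ 0) (h : IsSquare (u * v * w)) (huv : v - u ≠ 0) (huw : w - u ≠ 0)
    (hpv : padicValRat p (v - u) = 0) (hpw : padicValRat p (w - u) = 0) :
    Even (padicValRat p u) := by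
  obtain ⟨y, hy⟩ := h
  have hy0 : y ≠ 0 := by rintro rfl; simp [hu, hv, hw] at hy
  have hval := congrArg (padicValRat p) hy
  rw [padicValRat.mul (mul_ne_zero hu hv) hw, padicValRat.mul hu hv,
    padicValRat.mul hy0 hy0] at hval
  have key : ∀ v : ℚ, v ≠ 0 → v - u ≠ 0 → padicValRat p (v - u) = 0 →
      padicValRat p u ≠ 0 → padicValRat p v = min (padicValRat p u) 0 := by
    intro v hv hvu hp h0
    have := padicValRat.add_eq_min (p := p) (q := u) (r := v - u) (by simpa using hv) hu hvu
      (by rwa [hp])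
    rwa [add_sub_cancel, hp] at this
  by_cases h0 : padicValRat p u = 0
  · simp [h0]
  · have h1 := key v hv huv hpv h0
    have h2 := key w hw huw hpw h0
    rcases le_total (padicValRat p u) 0 with h3 | h3
    · rw [min_eq_left h3] at h1 h2
      rw [Int.even_iff]; omega
    · rw [min_eq_right h3] at h1 h2
      rw [Int.even_iff]; omega

section splitCurve

variable {e e' : ℚ}

theorem exists_add_self_eq_of_isSquare (he : e ≠ 0) (he' : e' ≠ 0) (hee : e ≠ e') {x y : ℚ}
    (h : (splitCurve e e').Nonsingular x y) (h₁ : IsSquare x) (h₂ : IsSquare (x - e))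
    (h₃ : IsSquare (x - e')) : ∃ R, R + R = Point.some x y h := by
  have := splitCurve_isElliptic he he' hee
  obtain ⟨r, hr⟩ := h₁
  obtain ⟨s, hs⟩ := h₂
  obtain ⟨t, ht⟩ := h₃
  have hrs : r + s ≠ 0 := by
    intro h; apply he
    linear_combination hr - hs + (r - s) * h
  have hrt : r + t ≠ 0 := by
    intro h; apply he'
    linear_combination hr - ht + (r - t) * h
  have hst : s + t ≠ 0 := by
    intro h; apply hee
    linear_combination ht - hs - (s - t) * h
  have hy : (r + s) * (r + t) * (s + t) ≠ 0 := mul_ne_zero (mul_ne_zero hrs hrt) hst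
  have hE : e = r * r - s * s := by linear_combination hr - hs
  have hE' : e' = r * r - t * t := by linear_combination hr - ht
  have heq : (splitCurve e e').Equation ((r + s) * (r + t)) ((r + s) * (r + t) * (s + t)) := by
    rw [splitCurve_equation, hE, hE']
    ring
  have hns : (splitCurve e e').Nonsingular ((r + s) * (r + t)) ((r + s) * (r + t) * (s + t)) :=
    (equation_iff_nonsingular).mp heq
  obtain ⟨x', y', h', hadd, hx', -⟩ := splitCurve_some_add_self hns hy
  have hslope : (3 * ((r + s) * (r + t)) ^ 2 - 2 * (e + e') * ((r + s) * (r + t)) + e * e') /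
      (2 * ((r + s) * (r + t) * (s + t))) = r + s + t := by
    rw [div_eq_iff (by positivity), hE, hE']
    ring
  have hxx : x' = x := by
    rw [hx', hslope, hr, hE, hE']; ring
  have hcase := Point.X_eq_iff (h₁ := h') (h₂ := h) |>.mp hxx
  rw [← hadd] at hcase
  rcases hcase with h1 | h1
  · exact ⟨_, h1⟩
  · exact ⟨-Point.some _ _ hns, by rw [← neg_add, h1, neg_neg]⟩

theorem isSquare_of_mul_eq_sq {a b c : ℚ} (h : a * b = c ^ 2) (hb : IsSquare b) (hb0 : b ≠ 0) :
    IsSquare a := by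
  obtain ⟨s, hs⟩ := hb
  have hs0 : s ≠ 0 := by rintro rfl; simp at hs; exact hb0 hs
  refine ⟨c / s, ?_⟩
  field_simp
  rw [pow_two s, ← hs, h]

theorem exists_add_self_eq_sub (he : e ≠ 0) (he' : e' ≠ 0) (hee : e ≠ e') {x₁ y₁ x₂ y₂ : ℚ}
    (h₁ : (splitCurve e e').Nonsingular x₁ y₁) (h₂ : (splitCurve e e').Nonsingular x₂ y₂)
    (hy₁ : y₁ ≠ 0) (hy₂ : y₂ ≠ 0)
    (hs : ∀ c : ℚ, c * (c - e) * (c - e') = 0 → IsSquare ((x₁ - c) * (x₂ - c))) :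
    ∃ R, R + R = Point.some x₁ y₁ h₁ - Point.some x₂ y₂ h₂ := by
  have := splitCurve_isElliptic he he' hee
  have e1 := splitCurve_equation.mp h₁.1
  have e2 := splitCurve_equation.mp h₂.1
  by_cases hx : x₁ = x₂
  · rcases (Point.X_eq_iff (h₁ := h₁) (h₂ := h₂)).mp hx with h | h
    · exact ⟨0, by rw [h, sub_self, add_zero]⟩
    · exact ⟨Point.some x₁ y₁ h₁, by rw [h, sub_eq_add_neg]⟩
  · obtain ⟨h₂', hneg⟩ := splitCurve_neg_some h₂
    obtain ⟨x, y, h, hadd, hX⟩ := splitCurve_some_add_some h₁ h₂' hx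
    rw [sub_eq_add_neg (Point.some x₁ y₁ h₁), hneg, hadd]
    obtain ⟨l, hl⟩ : ∃ l, l = (y₁ - -y₂) / (x₁ - x₂) := ⟨_, rfl⟩
    rw [← hl] at hX
    have hd := sub_ne_zero.mpr hx
    have hl' : l * (x₁ - x₂) = y₁ + y₂ := by rw [hl, div_mul_cancel₀ _ hd]; ring
    have hsq : ∀ c : ℚ, c * (c - e) * (c - e') = 0 → IsSquare (x - c) := by
      intro c hc
      have hy2' : -y₂ = l * (x₂ - x₁) + y₁ := by linear_combination hl'
      have e2' : (l * (x₂ - x₁) + y₁) ^ 2 = x₂ * (x₂ - e) * (x₂ - e') := by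
        rw [← hy2', ← e2]; ring
      refine isSquare_of_mul_eq_sq (c := l * (c - x₁) + y₁) (b := (x₁ - c) * (x₂ - c)) ?_
        (hs c hc) ?_
      · apply mul_left_cancel₀ hd
        rw [hX]
        linear_combination (x₂ - x₁) * hc - (c - x₂) * e1 + (c - x₁) * e2'
      · refine mul_ne_zero ?_ ?_
        · intro h0; apply hy₁
          rw [sub_eq_zero] at h0
          rw [← h0, ← e1] at hc
          exact pow_eq_zero_iff two_ne_zero |>.mp hc
        · intro h0; apply hy₂
          rw [sub_eq_zero] at h0
          rw [← h0, ← e2] at hc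
          exact pow_eq_zero_iff two_ne_zero |>.mp hc
    refine exists_add_self_eq_of_isSquare he he' hee h ?_ (hsq e (by simp)) (hsq e' (by simp))
    simpa using hsq 0 (by simp)

theorem splitCurve_y_eq_zero_iff {x y : ℚ} (h : (splitCurve e e').Nonsingular x y) :
    y = 0 ↔ x * (x - e) * (x - e') = 0 := by
  rw [← splitCurve_equation.mp h.1, pow_eq_zero_iff two_ne_zero]

theorem splitCurve_isSquare_mul (e e' : ℤ) {x₁ y₁ x₂ y₂ : ℚ}
    (h₁ : (splitCurve (e : ℚ) e').Nonsingular x₁ y₁)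
    (h₂ : (splitCurve (e : ℚ) e').Nonsingular x₂ y₂) (hy₁ : y₁ ≠ 0) (hy₂ : y₂ ≠ 0)
    (hee : e * e' * (e - e') ≠ 0)
    (hsgn : ∀ c : ℚ, c ∈ ({0, (e : ℚ), (e' : ℚ)} : Set ℚ) → (0 < x₁ - c ↔ 0 < x₂ - c))
    (hpar : ∀ c : ℚ, c ∈ ({0, (e : ℚ), (e' : ℚ)} : Set ℚ) → ∀ p ∈ (e * e' * (e - e')).natAbs.primeFactors,
      (Even (padicValRat p (x₁ - c)) ↔ Even (padicValRat p (x₂ - c))))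
    (c : ℚ) (hc : c ∈ ({0, (e : ℚ), (e' : ℚ)} : Set ℚ)) : IsSquare ((x₁ - c) * (x₂ - c)) := by
  have hne : ∀ {x y : ℚ}, (splitCurve (e : ℚ) e').Nonsingular x y → y ≠ 0 →
      ∀ c ∈ ({0, (e : ℚ), (e' : ℚ)} : Set ℚ), x - c ≠ 0 := by
    intro x y h hy c hc h0
    apply hy
    rw [splitCurve_y_eq_zero_iff h, sub_eq_zero.mp h0]
    rcases hc with rfl | rfl | rfl <;> simp
  have hx1 := hne h₁ hy₁ c hc
  have hx2 := hne h₂ hy₂ c hc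
  refine isSquare_of_pos_of_even_padicValRat ?_ fun p hp => ?_
  · rcases lt_or_gt_of_ne hx1 with h | h
    · refine mul_pos_of_neg_of_neg h (lt_of_le_of_ne (not_lt.mp fun h' => ?_) hx2)
      exact (lt_asymm h) ((hsgn c hc).mpr h')
    · exact mul_pos h ((hsgn c hc).mp h)
  have : Fact p.Prime := ⟨hp⟩
  rw [padicValRat.mul hx1 hx2, Int.even_add]
  by_cases hpS : p ∈ (e * e' * (e - e')).natAbs.primeFactors
  · exact hpar c hc p hpS
  have hpe : ∀ d : ℤ, d ∣ e * e' * (e - e') → padicValRat p (d : ℚ) = 0 := by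
    intro d hd
    rw [padicValRat.of_int, padicValInt.eq_zero_of_not_dvd]
    · simp
    · intro hpd
      apply hpS
      rw [Nat.mem_primeFactors]
      exact ⟨hp, Int.natCast_dvd.mp (hpd.trans hd), Int.natAbs_ne_zero.mpr hee⟩
  have hd1 : padicValRat p (e : ℚ) = 0 := hpe e (Dvd.intro _ (mul_assoc e e' (e - e')).symm)
  have hd2 : padicValRat p (e' : ℚ) = 0 := hpe e' ⟨e * (e - e'), by ring⟩
  have hd3 : padicValRat p ((e : ℚ) - e') = 0 := by
    have := hpe (e - e') ⟨e * e', by ring⟩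
    push_cast at this; exact this
  have hd3' : padicValRat p ((e' : ℚ) - e) = 0 := by rw [← neg_sub, padicValRat.neg, hd3]
  have he0 : (e : ℚ) ≠ 0 := by rintro h; apply hee; simp [Int.cast_eq_zero.mp h]
  have he'0 : (e' : ℚ) ≠ 0 := by rintro h; apply hee; simp [Int.cast_eq_zero.mp h]
  have hde : (e : ℚ) - e' ≠ 0 := by
    intro h; apply hee
    have : e - e' = 0 := by exact_mod_cast h
    rw [this, mul_zero]
  have hde' : (e' : ℚ) - e ≠ 0 := by rw [← neg_sub]; exact neg_ne_zero.mpr hde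
  have key : ∀ {x y : ℚ}, (splitCurve (e : ℚ) e').Nonsingular x y → y ≠ 0 →
      Even (padicValRat p (x - c)) := by
    intro x y h hy
    have heq := splitCurve_equation.mp h.1
    have n1 := hne h hy 0 (by simp)
    have n2 := hne h hy e (by simp)
    have n3 := hne h hy e' (by simp)
    rw [sub_zero] at n1
    rcases hc with rfl | rfl | rfl
    · rw [sub_zero]
      refine even_padicValRat_of_isSquare_mul n1 n2 n3 ⟨y, by rw [← heq]; ring⟩ ?_ ?_ ?_ ?_
      · simpa using he0
      · simpa using he'0
      · simpa using hd1
      · simpa using hd2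
    · refine even_padicValRat_of_isSquare_mul n2 n1 n3 ⟨y, by linear_combination -heq⟩ ?_ ?_ ?_ ?_
      · simpa using he0
      · simpa using hde
      · simpa using hd1
      · simpa using hd3
    · refine even_padicValRat_of_isSquare_mul n3 n1 n2 ⟨y, by linear_combination -heq⟩ ?_ ?_ ?_ ?_
      · simpa using he'0
      · simpa using hde'
      · simpa using hd2
      · simpa using hd3'
  simp [key h₁ hy₁, key h₂ hy₂]

open Classical in
/-- The invariants of a point of `splitCurve e e'` that decide divisibility by two. -/
noncomputable def descentInvariant (e e' : ℤ) : (splitCurve (e : ℚ) e').Point →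
    Option (Option ℚ) × (Fin 3 → Bool) × (Fin 3 → (e * e' * (e - e')).natAbs.primeFactors → Bool)
  | .zero => (none, fun _ => false, fun _ _ => false)
  | .some x y _ => (some (if y = 0 then some x else none),
      fun i => decide (0 < x - ![(0 : ℚ), e, e'] i),
      fun i p => decide (Even (padicValRat p (x - ![(0 : ℚ), e, e'] i))))

theorem finite_range_descentInvariant (e e' : ℤ) : (Set.range (descentInvariant e e')).Finite := by
  refine Set.Finite.subset (s := ({none, some none, some (some 0), some (some (e : ℚ)),
    some (some (e' : ℚ))} : Set (Option (Option ℚ))) ×ˢ Set.univ)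
    (Set.Finite.prod (Set.toFinite _) Set.finite_univ) ?_
  rintro _ ⟨P, rfl⟩
  refine ⟨?_, trivial⟩
  rcases P with _ | ⟨x, y, h⟩
  · left; rfl
  · simp only [descentInvariant]
    split_ifs with hy
    · rw [splitCurve_y_eq_zero_iff h] at hy
      rcases mul_eq_zero.mp hy with hy | hy
      · rcases mul_eq_zero.mp hy with hy | hy
        · simp [hy]
        · simp [sub_eq_zero.mp hy]
      · simp [sub_eq_zero.mp hy]
    · simp

theorem exists_add_self_of_descentInvariant_eq (e e' : ℤ) (hee : e * e' * (e - e') ≠ 0)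
    (P Q : (splitCurve (e : ℚ) e').Point) (h : descentInvariant e e' P = descentInvariant e e' Q) :
    ∃ R, R + R = P - Q := by
  have he0 : (e : ℚ) ≠ 0 := by rintro h; apply hee; simp [Int.cast_eq_zero.mp h]
  have he'0 : (e' : ℚ) ≠ 0 := by rintro h; apply hee; simp [Int.cast_eq_zero.mp h]
  have hde : (e : ℚ) ≠ e' := by
    intro h; apply hee
    have : e = e' := by exact_mod_cast h
    rw [this, sub_self, mul_zero]
  rcases P with _ | ⟨x₁, y₁, h₁⟩ <;> rcases Q with _ | ⟨x₂, y₂, h₂⟩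
  · exact ⟨0, by simp⟩
  · simp [descentInvariant] at h
  · simp [descentInvariant] at h
  · simp only [descentInvariant, Prod.mk.injEq, Option.some.injEq] at h
    obtain ⟨ha, hb, hc⟩ := h
    by_cases hy₁ : y₁ = 0
    · by_cases hy₂ : y₂ = 0
      · simp only [hy₁, hy₂, if_true, Option.some.injEq] at ha
        subst ha hy₁ hy₂
        exact ⟨0, by rw [sub_self, add_zero]⟩
      · simp [hy₁, hy₂] at ha
    · by_cases hy₂ : y₂ = 0
      · simp [hy₁, hy₂] at ha
      · have hcase : ∀ c : ℚ, c ∈ ({0, (e : ℚ), (e' : ℚ)} : Set ℚ) →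
            ∃ i, c = ![(0 : ℚ), e, e'] i := by
          rintro c (rfl | rfl | rfl)
          · exact ⟨0, rfl⟩
          · exact ⟨1, rfl⟩
          · exact ⟨2, rfl⟩
        refine exists_add_self_eq_sub he0 he'0 hde h₁ h₂ hy₁ hy₂ fun c hc0 => ?_
        refine splitCurve_isSquare_mul e e' h₁ h₂ hy₁ hy₂ hee ?_ ?_ c ?_
        · intro c hc'
          obtain ⟨i, rfl⟩ := hcase c hc'
          exact decide_eq_decide.mp (congrFun hb i)
        · intro c hc' p hp
          obtain ⟨i, rfl⟩ := hcase c hc'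
          exact decide_eq_decide.mp (congrFun (congrFun hc i) ⟨p, hp⟩)
        · rcases mul_eq_zero.mp hc0 with h | h
          · rcases mul_eq_zero.mp h with h | h
            · exact Or.inl h
            · exact Or.inr (Or.inl (sub_eq_zero.mp h))
          · exact Or.inr (Or.inr (sub_eq_zero.mp h))

/-- The Mordell–Weil theorem for `y² = x (x - e) (x - e')`. -/
theorem splitCurve_point_fg (e e' : ℤ) (hee : e * e' * (e - e') ≠ 0) :
    AddGroup.FG (splitCurve (e : ℚ) e').Point := by
  have he0 : (e : ℚ) ≠ 0 := by rintro h; apply hee; simp [Int.cast_eq_zero.mp h]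
  have he'0 : (e' : ℚ) ≠ 0 := by rintro h; apply hee; simp [Int.cast_eq_zero.mp h]
  have hde : (e : ℚ) ≠ e' := by
    intro h; apply hee
    have : e = e' := by exact_mod_cast h
    rw [this, sub_self, mul_zero]
  have := splitCurve_isElliptic he0 he'0 hde
  obtain ⟨C, hC⟩ := exists_xHeight_parallelogram (e := (e : ℚ)) (e' := e')
  refine AddCommGroup.fg_of_descent' (h := xHeight) (C := C) ?_ xHeight_nonneg hC
  have hfin : Finite ((splitCurve (e : ℚ) e').Point ⧸
      (nsmulAddMonoidHom (α := (splitCurve (e : ℚ) e').Point) 2).range) := by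
    have := (finite_range_descentInvariant e e').to_subtype
    refine Finite.of_injective
      (fun a => (⟨descentInvariant e e' a.out, ⟨_, rfl⟩⟩ : Set.range (descentInvariant e e'))) ?_
    intro a b hab
    obtain ⟨R, hR⟩ := exists_add_self_of_descentInvariant_eq e e' hee b.out a.out
      (congrArg Subtype.val hab).symm
    rw [← QuotientAddGroup.out_eq' a, ← QuotientAddGroup.out_eq' b, QuotientAddGroup.eq]
    refine ⟨R, ?_⟩
    rw [nsmulAddMonoidHom_apply, two_nsmul, hR]
    abel
  exact AddSubgroup.finiteIndex_of_finite_quotient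

end splitCurve

end

section

open Filter Topology

section CanonicalHeight

variable {G : Type*} [AddCommGroup G] {h : G → ℝ} {C : ℝ}

/-- A function satisfying the parallelogram law up to a bounded error is at bounded distance of
one satisfying it exactly. -/
theorem exists_parallelogram_of_abs_le (h0 : ∀ x, 0 ≤ h x)
    (hC : ∀ x y, |h (x + y) + h (x - y) - 2 * (h x + h y)| ≤ C) :
    ∃ q : G → ℝ, (∀ x, 0 ≤ q x) ∧ (∀ x y, q (x + y) + q (x - y) = 2 * (q x + q y)) ∧
      ∃ D, ∀ x, |q x - h x| ≤ D := by
  have h2 : ∀ x, |h (2 • x) - 4 * h x| ≤ C + h 0 := by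
    intro x
    have := hC x x
    rw [sub_self, ← two_nsmul, abs_le] at this
    have h00 := h0 0
    rw [abs_le]
    constructor <;> linarith [this.1, this.2]
  set D := C + h 0 with hD
  set s : G → ℕ → ℝ := fun x n => h ((2 ^ n) • x) / 4 ^ n with hs
  have hstep : ∀ x n, dist (s x n) (s x (n + 1)) ≤ D / 4 / 1 * (1 / 4) ^ n := by
    intro x n
    have := h2 ((2 ^ n) • x)
    rw [← mul_nsmul', ← pow_succ'] at this
    rw [dist_comm, Real.dist_eq, hs]
    have heq : h ((2 ^ (n + 1)) • x) / 4 ^ (n + 1) - h ((2 ^ n) • x) / 4 ^ n =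
        (h ((2 ^ (n + 1)) • x) - 4 * h ((2 ^ n) • x)) / 4 ^ (n + 1) := by
      rw [pow_succ (4 : ℝ)]; field_simp
    simp only
    rw [heq, abs_div, abs_of_pos (by positivity : (0 : ℝ) < 4 ^ (n + 1)), one_div, inv_pow,
      div_le_iff₀ (by positivity)]
    calc _ ≤ D := this
      _ = _ := by rw [pow_succ]; field_simp
  have hcau : ∀ x, CauchySeq (s x) := fun x =>
    cauchySeq_of_le_geometric (1 / 4) (D / 4 / 1) (by norm_num) (hstep x)
  choose q hq using fun x => cauchySeq_tendsto_of_complete (hcau x)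
  refine ⟨q, fun x => ?_, fun x y => ?_, D / 4 / 1 / (1 - 1 / 4), fun x => ?_⟩
  · exact ge_of_tendsto' (hq x) fun n => div_nonneg (h0 _) (by positivity)
  · have hl := ((hq (x + y)).add (hq (x - y))).sub (((hq x).add (hq y)).const_mul 2)
    have hz : Tendsto (fun n : ℕ => C * (1 / 4 : ℝ) ^ n) atTop (𝓝 0) := by
      simpa using (tendsto_pow_atTop_nhds_zero_of_lt_one (by norm_num : (0 : ℝ) ≤ 1 / 4)
        (by norm_num)).const_mul C
    have hl0 := squeeze_zero_norm (f := fun n => s (x + y) n + s (x - y) n - 2 * (s x n + s y n))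
      (fun n => ?_) hz
    · exact sub_eq_zero.mp (tendsto_nhds_unique hl hl0)
    · have := hC ((2 ^ n) • x) ((2 ^ n) • y)
      rw [← smul_add, ← nsmul_sub] at this
      rw [Real.norm_eq_abs, hs]
      have heq : h ((2 ^ n) • (x + y)) / 4 ^ n + h ((2 ^ n) • (x - y)) / 4 ^ n -
          2 * (h ((2 ^ n) • x) / 4 ^ n + h ((2 ^ n) • y) / 4 ^ n) =
          (h ((2 ^ n) • (x + y)) + h ((2 ^ n) • (x - y)) -
            2 * (h ((2 ^ n) • x) + h ((2 ^ n) • y))) / 4 ^ n := by field_simp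
      simp only
      rw [heq, abs_div, abs_of_pos (by positivity : (0 : ℝ) < 4 ^ n), one_div, inv_pow,
        ← div_eq_mul_inv]
      gcongr
  · have := dist_le_of_le_geometric_of_tendsto₀ (1 / 4) (D / 4 / 1) (by norm_num) (hstep x) (hq x)
    rw [dist_comm, Real.dist_eq] at this
    simpa [hs] using this

variable {q : G → ℝ}

/-- The polar form of a function satisfying the parallelogram law is additive. -/
theorem polar_add_of_parallelogram (hq : ∀ x y, q (x + y) + q (x - y) = 2 * (q x + q y))
    (x y z : G) : q (x + y + z) - q (x + y) - q z = (q (x + z) - q x - q z) +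
      (q (y + z) - q y - q z) := by
  have h1 := hq (x + z) y
  have h2 := hq (x - y) z
  have h3 := hq x y
  have h4 := hq (x + z) (y + z)
  have h5 := hq (x + y + z) z
  have h6 := hq x (y + z)
  have h7 := hq y z
  have h8 := hq x z
  have h9 := hq (x - z) y
  have h10 := hq (x + y) z
  have r1 : x + z + y = x + y + z := by abel
  have r2 : x + z - y = x - y + z := by abel
  have r3 : x + z + (y + z) = x + y + z + z := by abel
  have r4 : x + z - (y + z) = x - y := by abel
  have r5 : x + y + z - z = x + y := by abel
  have r6 : x - z + y = x + y - z := by abel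
  have r7 : x - z - y = x - y - z := by abel
  rw [r1, r2] at h1
  rw [r3, r4] at h4
  rw [r5] at h5
  rw [r6, r7] at h9
  linarith

theorem quadratic_zsmul_of_parallelogram (hq : ∀ x y, q (x + y) + q (x - y) = 2 * (q x + q y)) :
    ∃ b : G →+ G →+ ℝ, ∀ x, q x = b x x := by
  have h0 : q 0 = 0 := by have := hq 0 0; simp at this; linarith
  let b : G →+ G →+ ℝ := AddMonoidHom.mk' (fun x => AddMonoidHom.mk'
    (fun y => (q (x + y) - q x - q y) / 2) (fun y z => by
      have := polar_add_of_parallelogram hq y z x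
      rw [add_comm (y + z) x, add_comm y x, add_comm z x] at this
      linarith)) (fun x y => by
      ext z
      have := polar_add_of_parallelogram hq x y z
      simp
      linarith)
  refine ⟨b, fun x => ?_⟩
  have := hq x x
  rw [sub_self, h0] at this
  simp [b]
  linarith

end CanonicalHeight

section Gram

theorem exists_sum_sq_of_int_nonneg {n : ℕ} (M : Matrix (Fin n) (Fin n) ℝ) (hM : M.IsSymm)
    (h : ∀ v : Fin n → ℤ, 0 ≤ ∑ i, ∑ j, (v i : ℝ) * v j * M i j) :
    ∃ (m : ℕ) (A : Fin m → Fin n → ℝ), ∀ v : Fin n → ℝ,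
      ∑ i, ∑ j, v i * v j * M i j = ∑ l, (∑ i, A l i * v i) ^ 2 := by
  have hrat : ∀ v : Fin n → ℚ, 0 ≤ ∑ i, ∑ j, (v i : ℝ) * v j * M i j := by
    intro v
    obtain ⟨d, hd⟩ : ∃ d : ℕ, d = ∏ i, (v i).den := ⟨_, rfl⟩
    have hd0 : d ≠ 0 := by rw [hd]; exact Finset.prod_ne_zero_iff.mpr fun i _ => (v i).den_nz
    have hw : ∀ i, ∃ w : ℤ, (w : ℚ) = d * v i := by
      intro i
      obtain ⟨c, hc⟩ : (v i).den ∣ d := hd ▸ Finset.dvd_prod_of_mem _ (Finset.mem_univ i)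
      refine ⟨c * (v i).num, ?_⟩
      rw [hc]
      push_cast
      rw [mul_comm ((v i).den : ℚ), mul_assoc, Rat.den_mul_eq_num]
    choose w hw using hw
    have hw' : ∀ i, (w i : ℝ) = d * v i := fun i => by exact_mod_cast hw i
    have := h w
    simp only [hw'] at this
    have heq : ∑ i, ∑ j, (d * v i : ℝ) * (d * v j) * M i j =
        d ^ 2 * ∑ i, ∑ j, (v i : ℝ) * v j * M i j := by
      rw [Finset.mul_sum]
      refine Finset.sum_congr rfl fun i _ => ?_
      rw [Finset.mul_sum]
      exact Finset.sum_congr rfl fun j _ => by ring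
    rw [heq] at this
    exact nonneg_of_mul_nonneg_right this (by positivity)
  have hreal : ∀ v : Fin n → ℝ, 0 ≤ ∑ i, ∑ j, v i * v j * M i j := by
    have hdense : DenseRange (Pi.map (fun _ : Fin n => ((↑) : ℚ → ℝ))) :=
      DenseRange.piMap fun _ => Rat.denseRange_cast
    intro v
    refine hdense.induction_on (p := fun v => 0 ≤ ∑ i, ∑ j, v i * v j * M i j) v ?_ ?_
    · exact isClosed_le continuous_const (by fun_prop)
    · exact hrat
  have hpsd : M.PosSemidef := by
    refine Matrix.PosSemidef.of_dotProduct_mulVec_nonneg ?_ ?_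
    · rw [Matrix.IsHermitian, Matrix.conjTranspose_eq_transpose_of_trivial]; exact hM
    · intro v
      have := hreal v
      simp only [dotProduct, Matrix.mulVec, star_trivial, Finset.mul_sum]
      refine this.trans_eq (Finset.sum_congr rfl fun i _ => Finset.sum_congr rfl fun j _ => by ring)
  obtain ⟨m, A, hA⟩ := Matrix.posSemidef_iff_eq_sum_vecMulVec.mp hpsd
  refine ⟨m, A, fun v => ?_⟩
  subst hA
  simp only [Matrix.sum_apply, Matrix.vecMulVec_apply, Finset.mul_sum, star_trivial]
  simp only [pow_two, Finset.sum_mul_sum]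
  rw [Finset.sum_congr rfl fun i _ => Finset.sum_comm]
  rw [Finset.sum_comm]
  refine Finset.sum_congr rfl fun l _ => Finset.sum_congr rfl fun i _ =>
    Finset.sum_congr rfl fun j _ => by ring

/-- A height on a finitely generated group is, up to a bounded error, the square of a Euclidean
norm. -/
theorem exists_norm_sq_sub_le {G : Type*} [AddCommGroup G] [AddGroup.FG G] {h : G → ℝ} {C : ℝ}
    (h0 : ∀ x, 0 ≤ h x) (hC : ∀ x y, |h (x + y) + h (x - y) - 2 * (h x + h y)| ≤ C) :
    ∃ (m : ℕ) (Λ : G → EuclideanSpace ℝ (Fin m)) (D : ℝ), ∀ (a : ℕ) (x y : G),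
      |‖(a : ℝ) • Λ x + Λ y‖ ^ 2 - h (a • x + y)| ≤ D := by
  obtain ⟨q, hq0, hq, D, hD⟩ := exists_parallelogram_of_abs_le h0 hC
  obtain ⟨b, hb⟩ := quadratic_zsmul_of_parallelogram hq
  have : Module.Finite ℤ G := Module.Finite.iff_addGroup_fg.mpr inferInstance
  obtain ⟨n, φ, hφ⟩ := Module.Finite.exists_fin' ℤ G
  have hsymm : ∀ x y, b x y + b y x = q (x + y) - q x - q y := by
    intro x y; simp [hb]; ring
  set g : Fin n → G := fun i => φ (Pi.single i 1) with hg
  have hφv : ∀ v, φ v = ∑ i, v i • g i := by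
    intro v
    conv_lhs => rw [← Finset.univ_sum_single v, map_sum]
    refine Finset.sum_congr rfl fun i _ => ?_
    rw [hg, ← map_smul, ← Pi.single_smul, smul_eq_mul, mul_one]
  set M : Matrix (Fin n) (Fin n) ℝ := fun i j => (b (g i) (g j) + b (g j) (g i)) / 2 with hMdef
  have hMq : ∀ v : Fin n → ℤ, ∑ i, ∑ j, (v i : ℝ) * v j * M i j = q (φ v) := by
    intro v
    have e1 : q (φ v) = ∑ i, ∑ j, (v i : ℝ) * v j * b (g i) (g j) := by
      rw [hb, hφv]
      simp only [map_sum, AddMonoidHom.finsetSum_apply, map_zsmul, AddMonoidHom.zsmul_apply,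
        zsmul_eq_mul, Finset.mul_sum]
      rw [Finset.sum_comm]
      refine Finset.sum_congr rfl fun i _ => Finset.sum_congr rfl fun j _ => by ring
    have e2 : q (φ v) = ∑ i, ∑ j, (v i : ℝ) * v j * b (g j) (g i) := by
      rw [e1, Finset.sum_comm]
      refine Finset.sum_congr rfl fun i _ => Finset.sum_congr rfl fun j _ => by ring
    have : q (φ v) = (q (φ v) + q (φ v)) / 2 := by ring
    rw [this]
    nth_rewrite 1 [e1]
    rw [e2, ← Finset.sum_add_distrib, Finset.sum_div]
    refine Finset.sum_congr rfl fun i _ => ?_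
    rw [← Finset.sum_add_distrib, Finset.sum_div]
    refine Finset.sum_congr rfl fun j _ => by simp only [hMdef]; ring
  obtain ⟨m, A, hA⟩ := exists_sum_sq_of_int_nonneg M
    (by ext i j; rw [Matrix.transpose_apply]; simp only [hMdef]; ring)
    (fun v => by rw [hMq]; exact hq0 _)
  choose w hw using hφ
  refine ⟨m, fun x => WithLp.toLp 2 fun l => ∑ i, A l i * w x i, D, fun a x y => ?_⟩
  have hv := hA (fun i => ((a • w x + w y) i : ℤ))
  rw [hMq] at hv
  have hφ' : φ (a • w x + w y) = a • x + y := by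
    rw [map_add, map_nsmul, hw, hw]
  rw [hφ'] at hv
  have hn : ‖(a : ℝ) • (WithLp.toLp 2 fun l => ∑ i, A l i * (w x i : ℝ) : EuclideanSpace ℝ (Fin m)) +
      WithLp.toLp 2 fun l => ∑ i, A l i * (w y i : ℝ)‖ ^ 2 = q (a • x + y) := by
    rw [hv, EuclideanSpace.norm_sq_eq]
    refine Finset.sum_congr rfl fun l _ => ?_
    simp only [PiLp.add_apply, PiLp.smul_apply, smul_eq_mul, Real.norm_eq_abs, sq_abs,
      Finset.mul_sum, ← Finset.sum_add_distrib]
    congr 1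
    refine Finset.sum_congr rfl fun i _ => ?_
    simp
    ring
  rw [hn]
  exact hD _

end Gram

section Aligned

theorem norm_estimates_of_close {E : Type*} [NormedAddCommGroup E] [InnerProductSpace ℝ E]
    {u v : E} {δ X H : ℝ} (hδ0 : 0 < δ) (hδ1 : δ ≤ 1) (hX : 0 < X) (hu : |‖u‖ ^ 2 - X| ≤ δ * X)
    (hv : |‖v‖ ^ 2 - H| ≤ δ * X) (hH : H ≤ 4 * X) (huv : ‖u - v‖ ^ 2 ≤ δ ^ 2 * X) :
    |X - H| ≤ 7 * δ * X ∧ (4 - 12 * δ) * X ≤ ‖u + v‖ ^ 2 := by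
  obtain ⟨s, hs, rfl⟩ : ∃ s : ℝ, 0 < s ∧ X = s ^ 2 :=
    ⟨√X, Real.sqrt_pos.mpr hX, (Real.sq_sqrt hX.le).symm⟩
  rw [abs_le] at hu hv
  have hδs : δ * s ^ 2 ≤ s ^ 2 := by nlinarith [sq_nonneg s]
  have h1 : ‖u‖ ≤ 2 * s := by
    refine abs_le_of_sq_le_sq' ?_ (by positivity) |>.2
    nlinarith
  have h2 : ‖v‖ ≤ 3 * s := by
    refine abs_le_of_sq_le_sq' ?_ (by positivity) |>.2
    nlinarith
  have h3 : ‖u - v‖ ≤ δ * s := by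
    refine abs_le_of_sq_le_sq' ?_ (by positivity) |>.2
    nlinarith
  have h4 : |‖u‖ - ‖v‖| ≤ δ * s := (abs_norm_sub_norm_le u v).trans h3
  have hU := norm_nonneg u
  have hV := norm_nonneg v
  have h5 : |‖u‖ ^ 2 - ‖v‖ ^ 2| ≤ δ * s * (5 * s) := by
    have : ‖u‖ ^ 2 - ‖v‖ ^ 2 = (‖u‖ - ‖v‖) * (‖u‖ + ‖v‖) := by ring
    rw [this, abs_mul, abs_of_nonneg (by positivity : 0 ≤ ‖u‖ + ‖v‖)]
    exact mul_le_mul h4 (by linarith) (by positivity) (by positivity)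
  refine ⟨?_, ?_⟩
  · rw [abs_le] at h5 ⊢
    constructor <;> nlinarith
  · have h6 : 2 * ‖u‖ - δ * s ≤ ‖u + v‖ := by
      have : (2 : ℝ) • u = (u + v) + (u - v) := by rw [two_smul]; abel
      have h7 := norm_add_le (u + v) (u - v)
      rw [← this, norm_smul, Real.norm_ofNat] at h7
      linarith
    rcases le_or_gt 0 (2 * ‖u‖ - δ * s) with h7 | h7
    · have h8 := pow_le_pow_left₀ h7 h6 2
      nlinarith [mul_le_mul_of_nonneg_left h1 (by positivity : 0 ≤ 4 * δ * s), sq_nonneg (δ * s)]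
    · have h9 : ‖u‖ ^ 2 ≤ (δ * s / 2) ^ 2 := pow_le_pow_left₀ hU (by linarith) 2
      have h10 : (δ * s / 2) ^ 2 ≤ δ * s ^ 2 / 4 := by nlinarith [sq_nonneg s]
      have : (4 - 12 * δ) * s ^ 2 ≤ 0 := by nlinarith
      exact this.trans (by positivity)

variable {ι G₁ G₂ : Type*} [Infinite ι] [AddCommGroup G₁] [AddCommGroup G₂] [AddGroup.FG G₁]
  [AddGroup.FG G₂]

/-- Among infinitely many points of two finitely generated groups there are two, one much higher
than the other, which are almost aligned up to a power of two. -/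
theorem exists_aligned_pair {h₁ : G₁ → ℝ} {h₂ : G₂ → ℝ} {C : ℝ} (h₁0 : ∀ x, 0 ≤ h₁ x)
    (h₁C : ∀ x y, |h₁ (x + y) + h₁ (x - y) - 2 * (h₁ x + h₁ y)| ≤ C) (h₂0 : ∀ x, 0 ≤ h₂ x)
    (h₂C : ∀ x y, |h₂ (x + y) + h₂ (x - y) - 2 * (h₂ x + h₂ y)| ≤ C) (H : ι → ℝ)
    (hH : ∀ B, {i | H i ≤ B}.Finite) (R₁ : ι → G₁) (R₂ : ι → G₂)
    (hR₁ : ∀ i, |h₁ (R₁ i) - H i| ≤ C) (hR₂ : ∀ i, |h₂ (R₂ i) - H i| ≤ C) (ε : ℝ) (hε : 0 < ε)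
    (B : ℕ) : ∃ (i j : ι) (k : ℕ), B ≤ k ∧ B ≤ H i ∧ |4 ^ k * H i - H j| ≤ ε * (4 ^ k * H i) ∧
      (4 - ε) * (4 ^ k * H i) ≤ h₁ (2 ^ k • R₁ i + R₁ j) ∧
      (4 - ε) * (4 ^ k * H i) ≤ h₂ (2 ^ k • R₂ i + R₂ j) := by
  obtain ⟨m₁, Λ₁, D₁, hΛ₁⟩ := exists_norm_sq_sub_le h₁0 h₁C
  obtain ⟨m₂, Λ₂, D₂, hΛ₂⟩ := exists_norm_sq_sub_le h₂0 h₂C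
  obtain ⟨δ, hδ0, hδ1, hδε⟩ : ∃ δ : ℝ, 0 < δ ∧ δ ≤ 1 ∧ 13 * δ ≤ ε :=
    ⟨min 1 (ε / 13), by positivity, min_le_left _ _, by
      have := min_le_right 1 (ε / 13); linarith⟩
  set D : ℝ := |C| + |D₁| + |D₂| with hD
  have hD0 : 0 ≤ D := by positivity
  have hD1' : C + D₁ ≤ D := by
    rw [hD]; have := le_abs_self D₁; have := abs_nonneg D₂; have := le_abs_self C; linarith
  have hD2' : C + D₂ ≤ D := by
    rw [hD]; have := le_abs_self D₂; have := abs_nonneg D₁; have := le_abs_self C; linarith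
  have hD1'' : D₁ ≤ D := by
    rw [hD]; have := le_abs_self D₁; have := abs_nonneg D₂; have := abs_nonneg C; linarith
  have hD2'' : D₂ ≤ D := by
    rw [hD]; have := le_abs_self D₂; have := abs_nonneg D₁; have := abs_nonneg C; linarith
  set u : ι → EuclideanSpace ℝ (Fin m₁) := fun i => Λ₁ (R₁ i) with hu
  set v : ι → EuclideanSpace ℝ (Fin m₂) := fun i => Λ₂ (R₂ i) with hv
  have hΛ0₁ : ∀ i, |‖u i‖ ^ 2 - H i| ≤ D := by
    intro i
    have h1 := hΛ₁ 0 0 (R₁ i)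
    simp only [Nat.cast_zero, zero_smul, zero_add] at h1
    have h2 := hR₁ i
    have h3 := hD1'
    rw [abs_le] at *
    constructor <;> linarith [h1.1, h1.2, h2.1, h2.2]
  have hΛ0₂ : ∀ i, |‖v i‖ ^ 2 - H i| ≤ D := by
    intro i
    have h1 := hΛ₂ 0 0 (R₂ i)
    simp only [Nat.cast_zero, zero_smul, zero_add] at h1
    have h2 := hR₂ i
    have h3 := hD2'
    rw [abs_le] at *
    constructor <;> linarith [h1.1, h1.2, h2.1, h2.2]
  choose K hK1 hK2 using fun i : ι =>
    exists_nat_pow_near (le_max_left 1 (H i)) (by norm_num : (1 : ℝ) < 4)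
  have hbound : ∀ {x : ℝ} (i : ι), 0 ≤ x → |x ^ 2 - H i| ≤ D →
      ((2 : ℝ) ^ K i)⁻¹ * x ≤ 2 * (1 + D) := by
    intro x i hx h
    rw [inv_mul_le_iff₀ (by positivity)]
    refine abs_le_of_sq_le_sq' ?_ (by positivity) |>.2
    have h1 : x ^ 2 ≤ (1 + D) * max 1 (H i) := by
      have := (abs_le.mp h).2
      have h3 := le_max_left 1 (H i)
      have h4 := le_max_right 1 (H i)
      nlinarith
    have h2 : ((2 : ℝ) ^ K i * (2 * (1 + D))) ^ 2 = (1 + D) * ((1 + D) * 4 ^ (K i + 1)) := by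
      have h4 : (4 : ℝ) ^ (K i + 1) = (2 ^ K i) ^ 2 * 4 := by
        rw [pow_succ, ← pow_mul, mul_comm (K i) 2, pow_mul]; norm_num
      rw [h4]; ring
    rw [h2]
    refine h1.trans (mul_le_mul_of_nonneg_left ?_ (by positivity))
    calc max 1 (H i) ≤ 1 * 4 ^ (K i + 1) := by rw [one_mul]; exact (hK2 i).le
      _ ≤ _ := by gcongr; linarith
  set f := Infinite.natEmbedding ι with hf
  have hlim : Tendsto (fun n => H (f n)) atTop atTop := by
    rw [← Nat.cofinite_eq_atTop]
    refine Tendsto.comp ?_ f.injective.tendsto_cofinite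
    rw [tendsto_atTop]
    intro b
    rw [eventually_cofinite]
    exact (hH b).subset fun i hi => (not_le.mp hi).le
  set w : ℕ → EuclideanSpace ℝ (Fin m₁) × EuclideanSpace ℝ (Fin m₂) := fun n =>
    (((2 : ℝ) ^ K (f n))⁻¹ • u (f n), ((2 : ℝ) ^ K (f n))⁻¹ • v (f n)) with hw
  have hwb : ∀ n, w n ∈ Metric.closedBall (0 : EuclideanSpace ℝ (Fin m₁) × EuclideanSpace ℝ (Fin m₂))
      (2 * (1 + D)) := by
    intro n
    rw [mem_closedBall_zero_iff, Prod.norm_def]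
    refine max_le ?_ ?_
    · rw [norm_smul, norm_inv, norm_pow, Real.norm_ofNat]
      exact hbound _ (norm_nonneg _) (hΛ0₁ _)
    · rw [norm_smul, norm_inv, norm_pow, Real.norm_ofNat]
      exact hbound _ (norm_nonneg _) (hΛ0₂ _)
  obtain ⟨w₀, -, ψ, hψ, hψl⟩ := tendsto_subseq_of_bounded Metric.isBounded_closedBall hwb
  obtain ⟨N, hN⟩ := Metric.cauchySeq_iff.mp hψl.cauchySeq δ hδ0
  have hlimψ := hlim.comp hψ.tendsto_atTop
  obtain ⟨n₁, hn₁N, hn₁⟩ := ((eventually_ge_atTop N).and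
    (hlimψ.eventually_ge_atTop (max (max 1 B) (D / δ)))).exists
  set i := f (ψ n₁) with hi
  obtain ⟨n₂, hn₂N, hn₂⟩ := ((eventually_ge_atTop N).and
    (hlimψ.eventually_ge_atTop ((4 : ℝ) ^ (K i + B + 1)))).exists
  set j := f (ψ n₂) with hj
  have hHi : max (max 1 (B : ℝ)) (D / δ) ≤ H i := hn₁
  have hHj : (4 : ℝ) ^ (K i + B + 1) ≤ H j := hn₂
  have hHi1 : 1 ≤ H i := (le_max_left _ _).trans ((le_max_left _ _).trans hHi)
  have hHiB : (B : ℝ) ≤ H i := (le_max_right _ _).trans ((le_max_left _ _).trans hHi)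
  have hHiD : D ≤ δ * H i := by
    have := (le_max_right _ _).trans hHi
    rwa [div_le_iff₀ hδ0, mul_comm] at this
  have hHj1 : 1 ≤ H j := (one_le_pow₀ (by norm_num)).trans hHj
  have hKi1 : (4 : ℝ) ^ K i ≤ H i := by simpa [hHi1] using hK1 i
  have hKi2 : H i < (4 : ℝ) ^ (K i + 1) := by simpa [hHi1] using hK2 i
  have hKj1 : (4 : ℝ) ^ K j ≤ H j := by simpa [hHj1] using hK1 j
  have hKj2 : H j < (4 : ℝ) ^ (K j + 1) := by simpa [hHj1] using hK2 j
  have hKij : K i + B ≤ K j := by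
    have := (pow_lt_pow_iff_right₀ (by norm_num : (1 : ℝ) < 4)).mp (hHj.trans_lt hKj2)
    omega
  obtain ⟨k, hk⟩ : ∃ k, K j = K i + k := ⟨K j - K i, by omega⟩
  have h4k : (1 : ℝ) ≤ 4 ^ k := one_le_pow₀ (by norm_num)
  have hX1 : (4 : ℝ) ^ K j ≤ 4 ^ k * H i := by
    rw [hk, pow_add, mul_comm]; gcongr
  have hX0 : 0 < 4 ^ k * H i := by positivity
  have hHX : H i ≤ 4 ^ k * H i := le_mul_of_one_le_left (by linarith) h4k
  have hDX : D ≤ δ * (4 ^ k * H i) := hHiD.trans (by gcongr)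
  have hHjX : H j ≤ 4 * (4 ^ k * H i) := by
    rw [pow_succ] at hKj2; linarith
  have hdist := hN n₁ hn₁N n₂ hn₂N
  rw [dist_eq_norm, Prod.norm_def, max_lt_iff] at hdist
  have hcast : ((2 ^ k : ℕ) : ℝ) = 2 ^ k := by push_cast; rfl
  have key : ∀ {E : Type} [NormedAddCommGroup E] [InnerProductSpace ℝ E] (x y : E),
      ‖((2 : ℝ) ^ K i)⁻¹ • x - ((2 : ℝ) ^ K j)⁻¹ • y‖ < δ → |‖x‖ ^ 2 - H i| ≤ D →
      |‖y‖ ^ 2 - H j| ≤ D → |4 ^ k * H i - H j| ≤ 7 * δ * (4 ^ k * H i) ∧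
        (4 - 12 * δ) * (4 ^ k * H i) ≤ ‖(2 : ℝ) ^ k • x + y‖ ^ 2 := by
    intro E _ _ x y hxy hx hy
    refine norm_estimates_of_close hδ0 hδ1 hX0 ?_ (hy.trans hDX) hHjX ?_
    · rw [norm_smul, mul_pow, norm_pow, Real.norm_ofNat, ← pow_mul, mul_comm k 2, pow_mul,
        show (2 : ℝ) ^ 2 = 4 by norm_num, ← mul_sub, abs_mul, abs_of_pos (by positivity),
        mul_left_comm]
      exact mul_le_mul_of_nonneg_left (hx.trans hHiD) (by positivity)
    · have : (2 : ℝ) ^ k • x - y =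
          (2 : ℝ) ^ K j • (((2 : ℝ) ^ K i)⁻¹ • x - ((2 : ℝ) ^ K j)⁻¹ • y) := by
        rw [smul_sub, smul_smul, smul_smul, mul_inv_cancel₀ (by positivity), one_smul, hk, pow_add]
        congr 2
        field_simp
      rw [this, norm_smul, mul_pow, norm_pow, Real.norm_ofNat, ← pow_mul, mul_comm (K j) 2,
        pow_mul, show (2 : ℝ) ^ 2 = 4 by norm_num, mul_comm]
      exact mul_le_mul (pow_le_pow_left₀ (norm_nonneg _) hxy.le 2) hX1 (by positivity)
        (by positivity)
  obtain ⟨hA, hB1⟩ := key (u i) (u j) hdist.1 (hΛ0₁ i) (hΛ0₁ j)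
  obtain ⟨-, hB2⟩ := key (v i) (v j) hdist.2 (hΛ0₂ i) (hΛ0₂ j)
  refine ⟨i, j, k, by omega, hHiB, hA.trans (by gcongr; linarith), ?_, ?_⟩
  · have := abs_le.mp (hΛ₁ (2 ^ k) (R₁ i) (R₁ j))
    rw [hcast] at this
    have h3 : (4 - ε) * (4 ^ k * H i) ≤ (4 - 12 * δ) * (4 ^ k * H i) - δ * (4 ^ k * H i) := by
      nlinarith
    linarith [this.2]
  · have := abs_le.mp (hΛ₂ (2 ^ k) (R₂ i) (R₂ j))
    rw [hcast] at this
    have h3 : (4 - ε) * (4 ^ k * H i) ≤ (4 - 12 * δ) * (4 ^ k * H i) - δ * (4 ^ k * H i) := by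
      nlinarith
    linarith [this.2]

end Aligned

end

section

open WeierstrassCurve Affine Polynomial

section HeightRational

theorem exists_mul_add_mul_eq_of_isCoprime {K : Type*} [Field K] {A B P : K[X]} {N : ℕ}
    (hA : A.natDegree ≤ N) (hB : B.natDegree = N) (hB0 : B ≠ 0) (hAB : IsCoprime A B)
    (hP : P.natDegree ≤ N + N) :
    ∃ u v : K[X], u.natDegree ≤ N ∧ v.natDegree ≤ N ∧ u * A + v * B = P := by
  obtain ⟨a, b, hab⟩ := hAB
  set t := (P * a) % B with ht
  set s := (P * a) / B with hs
  have hst : B * s + t = P * a := EuclideanDomain.div_add_mod _ _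
  have htd : t.natDegree ≤ N := by
    rw [← hB]
    exact natDegree_le_natDegree (EuclideanDomain.mod_lt _ hB0).le
  have hsum : t * A + (s * A + P * b) * B = P := by
    linear_combination A * hst + P * hab
  refine ⟨t, s * A + P * b, htd, ?_, hsum⟩
  by_cases hv : s * A + P * b = 0
  · simp [hv]
  have h1 : ((s * A + P * b) * B).natDegree ≤ N + N := by
    have : (s * A + P * b) * B = P - t * A := by linear_combination hsum
    rw [this]
    refine (natDegree_sub_le _ _).trans (max_le hP ?_)
    exact natDegree_mul_le.trans (add_le_add htd hA)
  rw [natDegree_mul hv hB0, hB] at h1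
  omega

/-- The height of the value of a rational function of degree `N`. -/
theorem exists_abs_logHeight₁_eval_div_sub_le {A B : ℚ[X]} {N : ℕ} (hA : A.natDegree ≤ N)
    (hB : B.natDegree = N) (hB0 : B ≠ 0) (hAB : IsCoprime A B) :
    ∃ C : ℝ, ∀ x : ℚ, |Height.logHeight₁ (A.eval x / B.eval x) - N * Height.logHeight₁ x| ≤ C := by
  obtain ⟨u₁, v₁, hu₁, hv₁, h₁⟩ := exists_mul_add_mul_eq_of_isCoprime hA hB hB0 hAB
    (P := 1) (by simp)
  obtain ⟨u₀, v₀, hu₀, hv₀, h₀⟩ := exists_mul_add_mul_eq_of_isCoprime hA hB hB0 hAB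
    (P := X ^ (N + N)) (by simp)
  have hev : ∀ (p : ℚ[X]) (x : ℚ), p.natDegree ≤ N →
      MvPolynomial.eval ![x, 1] (p.homogenize N) = p.eval x := by
    intro p x hp
    have := eval₂_homogenize_of_eq_one hp (RingHom.id ℚ) ![x, 1] rfl
    simpa [MvPolynomial.eval₂_id, Polynomial.eval₂_id] using this
  obtain ⟨C₁, hC₁⟩ := Height.logHeight_eval_le' (p := ![A.homogenize N, B.homogenize N]) (N := N)
    (by intro i; fin_cases i <;> simp)
  obtain ⟨C₂, hC₂⟩ := Height.logHeight_eval_ge' (N := N) (M := N)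
    (q := fun ij : Fin 2 × Fin 2 => (![![u₀, v₀], ![u₁, v₁]] ij.1 ij.2).homogenize N)
    (fun a => isHomogeneous_homogenize _)
  refine ⟨max C₁ (-C₂), fun x => ?_⟩
  have e1 : (fun j => MvPolynomial.eval ![x, 1] ((![A.homogenize N, B.homogenize N] : Fin 2 →
      MvPolynomial (Fin 2) ℚ) j)) = ![A.eval x, B.eval x] := by
    ext j
    fin_cases j
    · exact hev A x hA
    · exact hev B x hB.le
  have h2 := hC₂ ![A.homogenize N, B.homogenize N] (x := ![x, 1]) (by
    intro k
    rw [Fin.sum_univ_two]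
    fin_cases k
    · simp only [Fin.zero_eta, Matrix.cons_val_zero, Matrix.cons_val_one]
      rw [hev _ _ hu₀, hev _ _ hv₀, hev _ _ hA, hev _ _ hB.le, ← eval_mul, ← eval_mul, ← eval_add,
        h₀]
      simp
    · simp only [Fin.mk_one, Matrix.cons_val_zero, Matrix.cons_val_one]
      rw [hev _ _ hu₁, hev _ _ hv₁, hev _ _ hA, hev _ _ hB.le, ← eval_mul, ← eval_mul, ← eval_add,
        h₁]
      simp)
  have h1 := hC₁ ![x, 1]
  rw [e1, ← Height.logHeight₁_eq_logHeight, ← Height.logHeight₁_div_eq_logHeight] at h1 h2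
  rw [abs_le]
  constructor
  · linarith [le_max_right C₁ (-C₂)]
  · linarith [le_max_left C₁ (-C₂)]

end HeightRational

section Forms

variable {R : Type*} [CommRing R]

/-- The numerator of the `x`-coordinate of the double of a point, on `y² = x³ + c₂ x² + c₄ x`. -/
def dblNum (c₄ A B : R) : R := (A ^ 2 - c₄ * B ^ 2) ^ 2

/-- The denominator of the `x`-coordinate of the double of a point. -/
def dblDen (c₂ c₄ A B : R) : R := 4 * A * B * (A ^ 2 + c₂ * A * B + c₄ * B ^ 2)

/-- The factor by which the numerator of the `y`-coordinate is multiplied under doubling. -/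
def dblFactor (c₂ c₄ A B : R) : R := 2 * (A ^ 2 - c₄ * B ^ 2) *
  (A ^ 4 + 2 * c₂ * A ^ 3 * B + 6 * c₄ * A ^ 2 * B ^ 2 + 2 * c₂ * c₄ * A * B ^ 3 + c₄ ^ 2 * B ^ 4)

/-- The numerators and denominators of the coordinates of the multiples `2 ^ k P`. -/
def dblIter (c₂ c₄ : R) (v : R × R × R) : ℕ → R × R × R
  | 0 => v
  | k + 1 => (dblNum c₄ (dblIter c₂ c₄ v k).1 (dblIter c₂ c₄ v k).2.1,
      dblDen c₂ c₄ (dblIter c₂ c₄ v k).1 (dblIter c₂ c₄ v k).2.1,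
      dblFactor c₂ c₄ (dblIter c₂ c₄ v k).1 (dblIter c₂ c₄ v k).2.1 * (dblIter c₂ c₄ v k).2.2)

theorem map_dblIter {S : Type*} [CommRing S] (φ : R →+* S) (c₂ c₄ : R) (v : R × R × R) (k : ℕ) :
    dblIter (φ c₂) (φ c₄) (φ v.1, φ v.2.1, φ v.2.2) k =
      (φ (dblIter c₂ c₄ v k).1, φ (dblIter c₂ c₄ v k).2.1, φ (dblIter c₂ c₄ v k).2.2) := by
  induction k with
  | zero => rfl
  | succ k ih => simp [dblIter, ih, dblNum, dblDen, dblFactor, map_ofNat φ]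

theorem dblIter_mul (c₂ c₄ A B r y : R) (k : ℕ) :
    dblIter c₂ c₄ (A, B, y * r) k = ((dblIter c₂ c₄ (A, B, r) k).1, (dblIter c₂ c₄ (A, B, r) k).2.1,
      y * (dblIter c₂ c₄ (A, B, r) k).2.2) := by
  induction k with
  | zero => rfl
  | succ k ih => simp only [dblIter, ih]; ext <;> simp; ring

theorem dblIter_relation (c₂ c₄ A B r f : R)
    (h : r ^ 2 * f = B * (A ^ 3 + c₂ * A ^ 2 * B + c₄ * A * B ^ 2)) (k : ℕ) :
    (dblIter c₂ c₄ (A, B, r) k).2.2 ^ 2 * f = (dblIter c₂ c₄ (A, B, r) k).2.1 *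
      ((dblIter c₂ c₄ (A, B, r) k).1 ^ 3 +
        c₂ * (dblIter c₂ c₄ (A, B, r) k).1 ^ 2 * (dblIter c₂ c₄ (A, B, r) k).2.1 +
        c₄ * (dblIter c₂ c₄ (A, B, r) k).1 * (dblIter c₂ c₄ (A, B, r) k).2.1 ^ 2) := by
  induction k with
  | zero => exact h
  | succ k ih =>
    simp only [dblIter, dblNum, dblDen, dblFactor]
    generalize dblIter c₂ c₄ (A, B, r) k = v at *
    obtain ⟨A, B, r⟩ := v
    linear_combination (2 * (A ^ 2 - c₄ * B ^ 2) * (A ^ 4 + 2 * c₂ * A ^ 3 * B +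
      6 * c₄ * A ^ 2 * B ^ 2 + 2 * c₂ * c₄ * A * B ^ 3 + c₄ ^ 2 * B ^ 4)) ^ 2 * ih

/-- Up to a factor, the coordinates of the pair `(x (P - Q), x (P + Q))` of points of
`y² = x³ + c₂ x² + c₄ x`; here `w` is the product of the numerators of the `y`-coordinates. -/
def segreForm (c₂ c₄ A B A' B' w : R) : Fin 2 → Fin 2 → R :=
  ![![(A * B' - A' * B) ^ 2,
      (A * A' + c₄ * B * B') * (A * B' + A' * B) + 2 * c₂ * A * A' * B * B' - 2 * w],
    ![(A * A' + c₄ * B * B') * (A * B' + A' * B) + 2 * c₂ * A * A' * B * B' + 2 * w,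
      (A * A' - c₄ * B * B') ^ 2]]

theorem segreForm_mul_segreForm {c₂ c₄ A B A' B' w : R}
    (hw : w ^ 2 = B * (A ^ 3 + c₂ * A ^ 2 * B + c₄ * A * B ^ 2) *
      (B' * (A' ^ 3 + c₂ * A' ^ 2 * B' + c₄ * A' * B' ^ 2))) :
    segreForm c₂ c₄ A B A' B' w 0 0 * segreForm c₂ c₄ A B A' B' w 1 1 =
      segreForm c₂ c₄ A B A' B' w 0 1 * segreForm c₂ c₄ A B A' B' w 1 0 := by
  simp only [segreForm, Matrix.cons_val_zero, Matrix.cons_val_one]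
  linear_combination 4 * hw

theorem map_segreForm {S : Type*} [CommRing S] (φ : R →+* S) (c₂ c₄ A B A' B' w : R)
    (i j : Fin 2) : φ (segreForm c₂ c₄ A B A' B' w i j) =
      segreForm (φ c₂) (φ c₄) (φ A) (φ B) (φ A') (φ B') (φ w) i j := by
  fin_cases i <;> fin_cases j <;> simp [segreForm, map_ofNat φ]

end Forms

section Represents

variable {e e' : ℚ}

def Represents (P : (splitCurve e e').Point) (A B w : ℚ) : Prop :=
  w ^ 2 = B * (A ^ 3 - (e + e') * A ^ 2 * B + e * e' * A * B ^ 2) ∧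
    ((P = 0 ∧ B = 0 ∧ A ≠ 0) ∨ (B ≠ 0 ∧ ∃ h, P = Point.some (A / B) (w / B ^ 2) h))

theorem splitCurve_two_torsion {x y : ℚ} (h : (splitCurve e e').Nonsingular x y) (hy : y = 0) :
    Point.some x y h + Point.some x y h = 0 := by
  obtain ⟨h', h''⟩ := splitCurve_neg_some h
  rw [← eq_neg_iff_add_eq_zero, h'']
  congr 1
  simp [hy]

theorem Represents.double (he : e ≠ 0) (he' : e' ≠ 0) (hee : e ≠ e')
    {P : (splitCurve e e').Point} {A B w : ℚ} (h : Represents P A B w) :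
    Represents (P + P) (dblNum (e * e') A B) (dblDen (-(e + e')) (e * e') A B)
      (dblFactor (-(e + e')) (e * e') A B * w) := by
  obtain ⟨hw, h⟩ := h
  refine ⟨?_, ?_⟩
  · simp only [dblNum, dblDen, dblFactor]
    linear_combination (2 * (A ^ 2 - e * e' * B ^ 2) * (A ^ 4 + 2 * (-(e + e')) * A ^ 3 * B +
      6 * (e * e') * A ^ 2 * B ^ 2 + 2 * (-(e + e')) * (e * e') * A * B ^ 3 +
      (e * e') ^ 2 * B ^ 4)) ^ 2 * hw
  rcases h with ⟨rfl, rfl, hA⟩ | ⟨hB, hns, rfl⟩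
  · left
    refine ⟨by simp, by simp [dblDen], by simp [dblNum, hA]⟩
  have hden : dblDen (-(e + e')) (e * e') A B = 4 * B ^ 4 * (w / B ^ 2) ^ 2 := by
    simp only [dblDen]
    field_simp
    linear_combination -hw
  by_cases hy : w / B ^ 2 = 0
  · left
    refine ⟨splitCurve_two_torsion hns hy, by rw [hden, hy]; simp, ?_⟩
    have hw0 : w = 0 := by simpa [hB] using hy
    intro h0
    simp only [dblNum] at h0
    have h1 : A ^ 2 - e * e' * B ^ 2 = 0 := pow_eq_zero_iff two_ne_zero |>.mp h0
    have h2 : A * (A - e * B) * (A - e' * B) = 0 := by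
      apply mul_left_cancel₀ hB
      rw [hw0] at hw
      linear_combination -hw
    have hB2 : B ^ 2 ≠ 0 := pow_ne_zero 2 hB
    rcases mul_eq_zero.mp h2 with h2 | h2
    · rcases mul_eq_zero.mp h2 with h2 | h2
      · rw [h2] at h1
        have : e * e' * B ^ 2 = 0 := by linear_combination -h1
        simp [he, he', hB] at this
      · have : e * (e - e') * B ^ 2 = 0 := by
          linear_combination h1 - (A + e * B) * h2
        simp [he, hB, sub_eq_zero, hee] at this
    · have : e' * (e' - e) * B ^ 2 = 0 := by
        linear_combination h1 - (A + e' * B) * h2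
      simp [he', hB, sub_eq_zero, hee.symm] at this
  · right
    have hw0 : w ≠ 0 := by rintro rfl; simp at hy
    obtain ⟨x', y', h', hadd, hx', hy'⟩ := splitCurve_some_add_self hns hy
    have hd0 : dblDen (-(e + e')) (e * e') A B ≠ 0 := by rw [hden]; positivity
    refine ⟨hd0, ?_⟩
    have hw' : w ^ 2 = B * (A * (A - e * B) * (A - e' * B)) := by linear_combination hw
    have hX : x' = dblNum (e * e') A B / dblDen (-(e + e')) (e * e') A B := by
      rw [hden, hx', dblNum]
      field_simp
      linear_combination (-(32 * A - 16 * (e + e') * B)) * hw'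
    have hY : y' = dblFactor (-(e + e')) (e * e') A B * w /
        dblDen (-(e + e')) (e * e') A B ^ 2 := by
      rw [hy', hX, hden, dblNum, dblFactor]
      field_simp
      linear_combination (16 * A * B * (3 * A ^ 2 - 2 * (e + e') * A * B + e * e' * B ^ 2) -
        32 * (w ^ 2 + B * (A * (A - e * B) * (A - e' * B)))) * hw'
    subst hX hY
    exact ⟨h', hadd⟩

theorem Represents.dblIter (he : e ≠ 0) (he' : e' ≠ 0) (hee : e ≠ e')
    {P : (splitCurve e e').Point} {A B w : ℚ} (h : Represents P A B w) (k : ℕ) :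
    Represents (2 ^ k • P) (dblIter (-(e + e')) (e * e') (A, B, w) k).1
      (dblIter (-(e + e')) (e * e') (A, B, w) k).2.1
      (dblIter (-(e + e')) (e * e') (A, B, w) k).2.2 := by
  induction k with
  | zero => rw [pow_zero, one_nsmul]; exact h
  | succ k ih =>
    have := ih.double he he' hee
    rw [pow_succ', mul_nsmul', two_nsmul]
    exact this

/-- The `x`-coordinate of a sum of two points in terms of the Segre coordinates. -/
theorem Represents.add {P Q : (splitCurve e e').Point} {A B w A' B' w' : ℚ}
    (hP : Represents P A B w) (hQ : Represents Q A' B' w') (hPQ : P + Q ≠ 0) :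
    ∃ i, segreForm (-(e + e')) (e * e') A B A' B' (w * w') i 0 ≠ 0 ∧
      xHeight (P + Q) = Height.logHeight₁
        (segreForm (-(e + e')) (e * e') A B A' B' (w * w') i 1 /
          segreForm (-(e + e')) (e * e') A B A' B' (w * w') i 0) := by
  obtain ⟨hw, hP⟩ := hP
  obtain ⟨hw', hQ⟩ := hQ
  rcases hP with ⟨rfl, rfl, hA⟩ | ⟨hB, hns, rfl⟩
  · have hw0 : w = 0 := by simpa using hw
    subst hw0
    rcases hQ with ⟨rfl, -, -⟩ | ⟨hB', hns', rfl⟩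
    · simp at hPQ
    · refine ⟨0, by simp [segreForm, hA, hB'], ?_⟩
      rw [zero_add, xHeight_some]
      congr 1
      simp [segreForm]
      field_simp
  rcases hQ with ⟨rfl, rfl, hA'⟩ | ⟨hB', hns', rfl⟩
  · have hw0 : w' = 0 := by simpa using hw'
    subst hw0
    refine ⟨0, by simp [segreForm, hA', hB], ?_⟩
    rw [add_zero, xHeight_some]
    congr 1
    simp [segreForm]
    field_simp
  have h1 : w ^ 2 = B * (A * (A - e * B) * (A - e' * B)) := by linear_combination hw
  have h2 : w' ^ 2 = B' * (A' * (A' - e * B') * (A' - e' * B')) := by linear_combination hw'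
  by_cases hx : A / B = A' / B'
  · rcases (Point.X_eq_iff (h₁ := hns) (h₂ := hns')).mp hx with h | h
    · have hyy : w / B ^ 2 = w' / B' ^ 2 := by
        injection h
      by_cases hy : w / B ^ 2 = 0
      · rw [← h, splitCurve_two_torsion hns hy] at hPQ
        exact (hPQ rfl).elim
      have hw0 : w ≠ 0 := by rintro rfl; simp at hy
      obtain ⟨x', y', h', hadd, hx', hy'⟩ := splitCurve_some_add_self hns hy
      obtain ⟨l, rfl⟩ : ∃ l, B' = l * B := ⟨B' / B, by field_simp⟩
      have hl : l ≠ 0 := by rintro rfl; simp at hB'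
      have hA' : A' = l * A := by field_simp at hx; linear_combination -hx
      subst hA'
      have hw'l : w' = l ^ 2 * w := by field_simp at hyy; linear_combination -hyy
      subst hw'l
      have hden : segreForm (-(e + e')) (e * e') A B (l * A) (l * B) (w * (l ^ 2 * w)) 1 0 =
          4 * l ^ 2 * w ^ 2 := by
        simp only [segreForm, Matrix.cons_val_zero, Matrix.cons_val_one]
        linear_combination -2 * l ^ 2 * h1
      have hnum : segreForm (-(e + e')) (e * e') A B (l * A) (l * B) (w * (l ^ 2 * w)) 1 1 =
          l ^ 2 * (A ^ 2 - e * e' * B ^ 2) ^ 2 := by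
        simp only [segreForm, Matrix.cons_val_zero, Matrix.cons_val_one]
        ring
      refine ⟨1, by rw [hden]; positivity, ?_⟩
      rw [← h, hadd, xHeight_some, hden, hnum]
      congr 1
      rw [hx']
      field_simp
      linear_combination (-(32 * A - 16 * (e + e') * B)) * h1
    · rw [h, neg_add_cancel] at hPQ
      exact (hPQ rfl).elim
  · obtain ⟨x, y, h, hadd, hX⟩ := splitCurve_some_add_some hns hns' hx
    have hd : A * B' - A' * B ≠ 0 := by
      intro h0; apply hx; field_simp; linear_combination h0
    obtain ⟨D, hD⟩ : ∃ D, D = A * B' - A' * B := ⟨_, rfl⟩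
    have hd' : A / B - A' / B' = D / (B * B') := by rw [hD]; field_simp
    refine ⟨0, by simp [segreForm, hd], ?_⟩
    rw [hadd, xHeight_some, hX, hd']
    congr 1
    simp only [segreForm, Matrix.cons_val_zero, Matrix.cons_val_one]
    rw [← hD] at hd ⊢
    field_simp
    rw [hD]
    linear_combination B' ^ 4 * h1 + B ^ 4 * h2

end Represents

end

section

open WeierstrassCurve Affine Polynomial Height

section QuadPair

/-- The quadratic polynomial `(x - a)² + c`. -/
noncomputable def quad (a c : ℤ) : ℤ[X] := (X - C a) ^ 2 + C c

/-- The Wronskian of two quadratic polynomials. -/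
noncomputable def quadWronskian (a c a' c' : ℤ) : ℤ[X] :=
  2 * (quad a c * (X - C a') - (X - C a) * quad a' c')

def quadBeta (a c a' c' : ℤ) : ℤ := (a - a') ^ 2 + c + c'

def quadC₂ (a c a' c' : ℤ) : ℤ := -2 * quadBeta a c a' c'

def quadC₄ (a c a' c' : ℤ) : ℤ := quadBeta a c a' c' ^ 2 - 4 * c * c'

noncomputable def quadForms (a c a' c' : ℤ) : ℤ[X] × ℤ[X] × ℤ[X] :=
  (quadWronskian a c a' c' ^ 2, 4 * (quad a c * quad a' c'),
    8 * quadWronskian a c a' c' * (C c' * quad a c ^ 2 - C c * quad a' c' ^ 2))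

variable (a c a' c' : ℤ)

theorem quadForms_relation : (quadForms a c a' c').2.2 ^ 2 * (quad a c * quad a' c') =
    (quadForms a c a' c').2.1 * ((quadForms a c a' c').1 ^ 3 +
      C (quadC₂ a c a' c') * (quadForms a c a' c').1 ^ 2 * (quadForms a c a' c').2.1 +
      C (quadC₄ a c a' c') * (quadForms a c a' c').1 * (quadForms a c a' c').2.1 ^ 2) := by
  have key : 16 * (C c' * quad a c ^ 2 - C c * quad a' c' ^ 2) ^ 2 =
      quadWronskian a c a' c' ^ 4 +
        4 * C (quadC₂ a c a' c') * quadWronskian a c a' c' ^ 2 * (quad a c * quad a' c') +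
        16 * C (quadC₄ a c a' c') * (quad a c * quad a' c') ^ 2 := by
    simp only [quadC₂, quadC₄, quadBeta, quadWronskian, quad, map_mul, map_add, map_sub, map_pow,
      map_neg, map_ofNat]
    ring
  simp only [quadForms]
  linear_combination 4 * quadWronskian a c a' c' ^ 2 * (quad a c * quad a' c') * key

theorem natDegree_quadWronskian_le : (quadWronskian a c a' c').natDegree ≤ 2 := by
  have : quadWronskian a c a' c' = C (2 * (a' - a)) * X ^ 2 +
      C (2 * (a ^ 2 + c - a' ^ 2 - c')) * X +
      C (2 * (a * (a' ^ 2 + c') - a' * (a ^ 2 + c))) := by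
    simp only [quadWronskian, quad, map_mul, map_add, map_sub, map_pow, map_ofNat]
    ring
  rw [this]
  compute_degree

variable {a c a' c'}

theorem quadC₄_pos (hc : 0 < c) (hne : (a, c) ≠ (a', c')) : 0 < quadC₄ a c a' c' := by
  have h : quadC₄ a c a' c' = ((a - a') ^ 2 - c + c') ^ 2 + 4 * (a - a') ^ 2 * c := by
    simp only [quadC₄, quadBeta]; ring
  rw [h]
  by_cases ha : a = a'
  · subst ha
    have : c' - c ≠ 0 := by
      intro h; apply hne; rw [sub_eq_zero.mp h]
    have h2 : (a - a) ^ 2 - c + c' = c' - c := by ring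
    rw [h2]
    positivity
  · have : a - a' ≠ 0 := sub_ne_zero.mpr ha
    positivity

theorem isCoprime_map_quad_quad (hc : 0 < c) (hne : (a, c) ≠ (a', c')) :
    IsCoprime ((quad a c).map (Int.castRingHom ℚ)) ((quad a' c').map (Int.castRingHom ℚ)) := by
  have h0 : (quadC₄ a c a' c' : ℚ) ≠ 0 := by exact_mod_cast (quadC₄_pos hc hne).ne'
  have key : ∃ u v : ℤ[X], u * quad a c + v * quad a' c' = C (quadC₄ a c a' c') := by
    refine ⟨C (4 * (a' - a) ^ 2) - (C (2 * (a' - a)) * (X - C a) + C ((a' - a) ^ 2 - c + c')),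
      C (2 * (a' - a)) * (X - C a) + C ((a' - a) ^ 2 - c + c'), ?_⟩
    simp only [quadC₄, quadBeta, quad, map_mul, map_add, map_sub, map_pow, map_ofNat]
    ring
  obtain ⟨u, v, huv⟩ := key
  have := congrArg (Polynomial.map (Int.castRingHom ℚ)) huv
  rw [Polynomial.map_add, Polynomial.map_mul, Polynomial.map_mul, map_C] at this
  refine ⟨C ((quadC₄ a c a' c' : ℚ)⁻¹) * u.map (Int.castRingHom ℚ),
    C ((quadC₄ a c a' c' : ℚ)⁻¹) * v.map (Int.castRingHom ℚ), ?_⟩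
  rw [mul_assoc, mul_assoc, ← mul_add, this, ← C_mul, eq_intCast, inv_mul_cancel₀ h0, C_1]

theorem isCoprime_map_quad_X_sub_C (hc : 0 < c) :
    IsCoprime ((quad a c).map (Int.castRingHom ℚ)) (X - C (a : ℚ)) := by
  have h0 : (c : ℚ) ≠ 0 := by exact_mod_cast hc.ne'
  refine ⟨C (c : ℚ)⁻¹, -C (c : ℚ)⁻¹ * (X - C (a : ℚ)), ?_⟩
  have h1 : (C (c : ℚ)⁻¹ : ℚ[X]) * C (c : ℚ) = 1 := by rw [← C_mul, inv_mul_cancel₀ h0, C_1]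
  simp only [quad, Polynomial.map_add, Polynomial.map_pow, Polynomial.map_sub, map_X, map_C,
    eq_intCast (Int.castRingHom ℚ)]
  linear_combination h1

theorem isCoprime_map_quadWronskian (hc : 0 < c) (hc' : 0 < c') (hne : (a, c) ≠ (a', c')) :
    IsCoprime ((quadForms a c a' c').1.map (Int.castRingHom ℚ))
      ((quadForms a c a' c').2.1.map (Int.castRingHom ℚ)) := by
  have h12 := isCoprime_map_quad_quad hc hne
  have h1 := isCoprime_map_quad_X_sub_C (a := a) hc
  have h2 := isCoprime_map_quad_X_sub_C (a := a') hc'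
  have h2u : IsUnit (2 : ℚ[X]) := by
    have : (2 : ℚ[X]) = C 2 := (map_ofNat C 2).symm
    rw [this]; exact isUnit_C.mpr (by norm_num)
  have h4u : IsUnit (4 : ℚ[X]) := by
    have : (4 : ℚ[X]) = C 4 := (map_ofNat C 4).symm
    rw [this]; exact isUnit_C.mpr (by norm_num)
  have hW : (quadWronskian a c a' c').map (Int.castRingHom ℚ) =
      2 * ((quad a c).map (Int.castRingHom ℚ) * (X - C (a' : ℚ)) -
        (X - C (a : ℚ)) * (quad a' c').map (Int.castRingHom ℚ)) := by
    simp only [quadWronskian, Polynomial.map_mul, Polynomial.map_sub, map_X, map_C,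
      eq_intCast (Int.castRingHom ℚ), Polynomial.map_ofNat]
  simp only [quadForms, Polynomial.map_pow, Polynomial.map_mul, Polynomial.map_ofNat, hW]
  refine IsCoprime.pow_left ?_
  refine (isCoprime_mul_unit_left_left h2u _ _).mpr ?_
  refine (isCoprime_mul_unit_left_right h4u _ _).mpr ?_
  refine IsCoprime.mul_right ?_ ?_
  · rw [sub_eq_add_neg, add_comm, mul_comm ((quad a c).map _)]
    exact IsCoprime.add_mul_right_left ((h1.symm.mul_left h12.symm).neg_left) _
  · rw [sub_eq_add_neg, ← neg_mul]
    exact IsCoprime.add_mul_right_left (h12.mul_left h2.symm) _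

theorem quad_eval_pos (hc : 0 < c) (x : ℚ) : 0 < aeval x (quad a c) := by
  have : (0 : ℚ) < c := by exact_mod_cast hc
  have h : aeval x (quad a c) = (x - a) ^ 2 + c := by simp [quad]
  rw [h]
  positivity

theorem natDegree_map_quadForms : ((quadForms a c a' c').2.1.map (Int.castRingHom ℚ)).natDegree = 4
    := by
  have : (quadForms a c a' c').2.1.map (Int.castRingHom ℚ) =
      4 * (((X - C (a : ℚ)) ^ 2 + C (c : ℚ)) * ((X - C (a' : ℚ)) ^ 2 + C (c' : ℚ))) := by
    simp [quadForms, quad]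
  rw [this]
  have h : ∀ b d : ℚ, ((X - C b) ^ 2 + C d : ℚ[X]).Monic ∧
      ((X - C b) ^ 2 + C d : ℚ[X]).natDegree = 2 := by
    intro b d
    have hd : ((X - C b) ^ 2 : ℚ[X]).natDegree = 2 := by simp
    exact ⟨((monic_X_sub_C b).pow 2).add_of_left (by
      refine degree_C_le.trans_lt ?_
      rw [degree_pow, degree_X_sub_C]; norm_num), by rw [natDegree_add_C, hd]⟩
  have h4 : (4 : ℚ[X]) = C 4 := (map_ofNat C 4).symm
  rw [h4, natDegree_C_mul (by norm_num), (h _ _).1.natDegree_mul (h _ _).1, (h _ _).2, (h _ _).2]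

theorem exists_abs_logHeight₁_quadForms_sub_le (hc : 0 < c) (hc' : 0 < c')
    (hne : (a, c) ≠ (a', c')) : ∃ D : ℝ, ∀ x : ℚ,
      |logHeight₁ (aeval x (quadForms a c a' c').1 / aeval x (quadForms a c a' c').2.1) -
        4 * logHeight₁ x| ≤ D := by
  have hd := natDegree_map_quadForms (a := a) (c := c) (a' := a') (c' := c')
  obtain ⟨D, hD⟩ := exists_abs_logHeight₁_eval_div_sub_le (N := 4)
    (A := (quadForms a c a' c').1.map (Int.castRingHom ℚ))
    (B := (quadForms a c a' c').2.1.map (Int.castRingHom ℚ))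
    (natDegree_map_le.trans (natDegree_pow_le.trans
      (by have := natDegree_quadWronskian_le a c a' c'; omega))) hd
    (by intro h; rw [h] at hd; simp at hd) (isCoprime_map_quadWronskian hc hc' hne)
  refine ⟨D, fun x => ?_⟩
  have := hD x
  simpa [eval_map, aeval_def] using this

/-- The numerators and denominator of `2 ^ k` times the map from `y² = quad a c * quad a' c'` to
the cubic. -/
noncomputable def quadIter (a c a' c' : ℤ) (k : ℕ) : ℤ[X] × ℤ[X] × ℤ[X] :=
  dblIter (C (quadC₂ a c a' c')) (C (quadC₄ a c a' c')) (quadForms a c a' c') k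

theorem aeval_quadIter (k : ℕ) (x y : ℚ) :
    dblIter (quadC₂ a c a' c' : ℚ) (quadC₄ a c a' c' : ℚ) (aeval x (quadForms a c a' c').1,
      aeval x (quadForms a c a' c').2.1, y * aeval x (quadForms a c a' c').2.2) k =
    (aeval x (quadIter a c a' c' k).1, aeval x (quadIter a c a' c' k).2.1,
      y * aeval x (quadIter a c a' c' k).2.2) := by
  rw [dblIter_mul]
  have := map_dblIter (aeval x : ℤ[X] →ₐ[ℤ] ℚ).toRingHom (C (quadC₂ a c a' c'))
    (C (quadC₄ a c a' c')) (quadForms a c a' c') k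
  simp only [AlgHom.toRingHom_eq_coe, RingHom.coe_coe, aeval_C, algebraMap_int_eq,
    eq_intCast (Int.castRingHom ℚ)] at this
  rw [this]
  rfl

theorem exists_represents (hc : 0 < c) (hc' : 0 < c') {e e' : ℤ}
    (he : -(e + e') = quadC₂ a c a' c') (he' : e * e' = quadC₄ a c a' c')
    (hE : e * e' * (e - e') ≠ 0) {x y : ℚ} (hy : y ^ 2 = aeval x (quad a c * quad a' c')) :
    ∃ P : (splitCurve (e : ℚ) e').Point, Represents P (aeval x (quadForms a c a' c').1)
      (aeval x (quadForms a c a' c').2.1) (y * aeval x (quadForms a c a' c').2.2) ∧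
      xHeight P = logHeight₁
        (aeval x (quadForms a c a' c').1 / aeval x (quadForms a c a' c').2.1) := by
  have he0 : (e : ℚ) ≠ 0 := by rintro h; apply hE; simp [Int.cast_eq_zero.mp h]
  have he'0 : (e' : ℚ) ≠ 0 := by rintro h; apply hE; simp [Int.cast_eq_zero.mp h]
  have hde : (e : ℚ) ≠ e' := by
    intro h; apply hE
    have : e = e' := by exact_mod_cast h
    rw [this, sub_self, mul_zero]
  have := splitCurve_isElliptic he0 he'0 hde
  have hrel := congrArg (aeval x) (quadForms_relation a c a' c')
  simp only [map_mul, map_add, map_pow, aeval_C, algebraMap_int_eq,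
    eq_intCast (Int.castRingHom ℚ), ← he, ← he'] at hrel
  push_cast at hrel
  rw [map_mul] at hy
  rw [← hy] at hrel
  have hw : (y * aeval x (quadForms a c a' c').2.2) ^ 2 = aeval x (quadForms a c a' c').2.1 *
      (aeval x (quadForms a c a' c').1 ^ 3 - ((e : ℚ) + e') * aeval x (quadForms a c a' c').1 ^ 2 *
      aeval x (quadForms a c a' c').2.1 + e * e' * aeval x (quadForms a c a' c').1 *
      aeval x (quadForms a c a' c').2.1 ^ 2) := by
    linear_combination hrel
  have hB : aeval x (quadForms a c a' c').2.1 ≠ 0 := by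
    have h1 := quad_eval_pos (a := a) hc x
    have h2 := quad_eval_pos (a := a') hc' x
    simp only [quadForms, map_mul, map_ofNat]
    positivity
  have hns : (splitCurve (e : ℚ) e').Nonsingular
      (aeval x (quadForms a c a' c').1 / aeval x (quadForms a c a' c').2.1)
      (y * aeval x (quadForms a c a' c').2.2 / aeval x (quadForms a c a' c').2.1 ^ 2) := by
    refine equation_iff_nonsingular.mp (splitCurve_equation.mpr ?_)
    field_simp
    linear_combination hw
  exact ⟨Point.some _ _ hns, ⟨hw, Or.inr ⟨hB, hns, rfl⟩⟩, xHeight_some hns⟩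

theorem exists_quadC₄_eq_mul (hc : 0 < c) (hc' : 0 < c') (hne : (a, c) ≠ (a', c'))
    (hsq : IsSquare (c * c')) : ∃ e e' : ℤ, -(e + e') = quadC₂ a c a' c' ∧
      e * e' = quadC₄ a c a' c' ∧ e * e' * (e - e') ≠ 0 := by
  obtain ⟨g, hg⟩ := hsq
  have hg0 : g ≠ 0 := by rintro rfl; have := mul_pos hc hc'; simp [hg] at this
  have h4 : (quadBeta a c a' c' + 2 * g) * (quadBeta a c a' c' - 2 * g) = quadC₄ a c a' c' := by
    simp only [quadC₄]; linear_combination 4 * hg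
  refine ⟨quadBeta a c a' c' + 2 * g, quadBeta a c a' c' - 2 * g, ?_, h4, ?_⟩
  · simp only [quadC₂]; ring
  · rw [h4]
    have h1 := (quadC₄_pos hc hne).ne'
    refine mul_ne_zero h1 ?_
    have : quadBeta a c a' c' + 2 * g - (quadBeta a c a' c' - 2 * g) = 4 * g := by ring
    rw [this]
    positivity

/-- The coordinates of the sum and the difference of `2 ^ k` times the image of `(x, y)` and of the
image of `(x', y')`. -/
noncomputable def quadSegre (a c a' c' : ℤ) (k : ℕ) (x y x' y' : ℚ) : Fin 2 → Fin 2 → ℚ :=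
  segreForm (quadC₂ a c a' c' : ℚ) (quadC₄ a c a' c' : ℚ) (aeval x (quadIter a c a' c' k).1)
    (aeval x (quadIter a c a' c' k).2.1) (aeval x' (quadForms a c a' c').1)
    (aeval x' (quadForms a c a' c').2.1)
    (y * aeval x (quadIter a c a' c' k).2.2 * (y' * aeval x' (quadForms a c a' c').2.2))

theorem exists_points_fg (hc : 0 < c) (hc' : 0 < c') (hne : (a, c) ≠ (a', c'))
    (hsq : IsSquare (c * c')) : ∃ (G : Type) (_ : AddCommGroup G) (_ : AddGroup.FG G) (h : G → ℝ)
      (D : ℝ), (∀ P, 0 ≤ h P) ∧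
      (∀ P Q, |h (P + Q) + h (P - Q) - 2 * (h P + h Q)| ≤ D) ∧
      ∃ R : {p : ℚ × ℚ // p.2 ^ 2 = aeval p.1 (quad a c * quad a' c')} → G,
        (∀ p, |h (R p) - 4 * logHeight₁ p.1.1| ≤ D) ∧
        ∀ p p' k, 0 < h (2 ^ k • R p + R p') →
          ∃ i, quadSegre a c a' c' k p.1.1 p.1.2 p'.1.1 p'.1.2 i 0 ≠ 0 ∧
            h (2 ^ k • R p + R p') = logHeight₁
              (quadSegre a c a' c' k p.1.1 p.1.2 p'.1.1 p'.1.2 i 1 /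
                quadSegre a c a' c' k p.1.1 p.1.2 p'.1.1 p'.1.2 i 0) := by
  obtain ⟨e, e', he, he', hE⟩ := exists_quadC₄_eq_mul hc hc' hne hsq
  have he0 : (e : ℚ) ≠ 0 := by rintro h; apply hE; simp [Int.cast_eq_zero.mp h]
  have he'0 : (e' : ℚ) ≠ 0 := by rintro h; apply hE; simp [Int.cast_eq_zero.mp h]
  have hde : (e : ℚ) ≠ e' := by
    intro h; apply hE
    have : e = e' := by exact_mod_cast h
    rw [this, sub_self, mul_zero]
  have := splitCurve_isElliptic he0 he'0 hde
  obtain ⟨D₁, hD₁⟩ := exists_xHeight_parallelogram (e := (e : ℚ)) (e' := e')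
  obtain ⟨D₂, hD₂⟩ := exists_abs_logHeight₁_quadForms_sub_le hc hc' hne
  choose R hR hR' using fun p : {p : ℚ × ℚ // p.2 ^ 2 = aeval p.1 (quad a c * quad a' c')} =>
    exists_represents hc hc' he he' hE p.2
  refine ⟨(splitCurve (e : ℚ) e').Point, inferInstance, splitCurve_point_fg e e' hE, xHeight,
    max D₁ D₂, xHeight_nonneg, fun P Q => (hD₁ P Q).trans (le_max_left _ _), R, fun p => ?_, ?_⟩
  · rw [hR']
    exact (hD₂ _).trans (le_max_right _ _)
  · intro p p' k hpos
    have h2 : (-((e : ℚ) + e')) = (quadC₂ a c a' c' : ℚ) := by rw [← he]; push_cast; ring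
    have h4 : (e : ℚ) * e' = (quadC₄ a c a' c' : ℚ) := by rw [← he']; push_cast; ring
    have hk := (hR p).dblIter he0 he'0 hde k
    have hne0 : 2 ^ k • R p + R p' ≠ 0 := by
      intro h0
      rw [h0] at hpos
      have : xHeight (0 : (splitCurve (e : ℚ) e').Point) = 0 := by
        rw [xHeight, Point.xRep_zero]
        have := logHeight₁_div_eq_logHeight (1 : ℚ) 0
        simp [← this]
      rw [this] at hpos
      exact lt_irrefl _ hpos
    have := hk.add (hR p') hne0
    rw [h2, h4, aeval_quadIter] at this
    exact this

/-- Among infinitely many common square values of three quadratics there are two at which the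
associated points on both elliptic curves are almost aligned up to a power of two. -/
theorem exists_aligned_points (a c : Fin 3 → ℤ) (hc : ∀ i, 0 < c i)
    (hsq : ∀ i j, IsSquare (c i * c j)) (hne : Function.Injective fun i => (a i, c i))
    (hinf : {x : ℚ | ∀ i, IsSquare (aeval x (quad (a i) (c i)))}.Infinite) (ε : ℝ) (hε : 0 < ε)
    (hε1 : ε ≤ 1) (B : ℕ) (hB : 1 ≤ B) : ∃ (x x' : ℚ) (k : ℕ) (y y' : Fin 2 → ℚ), B ≤ k ∧
      B ≤ logHeight₁ x ∧
      |4 ^ k * logHeight₁ x - logHeight₁ x'| ≤ ε * (4 ^ k * logHeight₁ x) ∧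
      ∀ j : Fin 2, y j ^ 2 = aeval x (quad (a 0) (c 0) * quad (a j.succ) (c j.succ)) ∧
        y' j ^ 2 = aeval x' (quad (a 0) (c 0) * quad (a j.succ) (c j.succ)) ∧
        ∃ i, quadSegre (a 0) (c 0) (a j.succ) (c j.succ) k x (y j) x' (y' j) i 0 ≠ 0 ∧
          (16 - ε) * (4 ^ k * logHeight₁ x) ≤ logHeight₁
            (quadSegre (a 0) (c 0) (a j.succ) (c j.succ) k x (y j) x' (y' j) i 1 /
              quadSegre (a 0) (c 0) (a j.succ) (c j.succ) k x (y j) x' (y' j) i 0) := by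
  have hne' : ∀ j : Fin 2, (a 0, c 0) ≠ (a j.succ, c j.succ) := fun j h =>
    (Fin.succ_ne_zero j) (hne h).symm
  obtain ⟨G₁, _, _, h₁, D₁, h₁0, h₁D, R₁, hR₁, hS₁⟩ :=
    exists_points_fg (hc 0) (hc 1) (hne' 0) (hsq 0 1)
  obtain ⟨G₂, _, _, h₂, D₂, h₂0, h₂D, R₂, hR₂, hS₂⟩ :=
    exists_points_fg (hc 0) (hc 2) (hne' 1) (hsq 0 2)
  have : Infinite {x : ℚ | ∀ i, IsSquare (aeval x (quad (a i) (c i)))} := hinf.to_subtype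
  choose w hw using fun x : {x : ℚ | ∀ i, IsSquare (aeval x (quad (a i) (c i)))} => x.2
  have hy : ∀ x (j : Fin 3), (w x 0 * w x j) ^ 2 =
      aeval x.1 (quad (a 0) (c 0) * quad (a j) (c j)) := by
    intro x j
    rw [map_mul, hw, hw]; ring
  obtain ⟨x, x', k, hk, hx, hxx', hl₁, hl₂⟩ := exists_aligned_pair (C := max D₁ D₂) h₁0
    (fun P Q => (h₁D P Q).trans (le_max_left _ _)) h₂0
    (fun P Q => (h₂D P Q).trans (le_max_right _ _))
    (fun x : {x : ℚ | ∀ i, IsSquare (aeval x (quad (a i) (c i)))} => 4 * logHeight₁ x.1)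
    (fun b => by
      refine Set.Finite.of_finite_image (f := Subtype.val) ?_ Subtype.val_injective.injOn
      refine (NumberField.finite_setOfPred_logHeight₁_le ℚ (b / 4)).subset ?_
      rintro _ ⟨x, hx, rfl⟩
      have hx : 4 * logHeight₁ x.1 ≤ b := hx
      change logHeight₁ x.1 ≤ b / 4
      linarith)
    (fun x => R₁ ⟨(x.1, w x 0 * w x 1), hy x 1⟩) (fun x => R₂ ⟨(x.1, w x 0 * w x 2), hy x 2⟩)
    (fun x => (hR₁ _).trans (le_max_left _ _)) (fun x => (hR₂ _).trans (le_max_right _ _))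
    (ε / 4) (by positivity) (4 * B)
  have hB' : (1 : ℝ) ≤ B := by exact_mod_cast hB
  push_cast at hx
  have hx0 : 0 < 4 ^ k * logHeight₁ x.1 := by
    have : 0 < logHeight₁ x.1 := by linarith
    positivity
  have hpos : 0 < (4 - ε / 4) * (4 ^ k * (4 * logHeight₁ x.1)) := by nlinarith
  have heq : (16 - ε) * (4 ^ k * logHeight₁ x.1) =
    (4 - ε / 4) * (4 ^ k * (4 * logHeight₁ x.1)) := by ring
  refine ⟨x, x', k, fun j => w x 0 * w x j.succ, fun j => w x' 0 * w x' j.succ, by omega,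
    by linarith, ?_, ?_⟩
  · have : 4 ^ k * (4 * logHeight₁ x.1) - 4 * logHeight₁ x'.1 =
      4 * (4 ^ k * logHeight₁ x.1 - logHeight₁ x'.1) := by ring
    rw [this, abs_mul, abs_of_pos (by norm_num : (0 : ℝ) < 4)] at hxx'
    have h2 : 4 * |4 ^ k * logHeight₁ x.1 - logHeight₁ x'.1| ≤
      ε * (4 ^ k * logHeight₁ x.1) := hxx'.trans_eq (by ring)
    linarith [abs_nonneg (4 ^ k * logHeight₁ x.1 - logHeight₁ x'.1)]
  · intro j
    refine ⟨hy x _, hy x' _, ?_⟩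
    rw [heq]
    fin_cases j
    · obtain ⟨i, hi, hi'⟩ := hS₁ _ _ k (hpos.trans_le hl₁)
      exact ⟨i, hi, hl₁.trans_eq hi'⟩
    · obtain ⟨i, hi, hi'⟩ := hS₂ _ _ k (hpos.trans_le hl₂)
      exact ⟨i, hi, hl₂.trans_eq hi'⟩

end QuadPair

end

section

open Polynomial

section Seminorms

variable {R : Type*} [CommRing R]

/-- The weighted `ℓ¹` seminorm on polynomials. -/
noncomputable def polySeminorm (N : RingSeminorm R) (ρ : ℝ) (hρ : 0 ≤ ρ) : RingSeminorm R[X] :=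
  have hmono : ∀ (p : R[X]) (s : Finset ℕ), p.support ⊆ s →
      p.sum (fun n a => N a * ρ ^ n) = ∑ n ∈ s, N (p.coeff n) * ρ ^ n := fun p s hs => by
    rw [Polynomial.sum_def]
    exact Finset.sum_subset hs fun n _ hn => by
      rw [notMem_support_iff.mp hn, map_zero, zero_mul]
  have hadd : ∀ p q : R[X], (p + q).sum (fun n a => N a * ρ ^ n) ≤
      p.sum (fun n a => N a * ρ ^ n) + q.sum (fun n a => N a * ρ ^ n) := fun p q => by
    classical
    rw [hmono (p + q) (p.support ∪ q.support) support_add,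
      hmono p (p.support ∪ q.support) Finset.subset_union_left,
      hmono q (p.support ∪ q.support) Finset.subset_union_right, ← Finset.sum_add_distrib]
    refine Finset.sum_le_sum fun n _ => ?_
    rw [coeff_add, ← add_mul]
    exact mul_le_mul_of_nonneg_right (map_add_le_add N _ _) (by positivity)
  { toFun := fun p => p.sum fun n a => N a * ρ ^ n
    map_zero' := by simp
    add_le' := hadd
    neg' := fun p => by
      rw [hmono (-p) p.support (by rw [support_neg]), Polynomial.sum_def]
      exact Finset.sum_congr rfl fun n _ => by rw [coeff_neg, map_neg_eq_map]
    mul_le' := fun p q => by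
      have hmonomial : ∀ i (a : R), (monomial i a * q).sum (fun n a => N a * ρ ^ n) ≤
          N a * ρ ^ i * q.sum (fun n a => N a * ρ ^ n) := by
        intro i a
        rw [hmono _ (q.support.map (addRightEmbedding i)), Finset.sum_map, Polynomial.sum_def,
          Finset.mul_sum]
        · refine Finset.sum_le_sum fun n _ => ?_
          rw [addRightEmbedding_apply, coeff_monomial_mul, pow_add]
          calc N (a * q.coeff n) * (ρ ^ n * ρ ^ i) ≤ N a * N (q.coeff n) * (ρ ^ n * ρ ^ i) :=
                mul_le_mul_of_nonneg_right (map_mul_le_mul N _ _) (by positivity)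
            _ = _ := by ring
        · intro n hn
          rw [mem_support_iff] at hn
          have hin : i ≤ n := by
            by_contra h
            apply hn
            rw [← C_mul_X_pow_eq_monomial, mul_assoc, coeff_C_mul, coeff_X_pow_mul', if_neg h,
              mul_zero]
          obtain ⟨k, rfl⟩ := Nat.exists_eq_add_of_le hin
          rw [Finset.mem_map]
          refine ⟨k, ?_, by rw [addRightEmbedding_apply, add_comm]⟩
          rw [mem_support_iff]
          intro h0
          rw [add_comm, coeff_monomial_mul, h0, mul_zero] at hn
          exact hn rfl
      have hsum : ∀ (s : Finset ℕ) (g : ℕ → R[X]),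
          (∑ i ∈ s, g i).sum (fun n a => N a * ρ ^ n) ≤
            ∑ i ∈ s, (g i).sum (fun n a => N a * ρ ^ n) := by
        intro s g
        classical
        induction s using Finset.induction_on with
        | empty => simp
        | insert i s hi ih =>
          rw [Finset.sum_insert hi, Finset.sum_insert hi]
          exact (hadd _ _).trans (by gcongr)
      conv_lhs => rw [p.as_sum_support, Finset.sum_mul]
      refine (hsum _ _).trans ?_
      rw [Polynomial.sum_def p, Finset.sum_mul]
      exact Finset.sum_le_sum fun i _ => hmonomial i _ }

variable {N : RingSeminorm R} {ρ : ℝ} {hρ : 0 ≤ ρ}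

theorem polySeminorm_eq_sum (p : R[X]) {s : Finset ℕ} (hs : p.support ⊆ s) :
    polySeminorm N ρ hρ p = ∑ n ∈ s, N (p.coeff n) * ρ ^ n := by
  change p.sum (fun n a => N a * ρ ^ n) = _
  rw [Polynomial.sum_def]
  exact Finset.sum_subset hs fun n _ hn => by
    rw [notMem_support_iff.mp hn, map_zero, zero_mul]

theorem polySeminorm_monomial (n : ℕ) (a : R) :
    polySeminorm N ρ hρ (monomial n a) = N a * ρ ^ n := by
  rw [polySeminorm_eq_sum _ (support_monomial_subset n a)]
  simp

theorem polySeminorm_C (a : R) : polySeminorm N ρ hρ (C a) = N a := by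
  rw [← monomial_zero_left, polySeminorm_monomial]; simp

theorem polySeminorm_X_pow (n : ℕ) : polySeminorm N ρ hρ (X ^ n) = N 1 * ρ ^ n := by
  rw [X_pow_eq_monomial, polySeminorm_monomial]

theorem le_polySeminorm (p : R[X]) (n : ℕ) : N (p.coeff n) * ρ ^ n ≤ polySeminorm N ρ hρ p := by
  classical
  rw [polySeminorm_eq_sum p (Finset.subset_insert n p.support)]
  exact Finset.single_le_sum (f := fun n => N (p.coeff n) * ρ ^ n)
    (fun i _ => mul_nonneg (apply_nonneg N _) (by positivity)) (Finset.mem_insert_self _ _)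

/-- The seminorm on a quadratic algebra giving weight `w` to the square root. -/
noncomputable def quadraticSeminorm (N : RingSeminorm R) {a : R} (w : ℝ) (hw : 0 ≤ w)
    (h : N a ≤ w ^ 2) : RingSeminorm (QuadraticAlgebra R a 0) where
  toFun x := N x.re + w * N x.im
  map_zero' := by simp
  add_le' x y := by
    have h1 := map_add_le_add N x.re y.re
    have h2 := mul_le_mul_of_nonneg_left (map_add_le_add N x.im y.im) hw
    simp only [QuadraticAlgebra.re_add, QuadraticAlgebra.im_add]
    linarith
  neg' x := by simp
  mul_le' x y := by
    simp only [QuadraticAlgebra.re_mul, QuadraticAlgebra.im_mul, zero_mul, add_zero]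
    have h1 : N (x.re * y.re + a * x.im * y.im) ≤ N x.re * N y.re + w ^ 2 * N x.im * N y.im := by
      refine (map_add_le_add N _ _).trans (add_le_add (map_mul_le_mul N _ _) ?_)
      refine (map_mul_le_mul N _ _).trans ?_
      refine mul_le_mul_of_nonneg_right ?_ (apply_nonneg N _)
      refine (map_mul_le_mul N _ _).trans ?_
      exact mul_le_mul_of_nonneg_right h (apply_nonneg N _)
    have h2 : N (x.re * y.im + x.im * y.re) ≤ N x.re * N y.im + N x.im * N y.re :=
      (map_add_le_add N _ _).trans (add_le_add (map_mul_le_mul N _ _) (map_mul_le_mul N _ _))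
    have h3 := mul_le_mul_of_nonneg_left h2 hw
    refine (add_le_add h1 h3).trans_eq (by ring)

theorem quadraticSeminorm_apply {a : R} {w : ℝ} {hw : 0 ≤ w} {h : N a ≤ w ^ 2}
    (x : QuadraticAlgebra R a 0) : quadraticSeminorm N w hw h x = N x.re + w * N x.im := rfl

end Seminorms

section Wronskian

variable {K : Type*} [Field K] [CharZero K]

/-- The Wronskian of linearly independent polynomials does not vanish. -/
theorem det_hasseDeriv_ne_zero {n : ℕ} {g : Fin n → K[X]} (hg : LinearIndependent K g) :
    (Matrix.of fun i j : Fin n => hasseDeriv i (g j)).det ≠ 0 := by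
  intro hdet
  obtain ⟨v, hv0, hv⟩ := Matrix.exists_vecMul_eq_zero_iff.mpr hdet
  have hv' : ∀ j, ∑ i, v i * hasseDeriv i (g j) = 0 := fun j => congrFun hv j
  obtain ⟨i₀, hi₀⟩ := Function.ne_iff.mp hv0
  classical
  set s : Finset (Fin n) := Finset.univ.filter fun i => v i ≠ 0 with hs
  have hsne : s.Nonempty := ⟨i₀, by simpa [hs] using hi₀⟩
  set m := s.max' hsne with hm
  have hvm : v m ≠ 0 := by
    exact (Finset.mem_filter.mp (s.max'_mem hsne)).2
  have hvgt : ∀ i, m < i → v i = 0 := by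
    intro i hi
    by_contra h
    have := s.le_max' i (by simpa [hs] using h)
    exact absurd hi (not_lt.mpr this)
  obtain ⟨x, hx⟩ : ∃ x, (v m).eval x ≠ 0 := by
    by_contra! h
    exact hvm (Polynomial.funext fun x => by simpa using h x)
  have hspan : ∀ c : Fin n → K, ∑ i, v i * hasseDeriv i (∑ j, c j • g j) = 0 := by
    intro c
    simp only [map_sum, map_smul, Finset.mul_sum]
    rw [Finset.sum_comm]
    refine Finset.sum_eq_zero fun j _ => ?_
    simp only [mul_smul_comm]
    rw [← Finset.smul_sum, hv', smul_zero]
  have hzero : ∀ c : Fin n → K, (∀ i : Fin m, (hasseDeriv i (∑ j, c j • g j)).eval x = 0) →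
      ∑ j, c j • g j = 0 := by
    intro c hc
    have hspan := hspan c
    generalize ∑ j, c j • g j = f at hc hspan ⊢
    by_contra hne
    have hex : ∃ k, (hasseDeriv k f).eval x ≠ 0 := by
      by_contra! h
      apply hne
      apply taylor_injective x
      ext k
      rw [taylor_coeff, h, map_zero, coeff_zero]
    set k := Nat.find hex with hk
    have hk0 : (hasseDeriv k f).eval x ≠ 0 := Nat.find_spec hex
    have hklt : ∀ l < k, (hasseDeriv l f).eval x = 0 := fun l hl =>
      not_not.mp (Nat.find_min hex hl)
    have hmk : (m : ℕ) ≤ k := by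
      by_contra h
      exact hk0 (hc ⟨k, by omega⟩)
    have heq := congrArg (fun p => (hasseDeriv (k - m) p).eval x) hspan
    simp only [map_sum, hasseDeriv_mul, map_zero, eval_zero, eval_finsetSum, eval_mul] at heq
    have hcomp : ∀ (a b : ℕ), (hasseDeriv a (hasseDeriv b f)).eval x =
        ((a + b).choose a : K) * (hasseDeriv (a + b) f).eval x := by
      intro a b
      have := congrArg (fun φ : K[X] →ₗ[K] K[X] => (φ f).eval x) (hasseDeriv_comp (R := K) a b)
      simpa using this
    rw [Finset.sum_eq_single m, Finset.sum_eq_single (0, k - (m : ℕ))] at heq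
    · rw [hcomp, hasseDeriv_zero', Nat.sub_add_cancel hmk] at heq
      have hch : ((k.choose (k - m) : ℕ) : K) ≠ 0 := by
        exact_mod_cast (Nat.choose_pos (Nat.sub_le k m)).ne'
      exact mul_ne_zero hx (mul_ne_zero hch hk0) heq
    · rintro ⟨a, b⟩ hab hne'
      rw [Finset.HasAntidiagonal.mem_antidiagonal] at hab
      have : b + m < k := by
        rcases Nat.eq_zero_or_pos a with rfl | ha
        · exact absurd (by simp; omega) hne'
        · omega
      rw [hcomp, hklt _ this, mul_zero, mul_zero]
    · intro h; simp at h
    · intro i _ hi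
      refine Finset.sum_eq_zero fun ab hab => ?_
      rw [Finset.HasAntidiagonal.mem_antidiagonal] at hab
      rcases lt_or_gt_of_ne hi with h | h
      · rw [hcomp, hklt, mul_zero, mul_zero]
        have : (i : ℕ) < m := h
        omega
      · rw [hvgt i h]; simp
    · simp
  let φ : (Fin n → K) →ₗ[K] (Fin m → K) :=
    { toFun := fun c i => (hasseDeriv i (∑ j, c j • g j)).eval x
      map_add' := fun c d => by
        ext i; simp [add_smul, Finset.sum_add_distrib]
      map_smul' := fun a c => by
        ext i; simp [mul_smul, ← Finset.smul_sum] }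
  have hinj : Function.Injective φ := by
    rw [injective_iff_map_eq_zero]
    intro c hc
    have := hzero c fun i => congrFun hc i
    exact funext fun j => Fintype.linearIndependent_iff.mp hg c this j
  have := LinearMap.finrank_le_finrank_of_injective hinj
  simp only [Module.finrank_fin_fun] at this
  exact absurd m.2 (not_lt.mpr this)

end Wronskian

section RootMultiplicity

theorem X_sub_C_pow_dvd_iff_hasseDeriv {K : Type*} [Field K] {p : K[X]} {x : K} {n : ℕ} :
    (X - C x) ^ n ∣ p ↔ ∀ i < n, (hasseDeriv i p).eval x = 0 := by
  rw [X_sub_C_pow_dvd_iff, X_pow_dvd_iff]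
  refine forall₂_congr fun i _ => ?_
  rw [← taylor_coeff]
  rfl

theorem X_sub_C_pow_dvd_hasseDeriv {K : Type*} [Field K] {p : K[X]} {x : K} {n : ℕ}
    (h : (X - C x) ^ n ∣ p) (i : ℕ) : (X - C x) ^ (n - i) ∣ hasseDeriv i p := by
  rw [X_sub_C_pow_dvd_iff_hasseDeriv] at h ⊢
  intro j hj
  have := congrArg (fun φ : K[X] →ₗ[K] K[X] => (φ p).eval x) (hasseDeriv_comp (R := K) j i)
  simp only [LinearMap.comp_apply, LinearMap.smul_apply, eval_smul] at this
  rw [this, h (j + i) (by omega), smul_zero]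

/-- A power of `X - x` dividing an integral polynomial bounds the height of `x`. -/
theorem height_pow_le_of_X_sub_C_pow_dvd {W : ℤ[X]} (hW : W ≠ 0) {x : ℚ} {n : ℕ}
    (h : (X - C x) ^ n ∣ W.map (Int.castRingHom ℚ)) {M : ℝ} (hM : ∀ i, |(W.coeff i : ℝ)| ≤ M) :
    ((max x.num.natAbs x.den : ℕ) : ℝ) ^ n ≤ M := by
  have hprim : (C (x.den : ℤ) * X - C x.num).IsPrimitive := by
    rw [isPrimitive_iff_isUnit_of_C_dvd]
    intro r hr
    rw [C_dvd_iff_dvd_coeff] at hr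
    have h1 : r ∣ (x.den : ℤ) := by
      have := hr 1
      rwa [coeff_sub, coeff_C_mul, coeff_X_one, mul_one, coeff_C_of_ne_zero one_ne_zero,
        sub_zero] at this
    have h0 : r ∣ x.num := by simpa using hr 0
    exact (Rat.isCoprime_num_den x).isUnit_of_dvd' h0 h1
  have hden : (x.den : ℚ) ≠ 0 := by simp
  have hmap : (C (x.den : ℤ) * X - C x.num).map (Int.castRingHom ℚ) =
      C (x.den : ℚ) * (X - C x) := by
    rw [mul_sub, ← C_mul, Rat.den_mul_eq_num]
    simp
  have hdvd : (C (x.den : ℤ) * X - C x.num) ^ n ∣ W := by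
    have hpn : ((C (x.den : ℤ) * X - C x.num) ^ n).IsPrimitive := by
      induction n with
      | zero => rw [pow_zero]; exact isPrimitive_one
      | succ n ih =>
        rw [pow_succ]
        exact (ih (dvd_trans (pow_dvd_pow _ n.le_succ) h)).mul hprim
    rw [IsPrimitive.Int.dvd_iff_map_cast_dvd_map_cast _ _ hpn, Polynomial.map_pow, hmap, mul_pow,
      ← C_pow]
    exact (IsUnit.mul_left_dvd (isUnit_C.mpr (isUnit_iff_ne_zero.mpr (pow_ne_zero n hden)))).mpr h
  obtain ⟨V, hV⟩ := hdvd
  have hV0 : V ≠ 0 := by rintro rfl; simp at hV; exact hW hV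
  have habs : ∀ z : ℤ, z ≠ 0 → (1 : ℝ) ≤ |(z : ℝ)| := by
    intro z hz
    exact_mod_cast Int.one_le_abs hz
  have hlc : (x.den : ℝ) ^ n ≤ M := by
    have h1 : W.leadingCoeff = (x.den : ℤ) ^ n * V.leadingCoeff := by
      rw [hV, leadingCoeff_mul, leadingCoeff_pow]
      congr 2
      have hd : (x.den : ℤ) ≠ 0 := by simp
      rw [sub_eq_add_neg, ← C_neg, leadingCoeff_linear hd]
    calc (x.den : ℝ) ^ n ≤ (x.den : ℝ) ^ n * |(V.leadingCoeff : ℝ)| :=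
          le_mul_of_one_le_right (by positivity) (habs _ (leadingCoeff_ne_zero.mpr hV0))
      _ = |(W.leadingCoeff : ℝ)| := by
          rw [h1]; push_cast; rw [abs_mul, abs_of_nonneg (by positivity : (0 : ℝ) ≤ (x.den : ℝ) ^ n)]
      _ ≤ M := hM _
  have htc : (x.num.natAbs : ℝ) ^ n ≤ M := by
    by_cases hx : x.num = 0
    · refine le_trans ?_ hlc
      rw [hx, Rat.zero_of_num_zero hx]
      simp
      exact pow_le_one₀ le_rfl zero_le_one
    · have h1 : W.trailingCoeff = (-x.num) ^ n * V.trailingCoeff := by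
        have htl : (C (x.den : ℤ) * X - C x.num).trailingCoeff = -x.num := by
          rw [trailingCoeff, natTrailingDegree_eq_zero_of_constantCoeff_ne_zero (by simpa using hx)]
          simp
        have hpow : ∀ k, ((C (x.den : ℤ) * X - C x.num) ^ k).trailingCoeff = (-x.num) ^ k := by
          intro k
          induction k with
          | zero => simp [trailingCoeff]
          | succ k ih => rw [pow_succ, trailingCoeff_mul, ih, htl, pow_succ]
        rw [hV, trailingCoeff_mul, hpow]
      calc (x.num.natAbs : ℝ) ^ n ≤ (x.num.natAbs : ℝ) ^ n * |(V.trailingCoeff : ℝ)| :=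
            le_mul_of_one_le_right (by positivity) (habs _ (by
              rwa [Ne, trailingCoeff_eq_zero]))
        _ = |(W.trailingCoeff : ℝ)| := by
            rw [h1]; push_cast
            rw [abs_mul, abs_pow, abs_neg, Nat.cast_natAbs, Int.cast_abs]
        _ ≤ M := hM _
  rw [Nat.cast_max]
  rcases max_cases (x.num.natAbs : ℝ) (x.den : ℝ) with ⟨h, _⟩ | ⟨h, _⟩ <;> rw [h] <;> assumption

end RootMultiplicity

section WronskianBound

/-- The sum of the absolute values of the coefficients. -/
noncomputable def lOne : RingSeminorm ℤ[X] := polySeminorm (normRingSeminorm ℤ) 1 zero_le_one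

theorem abs_coeff_le_lOne (p : ℤ[X]) (i : ℕ) : |(p.coeff i : ℝ)| ≤ lOne p := by
  have := le_polySeminorm (N := normRingSeminorm ℤ) (hρ := zero_le_one) p i
  rw [one_pow, mul_one] at this
  exact this

theorem lOne_hasseDeriv_le {p : ℤ[X]} {r : ℕ} (hr : p.natDegree ≤ r) {M : ℝ}
    (hM : ∀ i, |(p.coeff i : ℝ)| ≤ M) (i : ℕ) :
    lOne (hasseDeriv i p) ≤ (r + 1) * 2 ^ r * M := by
  have hM0 : 0 ≤ M := (abs_nonneg _).trans (hM 0)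
  have hs : (hasseDeriv i p).support ⊆ Finset.range (r + 1) := by
    refine (supp_subset_range (Nat.lt_succ_of_le ?_))
    exact (natDegree_hasseDeriv_le p i).trans ((Nat.sub_le _ _).trans hr)
  rw [lOne, polySeminorm_eq_sum _ hs]
  calc _ ≤ ∑ n ∈ Finset.range (r + 1), 2 ^ r * M := by
        refine Finset.sum_le_sum fun n _ => ?_
        rw [one_pow, mul_one, hasseDeriv_coeff]
        change |(((n + i).choose i * p.coeff (n + i) : ℤ) : ℝ)| ≤ _
        push_cast
        rw [abs_mul, Nat.abs_cast]
        by_cases hni : n + i ≤ r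
        · refine mul_le_mul ?_ (hM _) (abs_nonneg _) (by positivity)
          have := (Nat.choose_le_two_pow (n + i) i).trans (Nat.pow_le_pow_right two_pos hni)
          exact_mod_cast this
        · rw [coeff_eq_zero_of_natDegree_lt (by omega)]
          simp; positivity
    _ = _ := by simp; ring

theorem map_hasseDeriv_intCast (i : ℕ) (p : ℤ[X]) :
    (hasseDeriv i p).map (Int.castRingHom ℚ) = hasseDeriv i (p.map (Int.castRingHom ℚ)) := by
  ext n
  simp [hasseDeriv_coeff]

/-- Polynomials in the span of integral polynomials of small height cannot vanish to high order
at a point of large height. -/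
theorem sum_order_mul_log_le {n : ℕ} {g : Fin n → ℤ[X]} {φ : Fin n → ℚ[X]} {T : Fin n → Fin n → ℚ}
    (hφg : ∀ j, φ j = ∑ k, T k j • (g k).map (Int.castRingHom ℚ)) (hφ : LinearIndependent ℚ φ)
    {r : ℕ} (hdeg : ∀ j, (g j).natDegree ≤ r) {M : ℝ} (hM1 : 1 ≤ M)
    (hM : ∀ j i, |((g j).coeff i : ℝ)| ≤ M)
    (x : ℚ) (ν : Fin n → ℕ) (hν : ∀ j, (X - C x) ^ ν j ∣ φ j) :
    ((∑ j, ν j : ℕ) - (∑ j : Fin n, (j : ℕ) : ℕ) : ℝ) * Height.logHeight₁ x ≤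
      n * (Real.log n + Real.log (r + 1) + r * Real.log 2 + Real.log M) := by
  have hφdet := det_hasseDeriv_ne_zero hφ
  set W : ℤ[X] := (Matrix.of fun i j : Fin n => hasseDeriv i (g j)).det with hWdef
  have hWmap : W.map (Int.castRingHom ℚ) =
      (Matrix.of fun i j : Fin n => hasseDeriv i ((g j).map (Int.castRingHom ℚ))).det := by
    rw [hWdef, ← coe_mapRingHom, RingHom.map_det]
    congr 1
    ext1 i j
    simp [map_hasseDeriv_intCast]
  have hmul : (Matrix.of fun i j : Fin n => hasseDeriv i (φ j)) =
      (Matrix.of fun i j : Fin n => hasseDeriv i ((g j).map (Int.castRingHom ℚ))) *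
        (Matrix.of fun k j => C (T k j)) := by
    ext1 i j
    rw [Matrix.mul_apply, Matrix.of_apply, hφg, map_sum]
    refine Finset.sum_congr rfl fun k _ => ?_
    rw [map_smul, Matrix.of_apply, Matrix.of_apply, mul_comm, C_mul']
  have hdet := congrArg Matrix.det hmul
  rw [Matrix.det_mul, ← hWmap] at hdet
  have hTC : (Matrix.of fun k j => C (T k j)).det = C (Matrix.of fun k j => T k j).det := by
    rw [RingHom.map_det]; rfl
  rw [hTC] at hdet
  have hT0 : (Matrix.of fun k j => T k j).det ≠ 0 := by
    intro h; rw [h, map_zero, mul_zero] at hdet; exact hφdet hdet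
  have hW0 : W ≠ 0 := by
    rintro h; rw [h] at hdet; simp at hdet; exact hφdet hdet
  set E := ∑ j, ν j - ∑ j : Fin n, (j : ℕ) with hE
  have hdvdφ : (X - C x) ^ E ∣ (Matrix.of fun i j : Fin n => hasseDeriv i (φ j)).det := by
    rw [Matrix.det_apply]
    refine Finset.dvd_sum fun σ _ => ?_
    suffices h : (X - C x) ^ E ∣ ∏ i, hasseDeriv (σ i : ℕ) (φ i) by
      rcases Int.units_eq_one_or (Equiv.Perm.sign σ) with h' | h'
      · rw [h', one_smul]; exact h
      · rw [h', Units.neg_smul, one_smul]; exact (dvd_neg).mpr h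
    refine (pow_dvd_pow _ (?_ : E ≤ ∑ i, (ν i - (σ i : ℕ)))).trans ?_
    · have h1 : ∑ j, (σ j : ℕ) = ∑ j : Fin n, (j : ℕ) :=
        Equiv.sum_comp σ (fun j : Fin n => (j : ℕ))
      have h2 : ∑ j, ν j ≤ ∑ i, ((ν i - (σ i : ℕ)) + (σ i : ℕ)) :=
        Finset.sum_le_sum fun i _ => by omega
      rw [Finset.sum_add_distrib, h1] at h2
      omega
    · rw [← Finset.prod_pow_eq_pow_sum]
      exact Finset.prod_dvd_prod_of_dvd _ _ fun i _ => X_sub_C_pow_dvd_hasseDeriv (hν i) _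
  have hdvd : (X - C x) ^ E ∣ W.map (Int.castRingHom ℚ) := by
    rw [hdet] at hdvdφ
    exact (IsUnit.dvd_mul_right (isUnit_C.mpr (isUnit_iff_ne_zero.mpr hT0))).mp hdvdφ
  set L : ℝ := (r + 1) * 2 ^ r * M with hL
  have hL0 : 0 < L := by positivity
  have hWb : lOne W ≤ n ^ n * L ^ n := by
    have hterm : ∀ σ : Equiv.Perm (Fin n),
        lOne (Equiv.Perm.sign σ • ∏ i, hasseDeriv (σ i : ℕ) (g i)) ≤ L ^ n := by
      intro σ
      have h1 : lOne (∏ i, hasseDeriv (σ i : ℕ) (g i)) ≤ ∏ i : Fin n, L := by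
        have h1' : ∀ s : Finset (Fin n), lOne (∏ i ∈ s, hasseDeriv (σ i : ℕ) (g i)) ≤ ∏ i ∈ s, L := by
          intro s
          induction s using Finset.induction_on with
          | empty =>
            have : lOne 1 ≤ 1 := by
              rw [lOne, ← C_1, polySeminorm_C]
              change ‖(1 : ℤ)‖ ≤ 1
              simp
            simpa using this
          | insert i s hi ih =>
            rw [Finset.prod_insert hi, Finset.prod_insert hi]
            exact (map_mul_le_mul lOne _ _).trans (mul_le_mul
              (lOne_hasseDeriv_le (hdeg i) (hM i) _) ih (apply_nonneg _ _) hL0.le)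
        exact h1' _
      rw [Finset.prod_const, Finset.card_univ, Fintype.card_fin] at h1
      rcases Int.units_eq_one_or (Equiv.Perm.sign σ) with h | h
      · rw [h, one_smul]; exact h1
      · rw [h, Units.neg_smul, one_smul, map_neg_eq_map]; exact h1
    rw [hWdef, Matrix.det_apply]
    have hsum : ∀ s : Finset (Equiv.Perm (Fin n)),
        lOne (∑ σ ∈ s, Equiv.Perm.sign σ • ∏ i, hasseDeriv (σ i : ℕ) (g i)) ≤ s.card * L ^ n := by
      intro s
      induction s using Finset.induction_on with
      | empty => simp
      | insert σ s hσ ih =>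
        rw [Finset.sum_insert hσ, Finset.card_insert_of_notMem hσ]
        push_cast
        have := map_add_le_add lOne (Equiv.Perm.sign σ • ∏ i, hasseDeriv (σ i : ℕ) (g i))
          (∑ σ ∈ s, Equiv.Perm.sign σ • ∏ i, hasseDeriv (σ i : ℕ) (g i))
        linarith [hterm σ]
    refine (hsum Finset.univ).trans ?_
    rw [Finset.card_univ, Fintype.card_perm, Fintype.card_fin]
    gcongr
    exact_mod_cast Nat.factorial_le_pow n
  have hH := height_pow_le_of_X_sub_C_pow_dvd hW0 hdvd
    (fun i => (abs_coeff_le_lOne W i).trans hWb)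
  have hH1 : (1 : ℝ) ≤ ((max x.num.natAbs x.den : ℕ) : ℝ) := by
    exact_mod_cast (Nat.one_le_iff_ne_zero.mpr x.den_nz).trans (le_max_right _ _)
  have hlog := Real.log_le_log (by positivity) hH
  rw [Real.log_pow, ← Rat.logHeight₁_eq_log_max] at hlog
  have hEge : ((∑ j, ν j : ℕ) - (∑ j : Fin n, (j : ℕ) : ℕ) : ℝ) ≤ (E : ℝ) := by
    rw [sub_le_iff_le_add]
    have : ∑ j, ν j ≤ E + ∑ j : Fin n, (j : ℕ) := by omega
    exact_mod_cast this
  refine (mul_le_mul_of_nonneg_right hEge (Height.zero_le_logHeight₁ x)).trans (hlog.trans ?_)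
  rcases Nat.eq_zero_or_pos n with rfl | hn
  · simp
  have hn' : (0 : ℝ) < n := by exact_mod_cast hn
  rw [← mul_pow, Real.log_pow, Real.log_mul hn'.ne' hL0.ne', hL, Real.log_mul (by positivity)
    (by positivity), Real.log_mul (by positivity) (by positivity), Real.log_pow]
  apply le_of_eq
  ring

end WronskianBound

section Index

theorem eval_C_hasseDeriv_eq_sum (P : ℚ[X][X]) (y : ℚ) (j : ℕ) {N : ℕ} (hN : P.natDegree < N) :
    (hasseDeriv j P).eval (C y) =
      ∑ k ∈ Finset.range N, ((k.choose j : ℚ) * y ^ (k - j)) • P.coeff k := by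
  conv_lhs => rw [P.as_sum_range' N hN, map_sum, eval_finsetSum]
  refine Finset.sum_congr rfl fun k _ => ?_
  rw [hasseDeriv_monomial, eval_monomial, smul_eq_C_mul, C_mul, C_pow, map_natCast]
  ring

theorem eval_hasseDeriv_sum_monomial (y : ℚ) (j N : ℕ) (c : ℕ → ℚ) :
    (hasseDeriv j (∑ k ∈ Finset.range N, monomial k (c k))).eval y =
      ∑ k ∈ Finset.range N, ((k.choose j : ℚ) * y ^ (k - j)) * c k := by
  rw [map_sum, eval_finsetSum]
  refine Finset.sum_congr rfl fun k _ => ?_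
  rw [hasseDeriv_monomial, eval_monomial]
  ring

/-- In a sequence of vectors, those not in the span of their predecessors form a basis of the
span adapted to the filtration. -/
theorem exists_pivots {K V : Type*} [Field K] [AddCommGroup V] [Module K V] (G : ℕ → V) (r : ℕ) :
    ∃ (n : ℕ) (o : Fin n → ℕ), StrictMono o ∧ (∀ k, o k ≤ r) ∧ LinearIndependent K (G ∘ o) ∧
      ∀ j ≤ r, G j ∈ Submodule.span K ((G ∘ o) '' {k | o k ≤ j}) := by
  classical
  set O : Finset ℕ := (Finset.range (r + 1)).filter fun j =>
    G j ∉ Submodule.span K (G '' {i | i < j}) with hO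
  refine ⟨O.card, O.orderEmbOfFin rfl, (O.orderEmbOfFin rfl).strictMono, fun k => ?_, ?_, ?_⟩
  · have := (Finset.mem_filter.mp (O.orderEmbOfFin_mem rfl k)).1
    exact Nat.lt_succ_iff.mp (Finset.mem_range.mp this)
  · rw [Fintype.linearIndependent_iff]
    intro c hc
    by_contra! hne
    obtain ⟨i₀, hi₀⟩ := hne
    set s := Finset.univ.filter fun i => c i ≠ 0 with hs
    have hsne : s.Nonempty := ⟨i₀, by simpa [hs] using hi₀⟩
    set m := s.max' hsne with hm
    have hcm : c m ≠ 0 := (Finset.mem_filter.mp (s.max'_mem hsne)).2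
    have hgt : ∀ i, m < i → c i = 0 := by
      intro i hi
      by_contra h
      exact absurd hi (not_lt.mpr (s.le_max' i (by simpa [hs] using h)))
    have hmem := (Finset.mem_filter.mp (O.orderEmbOfFin_mem rfl m)).2
    apply hmem
    rw [← Finset.add_sum_erase _ _ (Finset.mem_univ m)] at hc
    have hG : G (O.orderEmbOfFin rfl m) = (c m)⁻¹ • -∑ i ∈ Finset.univ.erase m,
        c i • (G ∘ O.orderEmbOfFin rfl) i := by
      rw [← eq_neg_of_add_eq_zero_left hc, smul_smul, inv_mul_cancel₀ hcm, one_smul]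
      rfl
    rw [hG]
    refine Submodule.smul_mem _ _ (Submodule.neg_mem _ (Submodule.sum_mem _ fun i hi => ?_))
    rcases lt_or_gt_of_ne (Finset.ne_of_mem_erase hi) with h | h
    · exact Submodule.smul_mem _ _ (Submodule.subset_span
        ⟨_, (O.orderEmbOfFin rfl).strictMono h, rfl⟩)
    · rw [hgt i h, zero_smul]; exact Submodule.zero_mem _
  · intro j
    induction j using Nat.strong_induction_on with
    | _ j ih =>
      intro hj
      by_cases hjO : j ∈ O
      · have : j ∈ Set.range (O.orderEmbOfFin rfl) := by
          rw [Finset.range_orderEmbOfFin]; exact hjO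
        obtain ⟨k, hk⟩ := this
        exact Submodule.subset_span ⟨k, hk.le, by simp [hk]⟩
      · have hmem : G j ∈ Submodule.span K (G '' {i | i < j}) := by
          by_contra h
          exact hjO (Finset.mem_filter.mpr ⟨Finset.mem_range.mpr (Nat.lt_succ_of_le hj), h⟩)
        refine (Submodule.span_le.mpr ?_) hmem
        rintro _ ⟨i, hi, rfl⟩
        refine Submodule.span_mono ?_ (ih i hi (le_of_lt (lt_of_lt_of_le hi hj)))
        have hi' : i < j := hi
        refine Set.image_mono fun k hk => ?_
        have hk' : _ ≤ i := hk
        exact le_trans hk' hi'.le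

theorem sum_max_sub_ge {n r : ℕ} (hn : n ≤ 2 * r) {Θ : ℝ} (hΘ0 : 0 < Θ) (hΘ1 : Θ ≤ 1) (hr : 0 < r) :
    n * Θ ^ 2 / 8 ≤ ∑ k ∈ Finset.range n, max 0 (Θ - k / r) := by
  have hr' : (0 : ℝ) < r := by exact_mod_cast hr
  set m := ⌊Θ * r / 2⌋₊ + 1 with hm
  have hm1 : Θ * r / 2 ≤ m := by
    rw [hm]; push_cast; exact (Nat.lt_floor_add_one _).le
  have h1 : ∑ k ∈ Finset.range (min n m), Θ / 2 ≤ ∑ k ∈ Finset.range n, max 0 (Θ - k / r) := by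
    refine (Finset.sum_le_sum fun k hk => ?_).trans (Finset.sum_le_sum_of_subset_of_nonneg
      (Finset.range_subset_range.mpr (min_le_left n m)) fun _ _ _ => le_max_left _ _)
    refine le_max_of_le_right ?_
    have hkm : k < m := (Finset.mem_range.mp hk).trans_le (min_le_right n m)
    have hk1 : (k : ℝ) ≤ Θ * r / 2 := by
      have : k ≤ ⌊Θ * r / 2⌋₊ := by omega
      exact (Nat.le_floor_iff (by positivity)).mp this
    have : (k : ℝ) / r ≤ Θ / 2 := by rw [div_le_iff₀ hr']; linarith
    linarith
  rw [Finset.sum_const, Finset.card_range, nsmul_eq_mul] at h1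
  refine le_trans ?_ h1
  have hn' : (n : ℝ) ≤ 2 * r := by exact_mod_cast hn
  have h2 : (n : ℝ) * Θ / 4 ≤ ((min n m : ℕ) : ℝ) := by
    rw [Nat.cast_min]
    refine le_min ?_ ?_
    · have := Nat.cast_nonneg (α := ℝ) n; nlinarith
    · nlinarith
  nlinarith

theorem exists_fin_basis_of_finrank {ι V : Type*} [Finite ι] [AddCommGroup V] [Module ℚ V]
    (v : ι → V) {n : ℕ} {φ : Fin n → V} (hφ : LinearIndependent ℚ φ)
    (hspan : Submodule.span ℚ (Set.range v) = Submodule.span ℚ (Set.range φ)) :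
    ∃ (a : Fin n → ι) (T : Fin n → Fin n → ℚ), ∀ j, φ j = ∑ k, T k j • v (a k) := by
  obtain ⟨κ, a, ha, hsp, hli⟩ := exists_linearIndependent' ℚ v
  have : Finite κ := Finite.of_injective a ha
  have := Fintype.ofFinite κ
  have h1 := finrank_span_eq_card hli
  rw [hsp, hspan, finrank_span_eq_card hφ, Fintype.card_fin] at h1
  let e : Fin n ≃ κ := (Fintype.equivFinOfCardEq h1.symm).symm
  have hmem : ∀ j, ∃ c : κ → ℚ, ∑ k, c k • (v ∘ a) k = φ j := by
    intro j
    rw [← Submodule.mem_span_range_iff_exists_fun, hsp, hspan]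
    exact Submodule.subset_span ⟨j, rfl⟩
  choose c hc using hmem
  refine ⟨a ∘ e, fun k j => c j (e k), fun j => ?_⟩
  rw [← hc j]
  exact (Equiv.sum_comp e fun k => c j k • (v ∘ a) k).symm

/-- A form of Roth's lemma in two variables: an integral polynomial of small height has small index
at a point whose coordinates have large and very different heights. -/
theorem exists_index_lt {F : ℤ[X][X]} (hF : F ≠ 0) {r₁ r₂ : ℕ} (hr₁ : 0 < r₁) (hr₂ : 0 < r₂)
    (hdegy : F.natDegree ≤ r₂) (hdegx : ∀ j, (F.coeff j).natDegree ≤ r₁) {M : ℝ} (hM1 : 1 ≤ M)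
    (hM : ∀ i j, |((F.coeff j).coeff i : ℝ)| ≤ M) {x y : ℚ} {Θ σ : ℝ} (hΘ0 : 0 < Θ) (hΘ1 : Θ ≤ 1)
    (hσΘ : 24 * σ < Θ ^ 2) (hx0 : 0 < Height.logHeight₁ x) (hy0 : 0 < Height.logHeight₁ y)
    (hx : Real.log (r₂ + 1) + Real.log (r₁ + 1) + r₁ * Real.log 2 + Real.log M ≤
      σ * r₁ * Height.logHeight₁ x)
    (hy : Real.log (r₂ + 1) + Real.log (r₂ + 1) + r₂ * Real.log 2 + Real.log M ≤
      σ * r₂ * Height.logHeight₁ y) (hr : (r₂ : ℝ) ≤ σ * r₁) :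
    ∃ i j : ℕ, (i : ℝ) / r₁ + j / r₂ < Θ ∧ (hasseDeriv i ((hasseDeriv j
      (F.map (mapRingHom (Int.castRingHom ℚ)))).eval (C y))).eval x ≠ 0 := by
  by_contra! hvan
  have hr₁' : (0 : ℝ) < r₁ := by exact_mod_cast hr₁
  have hr₂' : (0 : ℝ) < r₂ := by exact_mod_cast hr₂
  set P : ℚ[X][X] := F.map (mapRingHom (Int.castRingHom ℚ)) with hP
  have hPc : ∀ j, P.coeff j = (F.coeff j).map (Int.castRingHom ℚ) := by
    intro j; rw [hP, coeff_map, coe_mapRingHom]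
  have hPdeg : P.natDegree < r₂ + 1 := Nat.lt_succ_of_le (natDegree_map_le.trans hdegy)
  have hP0 : P ≠ 0 := by
    rw [hP, Ne, Polynomial.map_eq_zero_iff]
    · exact hF
    · exact map_injective _ Int.cast_injective
  set G : ℕ → ℚ[X] := fun j => (hasseDeriv j P).eval (C y) with hG
  have hGsum : ∀ j, G j = ∑ k ∈ Finset.range (r₂ + 1),
      ((k.choose j : ℚ) * y ^ (k - j)) • P.coeff k := fun j => eval_C_hasseDeriv_eq_sum P y j hPdeg
  have hGsum' : ∀ j, P.coeff j = ∑ k ∈ Finset.range (r₂ + 1),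
      ((k.choose j : ℚ) * (-y) ^ (k - j)) • G k := by
    intro j
    have hdeg' : (taylor (C y) P).natDegree < r₂ + 1 := by rwa [natDegree_taylor]
    have h1 := eval_C_hasseDeriv_eq_sum (taylor (C y) P) (-y) j hdeg'
    rw [← taylor_coeff, taylor_taylor, C_neg, neg_add_cancel, taylor_zero] at h1
    rw [h1]
    refine Finset.sum_congr rfl fun k _ => ?_
    rw [taylor_coeff]
  obtain ⟨n, o, ho, hor, hli, hpiv⟩ := exists_pivots (K := ℚ) G r₂
  set φ : Fin n → ℚ[X] := G ∘ o with hφ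
  have hGφ : ∀ j ≤ r₂, G j ∈ Submodule.span ℚ (Set.range φ) := fun j hj =>
    Submodule.span_mono (Set.image_subset_range _ _) (hpiv j hj)
  have hPφ : ∀ j, P.coeff j ∈ Submodule.span ℚ (Set.range φ) := by
    intro j
    rw [hGsum' j]
    exact Submodule.sum_mem _ fun k hk => Submodule.smul_mem _ _
      (hGφ k (Nat.lt_succ_iff.mp (Finset.mem_range.mp hk)))
  have hn0 : 0 < n := by
    rcases Nat.eq_zero_or_pos n with rfl | h
    · exfalso
      apply hP0
      ext1 j
      have := hPφ j
      rw [Set.range_eq_empty φ, Submodule.span_empty, Submodule.mem_bot] at this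
      rw [this, coeff_zero]
    · exact h
  have hko : ∀ k : Fin n, (k : ℕ) ≤ o k := by
    intro k
    obtain ⟨k, hk⟩ := k
    induction k with
    | zero => exact Nat.zero_le _
    | succ k ih =>
      have h1 := ih (Nat.lt_of_succ_lt hk)
      have h2 : o ⟨k, Nat.lt_of_succ_lt hk⟩ < o ⟨k + 1, hk⟩ := ho (by simp)
      exact Nat.succ_le_of_lt (lt_of_le_of_lt h1 h2)
  have hnr : n ≤ r₂ + 1 := by
    have := hko ⟨n - 1, by omega⟩
    have h2 := hor ⟨n - 1, by omega⟩
    simp only at this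
    omega
  have hn0' : (0 : ℝ) < n := by exact_mod_cast hn0
  have hlogn : Real.log n ≤ Real.log (r₂ + 1) :=
    Real.log_le_log hn0' (by exact_mod_cast hnr)
  have hspanx : Submodule.span ℚ (Set.range fun j : Fin (r₂ + 1) =>
      (F.coeff j).map (Int.castRingHom ℚ)) = Submodule.span ℚ (Set.range φ) := by
    refine le_antisymm (Submodule.span_le.mpr ?_) (Submodule.span_le.mpr ?_)
    · rintro _ ⟨j, rfl⟩
      simp only [← hPc]
      exact hPφ _
    · rintro _ ⟨k, rfl⟩
      simp only [hφ, Function.comp_apply, SetLike.mem_coe]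
      rw [hGsum]
      refine Submodule.sum_mem _ fun j hj => Submodule.smul_mem _ _ (Submodule.subset_span
        ⟨⟨j, Finset.mem_range.mp hj⟩, (hPc j).symm⟩)
  obtain ⟨a, T, hT⟩ := exists_fin_basis_of_finrank _ hli hspanx
  have hxbound := sum_order_mul_log_le (g := fun k => F.coeff (a k)) (M := M) hT hli
    (fun k => hdegx _) hM1 (fun k i => hM i _) x (fun k => ⌈(r₁ : ℝ) * (Θ - o k / r₂)⌉₊) (by
      intro k
      rw [X_sub_C_pow_dvd_iff_hasseDeriv]
      intro i hi
      rw [Nat.lt_ceil] at hi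
      refine hvan i (o k) ?_
      rw [← lt_sub_iff_add_lt, div_lt_iff₀ hr₁', mul_comm]
      exact hi)
  have hlam : ∀ k : Fin n, ∃ l : ℚ[X] →ₗ[ℚ] ℚ, ∀ i, l (φ i) = if i = k then 1 else 0 := by
    intro k
    obtain ⟨l, hl⟩ := LinearMap.exists_extend ((Module.Basis.span hli).coord k)
    refine ⟨l, fun i => ?_⟩
    have h1 : l ((Module.Basis.span hli) i : ℚ[X]) =
        (Module.Basis.span hli).coord k (Module.Basis.span hli i) :=
      LinearMap.congr_fun hl _
    rwa [Module.Basis.coord_apply, Module.Basis.repr_self, Finsupp.single_apply,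
      Module.Basis.span_apply] at h1
  choose l hl using hlam
  set ψ : Fin n → ℚ[X] := fun k => ∑ j ∈ Finset.range (r₂ + 1), monomial j (l k (P.coeff j)) with hψ
  have hψG : ∀ k j, (hasseDeriv j (ψ k)).eval y = l k (G j) := by
    intro k j
    rw [hψ, eval_hasseDeriv_sum_monomial, hGsum, map_sum]
    refine Finset.sum_congr rfl fun i _ => ?_
    rw [map_smul, smul_eq_mul]
  have hψli : LinearIndependent ℚ ψ := by
    rw [Fintype.linearIndependent_iff]
    intro c hc i
    have := congrArg (fun p => (hasseDeriv (o i) p).eval y) hc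
    simp only [map_sum, map_smul, eval_finsetSum, eval_smul, hψG, smul_eq_mul, map_zero,
      eval_zero] at this
    rw [Finset.sum_eq_single i] at this
    · have h1 := hl i i
      rw [if_pos rfl] at h1
      change c i * l i (φ i) = 0 at this
      rwa [h1, mul_one] at this
    · intro k _ hk
      have h1 := hl k i
      rw [if_neg (Ne.symm hk)] at h1
      change c k * l k (φ i) = 0
      rw [h1, mul_zero]
    · simp
  have hψord : ∀ k, (X - C y) ^ o k ∣ ψ k := by
    intro k
    rw [X_sub_C_pow_dvd_iff_hasseDeriv]
    intro j hj
    rw [hψG]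
    have hmem := hpiv j (le_of_lt (lt_of_lt_of_le hj (hor k)))
    have hle : Submodule.span ℚ ((G ∘ o) '' {i | o i ≤ j}) ≤ LinearMap.ker (l k) := by
      rw [Submodule.span_le]
      rintro _ ⟨i, hi, rfl⟩
      have hik : i ≠ k := by
        rintro rfl
        exact absurd hj (not_lt.mpr hi)
      have := hl k i
      rw [if_neg hik] at this
      exact this
    exact hle hmem
  set Ey : Fin (r₁ + 1) → ℤ[X] := fun i =>
    ∑ j ∈ Finset.range (r₂ + 1), monomial j ((F.coeff j).coeff i) with hEy
  have hEycoeff : ∀ i j, (Ey i).coeff j = if j < r₂ + 1 then (F.coeff j).coeff i else 0 := by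
    intro i j
    simp only [hEy, finsetSum_coeff, coeff_monomial]
    rw [Finset.sum_ite_eq' (Finset.range (r₂ + 1)) j]
    simp
  have hEymap : ∀ i, (Ey i).map (Int.castRingHom ℚ) =
      ∑ j ∈ Finset.range (r₂ + 1), monomial j ((P.coeff j).coeff i) := by
    intro i
    simp only [hEy, Polynomial.map_sum, map_monomial, hPc, coeff_map]
  have hspany : Submodule.span ℚ (Set.range fun i => (Ey i).map (Int.castRingHom ℚ)) =
      Submodule.span ℚ (Set.range ψ) := by
    refine le_antisymm (Submodule.span_le.mpr ?_) (Submodule.span_le.mpr ?_)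
    · rintro _ ⟨i, rfl⟩
      have : (Ey i).map (Int.castRingHom ℚ) = ∑ k, (φ k).coeff i • ψ k := by
        rw [hEymap]
        simp only [hψ, Finset.smul_sum, smul_monomial]
        rw [Finset.sum_comm]
        refine Finset.sum_congr rfl fun j _ => ?_
        rw [← map_sum]
        congr 1
        obtain ⟨c, hc⟩ := (Submodule.mem_span_range_iff_exists_fun ℚ).mp (hPφ j)
        have hlc : ∀ k, l k (P.coeff j) = c k := by
          intro k
          rw [← hc, map_sum]
          simp only [map_smul, hl, smul_eq_mul]
          simp
        simp only [hlc]
        rw [← hc, finsetSum_coeff]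
        refine Finset.sum_congr rfl fun k _ => ?_
        rw [coeff_smul, smul_eq_mul, smul_eq_mul, mul_comm]
      simp only [SetLike.mem_coe]
      rw [this]
      exact Submodule.sum_mem _ fun k _ => Submodule.smul_mem _ _ (Submodule.subset_span ⟨k, rfl⟩)
    · rintro _ ⟨k, rfl⟩
      have : ψ k = ∑ i : Fin (r₁ + 1), l k (X ^ (i : ℕ)) • (Ey i).map (Int.castRingHom ℚ) := by
        simp only [hEymap, hψ, Finset.smul_sum, smul_monomial]
        rw [Finset.sum_comm]
        refine Finset.sum_congr rfl fun j _ => ?_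
        rw [← map_sum]
        congr 1
        have hd : (P.coeff j).natDegree < r₁ + 1 := by
          rw [hPc]; exact Nat.lt_succ_of_le (natDegree_map_le.trans (hdegx j))
        conv_lhs => rw [(P.coeff j).as_sum_range' (r₁ + 1) hd]
        rw [map_sum, ← Fin.sum_univ_eq_sum_range (fun i => l k (monomial i ((P.coeff j).coeff i)))]
        refine Finset.sum_congr rfl fun i _ => ?_
        rw [← smul_X_eq_monomial, map_smul, smul_eq_mul, smul_eq_mul, mul_comm]
      simp only [SetLike.mem_coe]
      rw [this]
      exact Submodule.sum_mem _ fun i _ => Submodule.smul_mem _ _ (Submodule.subset_span ⟨i, rfl⟩)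
  obtain ⟨b, U, hU⟩ := exists_fin_basis_of_finrank _ hψli hspany
  have hybound := sum_order_mul_log_le (g := fun k => Ey (b k)) (M := M) (r := r₂) hU hψli
    (fun k => natDegree_sum_le_of_forall_le _ _ fun j hj => (natDegree_monomial_le _).trans
      (Nat.lt_succ_iff.mp (Finset.mem_range.mp hj))) hM1
    (fun k i => by
      rw [hEycoeff]
      split_ifs
      · exact hM _ _
      · simp; linarith) y o hψord
  have hx' : ((∑ k, ⌈(r₁ : ℝ) * (Θ - o k / r₂)⌉₊ : ℕ) - (∑ j : Fin n, (j : ℕ) : ℕ) : ℝ) ≤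
      n * (σ * r₁) := by
    refine le_of_mul_le_mul_right (hxbound.trans ?_) hx0
    rw [mul_assoc]
    refine mul_le_mul_of_nonneg_left ?_ hn0'.le
    linarith
  have hy' : ((∑ k, o k : ℕ) - (∑ j : Fin n, (j : ℕ) : ℕ) : ℝ) ≤ n * (σ * r₂) := by
    refine le_of_mul_le_mul_right (hybound.trans ?_) hy0
    rw [mul_assoc]
    refine mul_le_mul_of_nonneg_left ?_ hn0'.le
    linarith
  have hsumk : ((∑ j : Fin n, (j : ℕ) : ℕ) : ℝ) ≤ n * (σ * r₁) := by
    have : (∑ j : Fin n, (j : ℕ)) ≤ ∑ j : Fin n, r₂ :=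
      Finset.sum_le_sum fun j _ => (hko j).trans (hor j)
    rw [Finset.sum_const, Finset.card_univ, Fintype.card_fin, smul_eq_mul] at this
    have h2 : ((∑ j : Fin n, (j : ℕ) : ℕ) : ℝ) ≤ n * r₂ := by exact_mod_cast this
    exact h2.trans (by gcongr)
  have hmax : r₁ * ∑ k, max 0 (Θ - o k / r₂) ≤ ((∑ k, ⌈(r₁ : ℝ) * (Θ - o k / r₂)⌉₊ : ℕ) : ℝ) := by
    push_cast
    rw [Finset.mul_sum]
    refine Finset.sum_le_sum fun k _ => ?_
    rw [mul_max_of_nonneg _ _ hr₁'.le, mul_zero]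
    exact max_le (Nat.cast_nonneg _) (Nat.le_ceil _)
  have hmax' : ∑ k, max 0 (Θ - o k / r₂) ≤ 2 * (n * σ) := by
    refine le_of_mul_le_mul_left ?_ hr₁'
    nlinarith
  have hlow : ∑ k : Fin n, max 0 (Θ - (k : ℕ) / r₂) - (∑ k, ((o k : ℝ) - (k : ℕ))) / r₂ ≤
      ∑ k, max 0 (Θ - o k / r₂) := by
    rw [Finset.sum_div, ← Finset.sum_sub_distrib]
    refine Finset.sum_le_sum fun k _ => ?_
    have h1 : (0 : ℝ) ≤ ((o k : ℝ) - (k : ℕ)) / r₂ :=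
      div_nonneg (sub_nonneg.mpr (by exact_mod_cast hko k)) hr₂'.le
    rw [sub_le_iff_le_add]
    refine max_le (add_nonneg (le_max_left _ _) h1) ?_
    have := le_max_right 0 (Θ - o k / r₂)
    have h2 : (Θ - (k : ℕ) / r₂ : ℝ) = (Θ - o k / r₂) + ((o k : ℝ) - (k : ℕ)) / r₂ := by
      field_simp; ring
    linarith
  have hdiff : (∑ k, ((o k : ℝ) - (k : ℕ))) / r₂ ≤ n * σ := by
    rw [div_le_iff₀ hr₂', Finset.sum_sub_distrib]
    push_cast at hy'
    linarith
  have hge := sum_max_sub_ge (n := n) (r := r₂) (by omega) hΘ0 hΘ1 hr₂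
  rw [← Fin.sum_univ_eq_sum_range (fun k => max 0 (Θ - (k : ℝ) / r₂))] at hge
  have : n * Θ ^ 2 / 8 ≤ 3 * (n * σ) := by linarith
  nlinarith

end Index

end

section

open Polynomial Module IntermediateField

section TwoGenerators

variable {F Ω : Type*} [Field F] [Field Ω] [Algebra F Ω]

theorem finrank_adjoin_simple_eq {a b : Ω} (ha : IsIntegral F⟮b⟯ a) :
    finrank F⟮b⟯ Ω = (minpoly F⟮b⟯ a).natDegree * finrank F⟮b, a⟯ Ω := by
  have h1 : ∀ K K' : IntermediateField F Ω, K = K' → finrank K Ω = finrank K' Ω := by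
    rintro _ _ rfl; rfl
  rw [← h1 _ _ (adjoin_simple_adjoin_simple F b a), ← adjoin.finrank ha]
  exact (finrank_mul_finrank F⟮b⟯ F⟮b⟯⟮a⟯ Ω).symm

/-- Evaluation of a bivariate polynomial. -/
noncomputable def biEval (u v : Ω) : F[X][X] →ₐ[F] Ω := aevalAeval u v

theorem biEval_monomial (u v : Ω) (n : ℕ) (p : F[X]) :
    biEval u v (monomial n p) = aeval u p * v ^ n := by
  rw [biEval, ← C_mul_X_pow_eq_monomial, map_mul, map_pow, aevalAeval_C]
  congr 2
  simp [aevalAeval]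

theorem natDegree_minpoly_of_irreducible {u v : Ω} (hu : Transcendental F u) :
    (∀ R : F[X][X], Irreducible R → biEval u v R = 0 →
      IsIntegral F⟮u⟯ v ∧ (minpoly F⟮u⟯ v).natDegree = R.natDegree) ∧
    (IsIntegral F⟮u⟯ v → ∃ R : F[X][X], Irreducible R ∧ biEval u v R = 0) := by
  let : Algebra F[X] F⟮u⟯ := (aeval (AdjoinSimple.gen F u)).toRingHom.toAlgebra
  let : Algebra F[X] Ω := (aeval u).toRingHom.toAlgebra
  have halg : ∀ p : F[X], (algebraMap F[X] F⟮u⟯ p : Ω) = aeval u p := by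
    intro p
    change ((aeval (AdjoinSimple.gen F u) p : F⟮u⟯) : Ω) = _
    rw [← coe_val, ← aeval_algHom_apply]
    rfl
  have : IsScalarTower F[X] F⟮u⟯ Ω := IsScalarTower.of_algebraMap_eq fun p => (halg p).symm
  have hinj : Function.Injective (algebraMap F[X] F⟮u⟯) := by
    rw [injective_iff_map_eq_zero]
    intro p hp
    have := halg p
    rw [hp] at this
    exact (transcendental_iff.mp hu) p this.symm
  have : FaithfulSMul F[X] F⟮u⟯ := (faithfulSMul_iff_algebraMap_injective _ _).mpr hinj
  have : IsFractionRing F[X] F⟮u⟯ := by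
    refine IsFractionRing.of_field F[X] F⟮u⟯ fun z => ?_
    obtain ⟨r, s, hrs⟩ := (mem_adjoin_simple_iff F z.1).mp z.2
    exact ⟨r, s, Subtype.ext (by rw [hrs]; push_cast; rw [halg, halg])⟩
  have hev : ∀ R : F[X][X], aeval v R = biEval u v R := by
    intro R
    induction R using Polynomial.induction_on' with
    | add p q hp hq => rw [map_add, map_add, hp, hq]
    | monomial n p => rw [biEval_monomial, aeval_monomial]; rfl
  refine ⟨fun R hR h => ?_, fun hv => ?_⟩
  · have hev : aeval v (R.map (algebraMap F[X] F⟮u⟯)) = 0 := by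
      rw [← h, aeval_map_algebraMap, hev]
    have hdeg : R.natDegree ≠ 0 := by
      intro h0
      rw [eq_C_of_natDegree_eq_zero h0] at h hR
      have h2 : aeval u (R.coeff 0) = 0 := by
        rw [← monomial_zero_left, biEval_monomial, pow_zero, mul_one] at h
        exact h
      have := (transcendental_iff.mp hu) _ h2
      rw [this, C_0] at hR
      exact not_irreducible_zero hR
    have hirr : Irreducible (R.map (algebraMap F[X] F⟮u⟯)) :=
      ((hR.isPrimitive hdeg).irreducible_iff_irreducible_map_fraction_map).mp hR
    have hmin := minpoly.eq_of_irreducible hirr hev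
    refine ⟨?_, ?_⟩
    · rw [← isAlgebraic_iff_isIntegral]
      exact ⟨_, hirr.ne_zero, hev⟩
    · rw [← hmin, mul_comm, natDegree_C_mul (inv_ne_zero (leadingCoeff_ne_zero.mpr hirr.ne_zero)),
        natDegree_map_eq_of_injective hinj]
  · have h1 : IsAlgebraic F[X] v := (IsFractionRing.isAlgebraic_iff F[X] F⟮u⟯ Ω).mpr hv.isAlgebraic
    obtain ⟨p, hp0, hp⟩ := h1
    have hker : (RingHom.ker (biEval (F := F) u v)).IsPrime := RingHom.ker_isPrime _
    obtain ⟨R, hR, hprime⟩ := hker.exists_mem_prime_of_ne_bot (by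
      intro hbot
      apply hp0
      rw [← Ideal.mem_bot, ← hbot, RingHom.mem_ker, ← hev, hp])
    exact ⟨R, hprime.irreducible, hR⟩

theorem natDegree_coeff_le_natDegree_swap (R : F[X][X]) (n : ℕ) :
    (R.coeff n).natDegree ≤ (Bivariate.swap R).natDegree := by
  have h : ∀ (R : F[X][X]) (i j : ℕ), ((Bivariate.swap R).coeff i).coeff j = (R.coeff j).coeff i := by
    intro R i j
    induction R using Polynomial.induction_on' with
    | add p q hp hq => simp [hp, hq]
    | monomial n p =>
      induction p using Polynomial.induction_on' with
      | add p q hp hq => rw [map_add, map_add]; simp [hp, hq]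
      | monomial m r =>
        rw [Bivariate.swap_monomial_monomial]
        simp only [coeff_monomial]
        split_ifs <;> simp_all [coeff_monomial]
  rw [natDegree_le_iff_coeff_eq_zero]
  intro i hi
  rw [← h, coeff_eq_zero_of_natDegree_lt hi, coeff_zero]

/-- Two elements over each of which `Ω` has the same finite degree satisfy a relation of
bidegree `(e, e)`. -/
theorem exists_relation_of_finrank_eq {u v : Ω} (hu : Transcendental F u) (hv : Transcendental F v)
    (huv : IsIntegral F⟮u⟯ v) (hfin : finrank F⟮u⟯ Ω ≠ 0) (heq : finrank F⟮u⟯ Ω = finrank F⟮v⟯ Ω) :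
    ∃ (e : ℕ) (R : F[X][X]), R ≠ 0 ∧ biEval u v R = 0 ∧ R.natDegree ≤ e ∧
      (∀ n, (R.coeff n).natDegree ≤ e) ∧ finrank F⟮u⟯ Ω = e * finrank F⟮u, v⟯ Ω := by
  obtain ⟨R, hR, hR0⟩ := (natDegree_minpoly_of_irreducible hu).2 huv
  obtain ⟨-, h1⟩ := (natDegree_minpoly_of_irreducible (v := v) hu).1 R hR hR0
  obtain ⟨h2, h3⟩ := (natDegree_minpoly_of_irreducible (v := u) hv).1 (Bivariate.swap R)
    ((MulEquiv.irreducible_iff (Bivariate.swap (R := F))).mpr hR)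
    (by rw [biEval, Bivariate.aevalAeval_swap]; exact hR0)
  have h4 := finrank_adjoin_simple_eq huv
  have h5 := finrank_adjoin_simple_eq h2
  rw [Set.pair_comm] at h5
  have h6 : (minpoly F⟮u⟯ v).natDegree = (minpoly F⟮v⟯ u).natDegree := by
    rw [heq, h5] at h4
    refine Nat.eq_of_mul_eq_mul_right (Nat.pos_of_ne_zero ?_) h4.symm
    intro h0
    rw [h0, mul_zero] at h5
    exact hfin (heq.trans h5)
  refine ⟨_, R, hR.ne_zero, hR0, h1.ge, fun n => ?_, h4⟩
  rw [h6, h3]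
  exact natDegree_coeff_le_natDegree_swap R n

/-- The span of the monomials `u ^ a * v ^ b` with `a, b ≤ n`. -/
def biSpan (F : Type*) {Ω : Type*} [Field F] [Field Ω] [Algebra F Ω] (u v : Ω) (n : ℕ) :
    Submodule F Ω :=
  Submodule.span F (Set.range fun p : Fin (n + 1) × Fin (n + 1) => u ^ (p.1 : ℕ) * v ^ (p.2 : ℕ))

variable {u v : Ω}

theorem pow_mul_pow_mem_biSpan {a b n : ℕ} (ha : a ≤ n) (hb : b ≤ n) :
    u ^ a * v ^ b ∈ biSpan F u v n :=
  Submodule.subset_span ⟨(⟨a, Nat.lt_succ_of_le ha⟩, ⟨b, Nat.lt_succ_of_le hb⟩), rfl⟩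

theorem biSpan_mono {m n : ℕ} (h : m ≤ n) : biSpan F u v m ≤ biSpan F u v n := by
  refine Submodule.span_le.mpr ?_
  rintro _ ⟨⟨a, b⟩, rfl⟩
  exact pow_mul_pow_mem_biSpan (by omega) (by omega)

theorem mul_mem_biSpan {m n : ℕ} {x y : Ω} (hx : x ∈ biSpan F u v m) (hy : y ∈ biSpan F u v n) :
    x * y ∈ biSpan F u v (m + n) := by
  have h : biSpan F u v m * biSpan F u v n ≤ biSpan F u v (m + n) := by
    rw [biSpan, biSpan, Submodule.span_mul_span]
    refine Submodule.span_le.mpr ?_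
    rintro _ ⟨_, ⟨⟨a, b⟩, rfl⟩, _, ⟨⟨a', b'⟩, rfl⟩, rfl⟩
    have : u ^ (a : ℕ) * v ^ (b : ℕ) * (u ^ (a' : ℕ) * v ^ (b' : ℕ)) =
        u ^ (a + a' : ℕ) * v ^ (b + b' : ℕ) := by ring
    simp only [this]
    exact pow_mul_pow_mem_biSpan (by omega) (by omega)
  exact h (Submodule.mul_mem_mul hx hy)

theorem pow_mem_biSpan {m : ℕ} {x : Ω} (hx : x ∈ biSpan F u v m) (n : ℕ) :
    x ^ n ∈ biSpan F u v (n * m) := by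
  induction n with
  | zero => simpa using pow_mul_pow_mem_biSpan (F := F) (u := u) (v := v) (le_refl 0) (le_refl 0)
  | succ n ih => rw [pow_succ, Nat.succ_mul]; exact mul_mem_biSpan ih hx

/-- The polynomials of bidegree at most `(n, n)`. -/
noncomputable def biPolyMap (F : Type*) [Field F] (n : ℕ) : (Fin n × Fin n → F) →ₗ[F] F[X][X] :=
  Fintype.linearCombination F fun p => monomial (p.2 : ℕ) (monomial (p.1 : ℕ) (1 : F))

theorem coeff_coeff_biPolyMap {n : ℕ} (c : Fin n × Fin n → F) (p : Fin n × Fin n) :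
    ((biPolyMap F n c).coeff p.2).coeff p.1 = c p := by
  rw [biPolyMap, Fintype.linearCombination_apply, finsetSum_coeff, finsetSum_coeff,
    Finset.sum_eq_single p]
  · simp
  · intro q _ hq
    rw [coeff_smul, coeff_smul, coeff_monomial]
    split_ifs with h
    · rw [coeff_monomial, if_neg, smul_zero]
      exact fun h' => hq (Prod.ext (Fin.ext h') (Fin.ext h))
    · simp
  · simp

theorem biPolyMap_injective (n : ℕ) : Function.Injective (biPolyMap F n) := by
  intro c c' h
  ext p
  rw [← coeff_coeff_biPolyMap c, h, coeff_coeff_biPolyMap]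

theorem mem_range_biPolyMap {n : ℕ} {R : F[X][X]} (h1 : R.natDegree < n)
    (h2 : ∀ i, (R.coeff i).natDegree < n) : R ∈ LinearMap.range (biPolyMap F n) := by
  refine ⟨fun p => (R.coeff p.2).coeff p.1, ?_⟩
  rw [biPolyMap, Fintype.linearCombination_apply, Fintype.sum_prod_type_right]
  conv_rhs => rw [R.as_sum_range' n h1]
  rw [Finset.sum_range]
  refine Finset.sum_congr rfl fun j _ => ?_
  conv_rhs => rw [(R.coeff j).as_sum_range' n (h2 j), map_sum, Finset.sum_range]
  refine Finset.sum_congr rfl fun i _ => ?_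
  rw [smul_monomial, smul_monomial, smul_eq_mul, mul_one]

theorem natDegree_lt_of_mem_range {n : ℕ} {R : F[X][X]} (h : R ∈ LinearMap.range (biPolyMap F (n + 1))) :
    R.natDegree ≤ n ∧ ∀ i, (R.coeff i).natDegree ≤ n := by
  obtain ⟨c, rfl⟩ := h
  rw [biPolyMap, Fintype.linearCombination_apply]
  refine ⟨natDegree_sum_le_of_forall_le _ _ fun p _ => ?_, fun i => ?_⟩
  · exact (natDegree_smul_le _ _).trans ((natDegree_monomial_le _).trans (by omega))
  · rw [finsetSum_coeff]
    refine natDegree_sum_le_of_forall_le _ _ fun p _ => ?_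
    rw [coeff_smul, coeff_monomial]
    refine (natDegree_smul_le _ _).trans ?_
    split_ifs
    · exact (natDegree_monomial_le _).trans (by omega)
    · simp

theorem finrank_biSpan_le {R : F[X][X]} (hR : R ≠ 0) (hR0 : biEval u v R = 0) {e : ℕ}
    (h1 : R.natDegree ≤ e) (h2 : ∀ n, (R.coeff n).natDegree ≤ e) (n : ℕ) :
    finrank F (biSpan F u v (n + e)) ≤ e * (2 * (n + e + 1)) := by
  set φ : (Fin (n + e + 1) × Fin (n + e + 1) → F) →ₗ[F] Ω :=
    (biEval u v).toLinearMap ∘ₗ biPolyMap F (n + e + 1) with hφ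
  have hrange : LinearMap.range φ = biSpan F u v (n + e) := by
    have : φ = Fintype.linearCombination F
        (fun p : Fin (n + e + 1) × Fin (n + e + 1) => u ^ (p.1 : ℕ) * v ^ (p.2 : ℕ)) := by
      ext p
      simp [hφ, biPolyMap, Fintype.linearCombination_apply, biEval_monomial, aeval_monomial]
    rw [this, Fintype.range_linearCombination, biSpan]
  have hrn := LinearMap.finrank_range_add_finrank_ker φ
  rw [hrange, finrank_fintype_fun_eq_card, Fintype.card_prod, Fintype.card_fin] at hrn
  have hmul : ∀ c : Fin (n + 1) × Fin (n + 1) → F,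
      R * biPolyMap F (n + 1) c ∈ LinearMap.range (biPolyMap F (n + e + 1)) := by
    intro c
    obtain ⟨h3, h4⟩ := natDegree_lt_of_mem_range (LinearMap.mem_range_self (biPolyMap F (n + 1)) c)
    refine mem_range_biPolyMap ?_ fun i => ?_
    · exact Nat.lt_succ_of_le (natDegree_mul_le.trans (by omega))
    · rw [coeff_mul]
      refine Nat.lt_succ_of_le (natDegree_sum_le_of_forall_le _ _ fun p _ => ?_)
      exact natDegree_mul_le.trans (by have := h2 p.1; have := h4 p.2; omega)
  have hker : (n + 1) * (n + 1) ≤ finrank F (LinearMap.ker φ) := by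
    set ι := LinearEquiv.ofInjective _ (biPolyMap_injective (F := F) (n + e + 1))
    set ψ : (Fin (n + 1) × Fin (n + 1) → F) →ₗ[F] (Fin (n + e + 1) × Fin (n + e + 1) → F) :=
      ι.symm.toLinearMap ∘ₗ LinearMap.codRestrict _
        (LinearMap.mulLeft F R ∘ₗ biPolyMap F (n + 1)) hmul with hψ
    have hψ' : ∀ c, biPolyMap F (n + e + 1) (ψ c) = R * biPolyMap F (n + 1) c := by
      intro c
      have : ι (ψ c) = ⟨R * biPolyMap F (n + 1) c, hmul c⟩ := by
        rw [hψ]; exact LinearEquiv.apply_symm_apply _ _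
      exact congrArg Subtype.val this
    have hinj : Function.Injective ψ := by
      intro c c' h
      apply biPolyMap_injective
      apply mul_left_cancel₀ hR
      rw [← hψ', h, hψ']
    have hle : LinearMap.range ψ ≤ LinearMap.ker φ := by
      rintro _ ⟨c, rfl⟩
      rw [LinearMap.mem_ker, hφ, LinearMap.comp_apply, hψ']
      simp [hR0]
    have := Submodule.finrank_mono hle
    rwa [LinearMap.finrank_range_of_inj hinj, finrank_fintype_fun_eq_card, Fintype.card_prod,
      Fintype.card_fin] at this
  nlinarith

end TwoGenerators

section DegreeInequality

variable {F Ω : Type*} [Field F] [Field Ω] [Algebra F Ω] {u v : Ω}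

theorem linearIndependent_pow_of_transcendental {Z : Ω} (hZ : Transcendental F Z) :
    LinearIndependent F (fun n : ℕ => Z ^ n) := by
  have h := (basisMonomials F).linearIndependent.map' (aeval (R := F) Z).toLinearMap (by
    rw [LinearMap.ker_eq_bot]
    exact transcendental_iff_injective.mp hZ)
  have h2 : (fun n : ℕ => Z ^ n) = (aeval (R := F) Z).toLinearMap ∘ basisMonomials F := by
    ext n
    simp
  rw [h2]
  exact h

theorem exists_monomials_adjoin_pair {K : Type*} [Field K] [Algebra K Ω] [FiniteDimensional K Ω]
    (u v : Ω) : ∃ (D : ℕ) (e : Fin D → ℕ × ℕ), D = finrank K (adjoin K {u, v}) ∧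
      LinearIndependent K fun i => u ^ (e i).1 * v ^ (e i).2 := by
  obtain ⟨κ, a, -, hsp, hli⟩ := exists_linearIndependent' K fun p : ℕ × ℕ => u ^ p.1 * v ^ p.2
  have hfin : Finite κ := hli.finite
  have : Fintype κ := Fintype.ofFinite κ
  have hspan : Submodule.span K (Set.range fun p : ℕ × ℕ => u ^ p.1 * v ^ p.2) =
      Subalgebra.toSubmodule (adjoin K {u, v}).toSubalgebra := by
    rw [adjoin_toSubalgebra_of_isAlgebraic fun x _ => Algebra.IsAlgebraic.isAlgebraic x,
      Algebra.adjoin_eq_span]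
    congr 1
    ext x
    rw [SetLike.mem_coe, Submonoid.mem_closure_pair]
    simp
  have hcard : Fintype.card κ = finrank K (adjoin K {u, v}) := by
    rw [← finrank_span_eq_card hli, hsp, hspan]
    rfl
  refine ⟨_, a ∘ (Fintype.equivFinOfCardEq hcard).symm, rfl, ?_⟩
  exact hli.comp _ (Equiv.injective _)

theorem pow_mem_biSpan_sup {ζ P Q : Ω} (hP : P ∈ biSpan F u v 2) (hQ : Q ∈ biSpan F u v 4)
    (hζ : ζ ^ 2 = P * ζ - Q) (j : ℕ) :
    ∃ α ∈ biSpan F u v (2 * j), ∃ β ∈ biSpan F u v (2 * j), ζ ^ j = α + β * ζ := by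
  have h1 : (1 : Ω) ∈ biSpan F u v 0 := by
    simpa using pow_mul_pow_mem_biSpan (F := F) (u := u) (v := v) (le_refl 0) (le_refl 0)
  have h : ∀ j, ∃ α ∈ biSpan F u v (2 * j + 2), ∃ β ∈ biSpan F u v (2 * j),
      ζ ^ (j + 1) = α + β * ζ := by
    intro j
    induction j with
    | zero => exact ⟨0, Submodule.zero_mem _, 1, h1, by ring⟩
    | succ j ih =>
      obtain ⟨α, hα, β, hβ, h⟩ := ih
      refine ⟨-(β * Q), Submodule.neg_mem _ (biSpan_mono (by omega) (mul_mem_biSpan hβ hQ)),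
        α + β * P, Submodule.add_mem _ (biSpan_mono (by omega) hα)
          (biSpan_mono (by omega) (mul_mem_biSpan hβ hP)), ?_⟩
      rw [pow_succ, h]
      linear_combination β * hζ
  cases j with
  | zero => exact ⟨1, h1, 0, Submodule.zero_mem _, by ring⟩
  | succ j =>
    obtain ⟨α, hα, β, hβ, h⟩ := h j
    exact ⟨α, hα, β, biSpan_mono (by omega) hβ, h⟩

theorem linearIndependent_pow_mul {ι : Type*} {Z : Ω} (hZ : Transcendental F Z) {g : ι → Ω}
    (hg : LinearIndependent F⟮Z⟯ g) : LinearIndependent F fun p : ℕ × ι => Z ^ p.1 * g p.2 := by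
  have hgen : Transcendental F (AdjoinSimple.gen F Z) := by
    rw [← transcendental_algebraMap_iff (A := Ω) (algebraMap F⟮Z⟯ Ω).injective]
    exact hZ
  have h := linearIndependent_smul (linearIndependent_pow_of_transcendental hgen) hg
  have h2 : (fun p : ℕ × ι => Z ^ p.1 * g p.2) =
      fun p : ℕ × ι => (AdjoinSimple.gen F Z) ^ p.1 • g p.2 := by
    ext p
    rw [Algebra.smul_def, map_pow, AdjoinSimple.algebraMap_gen]
  rw [h2]
  exact h

theorem card_mul_le_of_biquadratic {Z P Q : Ω} {R : F[X][X]} (hR : R ≠ 0) (hR0 : biEval u v R = 0)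
    {e : ℕ} (h1 : R.natDegree ≤ e) (h2 : ∀ n, (R.coeff n).natDegree ≤ e) (hne : u ≠ v)
    (hP : P ∈ biSpan F u v 2) (hQ : Q ∈ biSpan F u v 2) (hrel : (u - v) ^ 2 * Z ^ 2 = P * Z - Q)
    {D s n : ℕ} {ex : Fin D → ℕ × ℕ} (hs : ∀ i, (ex i).1 ≤ s ∧ (ex i).2 ≤ s)
    (hli : LinearIndependent F fun p : ℕ × Fin D => Z ^ p.1 * (u ^ (ex p.2).1 * v ^ (ex p.2).2)) :
    D * n ≤ 4 * e * (2 * n + s + e + 1) := by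
  have hP₀0 : (u - v) ^ 2 ≠ 0 := pow_ne_zero _ (sub_ne_zero.mpr hne)
  have hsub : u - v ∈ biSpan F u v 1 := by
    refine Submodule.sub_mem _ ?_ ?_
    · simpa using pow_mul_pow_mem_biSpan (F := F) (u := u) (v := v) (le_refl 1) (zero_le_one)
    · simpa using pow_mul_pow_mem_biSpan (F := F) (u := u) (v := v) (zero_le_one) (le_refl 1)
  have hP₀m : (u - v) ^ 2 ∈ biSpan F u v 2 := pow_mem_biSpan hsub 2
  generalize (u - v) ^ 2 = P₀ at *
  obtain ⟨ζ, hζ⟩ : ∃ ζ, ζ = P₀ * Z := ⟨_, rfl⟩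
  have hζ2 : ζ ^ 2 = P * ζ - P₀ * Q := by
    rw [hζ]; linear_combination P₀ * hrel
  have hPQ : P₀ * Q ∈ biSpan F u v 4 := biSpan_mono (Nat.le_refl (2 + 2)) (mul_mem_biSpan hP₀m hQ)
  have hli2 := (hli.comp (fun p : Fin n × Fin D => ((p.1 : ℕ), p.2))
    (fun p q h => by
      simp only [Prod.mk.injEq] at h
      exact Prod.ext (Fin.ext h.1) h.2)).map' (LinearMap.mulLeft F (P₀ ^ n)) (by
    rw [LinearMap.ker_eq_bot]
    exact mul_right_injective₀ (pow_ne_zero _ hP₀0))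
  obtain ⟨B, hB⟩ : ∃ B, B = biSpan F u v (2 * n + s + e) := ⟨_, rfl⟩
  have hBfin : FiniteDimensional F B := by
    rw [hB, biSpan]
    exact FiniteDimensional.span_of_finite F (Set.finite_range _)
  obtain ⟨Y, hY⟩ : ∃ Y : Submodule F Ω, Y = B ⊔ B.map (LinearMap.mulRight F ζ) := ⟨_, rfl⟩
  have hYfin : FiniteDimensional F Y := by rw [hY]; exact Submodule.finite_sup _ _
  have hmem : ∀ p : Fin n × Fin D,
      P₀ ^ n * (Z ^ (p.1 : ℕ) * (u ^ (ex p.2).1 * v ^ (ex p.2).2)) ∈ Y := by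
    rintro ⟨j, i⟩
    obtain ⟨α, hα, β, hβ, h⟩ := pow_mem_biSpan_sup hP hPQ hζ2 (j : ℕ)
    have heq : P₀ ^ n * (Z ^ (j : ℕ) * (u ^ (ex i).1 * v ^ (ex i).2)) =
        P₀ ^ (n - j) * (u ^ (ex i).1 * v ^ (ex i).2) * α +
          P₀ ^ (n - j) * (u ^ (ex i).1 * v ^ (ex i).2) * β * ζ := by
      have hpow : P₀ ^ n = P₀ ^ (n - j) * P₀ ^ (j : ℕ) := by
        rw [← pow_add, Nat.sub_add_cancel j.2.le]
      have hj : P₀ ^ (j : ℕ) * Z ^ (j : ℕ) = α + β * ζ := by rw [← mul_pow, ← hζ, h]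
      rw [hpow]
      linear_combination P₀ ^ (n - j) * (u ^ (ex i).1 * v ^ (ex i).2) * hj
    simp only [heq]
    have hm : ∀ γ ∈ biSpan F u v (2 * (j : ℕ)),
        P₀ ^ (n - j) * (u ^ (ex i).1 * v ^ (ex i).2) * γ ∈ B := by
      intro γ hγ
      have := mul_mem_biSpan (mul_mem_biSpan (pow_mem_biSpan hP₀m (n - j))
        (pow_mul_pow_mem_biSpan (F := F) (u := u) (v := v) (hs i).1 (hs i).2)) hγ
      rw [hB]
      exact biSpan_mono (by omega) this
    rw [hY]
    exact Submodule.add_mem_sup (hm α hα) ⟨_, hm β hβ, rfl⟩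
  have hcard : D * n ≤ finrank F Y := by
    have hli3 : LinearIndependent F (fun p : Fin n × Fin D => (⟨_, hmem p⟩ : Y)) :=
      LinearIndependent.of_comp Y.subtype hli2
    have := hli3.fintype_card_le_finrank
    rw [Fintype.card_prod, Fintype.card_fin, Fintype.card_fin] at this
    rwa [mul_comm]
  have h5 := Submodule.finrank_add_le_finrank_add_finrank B (B.map (LinearMap.mulRight F ζ))
  have h6 := Submodule.finrank_map_le (LinearMap.mulRight F ζ) B
  have h7 := finrank_biSpan_le hR hR0 h1 h2 (2 * n + s)
  rw [← hB] at h7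
  rw [← hY] at h5
  calc D * n ≤ 2 * (e * (2 * (2 * n + s + e + 1))) := by omega
    _ = _ := by ring

/-- If `Z` is a root of a quadratic polynomial whose coefficients are biquadratic in `u` and `v`,
then the degree over `F(Z)` is at most eight times the degree over `F(u)`. -/
theorem finrank_le_of_biquadratic {Z P Q : Ω} (hu : Transcendental F u) (hv : Transcendental F v)
    (huv : IsIntegral F⟮u⟯ v) (hfin : finrank F⟮u⟯ Ω ≠ 0) (heq : finrank F⟮u⟯ Ω = finrank F⟮v⟯ Ω)
    (hZ : Transcendental F Z) (hZfin : FiniteDimensional F⟮Z⟯ Ω) (hne : u ≠ v)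
    (hP : P ∈ biSpan F u v 2) (hQ : Q ∈ biSpan F u v 2)
    (hrel : (u - v) ^ 2 * Z ^ 2 = P * Z - Q) :
    finrank F⟮Z⟯ Ω ≤ 8 * finrank F⟮u⟯ Ω := by
  obtain ⟨e, R, hR, hR0, h1, h2, he⟩ := exists_relation_of_finrank_eq hu hv huv hfin heq
  obtain ⟨D, ex, hD, hex⟩ := exists_monomials_adjoin_pair (K := F⟮Z⟯) u v
  set M := adjoin F⟮Z⟯ {u, v} with hM
  have hDM : finrank F⟮Z⟯ Ω = D * finrank M Ω := by
    rw [hD]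
    exact (finrank_mul_finrank F⟮Z⟯ M Ω).symm
  have hMg : finrank M Ω ≤ finrank F⟮u, v⟯ Ω := by
    have hle : F⟮u, v⟯ ≤ M.restrictScalars F := by
      rw [adjoin_le_iff]
      exact subset_adjoin F⟮Z⟯ {u, v}
    have h3 := relfinrank_mul_finrank_top hle
    refine Nat.le_of_dvd (Nat.pos_of_ne_zero ?_) ⟨_, by rw [← h3, mul_comm]; rfl⟩
    intro h0
    rw [h0, mul_zero] at he
    exact hfin he
  obtain ⟨s, hs⟩ : ∃ s, ∀ i, (ex i).1 ≤ s ∧ (ex i).2 ≤ s := by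
    refine ⟨∑ i, ((ex i).1 + (ex i).2), fun i => ?_⟩
    have h3 : (ex i).1 + (ex i).2 ≤ ∑ i, ((ex i).1 + (ex i).2) :=
      Finset.single_le_sum (f := fun i => (ex i).1 + (ex i).2) (fun _ _ => Nat.zero_le _)
        (Finset.mem_univ i)
    omega
  have hli := linearIndependent_pow_mul hZ hex
  have hDe : D ≤ 8 * e := by
    by_contra hlt
    have := card_mul_le_of_biquadratic (n := 4 * e * (s + e + 1) + 1) hR hR0 h1 h2 hne hP hQ hrel
      hs hli
    have h3 := Nat.mul_le_mul_right (4 * e * (s + e + 1) + 1) (Nat.lt_of_not_le hlt)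
    have h4 : 4 * e * (2 * (4 * e * (s + e + 1) + 1) + s + e + 1) =
      8 * e * (4 * e * (s + e + 1) + 1) + 4 * e * (s + e + 1) := by ring
    rw [Nat.succ_mul] at h3
    omega
  calc finrank F⟮Z⟯ Ω = D * finrank M Ω := hDM
    _ ≤ 8 * e * finrank F⟮u, v⟯ Ω := Nat.mul_le_mul hDe hMg
    _ = _ := by rw [he]; ring

end DegreeInequality

section Transcendence

variable {F : Type*} {Ω : Type*} [Field F] [Field Ω] [Algebra F Ω]

theorem isAlgebraic_adjoin_simple_of_transcendental {x w : Ω}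
    (hx : Algebra.IsAlgebraic F⟮x⟯ Ω) (hw : Transcendental F w) : Algebra.IsAlgebraic F⟮w⟯ Ω := by
  have h1 : Algebra.IsAlgebraic (Algebra.adjoin F {x}) Ω := isAlgebraic_adjoin_iff_top.mp hx
  have h2 := Algebra.IsAlgebraic.trdeg_le_cardinalMk F ({x} : Set Ω)
  have h3 : AlgebraicIndependent F fun _ : Unit => w := algebraicIndependent_unique_type_iff.mpr hw
  have h4 := (h3.isTranscendenceBasis_of_lift_trdeg_le_of_finite (by simpa using h2)).isAlgebraic_field
  rwa [Set.range_const] at h4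

theorem transcendental_of_exchange {x x' τ : Ω} (hx : Transcendental F x)
    (hx' : Transcendental F⟮x⟯ x') (hτ : Algebra.IsAlgebraic F⟮τ⟯⟮x⟯ Ω) : Transcendental F⟮τ⟯ x := by
  intro h
  have h1 : Algebra.IsAlgebraic F⟮τ⟯ F⟮τ⟯⟮x⟯ := isAlgebraic_adjoin_simple h.isIntegral
  have h2 : Algebra.IsAlgebraic F⟮τ⟯ Ω := Algebra.IsAlgebraic.trans F⟮τ⟯ F⟮τ⟯⟮x⟯ Ω
  exact hx' ((isAlgebraic_adjoin_simple_of_transcendental h2 hx).isAlgebraic x')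

theorem isAlgebraic_of_adjoin_eq_top {K : Type*} [Field K] [Algebra K Ω] [Algebra F K]
    [IsScalarTower F K Ω] {S : Set Ω} (hS : adjoin F S = ⊤) (h : ∀ s ∈ S, IsAlgebraic K s) :
    Algebra.IsAlgebraic K Ω := by
  refine ⟨fun y => ?_⟩
  rw [← mem_algebraicClosure_iff]
  have h1 : adjoin F S ≤ (algebraicClosure K Ω).restrictScalars F := by
    rw [adjoin_le_iff]
    intro s hs
    exact mem_algebraicClosure_iff.mpr (h s hs)
  exact h1 (hS ▸ mem_top)

theorem finiteDimensional_of_adjoin_eq_top {K : Type*} [Field K] [Algebra K Ω] [Algebra F K]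
    [IsScalarTower F K Ω] {S : Set Ω} (hfin : S.Finite) (hS : adjoin F S = ⊤)
    (h : ∀ s ∈ S, IsAlgebraic K s) : FiniteDimensional K Ω := by
  have : Finite S := hfin
  have h1 : FiniteDimensional K (adjoin K S) :=
    finiteDimensional_adjoin fun s hs => (h s hs).isIntegral
  have h2 : adjoin K S = ⊤ := by
    rw [eq_top_iff]
    intro y _
    have h3 : adjoin F S ≤ (adjoin K S).restrictScalars F := by
      rw [adjoin_le_iff]
      exact subset_adjoin K S
    exact h3 (hS ▸ mem_top)
  rw [h2] at h1
  exact Module.Finite.equiv (topEquiv (F := K) (E := Ω)).toLinearEquiv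

theorem isAlgebraic_of_isAlgebraic_eval_div {K : Type*} [Field K] [Algebra K Ω] [Algebra F K]
    [IsScalarTower F K Ω] {t : Ω} {f g : F[X]} (hg : aeval t g ≠ 0) (hfg : ∀ c, f ≠ C c * g)
    (h : IsAlgebraic K (aeval t f / aeval t g)) : IsAlgebraic K t := by
  set s := aeval t f / aeval t g with hs
  have h1 : Algebra.IsAlgebraic K K⟮s⟯ := isAlgebraic_adjoin_simple h.isIntegral
  have hinj := (algebraMap F K⟮s⟯).injective
  have : IsScalarTower F K⟮s⟯ Ω := IsScalarTower.to₁₃₄ F K K⟮s⟯ Ω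
  refine IsAlgebraic.restrictScalars K (S := K⟮s⟯)
    ⟨f.map (algebraMap F K⟮s⟯) - C (AdjoinSimple.gen K s) * g.map (algebraMap F K⟮s⟯), ?_, ?_⟩
  · intro h0
    have hg0 : g.leadingCoeff ≠ 0 := by
      rw [Ne, leadingCoeff_eq_zero]
      rintro rfl
      simp at hg
    have hgk : algebraMap F K⟮s⟯ g.leadingCoeff ≠ 0 := by
      rwa [Ne, map_eq_zero_iff _ hinj]
    have h2 := congrArg (fun p => p.coeff g.natDegree) h0
    simp only [coeff_sub, coeff_map, coeff_C_mul, coeff_zero, coeff_natDegree] at h2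
    apply hfg (f.coeff g.natDegree / g.leadingCoeff)
    apply map_injective _ hinj
    rw [sub_eq_zero] at h0 h2
    rw [h0, Polynomial.map_mul, map_C, map_div₀, h2, mul_div_cancel_right₀ _ hgk]
  · rw [map_sub, map_mul, aeval_C, AdjoinSimple.algebraMap_gen, aeval_map_algebraMap,
      aeval_map_algebraMap, hs]
    field_simp
    ring

theorem transcendental_of_eval_div {t : Ω} (ht : Transcendental F t) {f g : F[X]}
    (hdeg : g.natDegree < f.natDegree) (hg : g ≠ 0) :
    Transcendental F (aeval t f / aeval t g) := by
  refine fun h => ht (isAlgebraic_of_isAlgebraic_eval_div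
    (fun h0 => hg (transcendental_iff.mp ht g h0)) (fun c hc => ?_) h)
  have := natDegree_C_mul_le c g
  rw [← hc] at this
  omega

theorem finrank_adjoin_eval_div {t : Ω} (ht : Transcendental F t) {f g : F[X]}
    (hdeg : g.natDegree < f.natDegree) (hg : g ≠ 0) (hfg : IsCoprime f g) :
    finrank F⟮aeval t f / aeval t g⟯ Ω = f.natDegree * finrank F⟮t⟯ Ω := by
  have hs := transcendental_of_eval_div ht hdeg hg
  have hgt : aeval t g ≠ 0 := fun h0 => hg (transcendental_iff.mp ht g h0)
  set s := aeval t f / aeval t g with hsdef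
  have hirr : Irreducible (C (-g) * X + C f) :=
    irreducible_C_mul_X_add_C (neg_ne_zero.mpr hg) hfg.symm.neg_left.isRelPrime
  have hswap : Bivariate.swap (C (-g) * X + C f) = f.map C - C X * g.map C := by
    rw [map_add, map_mul, Bivariate.swap_C, Bivariate.swap_C, Bivariate.swap_Y, Polynomial.map_neg]
    ring
  have hnat : (Bivariate.swap (C (-g) * X + C f)).natDegree = f.natDegree := by
    rw [hswap, natDegree_sub_eq_left_of_natDegree_lt, natDegree_map_eq_of_injective C_injective]
    rw [natDegree_map_eq_of_injective C_injective]
    refine lt_of_le_of_lt natDegree_mul_le ?_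
    rw [natDegree_C, natDegree_map_eq_of_injective C_injective]
    omega
  obtain ⟨h1, h2⟩ := (natDegree_minpoly_of_irreducible (v := t) hs).1 _
    ((MulEquiv.irreducible_iff (Bivariate.swap (R := F))).mpr hirr) (by
      rw [biEval, Bivariate.aevalAeval_swap]
      change biEval t s _ = 0
      rw [C_mul_X_eq_monomial, ← monomial_zero_left, map_add, biEval_monomial, biEval_monomial,
        hsdef, map_neg]
      field_simp
      ring)
  rw [finrank_adjoin_simple_eq h1, h2, hnat]
  congr 1
  have h3 : F⟮s, t⟯ = F⟮t⟯ := by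
    apply le_antisymm
    · rw [adjoin_le_iff]
      rintro y (rfl | rfl)
      · exact (mem_adjoin_simple_iff F _).mpr ⟨f, g, rfl⟩
      · exact mem_adjoin_simple_self F _
    · exact adjoin.mono F _ _ (by simp)
  rw [h3]

theorem finrank_adjoin_dblNum_div [CharZero F] {c₂ c₄ : F} (hc₄ : c₄ ≠ 0)
    (hdisc : c₂ ^ 2 ≠ 4 * c₄) {A B : Ω} (hB : B ≠ 0) (ht : Transcendental F (A / B)) :
    dblDen (algebraMap F Ω c₂) (algebraMap F Ω c₄) A B ≠ 0 ∧
    Transcendental F (dblNum (algebraMap F Ω c₄) A B /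
      dblDen (algebraMap F Ω c₂) (algebraMap F Ω c₄) A B) ∧
    finrank F⟮dblNum (algebraMap F Ω c₄) A B /
      dblDen (algebraMap F Ω c₂) (algebraMap F Ω c₄) A B⟯ Ω = 4 * finrank F⟮A / B⟯ Ω := by
  set f : F[X] := (X ^ 2 - C c₄) ^ 2 with hf
  set g : F[X] := C 4 * X * (X ^ 2 + C c₂ * X + C c₄) with hg
  have hfdeg : f.natDegree = 4 := by rw [hf]; compute_degree!
  have hgdeg : g.natDegree ≤ 3 := by rw [hg]; compute_degree
  have h4 : (4 : F) ≠ 0 := by norm_num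
  have hcop1 : IsCoprime (X ^ 2 - C c₄) (X : F[X]) := by
    refine ⟨-C c₄⁻¹, C c₄⁻¹ * X, ?_⟩
    have : C c₄⁻¹ * C c₄ = (1 : F[X]) := by rw [← C_mul, inv_mul_cancel₀ hc₄, C_1]
    linear_combination this
  have hcop2 : IsCoprime (X ^ 2 - C c₄) (X ^ 2 + C c₂ * X + C c₄ : F[X]) := by
    set δ := c₄ * (4 * c₄ - c₂ ^ 2) with hδ
    have hδ0 : δ ≠ 0 := mul_ne_zero hc₄ (sub_ne_zero.mpr (Ne.symm hdisc))
    have h1 : C δ⁻¹ * C δ = (1 : F[X]) := by rw [← C_mul, inv_mul_cancel₀ hδ0, C_1]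
    have h2 : C δ = C c₄ * (4 * C c₄ - C c₂ ^ 2) := by
      rw [hδ, C_mul, C_sub, C_mul, C_pow, map_ofNat C 4]
    refine ⟨C δ⁻¹ * (-(2 * C c₄ - C c₂ * X) + C c₂ ^ 2), C δ⁻¹ * (2 * C c₄ - C c₂ * X), ?_⟩
    linear_combination h1 - C δ⁻¹ * h2
  have hcop : IsCoprime f g := by
    rw [hf, hg]
    refine IsCoprime.pow_left (IsCoprime.mul_right (IsCoprime.mul_right ?_ hcop1) hcop2)
    exact ⟨0, C 4⁻¹, by rw [zero_mul, zero_add, ← C_mul, inv_mul_cancel₀ h4, C_1]⟩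
  have hg0 : g ≠ 0 := by
    rintro h0
    rw [h0, isCoprime_zero_right] at hcop
    have := natDegree_eq_zero_of_isUnit hcop
    omega
  have hgt : aeval (A / B) g ≠ 0 := fun h0 => hg0 (transcendental_iff.mp ht g h0)
  have hden : dblDen (algebraMap F Ω c₂) (algebraMap F Ω c₄) A B = B ^ 4 * aeval (A / B) g := by
    simp only [hg, dblDen, map_mul, map_add, map_pow, aeval_X, aeval_C, map_ofNat]
    field_simp
  have hnum : dblNum (algebraMap F Ω c₄) A B = B ^ 4 * aeval (A / B) f := by
    simp only [hf, dblNum, map_sub, map_pow, aeval_X, aeval_C]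
    field_simp
  have hq : dblNum (algebraMap F Ω c₄) A B / dblDen (algebraMap F Ω c₂) (algebraMap F Ω c₄) A B
      = aeval (A / B) f / aeval (A / B) g := by
    rw [hden, hnum, mul_div_mul_left _ _ (pow_ne_zero _ hB)]
  rw [hq]
  refine ⟨?_, transcendental_of_eval_div ht (by omega) hg0, ?_⟩
  · rw [hden]
    exact mul_ne_zero (pow_ne_zero _ hB) hgt
  · rw [finrank_adjoin_eval_div ht (by omega) hg0 hcop, hfdeg]

theorem finrank_adjoin_dblIter [CharZero F] {c₂ c₄ : F} (hc₄ : c₄ ≠ 0) (hdisc : c₂ ^ 2 ≠ 4 * c₄)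
    {A B r : Ω} (hB : B ≠ 0) (ht : Transcendental F (A / B)) (k : ℕ) :
    (dblIter (algebraMap F Ω c₂) (algebraMap F Ω c₄) (A, B, r) k).2.1 ≠ 0 ∧
    Transcendental F ((dblIter (algebraMap F Ω c₂) (algebraMap F Ω c₄) (A, B, r) k).1 /
      (dblIter (algebraMap F Ω c₂) (algebraMap F Ω c₄) (A, B, r) k).2.1) ∧
    finrank F⟮(dblIter (algebraMap F Ω c₂) (algebraMap F Ω c₄) (A, B, r) k).1 /
      (dblIter (algebraMap F Ω c₂) (algebraMap F Ω c₄) (A, B, r) k).2.1⟯ Ω =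
        4 ^ k * finrank F⟮A / B⟯ Ω := by
  induction k with
  | zero => exact ⟨hB, ht, by rw [pow_zero, one_mul]; rfl⟩
  | succ k ih =>
    obtain ⟨h1, h2, h3⟩ := ih
    obtain ⟨h4, h5, h6⟩ := finrank_adjoin_dblNum_div hc₄ hdisc h1 h2
    refine ⟨h4, h5, ?_⟩
    rw [pow_succ, mul_comm (4 ^ k) 4, mul_assoc, ← h3, ← h6]
    rfl

end Transcendence

section SegreRelations

theorem segreForm_dbl_relation {R : Type*} [CommRing R] {c₂ c₄ A B A' B' w : R}
    (hw : w ^ 2 = B * (A ^ 3 + c₂ * A ^ 2 * B + c₄ * A * B ^ 2) *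
      (B' * (A' ^ 3 + c₂ * A' ^ 2 * B' + c₄ * A' * B' ^ 2))) :
    (segreForm c₂ c₄ A B A' B' w 1 0 - segreForm c₂ c₄ A B A' B' w 0 1) ^ 2 * dblNum c₄ A B ^ 2 =
      2 * ((segreForm c₂ c₄ A B A' B' w 1 1 + c₄ * segreForm c₂ c₄ A B A' B' w 0 0) *
        (segreForm c₂ c₄ A B A' B' w 1 0 + segreForm c₂ c₄ A B A' B' w 0 1) +
        2 * c₂ * segreForm c₂ c₄ A B A' B' w 1 1 * segreForm c₂ c₄ A B A' B' w 0 0) *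
        dblNum c₄ A B * dblDen c₂ c₄ A B -
      (segreForm c₂ c₄ A B A' B' w 1 1 - c₄ * segreForm c₂ c₄ A B A' B' w 0 0) ^ 2 *
        dblDen c₂ c₄ A B ^ 2 := by
  simp only [segreForm, Matrix.cons_val_zero, Matrix.cons_val_one, dblNum, dblDen]
  linear_combination 16 * ((A ^ 2 - c₄ * B ^ 2) ^ 2) ^ 2 * hw

variable {Ω : Type*} [Field Ω] {c₂ c₄ A B A' B' w : Ω}

theorem segreForm_biquadratic
    (hw : w ^ 2 = B * (A ^ 3 + c₂ * A ^ 2 * B + c₄ * A * B ^ 2) *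
      (B' * (A' ^ 3 + c₂ * A' ^ 2 * B' + c₄ * A' * B' ^ 2)))
    (h0 : segreForm c₂ c₄ A B A' B' w 0 0 ≠ 0) (hD : dblDen c₂ c₄ A B ≠ 0) {u v Z : Ω}
    (hu : u = segreForm c₂ c₄ A B A' B' w 1 0 / segreForm c₂ c₄ A B A' B' w 0 0)
    (hv : v = segreForm c₂ c₄ A B A' B' w 0 1 / segreForm c₂ c₄ A B A' B' w 0 0)
    (hZ : Z = dblNum c₄ A B / dblDen c₂ c₄ A B) :
    (u - v) ^ 2 * Z ^ 2 = 2 * ((u * v + c₄) * (u + v) + 2 * c₂ * (u * v)) * Z -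
      (u * v - c₄) ^ 2 := by
  have h1 := segreForm_dbl_relation hw
  have h2 := segreForm_mul_segreForm hw
  rw [eq_div_iff h0] at hu hv
  rw [eq_div_iff hD] at hZ
  generalize segreForm c₂ c₄ A B A' B' w 0 0 = Φ at *
  rw [← hu, ← hv, ← hZ] at h1
  rw [← hu, ← hv] at h2
  have h3 : segreForm c₂ c₄ A B A' B' w 1 1 = u * v * Φ :=
    mul_left_cancel₀ h0 (h2.trans (by ring))
  rw [h3] at h1
  generalize dblDen c₂ c₄ A B = D at *
  refine mul_left_cancel₀ (mul_ne_zero (pow_ne_zero 2 h0) (pow_ne_zero 2 hD)) ?_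
  linear_combination h1

theorem isAlgebraic_of_segreForm {K : Type*} [Field K] [Algebra K Ω]
    (hw : w ^ 2 = B * (A ^ 3 + c₂ * A ^ 2 * B + c₄ * A * B ^ 2) *
      (B' * (A' ^ 3 + c₂ * A' ^ 2 * B' + c₄ * A' * B' ^ 2)))
    (hB : B ≠ 0) (hB' : B' ≠ 0) (h0 : segreForm c₂ c₄ A B A' B' w 0 0 ≠ 0) {t τ k₂ k₄ : K}
    (ht : algebraMap K Ω t = A / B) (hk₂ : algebraMap K Ω k₂ = c₂) (hk₄ : algebraMap K Ω k₄ = c₄)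
    (hτ : algebraMap K Ω τ = segreForm c₂ c₄ A B A' B' w 1 0 / segreForm c₂ c₄ A B A' B' w 0 0)
    (hne : t ^ 2 ≠ k₄) : IsAlgebraic K (A' / B') := by
  refine ⟨C ((τ - t) ^ 2) * X ^ 2 - C (2 * (t * τ ^ 2 + (t ^ 2 + k₄ + 2 * k₂ * t) * τ + k₄ * t)) * X
    + C ((t * τ - k₄) ^ 2), ?_, ?_⟩
  · intro h
    have key : ∀ a b c : K, C a * X ^ 2 - C b * X + C c = 0 → a = 0 ∧ c = 0 := by
      intro a b c h
      have h1 := congrArg (fun p => p.coeff 2) h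
      have h2 := congrArg (fun p => p.coeff 0) h
      simp [coeff_X, coeff_C] at h1 h2
      exact ⟨h1, h2⟩
    obtain ⟨h1, h2⟩ := key _ _ _ h
    apply hne
    rw [pow_eq_zero_iff two_ne_zero, sub_eq_zero] at h1 h2
    rw [← h2, h1]; ring
  · simp only [map_add, map_sub, map_mul, map_pow, aeval_X, aeval_C, ht, hk₂, hk₄, hτ, map_ofNat]
    have h2 := segreForm_mul_segreForm hw
    rw [eq_div_iff h0] at hτ
    generalize algebraMap K Ω τ = τ at *
    have hA : A = A / B * B := by field_simp
    have hA' : A' = A' / B' * B' := by field_simp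
    generalize A / B = t at *
    generalize A' / B' = t' at *
    have h3 : segreForm c₂ c₄ A B A' B' w 1 0 / segreForm c₂ c₄ A B A' B' w 0 0 = τ := by
      rw [← hτ]; field_simp
    rw [h3]
    have h4 : segreForm c₂ c₄ A B A' B' w 0 1 = 2 * ((A * A' + c₄ * B * B') * (A * B' + A' * B) +
        2 * c₂ * A * A' * B * B') - segreForm c₂ c₄ A B A' B' w 1 0 := by
      simp only [segreForm, Matrix.cons_val_zero, Matrix.cons_val_one]; ring
    rw [h4, ← hτ] at h2
    have h5 : segreForm c₂ c₄ A B A' B' w 0 0 = (B * B') ^ 2 * (t - t') ^ 2 := by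
      simp only [segreForm, Matrix.cons_val_zero]; rw [hA, hA']; ring
    have h6 : segreForm c₂ c₄ A B A' B' w 1 1 = (B * B') ^ 2 * (t * t' - c₄) ^ 2 := by
      simp only [segreForm, Matrix.cons_val_zero, Matrix.cons_val_one]; rw [hA, hA']; ring
    have h7 : 2 * ((A * A' + c₄ * B * B') * (A * B' + A' * B) + 2 * c₂ * A * A' * B * B') =
        2 * (B * B') ^ 2 * ((t * t' + c₄) * (t + t') + 2 * c₂ * (t * t')) := by
      rw [hA, hA']; ring
    rw [h6, h7] at h2
    generalize segreForm c₂ c₄ A B A' B' w 0 0 = Φ at *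
    refine mul_left_cancel₀ (mul_ne_zero h0 (pow_ne_zero 2 (mul_ne_zero hB hB'))) ?_
    linear_combination h2 - Φ * τ ^ 2 * h5

end SegreRelations

/-- A pair of distinct definite quadratic polynomials `(X - a)² + c` and `(X - a')² + c'`. -/
structure QuadPair where
  a : ℤ
  c : ℤ
  a' : ℤ
  c' : ℤ
  hc : 0 < c
  hc' : 0 < c'
  hne : (a, c) ≠ (a', c')

namespace QuadPair

variable (Q : QuadPair)

/-- The product of the two polynomials. -/
noncomputable def poly : ℤ[X] := quad Q.a Q.c * quad Q.a' Q.c'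

noncomputable def iter (k : ℕ) : ℤ[X] × ℤ[X] × ℤ[X] := quadIter Q.a Q.c Q.a' Q.c' k

def coeff₂ : ℤ := quadC₂ Q.a Q.c Q.a' Q.c'

def coeff₄ : ℤ := quadC₄ Q.a Q.c Q.a' Q.c'

theorem coeff₄_pos : 0 < Q.coeff₄ := quadC₄_pos Q.hc Q.hne

theorem coeff₂_sq_ne : Q.coeff₂ ^ 2 ≠ 4 * Q.coeff₄ := by
  have h1 := mul_pos Q.hc Q.hc'
  have h2 : Q.coeff₂ ^ 2 - 4 * Q.coeff₄ = 16 * (Q.c * Q.c') := by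
    simp only [coeff₂, coeff₄, quadC₂, quadC₄]; ring
  intro h
  omega

theorem iter_succ (k : ℕ) : Q.iter (k + 1) =
    (dblNum (C Q.coeff₄) (Q.iter k).1 (Q.iter k).2.1,
      dblDen (C Q.coeff₂) (C Q.coeff₄) (Q.iter k).1 (Q.iter k).2.1,
      dblFactor (C Q.coeff₂) (C Q.coeff₄) (Q.iter k).1 (Q.iter k).2.1 * (Q.iter k).2.2) := rfl

theorem iter_relation (k : ℕ) : (Q.iter k).2.2 ^ 2 * Q.poly = (Q.iter k).2.1 *
    ((Q.iter k).1 ^ 3 + C Q.coeff₂ * (Q.iter k).1 ^ 2 * (Q.iter k).2.1 +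
      C Q.coeff₄ * (Q.iter k).1 * (Q.iter k).2.1 ^ 2) := by
  have h := quadForms_relation (a := Q.a) (c := Q.c) (a' := Q.a') (c' := Q.c')
  exact dblIter_relation _ _ _ _ _ _ h k

theorem aeval_iter_relation {R : Type*} [CommRing R] (x : R) (k : ℕ) :
    aeval x (Q.iter k).2.2 ^ 2 * aeval x Q.poly = aeval x (Q.iter k).2.1 *
    (aeval x (Q.iter k).1 ^ 3 + (Q.coeff₂ : R) * aeval x (Q.iter k).1 ^ 2 * aeval x (Q.iter k).2.1 +
      (Q.coeff₄ : R) * aeval x (Q.iter k).1 * aeval x (Q.iter k).2.1 ^ 2) := by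
  have := congrArg (aeval x) (Q.iter_relation k)
  simpa using this

/-- The coordinates of the sum and the difference of `2 ^ k` times the point above `x` and of the
point above `x'`, where `z` is the product of the two ordinates. -/
noncomputable def form {R : Type*} [CommRing R] (k : ℕ) (x x' z : R) : Fin 2 → Fin 2 → R :=
  segreForm (Q.coeff₂ : R) (Q.coeff₄ : R) (aeval x (Q.iter k).1) (aeval x (Q.iter k).2.1)
    (aeval x' (Q.iter 0).1) (aeval x' (Q.iter 0).2.1)
    (aeval x (Q.iter k).2.2 * aeval x' (Q.iter 0).2.2 * z)

theorem form_weight {R : Type*} [CommRing R] {x x' z : R} (k : ℕ)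
    (hz : z ^ 2 = aeval x Q.poly * aeval x' Q.poly) :
    (aeval x (Q.iter k).2.2 * aeval x' (Q.iter 0).2.2 * z) ^ 2 = aeval x (Q.iter k).2.1 *
    (aeval x (Q.iter k).1 ^ 3 + (Q.coeff₂ : R) * aeval x (Q.iter k).1 ^ 2 * aeval x (Q.iter k).2.1 +
      (Q.coeff₄ : R) * aeval x (Q.iter k).1 * aeval x (Q.iter k).2.1 ^ 2) *
    (aeval x' (Q.iter 0).2.1 *
    (aeval x' (Q.iter 0).1 ^ 3 + (Q.coeff₂ : R) * aeval x' (Q.iter 0).1 ^ 2 * aeval x' (Q.iter 0).2.1 +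
      (Q.coeff₄ : R) * aeval x' (Q.iter 0).1 * aeval x' (Q.iter 0).2.1 ^ 2)) := by
  rw [← Q.aeval_iter_relation, ← Q.aeval_iter_relation, mul_pow, hz]
  ring

theorem form_mul_form {R : Type*} [CommRing R] {x x' z : R} (k : ℕ)
    (hz : z ^ 2 = aeval x Q.poly * aeval x' Q.poly) :
    Q.form k x x' z 0 0 * Q.form k x x' z 1 1 = Q.form k x x' z 0 1 * Q.form k x x' z 1 0 :=
  segreForm_mul_segreForm (Q.form_weight k hz)

theorem map_form {R S : Type*} [CommRing R] [CommRing S] (φ : R →+* S) (k : ℕ) (x x' z : R)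
    (i j : Fin 2) : φ (Q.form k x x' z i j) = Q.form k (φ x) (φ x') (φ z) i j := by
  have h : ∀ (x : R) (p : ℤ[X]), φ (aeval x p) = aeval (φ x) p := fun x p => by
    rw [aeval_def, aeval_def, hom_eval₂, RingHom.ext_int (φ.comp (algebraMap ℤ R)) (algebraMap ℤ S)]
  rw [form, map_segreForm, form]
  simp only [map_mul, h, map_intCast]

theorem form_neg {R : Type*} [CommRing R] (k : ℕ) (x x' z : R) :
    Q.form k x x' (-z) 1 0 = Q.form k x x' z 0 1 ∧ Q.form k x x' (-z) 0 0 = Q.form k x x' z 0 0 := by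
  simp only [form, segreForm, Matrix.cons_val_zero, Matrix.cons_val_one]
  exact ⟨by ring, trivial⟩

section Generic

variable {F Ω : Type*} [Field F] [Field Ω] [Algebra F Ω] [CharZero F]

theorem isAlgebraic_of_isAlgebraic_coord {K : Type*} [Field K] [Algebra K Ω] [CharZero K] {x : Ω}
    (hx : aeval x (Q.iter 0).2.1 ≠ 0)
    (h : IsAlgebraic K (aeval x (Q.iter 0).1 / aeval x (Q.iter 0).2.1)) : IsAlgebraic K x := by
  have hcop := isCoprime_map_quadWronskian Q.hc Q.hc' Q.hne
  have hdeg := natDegree_map_quadForms (a := Q.a) (c := Q.c) (a' := Q.a') (c' := Q.c')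
  set f := (quadForms Q.a Q.c Q.a' Q.c').1.map (Int.castRingHom ℚ)
  set g := (quadForms Q.a Q.c Q.a' Q.c').2.1.map (Int.castRingHom ℚ)
  have : CharZero Ω := charZero_of_injective_algebraMap (algebraMap K Ω).injective
  have hf : aeval x (Q.iter 0).1 = aeval x f := (aeval_map_algebraMap ℚ x _).symm
  have hg : aeval x (Q.iter 0).2.1 = aeval x g := (aeval_map_algebraMap ℚ x _).symm
  rw [hf, hg] at h
  rw [hg] at hx
  refine isAlgebraic_of_isAlgebraic_eval_div (F := ℚ) hx (fun c hc => ?_) h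
  rw [hc] at hcop
  have := natDegree_eq_zero_of_isUnit ((IsCoprime.of_mul_left_right hcop).isUnit_of_dvd' dvd_rfl dvd_rfl)
  omega

theorem iter_generic {x : Ω} (hx : Transcendental F x) (k : ℕ) :
    aeval x (Q.iter k).2.1 ≠ 0 ∧
    Transcendental F (aeval x (Q.iter k).1 / aeval x (Q.iter k).2.1) ∧
    finrank F⟮aeval x (Q.iter k).1 / aeval x (Q.iter k).2.1⟯ Ω =
      4 ^ k * finrank F⟮aeval x (Q.iter 0).1 / aeval x (Q.iter 0).2.1⟯ Ω := by
  have h0 : aeval x (Q.iter 0).2.1 ≠ 0 := by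
    intro h
    refine hx ⟨(Q.iter 0).2.1.map (algebraMap ℤ F), ?_, by rwa [aeval_map_algebraMap]⟩
    rw [Ne, Polynomial.map_eq_zero_iff (by exact Int.cast_injective)]
    intro h1
    have h2 := natDegree_map_quadForms (a := Q.a) (c := Q.c) (a' := Q.a') (c' := Q.c')
    have h3 : (quadForms Q.a Q.c Q.a' Q.c').2.1 = 0 := h1
    rw [h3] at h2
    simp at h2
  have ht : Transcendental F (aeval x (Q.iter 0).1 / aeval x (Q.iter 0).2.1) :=
    fun h => hx (Q.isAlgebraic_of_isAlgebraic_coord h0 h)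
  have h := finrank_adjoin_dblIter (F := F) (c₂ := Q.coeff₂) (c₄ := Q.coeff₄)
    (by exact_mod_cast Q.coeff₄_pos.ne') (by exact_mod_cast Q.coeff₂_sq_ne) h0 ht
    (r := aeval x (Q.iter 0).2.2) k
  have hm := map_dblIter (aeval x : ℤ[X] →ₐ[ℤ] Ω).toRingHom (C Q.coeff₂) (C Q.coeff₄) (Q.iter 0) k
  have hm' : dblIter (algebraMap F Ω Q.coeff₂) (algebraMap F Ω Q.coeff₄)
      (aeval x (Q.iter 0).1, aeval x (Q.iter 0).2.1, aeval x (Q.iter 0).2.2) k =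
      (aeval x (Q.iter k).1, aeval x (Q.iter k).2.1, aeval x (Q.iter k).2.2) := by
    rw [map_intCast, map_intCast]
    simp only [AlgHom.toRingHom_eq_coe, RingHom.coe_coe, aeval_C, algebraMap_int_eq,
      eq_intCast (Int.castRingHom Ω)] at hm
    exact hm
  have key : ∀ v : Ω × Ω × Ω, dblIter (algebraMap F Ω Q.coeff₂) (algebraMap F Ω Q.coeff₄)
      (aeval x (Q.iter 0).1, aeval x (Q.iter 0).2.1, aeval x (Q.iter 0).2.2) k = v →
      v.2.1 ≠ 0 ∧ Transcendental F (v.1 / v.2.1) ∧ finrank F⟮v.1 / v.2.1⟯ Ω =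
        4 ^ k * finrank F⟮aeval x (Q.iter 0).1 / aeval x (Q.iter 0).2.1⟯ Ω := by
    rintro _ rfl
    exact h
  exact key _ hm'

theorem iter_generic_ne_zero {x : Ω} (hx : Transcendental F x) (k : ℕ) :
    aeval x (Q.iter k).2.2 ≠ 0 ∧ aeval x Q.poly ≠ 0 := by
  have h1 := (Q.iter_generic hx (k + 1)).1
  rw [iter_succ] at h1
  have h2 := Q.aeval_iter_relation x k
  have h3 : aeval x (dblDen (C Q.coeff₂) (C Q.coeff₄) (Q.iter k).1 (Q.iter k).2.1) =
      4 * (aeval x (Q.iter k).2.2 ^ 2 * aeval x Q.poly) := by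
    rw [h2]
    have h4 : aeval x (4 : ℤ[X]) = 4 := map_ofNat _ 4
    simp only [dblDen, map_mul, map_add, map_pow, aeval_C, h4, algebraMap_int_eq,
      eq_intCast (Int.castRingHom Ω)]
    ring
  simp only [h3] at h1
  constructor
  · intro h; rw [h] at h1; simp at h1
  · intro h; rw [h] at h1; simp at h1

end Generic

end QuadPair

section GenericSurface

variable {Ω : Type*} [Field Ω] [CharZero Ω]

/-- The elements `x`, `x'`, `z₁`, `z₂` generate the function field of the surface
`zᵢ² = fᵢ(x) fᵢ(x')`. -/
structure IsGenericSurface (Q₁ Q₂ : QuadPair) (x x' z₁ z₂ : Ω) : Prop where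
  transcendental : Transcendental ℚ x
  transcendental' : Transcendental ℚ⟮x⟯ x'
  sq₁ : z₁ ^ 2 = aeval x Q₁.poly * aeval x' Q₁.poly
  sq₂ : z₂ ^ 2 = aeval x Q₂.poly * aeval x' Q₂.poly
  adjoin_eq_top : adjoin ℚ {x, x', z₁, z₂} = ⊤
  exists_conj : ∃ σ : Ω ≃ₐ[ℚ] Ω, σ x = x ∧ σ x' = x' ∧ σ z₁ = z₁ ∧ σ z₂ = -z₂

namespace QuadPair

variable (Q : QuadPair) {x x' z : Ω}

noncomputable def coordSub (k : ℕ) (x x' z : Ω) : Ω := Q.form k x x' z 1 0 / Q.form k x x' z 0 0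

theorem form_ne_zero (hx : Transcendental ℚ x) (hx' : Transcendental ℚ⟮x⟯ x') (k : ℕ) :
    Q.form k x x' z 0 0 ≠ 0 := by
  have h1 := Q.iter_generic hx k
  have h2 := Q.iter_generic hx' 0
  simp only [form, segreForm, Matrix.cons_val_zero]
  refine pow_ne_zero 2 fun h => h2.2.1 ?_
  have h3 : aeval x' (Q.iter 0).1 / aeval x' (Q.iter 0).2.1 =
      algebraMap ℚ⟮x⟯ Ω (aeval (AdjoinSimple.gen ℚ x) (Q.iter k).1 /
        aeval (AdjoinSimple.gen ℚ x) (Q.iter k).2.1) := by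
    rw [map_div₀, ← aeval_algebraMap_apply, ← aeval_algebraMap_apply, AdjoinSimple.algebraMap_gen,
      div_eq_div_iff h2.1 h1.1]
    linear_combination -h
  rw [h3]
  exact isAlgebraic_algebraMap _

theorem isAlgebraic_snd (hx : Transcendental ℚ x) (hx' : Transcendental ℚ⟮x⟯ x')
    (hz : z ^ 2 = aeval x Q.poly * aeval x' Q.poly) {k : ℕ} {K : Type*} [Field K] [Algebra K Ω]
    {ξ τ : K} (hξ : algebraMap K Ω ξ = x) (hτ : algebraMap K Ω τ = Q.coordSub k x x' z) :
    IsAlgebraic K x' := by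
  have h1 := Q.iter_generic hx k
  have h2 := Q.iter_generic hx' 0
  have : CharZero K := (RingHom.charZero_iff (algebraMap K Ω).injective).mpr inferInstance
  refine Q.isAlgebraic_of_isAlgebraic_coord h2.1 ?_
  have ht : algebraMap K Ω (aeval ξ (Q.iter k).1 / aeval ξ (Q.iter k).2.1) =
      aeval x (Q.iter k).1 / aeval x (Q.iter k).2.1 := by
    rw [map_div₀, ← aeval_algebraMap_apply, ← aeval_algebraMap_apply, hξ]
  refine isAlgebraic_of_segreForm (Q.form_weight k hz) h1.1 h2.1 (Q.form_ne_zero hx hx' k)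
    ht (k₂ := (Q.coeff₂ : K)) (k₄ := (Q.coeff₄ : K)) (by simp) (by simp) hτ ?_
  intro h
  refine h1.2.1 ⟨X ^ 2 - C (Q.coeff₄ : ℚ), X_pow_sub_C_ne_zero (by norm_num) _, ?_⟩
  have := congrArg (algebraMap K Ω) h
  rw [map_pow, ht] at this
  simp [this]

end QuadPair

namespace IsGenericSurface

variable {Q₁ Q₂ : QuadPair} {x x' z₁ z₂ : Ω}

theorem isAlgebraic_of_mem (h : IsGenericSurface Q₁ Q₂ x x' z₁ z₂)
    {K : Type*} [Field K] [Algebra K Ω] (hx : IsAlgebraic K x)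
    (hx' : IsAlgebraic K x') : ∀ s ∈ ({x, x', z₁, z₂} : Set Ω), IsAlgebraic K s := by
  have haeval : ∀ {y : Ω} (p : ℤ[X]), IsAlgebraic K y → IsAlgebraic K (aeval y p) := by
    intro y p hy
    rw [← mem_algebraicClosure_iff] at hy ⊢
    have h1 : aeval y p = algebraMap (algebraicClosure K Ω) Ω
        (aeval (⟨y, hy⟩ : algebraicClosure K Ω) p) := by
      rw [← aeval_algebraMap_apply]; rfl
    rw [h1]
    exact (aeval (⟨y, hy⟩ : algebraicClosure K Ω) p).2
  rintro s (rfl | rfl | rfl | rfl)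
  · exact hx
  · exact hx'
  · refine IsAlgebraic.of_pow (n := 2) (by norm_num) ?_
    rw [h.sq₁]
    exact (haeval _ hx).mul (haeval _ hx')
  · refine IsAlgebraic.of_pow (n := 2) (by norm_num) ?_
    rw [h.sq₂]
    exact (haeval _ hx).mul (haeval _ hx')

theorem transcendental_coordSub (h : IsGenericSurface Q₁ Q₂ x x' z₁ z₂) (k : ℕ) :
    Transcendental ℚ (Q₁.coordSub k x x' z₁) := by
  intro ht
  set τ := Q₁.coordSub k x x' z₁ with hτ
  have h1 : IsAlgebraic ℚ⟮x⟯ τ := ht.tower_top _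
  have h2 : Algebra.IsAlgebraic ℚ⟮x⟯ ℚ⟮x⟯⟮τ⟯ := isAlgebraic_adjoin_simple h1.isIntegral
  refine h.transcendental' (IsAlgebraic.restrictScalars ℚ⟮x⟯ (S := ℚ⟮x⟯⟮τ⟯) ?_)
  refine Q₁.isAlgebraic_snd h.transcendental h.transcendental' h.sq₁ (k := k)
    (ξ := algebraMap ℚ⟮x⟯ _ (AdjoinSimple.gen ℚ x)) (τ := AdjoinSimple.gen ℚ⟮x⟯ τ) ?_ ?_
  · rw [← IsScalarTower.algebraMap_apply, AdjoinSimple.algebraMap_gen]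
  · rw [AdjoinSimple.algebraMap_gen]

theorem isAlgebraic_adjoin_adjoin (h : IsGenericSurface Q₁ Q₂ x x' z₁ z₂) (k : ℕ) :

    Algebra.IsAlgebraic ℚ⟮Q₁.coordSub k x x' z₁⟯⟮x⟯ Ω := by
  set τ := Q₁.coordSub k x x' z₁ with hτ
  refine isAlgebraic_of_adjoin_eq_top h.adjoin_eq_top (h.isAlgebraic_of_mem ?_ ?_)
  · have : x = algebraMap ℚ⟮τ⟯⟮x⟯ Ω (AdjoinSimple.gen ℚ⟮τ⟯ x) :=
      (AdjoinSimple.algebraMap_gen _ _).symm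
    exact this ▸ isAlgebraic_algebraMap (AdjoinSimple.gen ℚ⟮τ⟯ x)
  · refine Q₁.isAlgebraic_snd h.transcendental h.transcendental' h.sq₁ (k := k)
      (ξ := AdjoinSimple.gen ℚ⟮τ⟯ x) (τ := algebraMap ℚ⟮τ⟯ _ (AdjoinSimple.gen ℚ τ)) ?_ ?_
    · rw [AdjoinSimple.algebraMap_gen]
    · rw [← IsScalarTower.algebraMap_apply, AdjoinSimple.algebraMap_gen]

theorem transcendental_fst (h : IsGenericSurface Q₁ Q₂ x x' z₁ z₂) (k : ℕ) :
    Transcendental ℚ⟮Q₁.coordSub k x x' z₁⟯ x :=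
  transcendental_of_exchange h.transcendental h.transcendental' (h.isAlgebraic_adjoin_adjoin k)

theorem finiteDimensional_adjoin_simple (h : IsGenericSurface Q₁ Q₂ x x' z₁ z₂) (k : ℕ)
    {w : Ω}
    (hw : Transcendental ℚ⟮Q₁.coordSub k x x' z₁⟯ w) :
    FiniteDimensional ℚ⟮Q₁.coordSub k x x' z₁⟯⟮w⟯ Ω := by
  have h1 := isAlgebraic_adjoin_simple_of_transcendental (h.isAlgebraic_adjoin_adjoin k) hw
  exact finiteDimensional_of_adjoin_eq_top (F := ℚ) (Set.toFinite _) h.adjoin_eq_top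
    fun s _ => h1.isAlgebraic s

theorem le_finrank (h : IsGenericSurface Q₁ Q₂ x x' z₁ z₂) (k : ℕ) :
    Transcendental ℚ⟮Q₁.coordSub k x x' z₁⟯ (Q₂.coordSub k x x' z₂) ∧
    4 ^ k ≤ 2 * finrank ℚ⟮Q₁.coordSub k x x' z₁⟯⟮Q₂.coordSub k x x' z₂⟯ Ω := by
  obtain ⟨σ, hσx, hσx', hσ₁, hσ₂⟩ := h.exists_conj
  set F := ℚ⟮Q₁.coordSub k x x' z₁⟯ with hF
  have hxF : Transcendental F x := h.transcendental_fst k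
  have hfin : ∀ {w : Ω}, Transcendental F w → FiniteDimensional F⟮w⟯ Ω :=
    fun hw => h.finiteDimensional_adjoin_simple k hw
  have hΦ0 := Q₂.form_ne_zero h.transcendental h.transcendental' (z := z₂) k
  have hσform : ∀ (Q : QuadPair) (z : Ω) (i j : Fin 2), σ (Q.form k x x' z i j) =
      Q.form k x x' (σ z) i j := by
    intro Q z i j
    have := Q.map_form (σ : Ω →+* Ω) k x x' z i j
    simpa [hσx, hσx'] using this
  have hσF : σ ∈ F.fixingSubgroup := by
    rw [IntermediateField.mem_fixingSubgroup_iff]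
    intro y hy
    obtain ⟨r, s, rfl⟩ := (mem_adjoin_simple_iff ℚ y).mp hy
    have hτ : σ (Q₁.coordSub k x x' z₁) = Q₁.coordSub k x x' z₁ := by
      rw [QuadPair.coordSub, map_div₀, hσform, hσform, hσ₁]
    have hp : ∀ p : ℚ[X], σ (aeval (Q₁.coordSub k x x' z₁) p) =
        aeval (Q₁.coordSub k x x' z₁) p := by
      intro p
      rw [← aeval_algHom_apply σ, hτ]
    rw [map_div₀, hp, hp]
  set σF : Ω ≃ₐ[F] Ω := F.fixingSubgroupEquiv ⟨σ, hσF⟩ with hσFdef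
  have hσFapply : ∀ y, σF y = σ y := fun y => rfl
  set u := Q₂.coordSub k x x' z₂ with hu
  set v := σF u with hv
  have hv' : v = Q₂.form k x x' z₂ 0 1 / Q₂.form k x x' z₂ 0 0 := by
    rw [hv, hσFapply, hu, QuadPair.coordSub, map_div₀, hσform, hσform, hσ₂, (Q₂.form_neg k x x' z₂).1,
      (Q₂.form_neg k x x' z₂).2]
  obtain ⟨hB, -, -⟩ := Q₂.iter_generic hxF k
  obtain ⟨hD, hZ, hZdeg⟩ := Q₂.iter_generic hxF (k + 1)
  set Z := aeval x (Q₂.iter (k + 1)).1 / aeval x (Q₂.iter (k + 1)).2.1 with hZdef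
  have hmapD : aeval x (Q₂.iter (k + 1)).2.1 = dblDen (Q₂.coeff₂ : Ω) (Q₂.coeff₄ : Ω)
      (aeval x (Q₂.iter k).1) (aeval x (Q₂.iter k).2.1) := by
    have h4 : aeval x (4 : ℤ[X]) = 4 := map_ofNat _ 4
    simp [QuadPair.iter_succ, dblDen, h4]
  have hmapN : aeval x (Q₂.iter (k + 1)).1 = dblNum (Q₂.coeff₄ : Ω)
      (aeval x (Q₂.iter k).1) (aeval x (Q₂.iter k).2.1) := by
    simp [QuadPair.iter_succ, dblNum]
  have hrel := segreForm_biquadratic (Q₂.form_weight k h.sq₂) hΦ0 (hmapD ▸ hD) hu hv'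
    (Z := Z) (by rw [hZdef, hmapD, hmapN])
  have hz₂ : z₂ ≠ 0 := by
    intro h0
    have h1 := h.sq₂
    rw [h0, zero_pow two_ne_zero] at h1
    exact mul_ne_zero (Q₂.iter_generic_ne_zero h.transcendental 0).2
      (Q₂.iter_generic_ne_zero h.transcendental' 0).2 h1.symm
  have hne : u ≠ v := by
    rw [hv', hu, QuadPair.coordSub]
    intro h1
    rw [div_left_inj' hΦ0] at h1
    have h2 : 4 * (aeval x (Q₂.iter k).2.2 * aeval x' (Q₂.iter 0).2.2 * z₂) = 0 := by
      have h3 : Q₂.form k x x' z₂ 1 0 - Q₂.form k x x' z₂ 0 1 =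
          4 * (aeval x (Q₂.iter k).2.2 * aeval x' (Q₂.iter 0).2.2 * z₂) := by
        simp only [QuadPair.form, segreForm, Matrix.cons_val_zero, Matrix.cons_val_one]
        ring
      rw [← h3, h1, sub_self]
    exact mul_ne_zero (by norm_num) (mul_ne_zero (mul_ne_zero
      (Q₂.iter_generic_ne_zero h.transcendental k).1
      (Q₂.iter_generic_ne_zero h.transcendental' 0).1) hz₂) h2
  have huF : Transcendental F u := by
    intro hu1
    have hv1 : IsAlgebraic F v := hu1.algHom σF.toAlgHom
    rw [← mem_algebraicClosure_iff] at hu1 hv1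
    set u' : algebraicClosure F Ω := ⟨u, hu1⟩ with hu'
    set v' : algebraicClosure F Ω := ⟨v, hv1⟩ with hv''
    refine hZ (IsAlgebraic.restrictScalars F (S := algebraicClosure F Ω)
      ⟨C ((u' - v') ^ 2) * X ^ 2 - C (2 * ((u' * v' + Q₂.coeff₄) * (u' + v') +
        2 * Q₂.coeff₂ * (u' * v'))) * X + C ((u' * v' - Q₂.coeff₄) ^ 2), ?_, ?_⟩)
    · have hcoeff : ∀ a b c : algebraicClosure F Ω,
          C a * X ^ 2 - C b * X + C c = 0 → a = 0 := by
        intro a b c h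
        have h1 := congrArg (fun p => p.coeff 2) h
        simpa [coeff_X, coeff_C] using h1
      intro h0
      have h1 := hcoeff _ _ _ h0
      rw [pow_eq_zero_iff two_ne_zero, sub_eq_zero] at h1
      exact hne (congrArg Subtype.val h1)
    · have hu2 : algebraMap (algebraicClosure F Ω) Ω u' = u := rfl
      have hv2 : algebraMap (algebraicClosure F Ω) Ω v' = v := rfl
      simp only [map_add, map_sub, map_mul, map_pow, aeval_X, aeval_C, hu2, hv2, map_ofNat,
        map_intCast]
      linear_combination hrel
  have hvF : Transcendental F v := fun hv1 => huF ((isAlgebraic_algHom_iff σF.toAlgHom σF.injective).mp hv1)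
  have hufin := hfin huF
  have hvfin := hfin hvF
  have heq : finrank F⟮u⟯ Ω = finrank F⟮v⟯ Ω := by
    have h1 := relfinrank_map_map F⟮u⟯ ⊤ σF.toAlgHom
    have h2 : (⊤ : IntermediateField F Ω).map σF.toAlgHom = ⊤ := by
      rw [eq_top_iff]
      intro y _
      exact ⟨σF.symm y, mem_top, σF.apply_symm_apply y⟩
    have h3 : F⟮u⟯.map σF.toAlgHom = F⟮v⟯ := by
      rw [adjoin_map, Set.image_singleton]
      rfl
    rw [h2, h3, relfinrank_top_right, relfinrank_top_right] at h1
    exact h1.symm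
  refine ⟨huF, ?_⟩
  have hmem : ∀ a b : ℕ, a ≤ 2 → b ≤ 2 → u ^ a * v ^ b ∈ biSpan F u v 2 :=
    fun a b ha hb => pow_mul_pow_mem_biSpan ha hb
  have key := finrank_le_of_biquadratic huF hvF (Algebra.IsIntegral.isIntegral v)
    finrank_pos.ne' heq hZ (hfin hZ) hne
    (P := 2 * ((u * v + Q₂.coeff₄) * (u + v) + 2 * Q₂.coeff₂ * (u * v)))
    (Q := (u * v - Q₂.coeff₄) ^ 2) ?_ ?_ hrel
  · have h0 : 0 < finrank F⟮aeval x (Q₂.iter 0).1 / aeval x (Q₂.iter 0).2.1⟯ Ω := by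
      have := hfin (Q₂.iter_generic hxF 0).2.1
      exact finrank_pos
    rw [hZdeg, pow_succ] at key
    nlinarith
  · have h1 : 2 * ((u * v + Q₂.coeff₄) * (u + v) + 2 * Q₂.coeff₂ * (u * v)) =
        (2 : F) • (u ^ 2 * v ^ 1) + (2 : F) • (u ^ 1 * v ^ 2) + (2 * Q₂.coeff₄ : F) • (u ^ 1 * v ^ 0) +
          (2 * Q₂.coeff₄ : F) • (u ^ 0 * v ^ 1) + (4 * Q₂.coeff₂ : F) • (u ^ 1 * v ^ 1) := by
      simp only [Algebra.smul_def, map_mul, map_ofNat, map_intCast]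
      ring
    rw [h1]
    refine Submodule.add_mem _ (Submodule.add_mem _ (Submodule.add_mem _ (Submodule.add_mem _ ?_ ?_)
      ?_) ?_) ?_ <;> exact Submodule.smul_mem _ _ (hmem _ _ (by norm_num) (by norm_num))
  · have h1 : (u * v - Q₂.coeff₄) ^ 2 = (1 : F) • (u ^ 2 * v ^ 2) +
        (-2 * Q₂.coeff₄ : F) • (u ^ 1 * v ^ 1) + (Q₂.coeff₄ ^ 2 : F) • (u ^ 0 * v ^ 0) := by
      simp only [Algebra.smul_def, map_mul, map_ofNat, map_intCast, map_neg, map_pow, map_one]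
      ring
    rw [h1]
    refine Submodule.add_mem _ (Submodule.add_mem _ ?_ ?_) ?_ <;>
      exact Submodule.smul_mem _ _ (hmem _ _ (by norm_num) (by norm_num))

end IsGenericSurface

end GenericSurface

/-- The monomial `x ^ i * x' ^ j * z₁ ^ ε₁ * z₂ ^ ε₂`. -/
def surfaceMonomial {R : Type*} [CommRing R] (x x' z₁ z₂ : R) (e : ℕ × ℕ × Fin 2 × Fin 2) : R :=
  x ^ e.1 * x' ^ e.2.1 * z₁ ^ (e.2.2.1 : ℕ) * z₂ ^ (e.2.2.2 : ℕ)

theorem map_surfaceMonomial {R S : Type*} [CommRing R] [CommRing S] (φ : R →+* S)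
    (x x' z₁ z₂ : R) (e : ℕ × ℕ × Fin 2 × Fin 2) :
    φ (surfaceMonomial x x' z₁ z₂ e) = surfaceMonomial (φ x) (φ x') (φ z₁) (φ z₂) e := by
  simp [surfaceMonomial]

namespace IsGenericSurface

variable {Ω : Type*} [Field Ω] [CharZero Ω] {Q₁ Q₂ : QuadPair} {x x' z₁ z₂ : Ω}

theorem span_surfaceMonomial (h : IsGenericSurface Q₁ Q₂ x x' z₁ z₂) {K : Type*} [Field K]
    [Algebra K Ω] [FiniteDimensional K Ω] :
    Submodule.span K (Set.range (surfaceMonomial x x' z₁ z₂)) = ⊤ := by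
  have : CharZero K := (RingHom.charZero_iff (algebraMap K Ω).injective).mpr inferInstance
  set G := Submodule.span K (Set.range (surfaceMonomial x x' z₁ z₂)) with hG
  have hG1 : ∀ e, surfaceMonomial x x' z₁ z₂ e ∈ G := fun e => Submodule.subset_span ⟨e, rfl⟩
  let S : Subalgebra K Ω :=
    { carrier := {y | ∀ g ∈ G, y * g ∈ G}
      mul_mem' := fun {a b} ha hb g hg => by rw [mul_assoc]; exact ha _ (hb g hg)
      one_mem' := fun g hg => by rwa [one_mul]
      add_mem' := fun {a b} ha hb g hg => by rw [add_mul]; exact G.add_mem (ha g hg) (hb g hg)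
      zero_mem' := fun g _ => by rw [zero_mul]; exact G.zero_mem
      algebraMap_mem' := fun r g hg => by rw [← Algebra.smul_def]; exact G.smul_mem r hg }
  have hmemS : ∀ y, (∀ e, y * surfaceMonomial x x' z₁ z₂ e ∈ G) → y ∈ S := by
    intro y hy g hg
    have hle : G ≤ G.comap (LinearMap.mulLeft K y) := by
      rw [hG, Submodule.span_le]
      rintro _ ⟨e, rfl⟩
      exact hy e
    exact hle hg
  have hxS : x ∈ S := hmemS x fun ⟨i, j, ε⟩ => by
    have : x * surfaceMonomial x x' z₁ z₂ (i, j, ε) = surfaceMonomial x x' z₁ z₂ (i + 1, j, ε) := by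
      simp only [surfaceMonomial]; ring
    rw [this]; exact hG1 _
  have hxS' : x' ∈ S := hmemS x' fun ⟨i, j, ε⟩ => by
    have : x' * surfaceMonomial x x' z₁ z₂ (i, j, ε) = surfaceMonomial x x' z₁ z₂ (i, j + 1, ε) := by
      simp only [surfaceMonomial]; ring
    rw [this]; exact hG1 _
  have hpoly : ∀ {y : Ω} (p : ℤ[X]), y ∈ S → aeval y p ∈ S := by
    intro y p hy
    have h1 : aeval y p = algebraMap S Ω (aeval (⟨y, hy⟩ : S) p) := by
      rw [← aeval_algebraMap_apply]; rfl
    rw [h1]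
    exact (aeval (⟨y, hy⟩ : S) p).2
  have hz₁S : z₁ ∈ S := hmemS z₁ fun ⟨i, j, ε₁, ε₂⟩ => by
    fin_cases ε₁
    · have : z₁ * surfaceMonomial x x' z₁ z₂ (i, j, 0, ε₂) =
          surfaceMonomial x x' z₁ z₂ (i, j, 1, ε₂) := by
        simp [surfaceMonomial]; ring
      exact this ▸ hG1 _
    · have : z₁ * surfaceMonomial x x' z₁ z₂ (i, j, 1, ε₂) =
          aeval x Q₁.poly * aeval x' Q₁.poly * surfaceMonomial x x' z₁ z₂ (i, j, 0, ε₂) := by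
        rw [← h.sq₁]; simp [surfaceMonomial]; ring
      change z₁ * surfaceMonomial x x' z₁ z₂ (i, j, 1, ε₂) ∈ G
      rw [this]
      exact S.mul_mem (hpoly _ hxS) (hpoly _ hxS') _ (hG1 _)
  have hz₂S : z₂ ∈ S := hmemS z₂ fun ⟨i, j, ε₁, ε₂⟩ => by
    fin_cases ε₂
    · have : z₂ * surfaceMonomial x x' z₁ z₂ (i, j, ε₁, 0) =
          surfaceMonomial x x' z₁ z₂ (i, j, ε₁, 1) := by
        simp [surfaceMonomial]; ring
      exact this ▸ hG1 _
    · have : z₂ * surfaceMonomial x x' z₁ z₂ (i, j, ε₁, 1) =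
          aeval x Q₂.poly * aeval x' Q₂.poly * surfaceMonomial x x' z₁ z₂ (i, j, ε₁, 0) := by
        rw [← h.sq₂]; simp [surfaceMonomial]; ring
      change z₂ * surfaceMonomial x x' z₁ z₂ (i, j, ε₁, 1) ∈ G
      rw [this]
      exact S.mul_mem (hpoly _ hxS) (hpoly _ hxS') _ (hG1 _)
  have hS : S = ⊤ := by
    have h1 : Algebra.adjoin K {x, x', z₁, z₂} ≤ S := by
      rw [Algebra.adjoin_le_iff]
      rintro s (rfl | rfl | rfl | rfl)
      exacts [hxS, hxS', hz₁S, hz₂S]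
    have h2 : Algebra.adjoin K {x, x', z₁, z₂} = ⊤ := by
      rw [← adjoin_toSubalgebra_of_isAlgebraic fun y _ => Algebra.IsAlgebraic.isAlgebraic y]
      have h3 : adjoin K {x, x', z₁, z₂} = ⊤ := by
        rw [eq_top_iff]
        intro y _
        have h3 : adjoin ℚ {x, x', z₁, z₂} ≤ (adjoin K {x, x', z₁, z₂}).restrictScalars ℚ := by
          rw [adjoin_le_iff]
          exact subset_adjoin K _
        exact h3 (h.adjoin_eq_top ▸ mem_top)
      rw [h3, top_toSubalgebra]
    exact top_le_iff.mp (h2 ▸ h1)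
  rw [eq_top_iff]
  intro y _
  have hy : y ∈ S := hS ▸ Algebra.mem_top
  have h1 : (1 : Ω) ∈ G := by simpa [surfaceMonomial] using hG1 (0, 0, 0, 0)
  simpa using hy 1 h1

/-- There are many monomials that are independent over the field generated by the coordinates of
the two differences. -/
theorem exists_independent_monomials (h : IsGenericSurface Q₁ Q₂ x x' z₁ z₂) (k : ℕ) :
    ∃ (d : ℕ) (e : Fin d → ℕ × ℕ × Fin 2 × Fin 2), 4 ^ k ≤ 2 * d ∧
      LinearIndependent ℚ fun p : ℕ × ℕ × Fin d => Q₁.coordSub k x x' z₁ ^ p.1 *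
        (Q₂.coordSub k x x' z₂ ^ p.2.1 * surfaceMonomial x x' z₁ z₂ (e p.2.2)) := by
  have h1 := h.transcendental_coordSub k
  obtain ⟨h2, h3⟩ := h.le_finrank k
  have := h.finiteDimensional_adjoin_simple k h2
  set K := ℚ⟮Q₁.coordSub k x x' z₁⟯⟮Q₂.coordSub k x x' z₂⟯
  obtain ⟨κ, a, -, hsp, hli⟩ := exists_linearIndependent' K (surfaceMonomial x x' z₁ z₂)
  have hfin : Finite κ := hli.finite
  have : Fintype κ := Fintype.ofFinite κ
  have hcard : Fintype.card κ = finrank K Ω := by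
    rw [← finrank_span_eq_card hli, hsp, h.span_surfaceMonomial, finrank_top]
  refine ⟨_, a ∘ (Fintype.equivFinOfCardEq hcard).symm, h3, ?_⟩
  have hli2 := hli.comp (Fintype.equivFinOfCardEq hcard).symm (Equiv.injective _)
  exact linearIndependent_pow_mul h1 (linearIndependent_pow_mul h2 hli2)

end IsGenericSurface

section QuadLift

variable {R A : Type*} [CommRing R] [CommRing A]

/-- The homomorphism out of `R[√a]` extending `φ` and sending `√a` to `y`. -/
def quadLift (φ : R →+* A) {a : R} (y : A) (h : y ^ 2 = φ a) : QuadraticAlgebra R a 0 →+* A where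
  toFun z := φ z.re + φ z.im * y
  map_zero' := by simp
  map_one' := by simp [QuadraticAlgebra.re_one, QuadraticAlgebra.im_one]
  map_add' z w := by simp; ring
  map_mul' z w := by
    simp only [QuadraticAlgebra.re_mul, QuadraticAlgebra.im_mul, map_add, map_mul, map_zero]
    linear_combination (-φ z.im * φ w.im) * h

theorem quadLift_apply (φ : R →+* A) {a : R} (y : A) (h : y ^ 2 = φ a) (z : QuadraticAlgebra R a 0) :
    quadLift φ y h z = φ z.re + φ z.im * y := rfl

theorem quadLift_algebraMap (φ : R →+* A) {a : R} (y : A) (h : y ^ 2 = φ a) (r : R) :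
    quadLift φ y h (algebraMap R _ r) = φ r := by simp [quadLift_apply]

theorem quadLift_omega (φ : R →+* A) {a : R} (y : A) (h : y ^ 2 = φ a) :
    quadLift φ y h QuadraticAlgebra.omega = y := by simp [quadLift_apply]

theorem omega_sq {a : R} : (QuadraticAlgebra.omega : QuadraticAlgebra R a 0) ^ 2 =
    algebraMap R _ a := by
  rw [pow_two, QuadraticAlgebra.omega_mul_omega_eq_mk]; rfl

end QuadLift

section NonSquare

/-- The polynomial `f(x) f(x')`. -/
noncomputable def symPoly (f : ℤ[X]) : ℤ[X][X] := C f * f.map C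

theorem symPoly_mul (f g : ℤ[X]) : symPoly (f * g) = symPoly f * symPoly g := by
  simp only [symPoly, C_mul, Polynomial.map_mul]; ring

theorem irreducible_map_quad {a c : ℤ} (hc : 0 < c) :
    Irreducible ((quad a c).map (Int.castRingHom ℚ)) := by
  have hdeg : ((quad a c).map (Int.castRingHom ℚ)).natDegree = 2 := by
    have : (quad a c).map (Int.castRingHom ℚ) = (X - C (a : ℚ)) ^ 2 + C (c : ℚ) := by simp [quad]
    rw [this, natDegree_add_C, natDegree_pow, natDegree_X_sub_C]
  rw [irreducible_iff_roots_eq_zero_of_degree_le_three (by omega) (by omega)]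
  rw [Multiset.eq_zero_iff_forall_notMem]
  intro x hx
  have h1 := isRoot_of_mem_roots hx
  have h2 := quad_eval_pos (a := a) hc x
  rw [IsRoot.def, eval_map] at h1
  rw [aeval_def] at h2
  exact h2.ne' h1

theorem not_isSquare_symPoly {a c : ℤ} (hc : 0 < c) {p g : ℤ[X]} (hp : p = quad a c * g)
    (hg : IsCoprime ((quad a c).map (Int.castRingHom ℚ)) (g.map (Int.castRingHom ℚ)))
    (h0 : p.eval 0 ≠ 0) (r : FractionRing ℤ[X][X]) :
    r ^ 2 ≠ algebraMap ℤ[X][X] _ (symPoly p) := by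
  intro hr
  have hcst : IsIntegral ℤ[X][X] r := by
    refine ⟨X ^ 2 - C (symPoly p), monic_X_pow_sub_C _ two_ne_zero, ?_⟩
    simp [hr]
  obtain ⟨s, rfl⟩ := IsIntegrallyClosed.isIntegral_iff.mp hcst
  rw [← map_pow] at hr
  have hs := IsFractionRing.injective ℤ[X][X] (FractionRing ℤ[X][X]) hr
  have h1 : (symPoly p).eval (C 0) = p * C (p.eval 0) := by
    rw [symPoly, eval_mul, eval_C, eval_map, eval₂_at_apply]
  have hpm : p.map (Int.castRingHom ℚ) = (quad a c).map (Int.castRingHom ℚ) *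
      g.map (Int.castRingHom ℚ) := by rw [hp, Polynomial.map_mul]
  have hs2 : (s.eval (C 0)).map (Int.castRingHom ℚ) ^ 2 = (quad a c).map (Int.castRingHom ℚ) *
      g.map (Int.castRingHom ℚ) * C ((Int.castRingHom ℚ) (p.eval 0)) := by
    rw [← Polynomial.map_pow, ← eval_pow, hs, h1, Polynomial.map_mul, map_C, hpm]
  have hirr := irreducible_map_quad (a := a) hc
  have hm : (Int.castRingHom ℚ) (p.eval 0) ≠ 0 := by simpa using h0
  obtain ⟨t, ht⟩ : (quad a c).map (Int.castRingHom ℚ) ∣ (s.eval (C 0)).map (Int.castRingHom ℚ) :=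
    hirr.prime.dvd_of_dvd_pow (n := 2)
      ⟨g.map (Int.castRingHom ℚ) * C ((Int.castRingHom ℚ) (p.eval 0)), by rw [hs2]; ring⟩
  rw [ht] at hs2
  have h3 : (quad a c).map (Int.castRingHom ℚ) * t ^ 2 =
      g.map (Int.castRingHom ℚ) * C ((Int.castRingHom ℚ) (p.eval 0)) := by
    refine mul_left_cancel₀ hirr.ne_zero ?_
    linear_combination hs2
  have h4 : (quad a c).map (Int.castRingHom ℚ) ∣ g.map (Int.castRingHom ℚ) := by
    refine ⟨t ^ 2 * C ((Int.castRingHom ℚ) (p.eval 0))⁻¹, ?_⟩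
    rw [← mul_assoc, h3, mul_assoc, ← C_mul, mul_inv_cancel₀ hm, C_1, mul_one]
  exact hirr.not_isUnit (hg.isUnit_of_dvd' dvd_rfl h4)

end NonSquare

section Surface

variable (Q₁ Q₂ : QuadPair)

/-- The point with coordinates `x`, `x'`, `z` satisfies `z² = f(x) f(x')`. -/
def QuadPair.OnSurface (Q : QuadPair) {R : Type*} [CommRing R] (x x' z : R) : Prop :=
  z ^ 2 = aeval x Q.poly * aeval x' Q.poly

abbrev SurfaceRing₁ : Type := QuadraticAlgebra ℤ[X][X] (symPoly Q₁.poly) 0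

/-- The coordinate ring `ℤ[x, x'][√(f₁(x) f₁(x')), √(f₂(x) f₂(x'))]`. -/
abbrev SurfaceRing : Type :=
  QuadraticAlgebra (SurfaceRing₁ Q₁) (algebraMap ℤ[X][X] (SurfaceRing₁ Q₁) (symPoly Q₂.poly)) 0

namespace SurfaceRing

/-- The first coordinate. -/
noncomputable def x : SurfaceRing Q₁ Q₂ := algebraMap ℤ[X][X] _ (C X)

/-- The second coordinate. -/
noncomputable def x' : SurfaceRing Q₁ Q₂ := algebraMap ℤ[X][X] _ X

/-- The first square root. -/
noncomputable def z₁ : SurfaceRing Q₁ Q₂ := algebraMap (SurfaceRing₁ Q₁) _ QuadraticAlgebra.omega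

/-- The second square root. -/
noncomputable def z₂ : SurfaceRing Q₁ Q₂ := QuadraticAlgebra.omega

variable {A : Type*} [CommRing A]

/-- Evaluation of polynomials in two variables. -/
noncomputable def evalPoly (x x' : A) : ℤ[X][X] →+* A :=
  eval₂RingHom (aeval x : ℤ[X] →ₐ[ℤ] A).toRingHom x'

theorem evalPoly_symPoly (x x' : A) (f : ℤ[X]) :
    evalPoly x x' (symPoly f) = aeval x f * aeval x' f := by
  simp only [evalPoly, symPoly, coe_eval₂RingHom, eval₂_mul, eval₂_C, eval₂_map]
  congr 1
  rw [aeval_def]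
  congr 1
  exact RingHom.ext_int _ _

variable {Q₁ Q₂}

/-- The homomorphism given by a solution of the equations. -/
noncomputable def eval {x x' z₁ z₂ : A} (h₁ : Q₁.OnSurface x x' z₁)
    (h₂ : Q₂.OnSurface x x' z₂) : SurfaceRing Q₁ Q₂ →+* A :=
  quadLift (quadLift (evalPoly x x') z₁ (by rw [evalPoly_symPoly]; exact h₁)) z₂
    (by rw [quadLift_algebraMap, evalPoly_symPoly]; exact h₂)

variable {x₀ x₀' w₁ w₂ : A} (h₁ : Q₁.OnSurface x₀ x₀' w₁)
    (h₂ : Q₂.OnSurface x₀ x₀' w₂)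

theorem eval_algebraMap (p : ℤ[X][X]) : eval h₁ h₂ (algebraMap _ _ p) = evalPoly x₀ x₀' p := by
  have : algebraMap ℤ[X][X] (SurfaceRing Q₁ Q₂) p =
      algebraMap (SurfaceRing₁ Q₁) _ (algebraMap ℤ[X][X] _ p) := rfl
  rw [eval, this, quadLift_algebraMap, quadLift_algebraMap]

theorem eval_x : eval h₁ h₂ (x Q₁ Q₂) = x₀ := by
  rw [x, eval_algebraMap]; simp [evalPoly]

theorem eval_x' : eval h₁ h₂ (x' Q₁ Q₂) = x₀' := by
  rw [x', eval_algebraMap]; simp [evalPoly]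

theorem eval_z₁ : eval h₁ h₂ (z₁ Q₁ Q₂) = w₁ := by
  rw [z₁, eval, quadLift_algebraMap, quadLift_omega]

theorem eval_z₂ : eval h₁ h₂ (z₂ Q₁ Q₂) = w₂ := by
  rw [z₂, eval, quadLift_omega]

theorem eq_evalPoly (φ : ℤ[X][X] →+* A) : φ = evalPoly (φ (C X)) (φ X) := by
  refine Polynomial.ringHom_ext' (Polynomial.ringHom_ext' (RingHom.ext_int _ _) ?_) ?_ <;>
    simp [evalPoly]

theorem map_symPoly (φ : ℤ[X][X] →+* A) (f : ℤ[X]) :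
    φ (symPoly f) = aeval (φ (C X)) f * aeval (φ X) f := by
  conv_lhs => rw [eq_evalPoly φ, evalPoly_symPoly]

variable (Q₁ Q₂)

theorem onSurface₁ : Q₁.OnSurface (x Q₁ Q₂) (x' Q₁ Q₂) (z₁ Q₁ Q₂) := by
  refine Eq.trans ?_ (map_symPoly (algebraMap ℤ[X][X] (SurfaceRing Q₁ Q₂)) Q₁.poly)
  rw [z₁, ← map_pow, omega_sq]
  rfl

theorem onSurface₂ : Q₂.OnSurface (x Q₁ Q₂) (x' Q₁ Q₂) (z₂ Q₁ Q₂) := by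
  refine Eq.trans ?_ (map_symPoly (algebraMap ℤ[X][X] (SurfaceRing Q₁ Q₂)) Q₂.poly)
  rw [z₂, omega_sq]
  rfl

end SurfaceRing

end Surface

section Domain

variable {R : Type*} [CommRing R] [IsDomain R]

theorem eq_zero_of_quadraticNorm_eq_zero {a : R} (h : ∀ r s : R, r ^ 2 = a * s ^ 2 → s = 0)
    {z : QuadraticAlgebra R a 0} (hz : z.norm = 0) : z = 0 := by
  rw [QuadraticAlgebra.norm_def] at hz
  have h1 := h z.re z.im (by linear_combination hz)
  rw [h1] at hz
  have h2 : z.re = 0 := by simpa using hz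
  exact QuadraticAlgebra.ext h2 h1

theorem isDomain_quadraticAlgebra {a : R} (h : ∀ r s : R, r ^ 2 = a * s ^ 2 → s = 0) :
    IsDomain (QuadraticAlgebra R a 0) := by
  have : NoZeroDivisors (QuadraticAlgebra R a 0) := ⟨fun {z w} hzw => by
    have h1 : z.norm * w.norm = 0 := by rw [← map_mul, hzw, QuadraticAlgebra.norm_zero]
    exact (mul_eq_zero.mp h1).imp (eq_zero_of_quadraticNorm_eq_zero h)
      (eq_zero_of_quadraticNorm_eq_zero h)⟩
  exact NoZeroDivisors.to_isDomain _

theorem eq_zero_of_sq_eq_algebraMap_mul_sq {a b : R} (h2 : (2 : R) ≠ 0)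
    (ha : ∀ r s : R, r ^ 2 = a * s ^ 2 → s = 0) (hb : ∀ r s : R, r ^ 2 = b * s ^ 2 → s = 0)
    (hab : ∀ r s : R, r ^ 2 = a * b * s ^ 2 → s = 0) (r s : QuadraticAlgebra R a 0)
    (h : r ^ 2 = algebraMap R _ b * s ^ 2) : s = 0 := by
  have ha0 : a ≠ 0 := fun h0 => one_ne_zero (ha 0 1 (by rw [h0]; ring))
  refine eq_zero_of_quadraticNorm_eq_zero ha ?_
  set u := r * star s with hu
  have h3 : u ^ 2 = algebraMap R _ (b * s.norm ^ 2) := by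
    have h4 := QuadraticAlgebra.algebraMap_norm_eq_mul_star s
    rw [hu, mul_pow, h, map_mul, map_pow, h4]
    ring
  have hre : u.re * u.re + a * u.im * u.im = b * s.norm ^ 2 := by
    have := congrArg QuadraticAlgebra.re h3
    rwa [pow_two, QuadraticAlgebra.re_mul] at this
  have him : u.re * u.im + u.im * u.re + 0 * u.im * u.im = 0 := by
    have := congrArg QuadraticAlgebra.im h3
    rwa [pow_two, QuadraticAlgebra.im_mul] at this
  have him' : 2 * (u.re * u.im) = 0 := by linear_combination him
  rcases mul_eq_zero.mp ((mul_eq_zero.mp him').resolve_left h2) with h0 | h0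
  · rw [h0] at hre
    exact hab (a * u.im) _ (by linear_combination a * hre)
  · rw [h0] at hre
    exact hb u.re _ (by linear_combination hre)

end Domain

section ClearDenominators

theorem exists_clear_denominators {R K : Type*} [CommRing R] [IsDomain R] [CommRing K] (φ : R →+* K)
    (D : Submonoid R) (h : ∀ a : K, ∃ n ∈ D, ∃ b : R, φ n * a = φ b) (p : K[X]) :
    ∃ n ∈ D, ∃ q : R[X], C (φ n) * p = q.map φ := by
  induction p using Polynomial.induction_on' with
  | add p q hp hq =>
    obtain ⟨n, hn, p', hp'⟩ := hp
    obtain ⟨m, hm, q', hq'⟩ := hq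
    refine ⟨n * m, D.mul_mem hn hm, C m * p' + C n * q', ?_⟩
    simp only [Polynomial.map_add, Polynomial.map_mul, map_C, ← hp', ← hq', map_mul]
    ring
  | monomial k a =>
    obtain ⟨n, hn, b, hb⟩ := h a
    exact ⟨n, hn, monomial k b, by rw [C_mul_monomial, hb, map_monomial]⟩

theorem exists_clear_denominators_bivariate (R : ℚ[X][X]) (hR : R ≠ 0) :
    ∃ n : ℤ, n ≠ 0 ∧ ∃ q : ℤ[X][X], q ≠ 0 ∧
      C (C (n : ℚ)) * R = q.map (mapRingHom (Int.castRingHom ℚ)) := by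
  have h1 : ∀ a : ℚ, ∃ n ∈ nonZeroDivisors ℤ, ∃ b : ℤ,
      (Int.castRingHom ℚ) n * a = (Int.castRingHom ℚ) b := fun a =>
    ⟨a.den, mem_nonZeroDivisors_of_ne_zero (by exact_mod_cast a.den_nz), a.num, by
      simp [mul_comm, Rat.mul_den_eq_num]⟩
  have h2 : ∀ p : ℚ[X], ∃ n ∈ (nonZeroDivisors ℤ).map (C : ℤ →+* ℤ[X]), ∃ q : ℤ[X],
      mapRingHom (Int.castRingHom ℚ) n * p = mapRingHom (Int.castRingHom ℚ) q := fun p => by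
    obtain ⟨n, hn, q, hq⟩ := exists_clear_denominators _ _ h1 p
    exact ⟨C n, ⟨n, hn, rfl⟩, q, by simpa using hq⟩
  obtain ⟨_, ⟨n, hn, rfl⟩, q, hq⟩ := exists_clear_denominators _ _ h2 R
  have hn0 : n ≠ 0 := nonZeroDivisors.ne_zero hn
  have hq' : C (C (n : ℚ)) * R = q.map (mapRingHom (Int.castRingHom ℚ)) := by
    rw [← hq]; simp
  refine ⟨n, hn0, q, ?_, hq'⟩
  rintro rfl
  rw [Polynomial.map_zero] at hq'
  refine (mul_ne_zero ?_ hR) hq'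
  simpa using hn0

end ClearDenominators

section Generic

variable {Q₁ Q₂ : QuadPair}

theorem eq_zero_of_sq_eq_symPoly_mul_sq {p : ℤ[X]}
    (h : ∀ r : FractionRing ℤ[X][X], r ^ 2 ≠ algebraMap ℤ[X][X] _ (symPoly p)) (r s : ℤ[X][X])
    (hrs : r ^ 2 = symPoly p * s ^ 2) : s = 0 := by
  by_contra hs
  have hs' : algebraMap ℤ[X][X] (FractionRing ℤ[X][X]) s ≠ 0 := by simpa using hs
  refine h (algebraMap _ _ r / algebraMap _ _ s) ?_
  rw [div_pow, ← map_pow, hrs, map_mul, map_pow, mul_div_assoc, div_self (pow_ne_zero 2 hs'), mul_one]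

theorem isCoprime_map_quad {a c a' c' : ℤ} (hc : 0 < c) (hc' : 0 < c') (hne : (a, c) ≠ (a', c')) :
    IsCoprime ((quad a c).map (Int.castRingHom ℚ)) ((quad a' c').map (Int.castRingHom ℚ)) := by
  have hirr := irreducible_map_quad (a := a) hc
  have hirr' := irreducible_map_quad (a := a') hc'
  refine (hirr.coprime_iff_not_dvd).mpr fun h => hne ?_
  have hm : ∀ (a c : ℤ), ((quad a c).map (Int.castRingHom ℚ)) = (X - C (a : ℚ)) ^ 2 + C (c : ℚ) := by
    intro a c; simp [quad]
  have hmonic : ∀ (a c : ℤ), ((quad a c).map (Int.castRingHom ℚ)).Monic := by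
    intro a c
    rw [hm]
    exact ((monic_X_sub_C _).pow 2).add_of_left (by
      rw [degree_pow, degree_X_sub_C]
      exact degree_C_le.trans_lt (by norm_num))
  have h1 := eq_of_monic_of_associated (hmonic a c) (hmonic a' c') (hirr.associated_of_dvd hirr' h)
  rw [hm, hm] at h1
  have h2 := congrArg (eval 0) h1
  have h3 := congrArg (eval 1) h1
  simp only [eval_add, eval_pow, eval_sub, eval_X, eval_C] at h2 h3
  have h4 : (a : ℚ) = a' := by linarith
  have h5 : (c : ℚ) = c' := by rw [h4] at h2; linarith
  exact Prod.ext (by exact_mod_cast h4) (by exact_mod_cast h5)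

theorem QuadPair.eval_poly_ne_zero (Q : QuadPair) : Q.poly.eval 0 ≠ 0 := by
  have h := Q.hc
  have h' := Q.hc'
  simp only [poly, quad, eval_mul, eval_add, eval_pow, eval_sub, eval_X, eval_C]
  positivity

theorem SurfaceRing.isDomain (ha : Q₁.a = Q₂.a) (hc : Q₁.c = Q₂.c)
    (hne : (Q₁.a', Q₁.c') ≠ (Q₂.a', Q₂.c')) : IsDomain (SurfaceRing Q₁ Q₂) := by
  have h1 := eq_zero_of_sq_eq_symPoly_mul_sq (not_isSquare_symPoly Q₁.hc (p := Q₁.poly) rfl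
    (isCoprime_map_quad Q₁.hc Q₁.hc' Q₁.hne) Q₁.eval_poly_ne_zero)
  have h2 := eq_zero_of_sq_eq_symPoly_mul_sq (not_isSquare_symPoly Q₂.hc (p := Q₂.poly) rfl
    (isCoprime_map_quad Q₂.hc Q₂.hc' Q₂.hne) Q₂.eval_poly_ne_zero)
  have hcop := isCoprime_map_quad Q₁.hc' Q₁.hc Q₁.hne.symm
  have h12 := eq_zero_of_sq_eq_symPoly_mul_sq (not_isSquare_symPoly Q₁.hc' (p := Q₁.poly * Q₂.poly)
    (g := quad Q₁.a Q₁.c * (quad Q₁.a Q₁.c * quad Q₂.a' Q₂.c'))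
    (by simp only [QuadPair.poly, ha, hc]; ring)
    (by
      simp only [Polynomial.map_mul]
      exact hcop.mul_right (hcop.mul_right (isCoprime_map_quad Q₁.hc' Q₂.hc' hne)))
    (by rw [eval_mul]; exact mul_ne_zero Q₁.eval_poly_ne_zero Q₂.eval_poly_ne_zero))
  rw [symPoly_mul] at h12
  have : IsDomain (SurfaceRing₁ Q₁) := isDomain_quadraticAlgebra h1
  exact isDomain_quadraticAlgebra (eq_zero_of_sq_eq_algebraMap_mul_sq two_ne_zero h1 h2 h12)

namespace SurfaceRing

theorem mem_of_mem_gens (T : Subring (SurfaceRing Q₁ Q₂)) (hx : x Q₁ Q₂ ∈ T) (hx' : x' Q₁ Q₂ ∈ T)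
    (h₁ : z₁ Q₁ Q₂ ∈ T) (h₂ : z₂ Q₁ Q₂ ∈ T) (s : SurfaceRing Q₁ Q₂) : s ∈ T := by
  have hp : ∀ p : ℤ[X][X], algebraMap ℤ[X][X] (SurfaceRing Q₁ Q₂) p ∈ T := by
    intro p
    induction p using Polynomial.induction_on' with
    | add p q hp hq => rw [map_add]; exact T.add_mem hp hq
    | monomial n a =>
      rw [← C_mul_X_pow_eq_monomial, map_mul, map_pow]
      refine T.mul_mem ?_ (T.pow_mem hx' n)
      induction a using Polynomial.induction_on' with
      | add p q hp hq => rw [C_add, map_add]; exact T.add_mem hp hq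
      | monomial m b =>
        rw [← C_mul_X_pow_eq_monomial, C_mul, C_pow, map_mul, map_pow]
        refine T.mul_mem ?_ (T.pow_mem hx m)
        have : algebraMap ℤ[X][X] (SurfaceRing Q₁ Q₂) (C (C b)) = (b : SurfaceRing Q₁ Q₂) := by simp
        rw [this]
        exact intCast_mem T b
  have hq : ∀ s : SurfaceRing₁ Q₁, algebraMap (SurfaceRing₁ Q₁) (SurfaceRing Q₁ Q₂) s ∈ T := by
    intro s
    have h : s = algebraMap ℤ[X][X] _ s.re + algebraMap ℤ[X][X] _ s.im * QuadraticAlgebra.omega := by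
      ext <;> simp
    rw [h, map_add, map_mul]
    exact T.add_mem (hp _) (T.mul_mem (hp _) h₁)
  have h : s = algebraMap (SurfaceRing₁ Q₁) _ s.re +
      algebraMap (SurfaceRing₁ Q₁) _ s.im * QuadraticAlgebra.omega := by
    ext <;> simp
  rw [h]
  exact T.add_mem (hq _) (T.mul_mem (hq _) h₂)

theorem algebraMap_poly_injective : Function.Injective (algebraMap ℤ[X][X] (SurfaceRing Q₁ Q₂)) :=
  fun _ _ h => congrArg (fun s : SurfaceRing Q₁ Q₂ => s.re.re) h

theorem star_algebraMap (s : SurfaceRing₁ Q₁) :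
    star (algebraMap (SurfaceRing₁ Q₁) (SurfaceRing Q₁ Q₂) s) = algebraMap _ _ s := by
  ext <;> simp

variable {Ω : Type*} [Field Ω] [CharZero Ω] [Algebra (SurfaceRing Q₁ Q₂) Ω]
  [IsFractionRing (SurfaceRing Q₁ Q₂) Ω]

variable (Ω) in
theorem isGenericSurface :
    IsGenericSurface Q₁ Q₂ (algebraMap _ Ω (x Q₁ Q₂))
    (algebraMap _ _ (x' Q₁ Q₂)) (algebraMap _ _ (z₁ Q₁ Q₂)) (algebraMap _ _ (z₂ Q₁ Q₂)) := by
  set ι := algebraMap (SurfaceRing Q₁ Q₂) Ω with hι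
  have hev : ∀ p : ℤ[X][X], evalPoly (ι (x Q₁ Q₂)) (ι (x' Q₁ Q₂)) p = 0 → p = 0 := by
    intro p hp
    refine algebraMap_poly_injective (Q₁ := Q₁) (Q₂ := Q₂) (IsFractionRing.injective _ Ω ?_)
    rw [map_zero, map_zero, ← hp]
    exact DFunLike.congr_fun (eq_evalPoly (ι.comp (algebraMap ℤ[X][X] (SurfaceRing Q₁ Q₂)))) p
  have htr : Transcendental ℚ (ι (x Q₁ Q₂)) := by
    intro h
    obtain ⟨p, hp0, hp⟩ := (IsFractionRing.isAlgebraic_iff ℤ ℚ _).mpr h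
    refine hp0 (C_injective ((hev (C p) ?_).trans C_0.symm))
    rw [← hp]
    simp [evalPoly]
  have hsq : ∀ Q : QuadPair, ∀ z : SurfaceRing Q₁ Q₂, Q.OnSurface (x Q₁ Q₂) (x' Q₁ Q₂) z →
      (ι z) ^ 2 = aeval (ι (x Q₁ Q₂)) Q.poly * aeval (ι (x' Q₁ Q₂)) Q.poly := by
    intro Q z hz
    rw [← map_pow, hz, map_mul]
    have h : ∀ (x : SurfaceRing Q₁ Q₂) (p : ℤ[X]), ι (aeval x p) = aeval (ι x) p := fun x p => by
      rw [aeval_def, aeval_def, hom_eval₂, RingHom.ext_int (ι.comp _) (algebraMap ℤ _)]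
    exact congrArg₂ _ (h _ _) (h _ _)
  refine ⟨htr, ?_, hsq _ _ (onSurface₁ Q₁ Q₂), hsq _ _ (onSurface₂ Q₁ Q₂), ?_, ?_⟩
  · intro h
    obtain ⟨R, hR, hR0⟩ := (natDegree_minpoly_of_irreducible htr).2 h.isIntegral
    obtain ⟨n, hn, q, hq0, hq⟩ := exists_clear_denominators_bivariate R hR.ne_zero
    refine hq0 (hev q ?_)
    have h1 : (biEval (F := ℚ) (ι (x Q₁ Q₂)) (ι (x' Q₁ Q₂))).toRingHom.comp
        (mapRingHom (mapRingHom (Int.castRingHom ℚ))) = evalPoly (ι (x Q₁ Q₂)) (ι (x' Q₁ Q₂)) := by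
      rw [eq_evalPoly (RingHom.comp _ _)]
      congr 1 <;> simp [biEval]
    rw [← h1]
    change biEval _ _ (q.map (mapRingHom (Int.castRingHom ℚ))) = 0
    rw [← hq, map_mul, hR0, mul_zero]
  · rw [eq_top_iff]
    intro f _
    obtain ⟨r, s, -, rfl⟩ := IsFractionRing.div_surjective (A := SurfaceRing Q₁ Q₂) f
    set T := (adjoin ℚ {ι (x Q₁ Q₂), ι (x' Q₁ Q₂), ι (z₁ Q₁ Q₂), ι (z₂ Q₁ Q₂)}) with hT
    have hmem := mem_of_mem_gens (T.toSubfield.toSubring.comap ι)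
      (subset_adjoin ℚ _ (by simp)) (subset_adjoin ℚ _ (by simp))
      (subset_adjoin ℚ _ (by simp)) (subset_adjoin ℚ _ (by simp))
    exact T.div_mem (hmem r) (hmem s)
  · let e : SurfaceRing Q₁ Q₂ ≃+* SurfaceRing Q₁ Q₂ := starRingAut
    let σ : Ω ≃+* Ω :=
      IsFractionRing.ringEquivOfRingEquiv e
    have hσ : ∀ s, σ (ι s) = ι (star s) := fun s =>
      IsFractionRing.ringEquivOfRingEquiv_algebraMap e s
    refine ⟨AlgEquiv.ofRingEquiv (f := σ) fun r => map_ratCast σ r, ?_, ?_, ?_, ?_⟩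
    · exact (hσ _).trans (congrArg ι (star_algebraMap _))
    · exact (hσ _).trans (congrArg ι (star_algebraMap _))
    · exact (hσ _).trans (congrArg ι (star_algebraMap _))
    · refine (hσ _).trans ((congrArg ι ?_).trans (map_neg ι _))
      ext <;> simp [z₂]

end SurfaceRing

end Generic

section Universal

variable {R A : Type*} [CommRing R] [CommRing A] {N : RingSeminorm R} {μ : RingSeminorm A}

theorem seminorm_mul_pow_le {x : A} {ρ : ℝ} (hx : μ x ≤ ρ) (r : A) (n : ℕ) :
    μ (r * x ^ n) ≤ μ r * ρ ^ n := by
  have hρ : 0 ≤ ρ := (apply_nonneg μ x).trans hx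
  induction n with
  | zero => simp
  | succ n ih =>
    rw [pow_succ, ← mul_assoc, pow_succ, ← mul_assoc]
    exact (map_mul_le_mul μ _ _).trans (mul_le_mul ih hx (apply_nonneg μ x)
      (mul_nonneg (apply_nonneg μ r) (pow_nonneg hρ n)))

theorem seminorm_sum_le {ι : Type*} (s : Finset ι) (f : ι → A) :
    μ (∑ i ∈ s, f i) ≤ ∑ i ∈ s, μ (f i) := by
  classical
  induction s using Finset.induction_on with
  | empty => simp
  | insert i s hi ih =>
    rw [Finset.sum_insert hi, Finset.sum_insert hi]
    exact (map_add_le_add μ _ _).trans (by gcongr)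

theorem seminorm_pow_le (h1 : μ 1 ≤ 1) {x : A} {ρ : ℝ} (hx : μ x ≤ ρ) (n : ℕ) :
    μ (x ^ n) ≤ ρ ^ n := by
  have hρ : 0 ≤ ρ := (apply_nonneg μ x).trans hx
  have := seminorm_mul_pow_le hx 1 n
  rw [one_mul] at this
  exact this.trans (mul_le_of_le_one_left (by positivity) h1)

theorem seminorm_eval₂_le {φ : R →+* A} (hφ : ∀ r, μ (φ r) ≤ N r) {x : A} {ρ : ℝ} {hρ : 0 ≤ ρ}
    (hx : μ x ≤ ρ) (p : R[X]) : μ (p.eval₂ φ x) ≤ polySeminorm N ρ hρ p := by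
  rw [eval₂_eq_sum, Polynomial.sum_def, polySeminorm_eq_sum p (Finset.Subset.refl p.support)]
  refine (seminorm_sum_le _ _).trans (Finset.sum_le_sum fun n _ => ?_)
  exact (seminorm_mul_pow_le hx _ n).trans (mul_le_mul_of_nonneg_right (hφ _) (by positivity))

theorem seminorm_intCast_le (h1 : μ 1 ≤ 1) (n : ℤ) : μ (n : A) ≤ |(n : ℝ)| := by
  have hnat : ∀ n : ℕ, μ (n : A) ≤ n := by
    intro n
    induction n with
    | zero => simp
    | succ n ih =>
      push_cast
      exact (map_add_le_add μ _ _).trans (add_le_add ih h1)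
  obtain ⟨n, rfl | rfl⟩ := n.eq_nat_or_neg
  · simpa using hnat n
  · simpa using hnat n

theorem seminorm_aeval_le (h1 : μ 1 ≤ 1) {x : A} {ρ : ℝ} {hρ : 0 ≤ ρ} (hx : μ x ≤ ρ) (p : ℤ[X]) :
    μ (aeval x p) ≤ polySeminorm (normRingSeminorm ℤ) ρ hρ p := by
  refine seminorm_eval₂_le (fun n => ?_) hx p
  have := seminorm_intCast_le h1 n
  rwa [← eq_intCast (algebraMap ℤ A) n] at this

theorem polySeminorm_le_of_natDegree_le {ρ : ℝ} (hρ : 1 ≤ ρ) {p : ℤ[X]} {D : ℕ}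
    (hD : p.natDegree ≤ D) :
    polySeminorm (normRingSeminorm ℤ) ρ (zero_le_one.trans hρ) p ≤ lOne p * ρ ^ D := by
  rw [lOne, polySeminorm_eq_sum p (Finset.Subset.refl p.support),
    polySeminorm_eq_sum p (Finset.Subset.refl p.support), Finset.sum_mul]
  refine Finset.sum_le_sum fun n hn => ?_
  rw [one_pow, mul_one]
  exact mul_le_mul_of_nonneg_left (pow_le_pow_right₀ hρ ((le_natDegree_of_mem_supp n hn).trans hD))
    (apply_nonneg _ _)

theorem polySeminorm_X_pow_mul {ρ : ℝ} {hρ : 0 ≤ ρ} (M : ℕ) (p : R[X]) :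
    polySeminorm N ρ hρ (X ^ M * p) = ρ ^ M * polySeminorm N ρ hρ p := by
  rw [polySeminorm_eq_sum (X ^ M * p) (s := p.support.map (addRightEmbedding M)), Finset.sum_map,
    polySeminorm_eq_sum p (Finset.Subset.refl p.support), Finset.mul_sum]
  · refine Finset.sum_congr rfl fun n _ => ?_
    rw [addRightEmbedding_apply, coeff_X_pow_mul, pow_add]
    ring
  · intro n hn
    rw [Polynomial.mem_support_iff, coeff_X_pow_mul'] at hn
    split_ifs at hn with h
    · exact Finset.mem_map.mpr ⟨n - M, Polynomial.mem_support_iff.mpr hn, by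
        rw [addRightEmbedding_apply]; omega⟩
    · exact absurd rfl hn

theorem polySeminorm_C_mul_of_eq {ρ : ℝ} {hρ : 0 ≤ ρ} {r : R} {t : ℝ} (h : ∀ p, N (r * p) = t * N p)
    (p : R[X]) : polySeminorm N ρ hρ (C r * p) = t * polySeminorm N ρ hρ p := by
  rw [polySeminorm_eq_sum (C r * p) (s := p.support), polySeminorm_eq_sum p (Finset.Subset.refl _),
    Finset.mul_sum]
  · refine Finset.sum_congr rfl fun n _ => ?_
    rw [coeff_C_mul, h, mul_assoc]
  · intro n hn
    rw [Polynomial.mem_support_iff, coeff_C_mul] at hn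
    rw [Polynomial.mem_support_iff]
    exact right_ne_zero_of_mul hn

theorem quadraticSeminorm_algebraMap_mul_of_eq {a : R} {w : ℝ} {hw : 0 ≤ w} {ha : N a ≤ w ^ 2}
    {r : R} {t : ℝ} (h : ∀ p, N (r * p) = t * N p) (z : QuadraticAlgebra R a 0) :
    quadraticSeminorm N w hw ha (algebraMap R _ r * z) = t * quadraticSeminorm N w hw ha z := by
  have h1 : (algebraMap R (QuadraticAlgebra R a 0) r * z).re = r * z.re := by simp
  have h2 : (algebraMap R (QuadraticAlgebra R a 0) r * z).im = r * z.im := by simp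
  rw [quadraticSeminorm_apply, quadraticSeminorm_apply, h1, h2, h, h]
  ring

end Universal

section SurfaceSeminorm

theorem normRingSeminorm_int_apply (n : ℤ) : normRingSeminorm ℤ n = |(n : ℝ)| := rfl

theorem QuadPair.natDegree_poly_le (Q : QuadPair) : Q.poly.natDegree ≤ 4 := by
  unfold poly quad
  compute_degree

variable (Q₁ Q₂ : QuadPair)

/-- A constant bounding the square roots on the surface. -/
noncomputable def surfaceConst : ℝ := 4 * (1 + lOne Q₁.poly + lOne Q₂.poly) ^ 2

theorem one_le_surfaceConst : 1 ≤ surfaceConst Q₁ Q₂ := by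
  have h1 := apply_nonneg lOne Q₁.poly
  have h2 := apply_nonneg lOne Q₂.poly
  unfold surfaceConst
  nlinarith

theorem lOne_le_surfaceConst : lOne Q₁.poly ≤ surfaceConst Q₁ Q₂ ∧
    lOne Q₂.poly ≤ surfaceConst Q₁ Q₂ := by
  have h1 := apply_nonneg lOne Q₁.poly
  have h2 := apply_nonneg lOne Q₂.poly
  unfold surfaceConst
  constructor <;> nlinarith

/-- The weighted `ℓ¹` seminorm on polynomials in two variables. -/
noncomputable def polySeminorm₂ {ρ ρ' : ℝ} (hρ : 1 ≤ ρ) (hρ' : 1 ≤ ρ') : RingSeminorm ℤ[X][X] :=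
  polySeminorm (polySeminorm (normRingSeminorm ℤ) ρ (zero_le_one.trans hρ)) ρ' (zero_le_one.trans hρ')

variable {ρ ρ' : ℝ} (hρ : 1 ≤ ρ) (hρ' : 1 ≤ ρ')

theorem polySeminorm₂_X : polySeminorm₂ hρ hρ' X = ρ' := by
  rw [← pow_one (X : ℤ[X][X]), polySeminorm₂, polySeminorm_X_pow, pow_one, ← C_1, polySeminorm_C]
  simp [normRingSeminorm_int_apply]

theorem polySeminorm₂_C_X : polySeminorm₂ hρ hρ' (C X) = ρ := by
  rw [polySeminorm₂, polySeminorm_C, ← pow_one X, polySeminorm_X_pow, pow_one]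
  simp [normRingSeminorm_int_apply]

theorem polySeminorm₂_one : polySeminorm₂ hρ hρ' 1 = 1 := by
  rw [← C_1, ← C_1, polySeminorm₂, polySeminorm_C, polySeminorm_C]
  simp [normRingSeminorm_int_apply]

theorem polySeminorm₂_symPoly_le {f : ℤ[X]} (hf : f.natDegree ≤ 4) :
    polySeminorm₂ hρ hρ' (symPoly f) ≤ (lOne f * (ρ ^ 2 * ρ' ^ 2)) ^ 2 := by
  have h := SurfaceRing.map_symPoly (RingHom.id ℤ[X][X]) f
  simp only [RingHom.id_apply] at h
  have key : ∀ (u v : ℤ[X][X]), symPoly f = u * v → polySeminorm₂ hρ hρ' u ≤ lOne f * ρ ^ 4 →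
      polySeminorm₂ hρ hρ' v ≤ lOne f * ρ' ^ 4 →
      polySeminorm₂ hρ hρ' (symPoly f) ≤ (lOne f * (ρ ^ 2 * ρ' ^ 2)) ^ 2 := by
    intro u v huv hu hv
    rw [huv]
    refine (map_mul_le_mul _ _ _).trans ((mul_le_mul hu hv (apply_nonneg _ _) ?_).trans_eq (by ring))
    exact mul_nonneg (apply_nonneg _ _) (by positivity)
  refine key _ _ h ?_ ?_
  · exact (seminorm_aeval_le (polySeminorm₂_one hρ hρ').le (polySeminorm₂_C_X hρ hρ').le f).trans
      (polySeminorm_le_of_natDegree_le hρ hf)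
  · exact (seminorm_aeval_le (polySeminorm₂_one hρ hρ').le (polySeminorm₂_X hρ hρ').le f).trans
      (polySeminorm_le_of_natDegree_le hρ' hf)

noncomputable def surfaceWeight (ρ ρ' : ℝ) : ℝ := surfaceConst Q₁ Q₂ * (ρ ^ 2 * ρ' ^ 2)

theorem surfaceWeight_nonneg (ρ ρ' : ℝ) : 0 ≤ surfaceWeight Q₁ Q₂ ρ ρ' :=
  mul_nonneg (zero_le_one.trans (one_le_surfaceConst Q₁ Q₂)) (by positivity)

theorem polySeminorm₂_symPoly₁_le :
    polySeminorm₂ hρ hρ' (symPoly Q₁.poly) ≤ surfaceWeight Q₁ Q₂ ρ ρ' ^ 2 := by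
  refine (polySeminorm₂_symPoly_le hρ hρ' Q₁.natDegree_poly_le).trans ?_
  exact pow_le_pow_left₀ (mul_nonneg (apply_nonneg _ _) (by positivity))
    (mul_le_mul_of_nonneg_right (lOne_le_surfaceConst Q₁ Q₂).1 (by positivity)) 2

theorem polySeminorm₂_symPoly₂_le :
    polySeminorm₂ hρ hρ' (symPoly Q₂.poly) ≤ surfaceWeight Q₁ Q₂ ρ ρ' ^ 2 := by
  refine (polySeminorm₂_symPoly_le hρ hρ' Q₂.natDegree_poly_le).trans ?_
  exact pow_le_pow_left₀ (mul_nonneg (apply_nonneg _ _) (by positivity))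
    (mul_le_mul_of_nonneg_right (lOne_le_surfaceConst Q₁ Q₂).2 (by positivity)) 2

/-- The seminorm on `ℤ[x, x', z₁]`. -/
noncomputable def surfaceSeminorm₁ : RingSeminorm (SurfaceRing₁ Q₁) :=
  quadraticSeminorm (polySeminorm₂ hρ hρ') (surfaceWeight Q₁ Q₂ ρ ρ')
    (surfaceWeight_nonneg Q₁ Q₂ ρ ρ') (polySeminorm₂_symPoly₁_le Q₁ Q₂ hρ hρ')

theorem surfaceSeminorm₁_algebraMap (p : ℤ[X][X]) :
    surfaceSeminorm₁ Q₁ Q₂ hρ hρ' (algebraMap _ _ p) = polySeminorm₂ hρ hρ' p := by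
  rw [surfaceSeminorm₁, quadraticSeminorm_apply]
  simp

/-- The seminorm on the coordinate ring of the surface giving weight `ρ` to `x` and `ρ'` to `x'`. -/
noncomputable def surfaceSeminorm : RingSeminorm (SurfaceRing Q₁ Q₂) :=
  quadraticSeminorm (surfaceSeminorm₁ Q₁ Q₂ hρ hρ') (surfaceWeight Q₁ Q₂ ρ ρ')
    (surfaceWeight_nonneg Q₁ Q₂ ρ ρ')
    (by rw [surfaceSeminorm₁_algebraMap]; exact polySeminorm₂_symPoly₂_le Q₁ Q₂ hρ hρ')

variable {Q₁ Q₂}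

theorem surfaceSeminorm_algebraMap₁ (s : SurfaceRing₁ Q₁) :
    surfaceSeminorm Q₁ Q₂ hρ hρ' (algebraMap _ _ s) = surfaceSeminorm₁ Q₁ Q₂ hρ hρ' s := by
  rw [surfaceSeminorm, quadraticSeminorm_apply]
  simp

theorem surfaceSeminorm_algebraMap (p : ℤ[X][X]) :
    surfaceSeminorm Q₁ Q₂ hρ hρ' (algebraMap _ _ p) = polySeminorm₂ hρ hρ' p := by
  rw [← surfaceSeminorm₁_algebraMap Q₁ Q₂, ← surfaceSeminorm_algebraMap₁]
  rfl

theorem surfaceSeminorm_x : surfaceSeminorm Q₁ Q₂ hρ hρ' (SurfaceRing.x Q₁ Q₂) = ρ := by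
  rw [SurfaceRing.x, surfaceSeminorm_algebraMap, polySeminorm₂_C_X]

theorem surfaceSeminorm_x' : surfaceSeminorm Q₁ Q₂ hρ hρ' (SurfaceRing.x' Q₁ Q₂) = ρ' := by
  rw [SurfaceRing.x', surfaceSeminorm_algebraMap, polySeminorm₂_X]

theorem surfaceSeminorm_one : surfaceSeminorm Q₁ Q₂ hρ hρ' 1 = 1 := by
  rw [← map_one (algebraMap ℤ[X][X] _), surfaceSeminorm_algebraMap, polySeminorm₂_one]

theorem surfaceSeminorm_z₁ :
    surfaceSeminorm Q₁ Q₂ hρ hρ' (SurfaceRing.z₁ Q₁ Q₂) = surfaceWeight Q₁ Q₂ ρ ρ' := by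
  rw [SurfaceRing.z₁, surfaceSeminorm_algebraMap₁, surfaceSeminorm₁, quadraticSeminorm_apply]
  simp [polySeminorm₂_one]

theorem surfaceSeminorm_z₂ :
    surfaceSeminorm Q₁ Q₂ hρ hρ' (SurfaceRing.z₂ Q₁ Q₂) = surfaceWeight Q₁ Q₂ ρ ρ' := by
  have h : surfaceSeminorm₁ Q₁ Q₂ hρ hρ' 1 = 1 := by
    rw [← map_one (algebraMap ℤ[X][X] _), surfaceSeminorm₁_algebraMap, polySeminorm₂_one]
  rw [SurfaceRing.z₂, surfaceSeminorm, quadraticSeminorm_apply]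
  simp [h]

theorem surfaceSeminorm_x_pow_mul (M : ℕ) (s : SurfaceRing Q₁ Q₂) :
    surfaceSeminorm Q₁ Q₂ hρ hρ' (SurfaceRing.x Q₁ Q₂ ^ M * s) =
      ρ ^ M * surfaceSeminorm Q₁ Q₂ hρ hρ' s := by
  have h : SurfaceRing.x Q₁ Q₂ ^ M =
      algebraMap (SurfaceRing₁ Q₁) _ (algebraMap ℤ[X][X] _ (C (X ^ M))) := by
    rw [C_pow, map_pow, map_pow]; rfl
  rw [h]
  refine quadraticSeminorm_algebraMap_mul_of_eq (fun s => ?_) s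
  refine quadraticSeminorm_algebraMap_mul_of_eq (fun s => ?_) s
  exact polySeminorm_C_mul_of_eq (polySeminorm_X_pow_mul M) s

end SurfaceSeminorm

section FormBounds

variable {A : Type*} [CommRing A] {μ : RingSeminorm A}

theorem seminorm_mul_le_of_le {a b : A} {s t : ℝ} (ha : μ a ≤ s) (hb : μ b ≤ t) :
    μ (a * b) ≤ s * t :=
  (map_mul_le_mul μ a b).trans
    (mul_le_mul ha hb (apply_nonneg μ b) ((apply_nonneg μ a).trans ha))

theorem seminorm_add_le_of_le {a b : A} {s t : ℝ} (ha : μ a ≤ s) (hb : μ b ≤ t) :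
    μ (a + b) ≤ s + t :=
  (map_add_le_add μ a b).trans (add_le_add ha hb)

theorem seminorm_sub_le_of_le {a b : A} {s t : ℝ} (ha : μ a ≤ s) (hb : μ b ≤ t) :
    μ (a - b) ≤ s + t :=
  (map_sub_le_add μ a b).trans (add_le_add ha hb)

theorem seminorm_ofNat_le (h1 : μ 1 ≤ 1) (n : ℕ) [n.AtLeastTwo] :
    μ (OfNat.ofNat n : A) ≤ (OfNat.ofNat n : ℝ) := by
  have := seminorm_intCast_le h1 (OfNat.ofNat n : ℤ)
  simpa using this

theorem seminorm_dbl_le (h1 : μ 1 ≤ 1) {c₂ c₄ a b : A} {c t : ℝ} (hc : 1 ≤ c) (h₂ : μ c₂ ≤ c)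
    (h₄ : μ c₄ ≤ c) (ha : μ a ≤ t) (hb : μ b ≤ t) :
    μ (dblNum c₄ a b) ≤ 48 * c ^ 3 * t ^ 4 ∧ μ (dblDen c₂ c₄ a b) ≤ 48 * c ^ 3 * t ^ 4 ∧
      μ (dblFactor c₂ c₄ a b) ≤ 48 * c ^ 3 * t ^ 6 := by
  have ht : 0 ≤ t := (apply_nonneg μ a).trans ha
  have hpa := fun n => seminorm_pow_le h1 ha n
  have hpb := fun n => seminorm_pow_le h1 hb n
  have hc2 : c ≤ c ^ 2 := le_self_pow₀ hc (by norm_num)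
  have hc3 : c ^ 2 ≤ c ^ 3 := pow_le_pow_right₀ hc (by norm_num)
  have hsub := seminorm_sub_le_of_le (hpa 2) (seminorm_mul_le_of_le h₄ (hpb 2))
  refine ⟨?_, ?_, ?_⟩
  · refine (seminorm_pow_le h1 hsub 2).trans ?_
    have h : (t ^ 2 + c * t ^ 2) ^ 2 = (1 + c) ^ 2 * t ^ 4 := by ring
    rw [h]
    refine mul_le_mul_of_nonneg_right ?_ (by positivity)
    nlinarith
  · refine (seminorm_mul_le_of_le (seminorm_mul_le_of_le (seminorm_mul_le_of_le
      (seminorm_ofNat_le h1 4) ha) hb) (seminorm_add_le_of_le (seminorm_add_le_of_le (hpa 2)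
        (seminorm_mul_le_of_le (seminorm_mul_le_of_le h₂ ha) hb))
        (seminorm_mul_le_of_le h₄ (hpb 2)))).trans ?_
    have h : (OfNat.ofNat 4 : ℝ) * t * t * (t ^ 2 + c * t * t + c * t ^ 2) =
        (4 + 8 * c) * t ^ 4 := by ring
    rw [h]
    refine mul_le_mul_of_nonneg_right ?_ (by positivity)
    nlinarith
  · refine (seminorm_mul_le_of_le (seminorm_mul_le_of_le (seminorm_ofNat_le h1 2) hsub)
      (seminorm_add_le_of_le (seminorm_add_le_of_le (seminorm_add_le_of_le (seminorm_add_le_of_le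
        (hpa 4) (seminorm_mul_le_of_le (seminorm_mul_le_of_le (seminorm_mul_le_of_le
          (seminorm_ofNat_le h1 2) h₂) (hpa 3)) hb))
        (seminorm_mul_le_of_le (seminorm_mul_le_of_le (seminorm_mul_le_of_le
          (seminorm_ofNat_le h1 6) h₄) (hpa 2)) (hpb 2)))
        (seminorm_mul_le_of_le (seminorm_mul_le_of_le (seminorm_mul_le_of_le (seminorm_mul_le_of_le
          (seminorm_ofNat_le h1 2) h₂) h₄) ha) (hpb 3)))
        (seminorm_mul_le_of_le (seminorm_pow_le h1 h₄ 2) (hpb 4)))).trans ?_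
    have h : (OfNat.ofNat 2 : ℝ) * (t ^ 2 + c * t ^ 2) * (t ^ 4 + OfNat.ofNat 2 * c * t ^ 3 * t +
        OfNat.ofNat 6 * c * t ^ 2 * t ^ 2 + OfNat.ofNat 2 * c * c * t * t ^ 3 + c ^ 2 * t ^ 4) =
        (2 * (1 + c) * (1 + 8 * c + 3 * c ^ 2)) * t ^ 6 := by ring
    rw [h]
    refine mul_le_mul_of_nonneg_right ?_ (by positivity)
    nlinarith

theorem seminorm_dbl_step (h1 : μ 1 ≤ 1) {c₂ c₄ a b r : A} {c Y u : ℝ} (hc : 1 ≤ c) (h₂ : μ c₂ ≤ c)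
    (h₄ : μ c₄ ≤ c) (hu : 0 ≤ u) (ha : 48 * c ^ 3 * μ a ≤ Y) (hb : 48 * c ^ 3 * μ b ≤ Y)
    (hr : u * μ r ≤ Y ^ 2) :
    48 * c ^ 3 * μ (dblNum c₄ a b) ≤ Y ^ 4 ∧ 48 * c ^ 3 * μ (dblDen c₂ c₄ a b) ≤ Y ^ 4 ∧
      u * μ (dblFactor c₂ c₄ a b * r) ≤ (Y ^ 4) ^ 2 := by
  have hκ1 : 1 ≤ 48 * c ^ 3 := by
    have : 1 ≤ c ^ 3 := one_le_pow₀ hc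
    linarith
  have hκ0 : 0 < 48 * c ^ 3 := by linarith
  obtain ⟨d1, d2, d3⟩ := seminorm_dbl_le h1 hc h₂ h₄
    ((le_div_iff₀' hκ0).mpr ha) ((le_div_iff₀' hκ0).mpr hb)
  generalize 48 * c ^ 3 = κ at *
  have hle4 : κ * (κ * (Y / κ) ^ 4) ≤ Y ^ 4 := by
    have h : κ * (κ * (Y / κ) ^ 4) = Y ^ 4 / κ ^ 2 := by field_simp
    rw [h]
    exact div_le_self (by positivity) (one_le_pow₀ hκ1)
  have hle6 : κ * (Y / κ) ^ 6 ≤ Y ^ 6 := by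
    have h : κ * (Y / κ) ^ 6 = Y ^ 6 / κ ^ 5 := by field_simp
    rw [h]
    exact div_le_self (by positivity) (one_le_pow₀ hκ1)
  refine ⟨(mul_le_mul_of_nonneg_left d1 hκ0.le).trans hle4,
    (mul_le_mul_of_nonneg_left d2 hκ0.le).trans hle4, ?_⟩
  calc _ ≤ u * (Y ^ 6 * μ r) := by
        refine mul_le_mul_of_nonneg_left ((map_mul_le_mul μ _ _).trans ?_) hu
        exact mul_le_mul_of_nonneg_right (d3.trans hle6) (apply_nonneg _ _)
    _ = Y ^ 6 * (u * μ r) := by ring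
    _ ≤ Y ^ 6 * Y ^ 2 := mul_le_mul_of_nonneg_left hr (by positivity)
    _ = _ := by ring

theorem seminorm_segreForm_le (h1 : μ 1 ≤ 1) {c₂ c₄ a b a' b' w : A} {c t t' g : ℝ} (hc : 1 ≤ c)
    (h₂ : μ c₂ ≤ c) (h₄ : μ c₄ ≤ c) (ha : μ a ≤ t) (hb : μ b ≤ t) (ha' : μ a' ≤ t') (hb' : μ b' ≤ t')
    (hg : 0 ≤ g) (hw : μ w ≤ g * (t ^ 2 * t' ^ 2)) (i j : Fin 2) :
    μ (segreForm c₂ c₄ a b a' b' w i j) ≤ (8 * c ^ 2 + 2 * g) * (t ^ 2 * t' ^ 2) := by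
  have hc2 : c ≤ c ^ 2 := le_self_pow₀ hc (by norm_num)
  have h00 : μ ((a * b' - a' * b) ^ 2) ≤ (8 * c ^ 2 + 2 * g) * (t ^ 2 * t' ^ 2) := by
    refine (seminorm_pow_le h1 (seminorm_sub_le_of_le (seminorm_mul_le_of_le ha hb')
      (seminorm_mul_le_of_le ha' hb)) 2).trans ?_
    have h : (t * t' + t' * t) ^ 2 = 4 * (t ^ 2 * t' ^ 2) := by ring
    rw [h]
    refine mul_le_mul_of_nonneg_right ?_ (by positivity)
    nlinarith
  have h11 : μ ((a * a' - c₄ * b * b') ^ 2) ≤ (8 * c ^ 2 + 2 * g) * (t ^ 2 * t' ^ 2) := by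
    refine (seminorm_pow_le h1 (seminorm_sub_le_of_le (seminorm_mul_le_of_le ha ha')
      (seminorm_mul_le_of_le (seminorm_mul_le_of_le h₄ hb) hb')) 2).trans ?_
    have h : (t * t' + c * t * t') ^ 2 = (1 + c) ^ 2 * (t ^ 2 * t' ^ 2) := by ring
    rw [h]
    refine mul_le_mul_of_nonneg_right ?_ (by positivity)
    nlinarith
  have hm : μ ((a * a' + c₄ * b * b') * (a * b' + a' * b) + 2 * c₂ * a * a' * b * b') ≤
      8 * c ^ 2 * (t ^ 2 * t' ^ 2) := by
    refine (seminorm_add_le_of_le (seminorm_mul_le_of_le (seminorm_add_le_of_le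
      (seminorm_mul_le_of_le ha ha') (seminorm_mul_le_of_le (seminorm_mul_le_of_le h₄ hb) hb'))
      (seminorm_add_le_of_le (seminorm_mul_le_of_le ha hb') (seminorm_mul_le_of_le ha' hb)))
      (seminorm_mul_le_of_le (seminorm_mul_le_of_le (seminorm_mul_le_of_le (seminorm_mul_le_of_le
        (seminorm_mul_le_of_le (seminorm_ofNat_le h1 2) h₂) ha) ha') hb) hb')).trans ?_
    have h : (t * t' + c * t * t') * (t * t' + t' * t) + OfNat.ofNat 2 * c * t * t' * t * t' =
        (2 + 4 * c) * (t ^ 2 * t' ^ 2) := by ring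
    rw [h]
    refine mul_le_mul_of_nonneg_right ?_ (by positivity)
    nlinarith
  have hw2 := seminorm_mul_le_of_le (seminorm_ofNat_le h1 2) hw
  have e : 8 * c ^ 2 * (t ^ 2 * t' ^ 2) + OfNat.ofNat 2 * (g * (t ^ 2 * t' ^ 2)) =
      (8 * c ^ 2 + 2 * g) * (t ^ 2 * t' ^ 2) := by ring
  fin_cases i <;> fin_cases j
  · exact h00
  · exact (seminorm_sub_le_of_le hm hw2).trans_eq e
  · exact (seminorm_add_le_of_le hm hw2).trans_eq e
  · exact h11

variable (Q : QuadPair)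

theorem natDegree_quadForms_le (a c a' c' : ℤ) : (quadForms a c a' c').1.natDegree ≤ 4 ∧
    (quadForms a c a' c').2.1.natDegree ≤ 4 ∧ (quadForms a c a' c').2.2.natDegree ≤ 6 := by
  have hW : (quadWronskian a c a' c').natDegree ≤ 2 := by
    have : quadWronskian a c a' c' =
        2 * (C (a' - a) * (X - C a) * (X - C a') + C c * (X - C a') - C c' * (X - C a)) := by
      simp only [quadWronskian, quad, C_sub]; ring
    rw [this]
    compute_degree
  have hq : ∀ a c, (quad a c).natDegree ≤ 2 := by
    intro a c
    unfold quad
    compute_degree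
  have h8 : (8 : ℤ[X]).natDegree = 0 := natDegree_ofNat 8
  have h4 : (4 : ℤ[X]).natDegree = 0 := natDegree_ofNat 4
  refine ⟨?_, ?_, ?_⟩
  · exact natDegree_pow_le_of_le 2 hW
  · exact (natDegree_mul_le_of_le h4.le (natDegree_mul_le_of_le (hq _ _) (hq _ _)))
  · refine (natDegree_mul_le_of_le (natDegree_mul_le_of_le h8.le hW) (natDegree_sub_le_of_le
      (natDegree_mul_le_of_le (natDegree_C _).le (natDegree_pow_le_of_le 2 (hq _ _)))
      (natDegree_mul_le_of_le (natDegree_C _).le (natDegree_pow_le_of_le 2 (hq _ _))))).trans ?_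
    norm_num

theorem QuadPair.exists_iter_bound : ∃ E : ℝ, 1 ≤ E ∧ ∀ (k : ℕ) (ρ : ℝ) (hρ : 1 ≤ ρ),
    polySeminorm (normRingSeminorm ℤ) ρ (zero_le_one.trans hρ) (Q.iter k).1 ≤ (E * ρ ^ 4) ^ 4 ^ k ∧
    polySeminorm (normRingSeminorm ℤ) ρ (zero_le_one.trans hρ) (Q.iter k).2.1 ≤
      (E * ρ ^ 4) ^ 4 ^ k ∧
    ρ ^ 2 * polySeminorm (normRingSeminorm ℤ) ρ (zero_le_one.trans hρ) (Q.iter k).2.2 ≤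
      ((E * ρ ^ 4) ^ 4 ^ k) ^ 2 := by
  obtain ⟨hd1, hd2, hd3⟩ := natDegree_quadForms_le Q.a Q.c Q.a' Q.c'
  set p := (quadForms Q.a Q.c Q.a' Q.c') with hp
  set T : ℝ := 1 + lOne p.1 + lOne p.2.1 + lOne p.2.2 with hT
  have hT1 := apply_nonneg lOne p.1
  have hT2 := apply_nonneg lOne p.2.1
  have hT3 := apply_nonneg lOne p.2.2
  have hT0 : 1 ≤ T := by linarith
  set c : ℝ := 1 + |(Q.coeff₂ : ℝ)| + |(Q.coeff₄ : ℝ)| with hcdef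
  have ha2 := abs_nonneg (Q.coeff₂ : ℝ)
  have ha4 := abs_nonneg (Q.coeff₄ : ℝ)
  have hc : 1 ≤ c := by linarith
  set κ : ℝ := 48 * c ^ 3 with hκ
  have hκ1 : 1 ≤ κ := by
    have : 1 ≤ c ^ 3 := one_le_pow₀ hc
    linarith
  have hκ0 : 0 < κ := by linarith
  refine ⟨κ * T, by nlinarith, fun k ρ hρ => ?_⟩
  have hρ0 : 0 < ρ := by linarith
  set μ := polySeminorm (normRingSeminorm ℤ) ρ (zero_le_one.trans hρ) with hμ
  have hμ1 : μ 1 ≤ 1 := by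
    rw [hμ, ← C_1, polySeminorm_C]
    simp [normRingSeminorm_int_apply]
  have hμC : ∀ n : ℤ, μ (C n) = |(n : ℝ)| := fun n => by rw [hμ, polySeminorm_C]; rfl
  have key : κ * μ (Q.iter k).1 ≤ (κ * T * ρ ^ 4) ^ 4 ^ k ∧
      κ * μ (Q.iter k).2.1 ≤ (κ * T * ρ ^ 4) ^ 4 ^ k ∧
      ρ ^ 2 * μ (Q.iter k).2.2 ≤ ((κ * T * ρ ^ 4) ^ 4 ^ k) ^ 2 := by
    induction k with
    | zero =>
      rw [pow_zero, pow_one]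
      refine ⟨?_, ?_, ?_⟩
      · rw [mul_assoc κ T]
        refine mul_le_mul_of_nonneg_left ((polySeminorm_le_of_natDegree_le hρ hd1).trans ?_) hκ0.le
        exact mul_le_mul_of_nonneg_right (by linarith) (by positivity)
      · rw [mul_assoc κ T]
        refine mul_le_mul_of_nonneg_left ((polySeminorm_le_of_natDegree_le hρ hd2).trans ?_) hκ0.le
        exact mul_le_mul_of_nonneg_right (by linarith) (by positivity)
      · have h3 := (polySeminorm_le_of_natDegree_le hρ hd3)
        have h4 : lOne p.2.2 ≤ (κ * T) ^ 2 := by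
          have h5 : T ≤ κ * T := le_mul_of_one_le_left (by linarith) hκ1
          have h6 : κ * T ≤ (κ * T) ^ 2 := le_self_pow₀ (hT0.trans h5) (by norm_num)
          linarith
        calc ρ ^ 2 * μ (Q.iter 0).2.2 ≤ ρ ^ 2 * (lOne p.2.2 * ρ ^ 6) :=
              mul_le_mul_of_nonneg_left h3 (by positivity)
          _ = lOne p.2.2 * ρ ^ 8 := by ring
          _ ≤ (κ * T) ^ 2 * ρ ^ 8 := mul_le_mul_of_nonneg_right h4 (by positivity)
          _ = _ := by ring
    | succ k ih =>
      rw [Q.iter_succ, pow_succ 4 k, pow_mul]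
      exact seminorm_dbl_step hμ1 hc (by rw [hμC]; linarith) (by rw [hμC]; linarith)
        (sq_nonneg ρ) ih.1 ih.2.1 ih.2.2
  refine ⟨?_, ?_, key.2.2⟩
  · exact (le_mul_of_one_le_left (apply_nonneg _ _) hκ1).trans key.1
  · exact (le_mul_of_one_le_left (apply_nonneg _ _) hκ1).trans key.2.1

theorem QuadPair.exists_form_bound (g : ℝ) (hg : 0 ≤ g) : ∃ E : ℝ, 1 ≤ E ∧
    ∀ (A : Type) [CommRing A] (μ : RingSeminorm A), μ 1 ≤ 1 → ∀ (x x' z : A) (ρ ρ' : ℝ), 1 ≤ ρ →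
      1 ≤ ρ' → μ x ≤ ρ → μ x' ≤ ρ' → μ z ≤ g * (ρ ^ 2 * ρ' ^ 2) → ∀ (k : ℕ) (i j : Fin 2),
      μ (Q.form k x x' z i j) ≤ E ^ 4 ^ k * ρ ^ (8 * 4 ^ k) * ρ' ^ 8 := by
  obtain ⟨E, hE, hb⟩ := Q.exists_iter_bound
  set c : ℝ := 1 + |(Q.coeff₂ : ℝ)| + |(Q.coeff₄ : ℝ)| with hcdef
  have ha2 := abs_nonneg (Q.coeff₂ : ℝ)
  have ha4 := abs_nonneg (Q.coeff₄ : ℝ)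
  have hc : 1 ≤ c := by linarith
  have hG : 1 ≤ 8 * c ^ 2 + 2 * g := by
    have : 1 ≤ c ^ 2 := one_le_pow₀ hc
    linarith
  refine ⟨(8 * c ^ 2 + 2 * g) * E ^ 4, by
    have : 1 ≤ E ^ 4 := one_le_pow₀ hE
    nlinarith, fun A _ μ hμ x x' z ρ ρ' hρ hρ' hx hx' hz k i j => ?_⟩
  obtain ⟨b1, b2, b3⟩ := hb k ρ hρ
  obtain ⟨b1', b2', b3'⟩ := hb 0 ρ' hρ'
  rw [pow_zero, pow_one] at b1' b2' b3'
  set Y := (E * ρ ^ 4) ^ 4 ^ k with hY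
  have hev := fun (p : ℤ[X]) => seminorm_aeval_le (hρ := zero_le_one.trans hρ) hμ hx p
  have hev' := fun (p : ℤ[X]) => seminorm_aeval_le (hρ := zero_le_one.trans hρ') hμ hx' p
  have hρ2 : 0 < ρ ^ 2 := by positivity
  have hρ2' : 0 < ρ' ^ 2 := by positivity
  have hw : μ (aeval x (Q.iter k).2.2 * aeval x' (Q.iter 0).2.2 * z) ≤
      g * (Y ^ 2 * (E * ρ' ^ 4) ^ 2) := by
    have w1 : μ (aeval x (Q.iter k).2.2) ≤ Y ^ 2 / ρ ^ 2 := by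
      rw [le_div_iff₀' hρ2]
      exact (mul_le_mul_of_nonneg_left (hev _) hρ2.le).trans b3
    have w2 : μ (aeval x' (Q.iter 0).2.2) ≤ (E * ρ' ^ 4) ^ 2 / ρ' ^ 2 := by
      rw [le_div_iff₀' hρ2']
      exact (mul_le_mul_of_nonneg_left (hev' _) hρ2'.le).trans b3'
    refine (seminorm_mul_le_of_le (seminorm_mul_le_of_le w1 w2) hz).trans_eq ?_
    field_simp
  have h := seminorm_segreForm_le hμ hc (c₂ := (Q.coeff₂ : A)) (c₄ := (Q.coeff₄ : A))
    ((seminorm_intCast_le hμ _).trans (by linarith)) ((seminorm_intCast_le hμ _).trans (by linarith))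
    ((hev _).trans b1) ((hev _).trans b2) ((hev' _).trans b1') ((hev' _).trans b2') hg hw i j
  refine h.trans ?_
  have hN : 1 ≤ 4 ^ k := Nat.one_le_pow _ _ (by norm_num)
  have e1 : Y ^ 2 * (E * ρ' ^ 4) ^ 2 = E ^ (2 * 4 ^ k + 2) * ρ ^ (8 * 4 ^ k) * ρ' ^ 8 := by
    rw [hY, mul_pow, mul_pow, mul_pow, ← pow_mul, ← pow_mul, ← pow_mul, ← pow_mul, pow_add]
    ring_nf
  rw [e1, mul_pow, ← pow_mul]
  have e2 : (8 * c ^ 2 + 2 * g) ≤ (8 * c ^ 2 + 2 * g) ^ 4 ^ k := le_self_pow₀ hG (by omega)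
  have e3 : E ^ (2 * 4 ^ k + 2) ≤ E ^ (4 * 4 ^ k) := pow_le_pow_right₀ hE (by omega)
  calc _ = (8 * c ^ 2 + 2 * g) * E ^ (2 * 4 ^ k + 2) * (ρ ^ (8 * 4 ^ k) * ρ' ^ 8) := by ring
    _ ≤ (8 * c ^ 2 + 2 * g) ^ 4 ^ k * E ^ (4 * 4 ^ k) * (ρ ^ (8 * 4 ^ k) * ρ' ^ 8) := by gcongr
    _ = _ := by ring

end FormBounds

section SmallRelation

theorem exists_coords_injective {ι : Type*} (T : Submodule ℚ (ι → ℚ)) [FiniteDimensional ℚ T] :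
    ∃ s : Finset ι, s.card ≤ finrank ℚ T ∧ ∀ f ∈ T, (∀ i ∈ s, f i = 0) → f = 0 := by
  let φ : ι → Dual ℚ T := fun i => (LinearMap.proj i).comp T.subtype
  obtain ⟨κ, a, ha, hspan, hli⟩ := exists_linearIndependent' ℚ φ
  have : Finite κ := hli.finite
  have : Fintype κ := Fintype.ofFinite κ
  classical
  refine ⟨Finset.univ.image a, ?_, fun f hf h => ?_⟩
  · refine Finset.card_image_le.trans ?_
    rw [Finset.card_univ, ← Subspace.dual_finrank_eq (K := ℚ) (V := T)]
    exact hli.fintype_card_le_finrank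
  · have key : ∀ ψ ∈ Submodule.span ℚ (Set.range (φ ∘ a)), ψ ⟨f, hf⟩ = 0 := by
      intro ψ hψ
      induction hψ using Submodule.span_induction with
      | mem ψ hψ =>
        obtain ⟨k, rfl⟩ := hψ
        exact h (a k) (Finset.mem_image_of_mem a (Finset.mem_univ k))
      | zero => rfl
      | add ψ χ _ _ h1 h2 => rw [LinearMap.add_apply, h1, h2, add_zero]
      | smul c ψ _ h1 => rw [LinearMap.smul_apply, h1, smul_zero]
    funext i
    exact key (φ i) (by rw [hspan]; exact Submodule.subset_span ⟨i, rfl⟩)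

theorem exists_small_solution {ι β : Type*} [Fintype β] [Nonempty β] (v : β → ι → ℤ) {B : ℝ} (hB : 1 ≤ B)
    (hv : ∀ b i, |(v b i : ℝ)| ≤ B)
    (hrank : 4 * finrank ℚ (Submodule.span ℚ (Set.range fun b i => (v b i : ℚ))) ≤
      3 * Fintype.card β) :
    ∃ t : β → ℤ, t ≠ 0 ∧ (∀ i, ∑ b, t b * v b i = 0) ∧
      ∀ b, |(t b : ℝ)| ≤ (Fintype.card β * B) ^ 3 := by
  classical
  set T := Submodule.span ℚ (Set.range fun b i => (v b i : ℚ)) with hT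
  have : FiniteDimensional ℚ T := FiniteDimensional.span_of_finite ℚ (Set.finite_range _)
  obtain ⟨s, hs, hinj⟩ := exists_coords_injective T
  have hcard : 0 < Fintype.card β := Fintype.card_pos
  have hcard1 : (1 : ℝ) ≤ Fintype.card β := by exact_mod_cast hcard
  have hone : 1 ≤ Fintype.card β * B := by nlinarith
  suffices h : ∃ t : β → ℤ, t ≠ 0 ∧ (∀ i ∈ s, ∑ b, t b * v b i = 0) ∧
      ∀ b, |(t b : ℝ)| ≤ (Fintype.card β * B) ^ 3 by
    obtain ⟨t, ht0, ht, htb⟩ := h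
    refine ⟨t, ht0, fun i => ?_, htb⟩
    have h1 : (∑ b, (t b : ℚ) • fun i => (v b i : ℚ)) = 0 := by
      refine hinj _ (Submodule.sum_mem _ fun b _ => Submodule.smul_mem _ _
        (Submodule.subset_span ⟨b, rfl⟩)) fun i hi => ?_
      rw [Finset.sum_apply]
      have := ht i hi
      simp only [Pi.smul_apply, smul_eq_mul]
      exact_mod_cast this
    have h2 := congrFun h1 i
    rw [Finset.sum_apply] at h2
    simp only [Pi.smul_apply, smul_eq_mul, Pi.zero_apply] at h2
    exact_mod_cast h2
  rcases s.eq_empty_or_nonempty with rfl | hsne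
  · obtain ⟨b⟩ := ‹Nonempty β›
    refine ⟨Pi.single b 1, by simp, by simp, fun b' => ?_⟩
    have h1 : |((Pi.single b 1 : β → ℤ) b' : ℝ)| ≤ 1 := by
      rcases eq_or_ne b' b with rfl | h
      · simp
      · simp [h]
    exact h1.trans (one_le_pow₀ hone)
  · let _ : SeminormedAddCommGroup (Matrix s β ℤ) := Matrix.seminormedAddCommGroup
    let A : Matrix s β ℤ := fun i b => v b i
    have hlt : Fintype.card s < Fintype.card β := by rw [Fintype.card_coe]; omega
    obtain ⟨t, ht0, ht, htb⟩ := Int.Matrix.exists_ne_zero_int_vec_norm_le A hlt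
      (by rw [Fintype.card_coe]; exact hsne.card_pos)
    refine ⟨t, ht0, fun i hi => ?_, fun b => ?_⟩
    · have := congrFun ht ⟨i, hi⟩
      rw [Matrix.mulVec, dotProduct] at this
      rw [← Pi.zero_apply (M := fun _ => ℤ) (⟨i, hi⟩ : s), ← this]
      exact Finset.sum_congr rfl fun b _ => mul_comm _ _
    · have hA : max 1 ‖A‖ ≤ B := by
        refine max_le hB ((Matrix.norm_le_iff (by linarith)).mpr fun i b => ?_)
        rw [Int.norm_eq_abs]
        exact hv b i
      have h1 : |(t b : ℝ)| ≤ ‖t‖ := by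
        rw [← Int.norm_eq_abs]; exact norm_le_pi_norm t b
      refine h1.trans (htb.trans ?_)
      have hbase : (Fintype.card β : ℝ) * max 1 ‖A‖ ≤ Fintype.card β * B := by gcongr
      have hbase1 : 1 ≤ (Fintype.card β : ℝ) * max 1 ‖A‖ := by
        have := le_max_left 1 ‖A‖
        nlinarith
      have hsR : (4 : ℝ) * Fintype.card s ≤ 3 * Fintype.card β := by
        rw [Fintype.card_coe]
        exact_mod_cast (Nat.mul_le_mul_left 4 hs).trans hrank
      have hltR : (Fintype.card s : ℝ) < Fintype.card β := by exact_mod_cast hlt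
      have hexp : (Fintype.card s : ℝ) / (Fintype.card β - Fintype.card s) ≤ 3 := by
        rw [div_le_iff₀ (by linarith)]
        linarith
      calc _ ≤ ((Fintype.card β : ℝ) * max 1 ‖A‖) ^ (3 : ℝ) :=
            Real.rpow_le_rpow_of_exponent_le hbase1 hexp
        _ ≤ (Fintype.card β * B) ^ (3 : ℝ) := Real.rpow_le_rpow (by linarith) hbase (by norm_num)
        _ = _ := by norm_cast

/-- The rational span of the coordinate vectors of a finite family. -/
noncomputable def coordSpan {S ι E : Type*} (cor : S → ι → ℤ) (G : E → S) (I : Finset E) :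
    Submodule ℚ (ι → ℚ) :=
  Submodule.span ℚ ((fun e i => (cor (G e) i : ℚ)) '' (I : Set E))

instance {S ι E : Type*} (cor : S → ι → ℤ) (G : E → S) (I : Finset E) :
    FiniteDimensional ℚ (coordSpan cor G I) :=
  FiniteDimensional.span_of_finite ℚ (I.finite_toSet.image _)

theorem exists_small_relation {S ι E : Type*} [CommRing S] (cor : S →+ (ι → ℤ))
    (hcor : Function.Injective cor) (G G' : E → S) (I I' : Finset E) (hI : I ⊆ I')
    (hG : ∀ e ∈ I, ∃ e' ∈ I', G' e = G e') {B : ℝ} (hB : 1 ≤ B)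
    (hb : ∀ e ∈ I', ∀ i, |(cor (G e) i : ℝ)| ≤ B)
    (hpos : 0 < finrank ℚ (coordSpan cor G I))
    (hrank : 2 * finrank ℚ (coordSpan cor G I') ≤ 3 * finrank ℚ (coordSpan cor G I)) :
    ∃ (b : Finset E) (c c' : E → ℤ), b ⊆ I ∧ b.card = finrank ℚ (coordSpan cor G I) ∧
      ∑ e ∈ b, c e • G e ≠ 0 ∧ ∑ e ∈ b, c e • G' e = ∑ e ∈ b, c' e • G e ∧
      ∀ e ∈ b, |(c e : ℝ)| ≤ (2 * b.card * B) ^ 3 ∧ |(c' e : ℝ)| ≤ (2 * b.card * B) ^ 3 := by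
  classical
  let g : E → ι → ℚ := fun e i => (cor (G e) i : ℚ)
  obtain ⟨κ, a, ha, hspan, hli⟩ := exists_linearIndependent' ℚ fun e : I => g e
  have : Finite κ := Finite.of_injective a ha
  have : Fintype κ := Fintype.ofFinite κ
  have hrange : Set.range (fun e : I => g e) = g '' (I : Set E) := by
    ext f; simp
  have hspan' : Submodule.span ℚ (Set.range ((fun e : I => g e) ∘ a)) = coordSpan cor G I := by
    rw [hspan, hrange]; rfl
  have hcard : Fintype.card κ = finrank ℚ (coordSpan cor G I) := by
    rw [← hspan', finrank_span_eq_card hli]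
  have : Nonempty κ := Fintype.card_pos_iff.mp (hcard ▸ hpos)
  let v : κ ⊕ κ → ι → ℤ := Sum.elim (fun k => cor (G' (a k))) (fun k => -cor (G (a k)))
  have hmem' : ∀ e ∈ I', g e ∈ coordSpan cor G I' := fun e he =>
    Submodule.subset_span ⟨e, he, rfl⟩
  obtain ⟨t, ht0, ht, htb⟩ := exists_small_solution v hB (fun b i => by
      rcases b with k | k
      · obtain ⟨e', he', h⟩ := hG _ (a k).2
        simpa [v, h] using hb e' he' i
      · simpa [v] using hb _ (hI (a k).2) i) (by
      rw [Fintype.card_sum, hcard]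
      have hle : Submodule.span ℚ (Set.range fun b i => (v b i : ℚ)) ≤ coordSpan cor G I' := by
        rw [Submodule.span_le]
        rintro _ ⟨k | k, rfl⟩
        · obtain ⟨e', he', h⟩ := hG _ (a k).2
          have h1 : (fun i => (v (Sum.inl k) i : ℚ)) = g e' := by
            funext i; simp [v, h, g]
          change (fun i => (v (Sum.inl k) i : ℚ)) ∈ _
          rw [h1]
          exact hmem' e' he'
        · have h1 : (fun i => (v (Sum.inr k) i : ℚ)) = -g (a k) := by
            funext i; simp [v, g]
          change (fun i => (v (Sum.inr k) i : ℚ)) ∈ _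
          rw [h1]
          exact Submodule.neg_mem _ (hmem' _ (hI (a k).2))
      have := Submodule.finrank_mono hle
      omega)
  have hinj : Function.Injective fun k => (a k : E) := Subtype.val_injective.comp ha
  let em : κ ↪ E := ⟨fun k => (a k : E), hinj⟩
  let ext : (κ → ℤ) → E → ℤ := fun f => Function.extend em f 0
  have hext : ∀ f k, ext f (a k) = f k := fun f k => hinj.extend_apply f 0 k
  have hcardb : (Finset.univ.map em).card = Fintype.card κ := by
    rw [Finset.card_map, Finset.card_univ]
  have hrel : ∑ k, t (Sum.inl k) • G' (a k) = ∑ k, t (Sum.inr k) • G (a k) := by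
    apply hcor
    funext i
    have := ht i
    simp only [Fintype.sum_sum_type, v, Sum.elim_inl, Sum.elim_inr, Pi.neg_apply] at this
    simp only [map_sum, map_zsmul, Finset.sum_apply, Pi.smul_apply, smul_eq_mul]
    simp only [mul_neg, Finset.sum_neg_distrib] at this
    linarith
  have hindep : ∀ f : κ → ℤ, ∑ k, f k • G (a k) = 0 → f = 0 := by
    intro f hf
    funext k
    have h1 : ∑ k, (f k : ℚ) • g (a k) = 0 := by
      funext i
      have := congrFun (congrArg cor hf) i
      simp only [map_sum, map_zsmul, map_zero, Finset.sum_apply, Pi.smul_apply, smul_eq_mul,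
        Pi.zero_apply] at this
      simp only [Finset.sum_apply, Pi.smul_apply, smul_eq_mul, Pi.zero_apply, g]
      exact_mod_cast this
    have := Fintype.linearIndependent_iff.mp hli (fun k => (f k : ℚ)) h1 k
    exact_mod_cast this
  have hbound : (Fintype.card (κ ⊕ κ) : ℝ) = 2 * (Finset.univ.map em).card := by
    rw [hcardb, Fintype.card_sum]; push_cast; ring
  rw [hbound] at htb
  refine ⟨Finset.univ.map em, ext fun k => t (Sum.inl k), ext fun k => t (Sum.inr k), ?_, ?_, ?_, ?_, ?_⟩
  · intro e he
    obtain ⟨k, -, rfl⟩ := Finset.mem_map.mp he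
    exact (a k).2
  · rw [hcardb, hcard]
  · intro h
    rw [Finset.sum_map] at h
    simp only [em, Function.Embedding.coeFn_mk, hext] at h
    have h1 := hindep _ h
    have h2 : ∀ k, t (Sum.inl k) = 0 := fun k => congrFun h1 k
    simp only [h2, zero_smul, Finset.sum_const_zero] at hrel
    have h3 := hindep _ hrel.symm
    refine ht0 (funext fun b => ?_)
    rcases b with k | k
    · exact h2 k
    · exact congrFun h3 k
  · rw [Finset.sum_map, Finset.sum_map]
    simp only [em, Function.Embedding.coeFn_mk, hext]
    exact hrel
  · intro e he
    obtain ⟨k, -, rfl⟩ := Finset.mem_map.mp he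
    simp only [em, Function.Embedding.coeFn_mk, hext]
    exact ⟨htb _, htb _⟩

theorem exists_slow_growth {f : ℕ → ℕ} {J : ℕ} (h : 2 ^ J * f J < 3 ^ J * f 0) :
    ∃ j < J, 2 * f (j + 1) ≤ 3 * f j := by
  by_contra! hcon
  have key : ∀ j ≤ J, 3 ^ j * f 0 ≤ 2 ^ j * f j := by
    intro j
    induction j with
    | zero => simp
    | succ j ih =>
      intro hj
      have h1 := ih (by omega)
      have h2 := hcon j (by omega)
      calc 3 ^ (j + 1) * f 0 = 3 * (3 ^ j * f 0) := by ring
        _ ≤ 3 * (2 ^ j * f j) := Nat.mul_le_mul_left 3 h1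
        _ = 2 ^ j * (3 * f j) := by ring
        _ ≤ 2 ^ j * (2 * f (j + 1)) := Nat.mul_le_mul_left _ h2.le
        _ = _ := by ring
  exact absurd (key J le_rfl) (not_le.mpr h)

end SmallRelation

namespace SurfaceRing

section Coord

variable {Q₁ Q₂ : QuadPair}

/-- The coefficients of an element in the monomial basis. -/
noncomputable def coord : SurfaceRing Q₁ Q₂ →+ (ℕ × ℕ × Fin 2 × Fin 2 → ℤ) where
  toFun s e := (((![![s.re.re, s.re.im], ![s.im.re, s.im.im]] : Fin 2 → Fin 2 → ℤ[X][X])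
    e.2.2.2 e.2.2.1).coeff e.2.1).coeff e.1
  map_zero' := by
    funext ⟨a, b, u, v⟩
    fin_cases u <;> fin_cases v <;> simp
  map_add' s t := by
    funext ⟨a, b, u, v⟩
    fin_cases u <;> fin_cases v <;> simp

theorem coord_injective : Function.Injective (coord : SurfaceRing Q₁ Q₂ →+ _) := by
  intro s t h
  have key : ∀ u v, ((![![s.re.re, s.re.im], ![s.im.re, s.im.im]] : Fin 2 → Fin 2 → ℤ[X][X]) v u) =
      ((![![t.re.re, t.re.im], ![t.im.re, t.im.im]] : Fin 2 → Fin 2 → ℤ[X][X]) v u) := by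
    intro u v
    ext b a
    exact congrFun h (a, b, u, v)
  have h1 := key 0 0
  have h2 := key 1 0
  have h3 := key 0 1
  have h4 := key 1 1
  simp only [Matrix.cons_val_zero, Matrix.cons_val_one] at h1 h2 h3 h4
  exact QuadraticAlgebra.ext (QuadraticAlgebra.ext h1 h2) (QuadraticAlgebra.ext h3 h4)

theorem one_le_surfaceWeight {ρ ρ' : ℝ} (hρ : 1 ≤ ρ) (hρ' : 1 ≤ ρ') :
    1 ≤ surfaceWeight Q₁ Q₂ ρ ρ' := by
  have h1 := one_le_surfaceConst Q₁ Q₂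
  have h2 : 1 ≤ ρ ^ 2 * ρ' ^ 2 := one_le_mul_of_one_le_of_one_le (one_le_pow₀ hρ) (one_le_pow₀ hρ')
  exact one_le_mul_of_one_le_of_one_le h1 h2

theorem coord_le_surfaceSeminorm {ρ ρ' : ℝ} (hρ : 1 ≤ ρ) (hρ' : 1 ≤ ρ') (s : SurfaceRing Q₁ Q₂)
    (e : ℕ × ℕ × Fin 2 × Fin 2) : |(coord s e : ℝ)| * ρ ^ (e.1 + 2 * (e.2.2.1 + e.2.2.2)) *
      ρ' ^ (e.2.1 + 2 * (e.2.2.1 + e.2.2.2)) ≤ surfaceSeminorm Q₁ Q₂ hρ hρ' s := by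
  obtain ⟨a, b, u, v⟩ := e
  have hw : ρ ^ 2 * ρ' ^ 2 ≤ surfaceWeight Q₁ Q₂ ρ ρ' :=
    le_mul_of_one_le_left (by positivity) (one_le_surfaceConst Q₁ Q₂)
  have hw0 := surfaceWeight_nonneg Q₁ Q₂ ρ ρ'
  have hp : ∀ p : ℤ[X][X], |((p.coeff b).coeff a : ℝ)| * ρ ^ a * ρ' ^ b ≤ polySeminorm₂ hρ hρ' p := by
    intro p
    have h1 := le_polySeminorm (N := polySeminorm (normRingSeminorm ℤ) ρ (zero_le_one.trans hρ))
      (hρ := zero_le_one.trans hρ') p b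
    have h2 := le_polySeminorm (N := normRingSeminorm ℤ) (hρ := zero_le_one.trans hρ) (p.coeff b) a
    exact (mul_le_mul_of_nonneg_right h2 (by positivity)).trans h1
  have key : ∀ {R : Type} [CommRing R] (N : RingSeminorm R) (y z : R),
      N y ≤ N y + surfaceWeight Q₁ Q₂ ρ ρ' * N z ∧
      N z * (ρ ^ 2 * ρ' ^ 2) ≤ N y + surfaceWeight Q₁ Q₂ ρ ρ' * N z := by
    intro R _ N y z
    have h1 := apply_nonneg N y
    have h2 := apply_nonneg N z
    have h3 := mul_nonneg hw0 h2
    exact ⟨by linarith, by nlinarith⟩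
  have h1 := fun t : SurfaceRing₁ Q₁ => key (polySeminorm₂ hρ hρ') t.re t.im
  have h2 := key (surfaceSeminorm₁ Q₁ Q₂ hρ hρ') s.re s.im
  have hr : 0 ≤ ρ ^ 2 * ρ' ^ 2 := by positivity
  fin_cases u <;> fin_cases v
  · refine Eq.trans_le ?_ ((hp s.re.re).trans ((h1 _).1.trans h2.1))
    simp [coord]
  · refine Eq.trans_le ?_ ((mul_le_mul_of_nonneg_right ((hp s.im.re).trans (h1 _).1) hr).trans h2.2)
    simp [coord]; ring
  · refine Eq.trans_le ?_ (((mul_le_mul_of_nonneg_right (hp s.re.im) hr).trans (h1 _).2).trans h2.1)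
    simp [coord]; ring
  · refine Eq.trans_le ?_ ((mul_le_mul_of_nonneg_right
      ((mul_le_mul_of_nonneg_right (hp s.im.im) hr).trans (h1 _).2) hr).trans h2.2)
    simp [coord]; ring

/-- The element `s` has degree at most `D` and `D'` in the two variables and size at most `A`. -/
def IsBounded (s : SurfaceRing Q₁ Q₂) (A : ℝ) (D D' : ℕ) : Prop :=
  ∀ (ρ ρ' : ℝ) (hρ : 1 ≤ ρ) (hρ' : 1 ≤ ρ'), surfaceSeminorm Q₁ Q₂ hρ hρ' s ≤ A * ρ ^ D * ρ' ^ D'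

theorem IsBounded.abs_coord_le {s : SurfaceRing Q₁ Q₂} {A : ℝ} {D D' : ℕ} (h : s.IsBounded A D D')
    (e : ℕ × ℕ × Fin 2 × Fin 2) : |(coord s e : ℝ)| ≤ A := by
  have := (coord_le_surfaceSeminorm le_rfl le_rfl s e).trans (h 1 1 le_rfl le_rfl)
  simpa using this

theorem le_of_pow_le_mul_pow {a D : ℕ} {A : ℝ} (h : ∀ ρ : ℝ, 1 ≤ ρ → ρ ^ a ≤ A * ρ ^ D) : a ≤ D := by
  by_contra! hlt
  have hA : 1 ≤ A := by simpa using h 1 le_rfl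
  have h1 := h (A + 1) (by linarith)
  have h2 : (A + 1) ^ (D + 1) ≤ (A + 1) ^ a := pow_le_pow_right₀ (by linarith) hlt
  have h3 : 0 < (A + 1) ^ D := by positivity
  rw [pow_succ] at h2
  nlinarith

theorem IsBounded.coord_eq_zero {s : SurfaceRing Q₁ Q₂} {A : ℝ} {D D' : ℕ} (h : s.IsBounded A D D')
    {e : ℕ × ℕ × Fin 2 × Fin 2}
    (he : D < e.1 + 2 * (e.2.2.1 + e.2.2.2) ∨ D' < e.2.1 + 2 * (e.2.2.1 + e.2.2.2)) : coord s e = 0 := by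
  by_contra h0
  have h1 : (1 : ℝ) ≤ |(coord s e : ℝ)| := by exact_mod_cast Int.one_le_abs h0
  rcases he with he | he
  · refine absurd (le_of_pow_le_mul_pow (a := e.1 + 2 * (e.2.2.1 + e.2.2.2)) (D := D) (A := A)
      fun ρ hρ => ?_) (not_le.mpr he)
    have := (coord_le_surfaceSeminorm hρ le_rfl s e).trans (h ρ 1 hρ le_rfl)
    simp only [one_pow, mul_one] at this
    exact (le_mul_of_one_le_left (by positivity) h1).trans this
  · refine absurd (le_of_pow_le_mul_pow (a := e.2.1 + 2 * (e.2.2.1 + e.2.2.2)) (D := D') (A := A)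
      fun ρ hρ => ?_) (not_le.mpr he)
    have := (coord_le_surfaceSeminorm le_rfl hρ s e).trans (h 1 ρ le_rfl hρ)
    simp only [one_pow, mul_one] at this
    exact (le_mul_of_one_le_left (by positivity) h1).trans this

theorem finrank_coordSpan_le {E : Type*} (G : E → SurfaceRing Q₁ Q₂) (I : Finset E) {A : ℝ} {D D' : ℕ}
    (h : ∀ e ∈ I, (G e).IsBounded A D D') :
    finrank ℚ (coordSpan coord G I) ≤ (D + 1) * ((D' + 1) * 4) := by
  classical
  set b : Finset (ℕ × ℕ × Fin 2 × Fin 2) :=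
    Finset.range (D + 1) ×ˢ Finset.range (D' + 1) ×ˢ Finset.univ with hb
  have hcard : b.card = (D + 1) * ((D' + 1) * 4) := by
    rw [hb, Finset.card_product, Finset.card_product, Finset.card_range, Finset.card_range]
    rfl
  let r : (ℕ × ℕ × Fin 2 × Fin 2 → ℚ) →ₗ[ℚ] (b → ℚ) :=
    LinearMap.funLeft ℚ ℚ (Subtype.val : b → ℕ × ℕ × Fin 2 × Fin 2)
  have hsupp : ∀ f ∈ coordSpan coord G I, ∀ e ∉ b, f e = 0 := by
    intro f hf e he
    induction hf using Submodule.span_induction with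
    | mem f hf =>
      obtain ⟨i, hi, rfl⟩ := hf
      have he' : D < e.1 + 2 * (e.2.2.1 + e.2.2.2) ∨ D' < e.2.1 + 2 * (e.2.2.1 + e.2.2.2) := by
        by_contra! hcon
        exact he (by simp only [hb, Finset.mem_product, Finset.mem_range, Finset.mem_univ, and_true]; omega)
      have := (h i hi).coord_eq_zero he'
      simp [this]
    | zero => rfl
    | add f g _ _ h1 h2 => rw [Pi.add_apply, h1, h2, add_zero]
    | smul c f _ h1 => rw [Pi.smul_apply, h1, smul_zero]
  have hinj : Function.Injective (r.comp (coordSpan coord G I).subtype) := by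
    rw [← LinearMap.ker_eq_bot, LinearMap.ker_eq_bot']
    intro f hf
    apply Subtype.ext
    funext e
    by_cases he : e ∈ b
    · exact congrFun hf ⟨e, he⟩
    · exact hsupp _ f.2 e he
  have := LinearMap.finrank_le_finrank_of_injective hinj
  rwa [finrank_fintype_fun_eq_card, Fintype.card_coe, hcard] at this

end Coord

section Terms

variable (Q₁ Q₂ : QuadPair)

/-- The basic sections of the auxiliary line bundle in the chart indexed by `l` and `l'`. -/
noncomputable def sectionForm {R : Type*} [CommRing R] (x x' z₁ z₂ : R) (k m : ℕ) (l l' : Fin 2)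
    (e : ℕ × ℕ × ℕ × ℕ × Fin 2 × Fin 2) : R :=
  (Q₁.form k x x' z₁ 1 l ^ e.1 * Q₁.form k x x' z₁ 0 l ^ (m - e.1)) *
  (Q₂.form k x x' z₂ 1 l' ^ e.2.1 * Q₂.form k x x' z₂ 0 l' ^ (m - e.2.1)) *
  surfaceMonomial x x' z₁ z₂ e.2.2

/-- The basic sections in the coordinate ring. -/
noncomputable def sectionTerm (k m : ℕ) (l l' : Fin 2) (e : ℕ × ℕ × ℕ × ℕ × Fin 2 × Fin 2) :
    SurfaceRing Q₁ Q₂ :=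
  sectionForm Q₁ Q₂ (x Q₁ Q₂) (x' Q₁ Q₂) (z₁ Q₁ Q₂) (z₂ Q₁ Q₂) k m l l' e

def sectionBox (m K K' : ℕ) : Finset (ℕ × ℕ × ℕ × ℕ × Fin 2 × Fin 2) :=
  Finset.range (m + 1) ×ˢ Finset.range (m + 1) ×ˢ Finset.range (K + 1) ×ˢ Finset.range (K' + 1) ×ˢ
    Finset.univ

variable {Q₁ Q₂}

theorem mem_sectionBox {m K K' : ℕ} {e : ℕ × ℕ × ℕ × ℕ × Fin 2 × Fin 2} :
    e ∈ sectionBox m K K' ↔ e.1 ≤ m ∧ e.2.1 ≤ m ∧ e.2.2.1 ≤ K ∧ e.2.2.2.1 ≤ K' := by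
  simp only [sectionBox, Finset.mem_product, Finset.mem_range, Finset.mem_univ, and_true]
  omega

theorem form_swap (Q : QuadPair) {R : Type*} [CommRing R] {x x' z : R} (h : Q.OnSurface x x' z) (k : ℕ)
    (i r : Fin 2) : Q.form k x x' z i 1 * Q.form k x x' z r 0 =
      Q.form k x x' z i 0 * Q.form k x x' z r 1 := by
  have h1 := Q.form_mul_form k h
  fin_cases i <;> fin_cases r
  · exact mul_comm _ _
  · exact h1.symm
  · exact (mul_comm _ _).trans (h1.trans (mul_comm _ _))
  · exact mul_comm _ _

theorem pow_form_swap (Q : QuadPair) {R : Type*} [CommRing R] {x x' z : R} (h : Q.OnSurface x x' z)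
    (k : ℕ) {i m : ℕ} (hi : i ≤ m) (r : Fin 2) :
    Q.form k x x' z 1 1 ^ i * Q.form k x x' z 0 1 ^ (m - i) * Q.form k x x' z r 0 ^ m =
      Q.form k x x' z 1 0 ^ i * Q.form k x x' z 0 0 ^ (m - i) * Q.form k x x' z r 1 ^ m := by
  have key : ∀ a b u v s t : R, a * u = b * v → s * u = t * v →
      a ^ i * s ^ (m - i) * u ^ m = b ^ i * t ^ (m - i) * v ^ m := by
    intro a b u v s t h1 h2
    have h3 : ∀ w : R, w ^ m = w ^ i * w ^ (m - i) := fun w => by rw [← pow_add]; congr 1; omega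
    rw [h3 u, h3 v]
    calc _ = (a * u) ^ i * (s * u) ^ (m - i) := by rw [mul_pow, mul_pow]; ring
      _ = _ := by rw [h1, h2, mul_pow, mul_pow]; ring
  exact key _ _ _ _ _ _ (form_swap Q h k 1 r) (form_swap Q h k 0 r)

theorem sectionForm_swap₁ {R : Type*} [CommRing R] {x x' z₁ z₂ : R} (h : Q₁.OnSurface x x' z₁)
    (k : ℕ) {m K K' : ℕ} {e : ℕ × ℕ × ℕ × ℕ × Fin 2 × Fin 2} (he : e ∈ sectionBox m K K')
    (l' r : Fin 2) :
    sectionForm Q₁ Q₂ x x' z₁ z₂ k m 1 l' e * Q₁.form k x x' z₁ r 0 ^ m =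
      sectionForm Q₁ Q₂ x x' z₁ z₂ k m 0 l' e * Q₁.form k x x' z₁ r 1 ^ m := by
  have h := pow_form_swap Q₁ h k (mem_sectionBox.mp he).1 r
  unfold sectionForm
  linear_combination (Q₂.form k x x' z₂ 1 l' ^ e.2.1 * Q₂.form k x x' z₂ 0 l' ^ (m - e.2.1)) *
    surfaceMonomial x x' z₁ z₂ e.2.2 * h

theorem sectionForm_swap₂ {R : Type*} [CommRing R] {x x' z₁ z₂ : R} (h : Q₂.OnSurface x x' z₂)
    (k : ℕ) {m K K' : ℕ} {e : ℕ × ℕ × ℕ × ℕ × Fin 2 × Fin 2} (he : e ∈ sectionBox m K K')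
    (l r : Fin 2) :
    sectionForm Q₁ Q₂ x x' z₁ z₂ k m l 1 e * Q₂.form k x x' z₂ r 0 ^ m =
      sectionForm Q₁ Q₂ x x' z₁ z₂ k m l 0 e * Q₂.form k x x' z₂ r 1 ^ m := by
  have h := pow_form_swap Q₂ h k (mem_sectionBox.mp he).2.1 r
  unfold sectionForm
  linear_combination (Q₁.form k x x' z₁ 1 l ^ e.1 * Q₁.form k x x' z₁ 0 l ^ (m - e.1)) *
    surfaceMonomial x x' z₁ z₂ e.2.2 * h

theorem map_sectionForm {R S : Type*} [CommRing R] [CommRing S] (φ : R →+* S) (x x' z₁ z₂ : R)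
    (k m : ℕ) (l l' : Fin 2) (e : ℕ × ℕ × ℕ × ℕ × Fin 2 × Fin 2) :
    φ (sectionForm Q₁ Q₂ x x' z₁ z₂ k m l l' e) =
      sectionForm Q₁ Q₂ (φ x) (φ x') (φ z₁) (φ z₂) k m l l' e := by
  simp only [sectionForm, map_mul, map_pow, QuadPair.map_form, map_surfaceMonomial]

theorem x_pow_mul_sectionForm {R : Type*} [CommRing R] (x x' z₁ z₂ : R) (k m M i j a : ℕ) (l l' : Fin 2)
    (b : ℕ × Fin 2 × Fin 2) : x ^ M * sectionForm Q₁ Q₂ x x' z₁ z₂ k m l l' (i, j, a, b) =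
      sectionForm Q₁ Q₂ x x' z₁ z₂ k m l l' (i, j, a + M, b) := by
  simp only [sectionForm, surfaceMonomial, pow_add]
  ring

theorem seminorm_surfaceMonomial_le {A : Type*} [CommRing A] {μ : RingSeminorm A} (hμ : μ 1 ≤ 1)
    {x x' z₁ z₂ : A} {ρ ρ' w : ℝ} (hρ : 1 ≤ ρ) (hρ' : 1 ≤ ρ') (hw : 1 ≤ w) (hx : μ x ≤ ρ) (hx' : μ x' ≤ ρ')
    (hz₁ : μ z₁ ≤ w) (hz₂ : μ z₂ ≤ w) {K K' : ℕ} {e : ℕ × ℕ × Fin 2 × Fin 2} (h : e.1 ≤ K)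
    (h' : e.2.1 ≤ K') : μ (surfaceMonomial x x' z₁ z₂ e) ≤ ρ ^ K * ρ' ^ K' * w ^ 2 := by
  unfold surfaceMonomial
  refine (seminorm_mul_le_of_le (seminorm_mul_le_of_le (seminorm_mul_le_of_le
    (seminorm_pow_le hμ hx _) (seminorm_pow_le hμ hx' _)) (seminorm_pow_le hμ hz₁ _))
    (seminorm_pow_le hμ hz₂ _)).trans ?_
  have hF : ∀ u : Fin 2, w ^ (u : ℕ) ≤ w := by
    intro u
    conv_rhs => rw [← pow_one w]
    exact pow_le_pow_right₀ hw (by omega)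
  have hw0 : 0 ≤ w := by linarith
  rw [pow_two, ← mul_assoc]
  gcongr
  · exact hF _
  · exact hF _

theorem seminorm_pow_mul_pow_le {A : Type*} [CommRing A] {μ : RingSeminorm A} (hμ : μ 1 ≤ 1) {a b : A}
    {F : ℝ} {i m : ℕ} (hi : i ≤ m) (ha : μ a ≤ F) (hb : μ b ≤ F) : μ (a ^ i * b ^ (m - i)) ≤ F ^ m := by
  refine (seminorm_mul_le_of_le (seminorm_pow_le hμ ha _) (seminorm_pow_le hμ hb _)).trans_eq ?_
  rw [← pow_add]; congr 1; omega

theorem seminorm_sectionForm_le {A : Type*} [CommRing A] {μ : RingSeminorm A} (hμ : μ 1 ≤ 1)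
    {x x' z₁ z₂ : A} {F F' G : ℝ} {k m : ℕ} {l l' : Fin 2} {e : ℕ × ℕ × ℕ × ℕ × Fin 2 × Fin 2}
    (hi : e.1 ≤ m) (hj : e.2.1 ≤ m) (h₁ : ∀ r, μ (Q₁.form k x x' z₁ r l) ≤ F)
    (h₂ : ∀ r, μ (Q₂.form k x x' z₂ r l') ≤ F') (hs : μ (surfaceMonomial x x' z₁ z₂ e.2.2) ≤ G) :
    μ (sectionForm Q₁ Q₂ x x' z₁ z₂ k m l l' e) ≤ F ^ m * F' ^ m * G :=
  seminorm_mul_le_of_le (seminorm_mul_le_of_le (seminorm_pow_mul_pow_le hμ hi (h₁ 1) (h₁ 0))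
    (seminorm_pow_mul_pow_le hμ hj (h₂ 1) (h₂ 0))) hs

theorem section_bound_aux {E₁ E₂ g ρ ρ' : ℝ} (h₁ : 1 ≤ E₁) (h₂ : 1 ≤ E₂) (hg : 1 ≤ g) (hρ : 1 ≤ ρ)
    (hρ' : 1 ≤ ρ') {N m : ℕ} (hm : 0 < m * N) (K K' : ℕ) :
    (E₁ ^ N * ρ ^ (8 * N) * ρ' ^ 8) ^ m * (E₂ ^ N * ρ ^ (8 * N) * ρ' ^ 8) ^ m *
      (ρ ^ K * ρ' ^ K' * (g * (ρ ^ 2 * ρ' ^ 2)) ^ 2) ≤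
    (E₁ * E₂ * g ^ 2) ^ (m * N) * ρ ^ (16 * (m * N) + K + 4) * ρ' ^ (16 * m + K' + 4) := by
  have e1 : (E₁ ^ N * ρ ^ (8 * N) * ρ' ^ 8) ^ m * (E₂ ^ N * ρ ^ (8 * N) * ρ' ^ 8) ^ m *
      (ρ ^ K * ρ' ^ K' * (g * (ρ ^ 2 * ρ' ^ 2)) ^ 2) = ((E₁ * E₂) ^ (m * N) * g ^ 2) *
      (ρ ^ (16 * (m * N) + K + 4) * ρ' ^ (16 * m + K' + 4)) := by
    simp only [mul_pow, ← pow_mul, pow_add]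
    ring
  rw [e1, mul_assoc _ (ρ ^ _), mul_pow (E₁ * E₂) (g ^ 2)]
  refine mul_le_mul_of_nonneg_right ?_ (by positivity)
  refine mul_le_mul_of_nonneg_left ?_ (by positivity)
  exact le_self_pow₀ (one_le_pow₀ hg) (Nat.pos_iff_ne_zero.mp hm)

variable (Q₁ Q₂) in
theorem exists_sectionTerm_bound : ∃ E : ℝ, 1 ≤ E ∧ ∀ (k m K K' : ℕ) (l l' : Fin 2),
    0 < m → ∀ e ∈ sectionBox m K K',
    (sectionTerm Q₁ Q₂ k m l l' e).IsBounded (E ^ (m * 4 ^ k)) (16 * (m * 4 ^ k) + K + 4)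
      (16 * m + K' + 4) := by
  have hg := one_le_surfaceConst Q₁ Q₂
  obtain ⟨E₁, hE₁, hb₁⟩ := Q₁.exists_form_bound (surfaceConst Q₁ Q₂) (by linarith)
  obtain ⟨E₂, hE₂, hb₂⟩ := Q₂.exists_form_bound (surfaceConst Q₁ Q₂) (by linarith)
  refine ⟨E₁ * E₂ * surfaceConst Q₁ Q₂ ^ 2, one_le_mul_of_one_le_of_one_le
    (one_le_mul_of_one_le_of_one_le hE₁ hE₂) (one_le_pow₀ hg),
    fun k m K K' l l' hm e he ρ ρ' hρ hρ' => ?_⟩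
  have hμ := (surfaceSeminorm_one (Q₁ := Q₁) (Q₂ := Q₂) hρ hρ').le
  have hx := (surfaceSeminorm_x (Q₁ := Q₁) (Q₂ := Q₂) hρ hρ').le
  have hx' := (surfaceSeminorm_x' (Q₁ := Q₁) (Q₂ := Q₂) hρ hρ').le
  have hz₁ := (surfaceSeminorm_z₁ (Q₁ := Q₁) (Q₂ := Q₂) hρ hρ').le
  have hz₂ := (surfaceSeminorm_z₂ (Q₁ := Q₁) (Q₂ := Q₂) hρ hρ').le
  obtain ⟨he1, he2, he3, he4⟩ := mem_sectionBox.mp he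
  have f₁ : ∀ i, surfaceSeminorm Q₁ Q₂ hρ hρ' (Q₁.form k (x Q₁ Q₂) (x' Q₁ Q₂) (z₁ Q₁ Q₂) i l) ≤
      E₁ ^ 4 ^ k * ρ ^ (8 * 4 ^ k) * ρ' ^ 8 := fun i =>
    hb₁ (SurfaceRing Q₁ Q₂) _ hμ _ _ _ ρ ρ' hρ hρ' hx hx' hz₁ k i l
  have f₂ : ∀ i, surfaceSeminorm Q₁ Q₂ hρ hρ' (Q₂.form k (x Q₁ Q₂) (x' Q₁ Q₂) (z₂ Q₁ Q₂) i l') ≤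
      E₂ ^ 4 ^ k * ρ ^ (8 * 4 ^ k) * ρ' ^ 8 := fun i =>
    hb₂ (SurfaceRing Q₁ Q₂) _ hμ _ _ _ ρ ρ' hρ hρ' hx hx' hz₂ k i l'
  have hm' := seminorm_surfaceMonomial_le hμ hρ hρ'
    (one_le_surfaceWeight hρ hρ') hx hx' hz₁ hz₂ he3 he4
  have hpos : 0 < m * 4 ^ k := Nat.mul_pos hm (by positivity)
  exact (seminorm_sectionForm_le hμ he1 he2 f₁ f₂ hm').trans
    (section_bound_aux hE₁ hE₂ hg hρ hρ' hpos K K')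

end Terms

end SurfaceRing

namespace SurfaceRing

section Rank

variable {Q₁ Q₂ : QuadPair}

theorem linearIndependent_coord {κ : Type*} {G : κ → SurfaceRing Q₁ Q₂} (h : LinearIndependent ℤ G) :
    LinearIndependent ℚ fun j i => (coord (G j) i : ℚ) := by
  let φ : SurfaceRing Q₁ Q₂ →+ (ℕ × ℕ × Fin 2 × Fin 2 → ℚ) :=
    ((Int.castAddHom ℚ).compLeft _).comp coord
  have hφ : Function.Injective φ := by
    refine Function.Injective.comp (g := (Int.castAddHom ℚ).compLeft _) ?_ coord_injective
    intro f g hfg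
    funext i
    exact Int.cast_injective (congrFun hfg i)
  rw [← LinearIndependent.iff_fractionRing ℤ ℚ]
  exact h.map' φ.toIntLinearMap (LinearMap.ker_eq_bot.mpr hφ)

theorem linearIndependent_sectionForm {Ω : Type*} [Field Ω] [CharZero Ω] {x x' z₁ z₂ : Ω}
    (h : IsGenericSurface Q₁ Q₂ x x' z₁ z₂) (k m : ℕ) {d : ℕ} {e : Fin d → ℕ × ℕ × Fin 2 × Fin 2}
    (hli : LinearIndependent ℚ fun p : ℕ × ℕ × Fin d => Q₁.coordSub k x x' z₁ ^ p.1 *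
      (Q₂.coordSub k x x' z₂ ^ p.2.1 * surfaceMonomial x x' z₁ z₂ (e p.2.2))) :
    LinearIndependent ℚ fun p : Fin (m + 1) × Fin (m + 1) × Fin d =>
      sectionForm Q₁ Q₂ x x' z₁ z₂ k m 0 0 (p.1, p.2.1, e p.2.2) := by
  have h₁ := Q₁.form_ne_zero (z := z₁) h.transcendental h.transcendental' k
  have h₂ := Q₂.form_ne_zero (z := z₂) h.transcendental h.transcendental' k
  set P := Q₁.form k x x' z₁ 0 0 ^ m * Q₂.form k x x' z₂ 0 0 ^ m with hP
  have hP0 : P ≠ 0 := mul_ne_zero (pow_ne_zero _ h₁) (pow_ne_zero _ h₂)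
  let inj : Fin (m + 1) × Fin (m + 1) × Fin d → ℕ × ℕ × Fin d := fun p => (p.1, p.2.1, p.2.2)
  have hinj : Function.Injective inj := by
    rintro ⟨a, b, c⟩ ⟨a', b', c'⟩ hab
    simp only [inj, Prod.mk.injEq, Fin.val_inj] at hab
    obtain ⟨rfl, rfl, rfl⟩ := hab
    rfl
  have h1 := (hli.comp inj hinj).map' (LinearMap.mulLeft ℚ P) (by
    rw [LinearMap.ker_eq_bot]
    exact mul_right_injective₀ hP0)
  refine Eq.subst (motive := fun f => LinearIndependent ℚ f) (funext fun p => Eq.symm ?_) h1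
  obtain ⟨i, j, c⟩ := p
  have key : ∀ {a b : Ω} {i : ℕ}, b ≠ 0 → i ≤ m → a ^ i * b ^ (m - i) = b ^ m * (a / b) ^ i := by
    intro a b i hb hi
    rw [div_pow, ← mul_div_assoc, eq_div_iff (pow_ne_zero _ hb), mul_assoc, ← pow_add,
      Nat.sub_add_cancel hi]
    ring
  have hi : (i : ℕ) ≤ m := by omega
  have hj : (j : ℕ) ≤ m := by omega
  simp only [Function.comp_apply, inj, LinearMap.mulLeft_apply, sectionForm, QuadPair.coordSub]
  rw [key h₁ hi, key h₂ hj, hP]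
  ring

theorem exists_le_finrank_coordSpan_of_isFractionRing (Ω : Type*) [Field Ω] [CharZero Ω]
    [Algebra (SurfaceRing Q₁ Q₂) Ω] [IsFractionRing (SurfaceRing Q₁ Q₂) Ω] (k : ℕ) :
    ∃ n₀, ∀ m K K', n₀ ≤ K → n₀ ≤ K' →
      m ^ 2 * 4 ^ k < 2 * finrank ℚ (coordSpan coord (sectionTerm Q₁ Q₂ k m 0 0) (sectionBox m K K')) := by
  have hgen := isGenericSurface (Q₁ := Q₁) (Q₂ := Q₂) Ω
  obtain ⟨d, e, hd, hli⟩ := hgen.exists_independent_monomials k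
  refine ⟨∑ c, ((e c).1 + (e c).2.1), fun m K K' hK hK' => ?_⟩
  have h1 := linearIndependent_sectionForm hgen k m hli
  rw [← LinearIndependent.iff_fractionRing ℤ ℚ] at h1
  have h2 : LinearIndependent ℤ fun p : Fin (m + 1) × Fin (m + 1) × Fin d =>
      sectionTerm Q₁ Q₂ k m 0 0 (p.1, p.2.1, e p.2.2) := by
    refine LinearIndependent.of_comp (algebraMap (SurfaceRing Q₁ Q₂)
      Ω).toAddMonoidHom.toIntLinearMap ?_
    refine Eq.subst (motive := fun f => LinearIndependent ℤ f) (funext fun p => Eq.symm ?_) h1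
    exact map_sectionForm (algebraMap (SurfaceRing Q₁ Q₂) Ω) _ _ _ _ _ _ _ _ _
  have h3 := linearIndependent_coord h2
  have h4 := finrank_span_eq_card h3
  have h5 : Submodule.span ℚ (Set.range fun (p : Fin (m + 1) × Fin (m + 1) × Fin d) i =>
      (coord (sectionTerm Q₁ Q₂ k m 0 0 (p.1, p.2.1, e p.2.2)) i : ℚ)) ≤
      coordSpan coord (sectionTerm Q₁ Q₂ k m 0 0) (sectionBox m K K') := by
    rw [Submodule.span_le]
    rintro _ ⟨p, rfl⟩
    refine Submodule.subset_span ⟨(p.1, p.2.1, e p.2.2), ?_, rfl⟩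
    have h6 : (e p.2.2).1 + (e p.2.2).2.1 ≤ ∑ c, ((e c).1 + (e c).2.1) :=
      Finset.single_le_sum (f := fun c => (e c).1 + (e c).2.1) (fun _ _ => Nat.zero_le _)
        (Finset.mem_univ _)
    have h7 := p.1.2
    have h8 := p.2.1.2
    rw [Finset.mem_coe, mem_sectionBox]
    refine ⟨?_, ?_, ?_, ?_⟩ <;> simp only <;> omega
  have h6 := Submodule.finrank_mono h5
  rw [h4, Fintype.card_prod, Fintype.card_prod, Fintype.card_fin, Fintype.card_fin] at h6
  have h7 : 0 < 4 ^ k := by positivity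
  calc m ^ 2 * 4 ^ k < (m + 1) ^ 2 * 4 ^ k := by gcongr; omega
    _ ≤ (m + 1) ^ 2 * (2 * d) := Nat.mul_le_mul_left _ hd
    _ = 2 * ((m + 1) * ((m + 1) * d)) := by ring
    _ ≤ _ := Nat.mul_le_mul_left 2 h6

theorem exists_le_finrank_coordSpan [IsDomain (SurfaceRing Q₁ Q₂)] (k : ℕ) :
    ∃ n₀, ∀ m K K', n₀ ≤ K → n₀ ≤ K' →
      m ^ 2 * 4 ^ k < 2 * finrank ℚ (coordSpan coord (sectionTerm Q₁ Q₂ k m 0 0) (sectionBox m K K')) :=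
  have : CharZero (FractionRing (SurfaceRing Q₁ Q₂)) := IsFractionRing.charZero (SurfaceRing Q₁ Q₂)
  exists_le_finrank_coordSpan_of_isFractionRing (FractionRing (SurfaceRing Q₁ Q₂)) k

end Rank

end SurfaceRing

namespace SurfaceRing

section Auxiliary

variable {Q₁ Q₂ : QuadPair}

/-- A section of the auxiliary line bundle in the chart indexed by `l` and `l'`. -/
noncomputable def sectionSum (Q₁ Q₂ : QuadPair) {R : Type*} [CommRing R] (x x' z₁ z₂ : R) (k m : ℕ)
    (b : Finset (ℕ × ℕ × ℕ × ℕ × Fin 2 × Fin 2)) (c : ℕ × ℕ × ℕ × ℕ × Fin 2 × Fin 2 → ℤ)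
    (l l' : Fin 2) : R :=
  ∑ e ∈ b, c e • sectionForm Q₁ Q₂ x x' z₁ z₂ k m l l' e

section Generic

variable {R : Type*} [CommRing R] {x x' z₁ z₂ : R} {k m K K' : ℕ}
  {b : Finset (ℕ × ℕ × ℕ × ℕ × Fin 2 × Fin 2)}

theorem sectionSum_swap₁ (h : Q₁.OnSurface x x' z₁) (hb : b ⊆ sectionBox m K K')
    (c : ℕ × ℕ × ℕ × ℕ × Fin 2 × Fin 2 → ℤ) (l' r : Fin 2) :
    sectionSum Q₁ Q₂ x x' z₁ z₂ k m b c 1 l' * Q₁.form k x x' z₁ r 0 ^ m =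
      sectionSum Q₁ Q₂ x x' z₁ z₂ k m b c 0 l' * Q₁.form k x x' z₁ r 1 ^ m := by
  rw [sectionSum, sectionSum, Finset.sum_mul, Finset.sum_mul]
  exact Finset.sum_congr rfl fun e he => by
    rw [smul_mul_assoc, smul_mul_assoc, sectionForm_swap₁ h k (hb he)]

theorem sectionSum_swap₂ (h : Q₂.OnSurface x x' z₂) (hb : b ⊆ sectionBox m K K')
    (c : ℕ × ℕ × ℕ × ℕ × Fin 2 × Fin 2 → ℤ) (l r : Fin 2) :
    sectionSum Q₁ Q₂ x x' z₁ z₂ k m b c l 1 * Q₂.form k x x' z₂ r 0 ^ m =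
      sectionSum Q₁ Q₂ x x' z₁ z₂ k m b c l 0 * Q₂.form k x x' z₂ r 1 ^ m := by
  rw [sectionSum, sectionSum, Finset.sum_mul, Finset.sum_mul]
  exact Finset.sum_congr rfl fun e he => by
    rw [smul_mul_assoc, smul_mul_assoc, sectionForm_swap₂ h k (hb he)]

theorem x_pow_mul_sectionSum_eq (c : ℕ × ℕ × ℕ × ℕ × Fin 2 × Fin 2 → ℤ) (M : ℕ) (l l' : Fin 2) :
    x ^ M * sectionSum Q₁ Q₂ x x' z₁ z₂ k m b c l l' = ∑ e ∈ b, c e •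
      sectionForm Q₁ Q₂ x x' z₁ z₂ k m l l' (e.1, e.2.1, e.2.2.1 + M, e.2.2.2) := by
  rw [sectionSum, Finset.mul_sum]
  exact Finset.sum_congr rfl fun e _ => by rw [mul_smul_comm, ← x_pow_mul_sectionForm]

theorem x_pow_mul_sectionSum [IsDomain R] (h₁ : Q₁.OnSurface x x' z₁) (h₂ : Q₂.OnSurface x x' z₂)
    (h₁0 : Q₁.form k x x' z₁ 0 0 ≠ 0) (h₂0 : Q₂.form k x x' z₂ 0 0 ≠ 0)
    (hb : b ⊆ sectionBox m K K') {c c' : ℕ × ℕ × ℕ × ℕ × Fin 2 × Fin 2 → ℤ} {M : ℕ}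
    (h : x ^ M * sectionSum Q₁ Q₂ x x' z₁ z₂ k m b c 0 0 = sectionSum Q₁ Q₂ x x' z₁ z₂ k m b c' 0 0)
    (l l' : Fin 2) :
    x ^ M * sectionSum Q₁ Q₂ x x' z₁ z₂ k m b c l l' = sectionSum Q₁ Q₂ x x' z₁ z₂ k m b c' l l' := by
  have hstep : x ^ M * sectionSum Q₁ Q₂ x x' z₁ z₂ k m b c 0 l' =
      sectionSum Q₁ Q₂ x x' z₁ z₂ k m b c' 0 l' := by
    fin_cases l'
    · exact h
    · refine mul_right_cancel₀ (pow_ne_zero m h₂0) ?_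
      change x ^ M * sectionSum Q₁ Q₂ x x' z₁ z₂ k m b c 0 1 * _ =
        sectionSum Q₁ Q₂ x x' z₁ z₂ k m b c' 0 1 * _
      rw [mul_assoc, sectionSum_swap₂ h₂ hb, sectionSum_swap₂ h₂ hb, ← mul_assoc, h]
  fin_cases l
  · exact hstep
  · refine mul_right_cancel₀ (pow_ne_zero m h₁0) ?_
    change x ^ M * sectionSum Q₁ Q₂ x x' z₁ z₂ k m b c 1 l' * _ =
      sectionSum Q₁ Q₂ x x' z₁ z₂ k m b c' 1 l' * _
    rw [mul_assoc, sectionSum_swap₁ h₁ hb, sectionSum_swap₁ h₁ hb, ← mul_assoc, hstep]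

theorem seminorm_sectionSum_le {μ : RingSeminorm R} (hμ : μ 1 ≤ 1)
    {c : ℕ × ℕ × ℕ × ℕ × Fin 2 × Fin 2 → ℤ} {A B : ℝ} {l l' : Fin 2} (hA : ∀ e ∈ b, |(c e : ℝ)| ≤ A)
    (hB : ∀ e ∈ b, μ (sectionForm Q₁ Q₂ x x' z₁ z₂ k m l l' e) ≤ B) :
    μ (sectionSum Q₁ Q₂ x x' z₁ z₂ k m b c l l') ≤ b.card * (A * B) := by
  refine (seminorm_sum_le _ _).trans ?_
  rw [← nsmul_eq_mul]
  refine Finset.sum_le_card_nsmul _ _ _ fun e he => ?_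
  rw [zsmul_eq_mul]
  exact seminorm_mul_le_of_le ((seminorm_intCast_le hμ _).trans (hA e he)) (hB e he)

end Generic

theorem form_ne_zero_of_isFractionRing (Ω : Type*) [Field Ω] [CharZero Ω]
    [Algebra (SurfaceRing Q₁ Q₂) Ω] [IsFractionRing (SurfaceRing Q₁ Q₂) Ω] (k : ℕ) :
    Q₁.form k (x Q₁ Q₂) (x' Q₁ Q₂) (z₁ Q₁ Q₂) 0 0 ≠ 0 ∧
    Q₂.form k (x Q₁ Q₂) (x' Q₁ Q₂) (z₂ Q₁ Q₂) 0 0 ≠ 0 := by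
  have hgen := isGenericSurface (Q₁ := Q₁) (Q₂ := Q₂) Ω
  constructor
  · intro h
    refine Q₁.form_ne_zero (z := algebraMap _ Ω (z₁ Q₁ Q₂)) hgen.transcendental hgen.transcendental' k ?_
    rw [← QuadPair.map_form, h, map_zero]
  · intro h
    refine Q₂.form_ne_zero (z := algebraMap _ Ω (z₂ Q₁ Q₂)) hgen.transcendental hgen.transcendental' k ?_
    rw [← QuadPair.map_form, h, map_zero]

theorem form_ne_zero [IsDomain (SurfaceRing Q₁ Q₂)] (k : ℕ) :
    Q₁.form k (x Q₁ Q₂) (x' Q₁ Q₂) (z₁ Q₁ Q₂) 0 0 ≠ 0 ∧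
    Q₂.form k (x Q₁ Q₂) (x' Q₁ Q₂) (z₂ Q₁ Q₂) 0 0 ≠ 0 :=
  have : CharZero (FractionRing (SurfaceRing Q₁ Q₂)) := IsFractionRing.charZero (SurfaceRing Q₁ Q₂)
  form_ne_zero_of_isFractionRing (FractionRing (SurfaceRing Q₁ Q₂)) k

theorem relation_size_le {E : ℝ} (hE : 1 ≤ E) {w N : ℕ} (hw : w ≤ 1936 * N ^ 2) (hN : 0 < N) :
    (w : ℝ) * ((2 * w * E ^ N) ^ 3 * E ^ N) ≤ (8 * 1936 ^ 4 * 2 ^ 8 * E ^ 4) ^ N := by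
  have h1 : (N : ℝ) ≤ 2 ^ N := by exact_mod_cast Nat.lt_two_pow_self.le
  have h2 : (w : ℝ) ≤ 1936 * ((2 : ℝ) ^ N) ^ 2 := by
    have : (w : ℝ) ≤ 1936 * (N : ℝ) ^ 2 := by exact_mod_cast hw
    refine this.trans ?_
    gcongr
  have h3 : (8 * 1936 ^ 4 : ℝ) ≤ (8 * 1936 ^ 4) ^ N := le_self_pow₀ (by norm_num) (by omega)
  calc (w : ℝ) * ((2 * w * E ^ N) ^ 3 * E ^ N) = 8 * (w : ℝ) ^ 4 * (E ^ N) ^ 4 := by ring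
    _ ≤ 8 * (1936 * ((2 : ℝ) ^ N) ^ 2) ^ 4 * (E ^ N) ^ 4 := by gcongr
    _ = (8 * 1936 ^ 4) * (2 ^ 8) ^ N * (E ^ 4) ^ N := by
        rw [mul_pow, ← pow_mul, ← pow_mul, ← pow_mul, ← pow_mul, ← pow_mul, mul_comm N 4, mul_comm 8 N]
        ring
    _ ≤ (8 * 1936 ^ 4) ^ N * (2 ^ 8) ^ N * (E ^ 4) ^ N := by gcongr
    _ = _ := by rw [← mul_pow, ← mul_pow]

theorem exists_level (k : ℕ) [IsDomain (SurfaceRing Q₁ Q₂)] {E : ℝ}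
    (hE : ∀ (k m K K' : ℕ) (l l' : Fin 2), 0 < m → ∀ e ∈ sectionBox m K K',
      (sectionTerm Q₁ Q₂ k m l l' e).IsBounded (E ^ (m * 4 ^ k)) (16 * (m * 4 ^ k) + K + 4)
      (16 * m + K' + 4)) :
    ∃ n₀, ∀ n, n₀ ≤ n → 0 < n → ∀ m, m = 11 ^ 23 * n → ∃ K, n ≤ K ∧ 11 * K ≤ m ∧
      0 < finrank ℚ (coordSpan coord (sectionTerm Q₁ Q₂ k m 0 0) (sectionBox m (K * 4 ^ k) K)) ∧
      finrank ℚ (coordSpan coord (sectionTerm Q₁ Q₂ k m 0 0) (sectionBox m (K * 4 ^ k) K)) ≤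
        1936 * (m * 4 ^ k) ^ 2 ∧
      2 * finrank ℚ (coordSpan coord (sectionTerm Q₁ Q₂ k m 0 0)
        (sectionBox m (11 * K * 4 ^ k) (11 * K))) ≤
      3 * finrank ℚ (coordSpan coord (sectionTerm Q₁ Q₂ k m 0 0) (sectionBox m (K * 4 ^ k) K)) := by
  obtain ⟨n₀, hn₀⟩ := exists_le_finrank_coordSpan (Q₁ := Q₁) (Q₂ := Q₂) k
  refine ⟨n₀, fun n hn hnpos m hm => ?_⟩
  have hN : 0 < 4 ^ k := by positivity
  have hmpos : 0 < m := by rw [hm]; positivity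
  set f : ℕ → ℕ := fun j => finrank ℚ (coordSpan coord (sectionTerm Q₁ Q₂ k m 0 0)
    (sectionBox m (11 ^ j * n * 4 ^ k) (11 ^ j * n))) with hf
  have hlow : ∀ j, m ^ 2 * 4 ^ k < 2 * f j := by
    intro j
    have h1 : n ≤ 11 ^ j * n := Nat.le_mul_of_pos_left n (by positivity)
    have h2 : 11 ^ j * n ≤ 11 ^ j * n * 4 ^ k := Nat.le_mul_of_pos_right _ hN
    exact hn₀ m _ _ (by omega) (by omega)
  have hup : ∀ j ≤ 23, f j ≤ 1936 * (m ^ 2 * 4 ^ k) := by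
    intro j hj
    have h1 : 11 ^ j * n ≤ m := by
      rw [hm]; exact Nat.mul_le_mul_right n (Nat.pow_le_pow_right (by norm_num) hj)
    have h2 : 11 ^ j * n * 4 ^ k ≤ m * 4 ^ k := Nat.mul_le_mul_right _ h1
    have h3 := finrank_coordSpan_le (sectionTerm Q₁ Q₂ k m 0 0)
      (sectionBox m (11 ^ j * n * 4 ^ k) (11 ^ j * n)) (hE k m _ _ 0 0 hmpos)
    have h4 : 1 ≤ m * 4 ^ k := Nat.mul_pos hmpos hN
    refine h3.trans ?_
    calc _ ≤ (22 * (m * 4 ^ k)) * ((22 * m) * 4) := Nat.mul_le_mul (by omega)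
          (Nat.mul_le_mul_right 4 (by omega))
      _ = _ := by ring
  obtain ⟨j, hj, hgrow⟩ := exists_slow_growth (f := f) (J := 23) (by
    have h1 := hlow 0
    have h2 := hup 23 le_rfl
    norm_num
    omega)
  refine ⟨11 ^ j * n, Nat.le_mul_of_pos_left n (by positivity), ?_, ?_, ?_, ?_⟩
  · rw [hm, ← mul_assoc, ← pow_succ']
    exact Nat.mul_le_mul_right n (Nat.pow_le_pow_right (by norm_num) hj)
  · have := hlow j
    simp only [hf] at this
    omega
  · refine (hup j hj.le).trans ?_
    rw [mul_pow]
    exact Nat.mul_le_mul_left _ (Nat.mul_le_mul_left _ (Nat.le_self_pow (by norm_num) _))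
  · have e1 : 11 * (11 ^ j * n) = 11 ^ (j + 1) * n := by ring
    rw [e1]
    exact hgrow

variable (Q₁ Q₂) in
theorem exists_auxiliary_section [IsDomain (SurfaceRing Q₁ Q₂)] : ∃ A : ℝ, 1 ≤ A ∧ ∀ k, ∃ n₀, ∀ n,
    n₀ ≤ n → 0 < n → ∀ m, m = 11 ^ 23 * n → ∃ (K : ℕ) (T : Fin 2 → Fin 2 → SurfaceRing Q₁ Q₂),
      n ≤ K ∧ 11 * K ≤ m ∧ T 0 0 ≠ 0 ∧
      (∀ l l' (ρ ρ' : ℝ) (hρ : 1 ≤ ρ) (hρ' : 1 ≤ ρ'),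
        ρ ^ (9 * (K * 4 ^ k)) * surfaceSeminorm Q₁ Q₂ hρ hρ' (T l l') ≤
          A ^ (m * 4 ^ k) * ρ ^ (16 * (m * 4 ^ k) + 4) * ρ' ^ (16 * m + K + 4)) ∧
      (∀ l' r, T 1 l' * Q₁.form k (x Q₁ Q₂) (x' Q₁ Q₂) (z₁ Q₁ Q₂) r 0 ^ m =
        T 0 l' * Q₁.form k (x Q₁ Q₂) (x' Q₁ Q₂) (z₁ Q₁ Q₂) r 1 ^ m) ∧
      (∀ l r, T l 1 * Q₂.form k (x Q₁ Q₂) (x' Q₁ Q₂) (z₂ Q₁ Q₂) r 0 ^ m =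
        T l 0 * Q₂.form k (x Q₁ Q₂) (x' Q₁ Q₂) (z₂ Q₁ Q₂) r 1 ^ m) := by
  obtain ⟨E, hE1, hE⟩ := exists_sectionTerm_bound Q₁ Q₂
  refine ⟨8 * 1936 ^ 4 * 2 ^ 8 * E ^ 4, ?_, fun k => ?_⟩
  · have : 1 ≤ E ^ 4 := one_le_pow₀ hE1
    linarith
  obtain ⟨n₀, hn₀⟩ := exists_level k hE
  refine ⟨n₀, fun n hn hnpos m hm => ?_⟩
  obtain ⟨K, hnK, hKm, hpos, hup, hgrow⟩ := hn₀ n hn hnpos m hm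
  have hmpos : 0 < m := by omega
  have hN : 0 < 4 ^ k := by positivity
  have hmN : 0 < m * 4 ^ k := Nat.mul_pos hmpos hN
  have hsub : sectionBox m (K * 4 ^ k) K ⊆ sectionBox m (11 * K * 4 ^ k) (11 * K) := by
    intro e he
    rw [mem_sectionBox] at he ⊢
    have h1 : K * 4 ^ k ≤ 11 * K * 4 ^ k := Nat.mul_le_mul_right _ (by omega)
    omega
  obtain ⟨b, c, c', hbI, hbcard, hne, hrel, hbd⟩ := exists_small_relation coord coord_injective
    (sectionTerm Q₁ Q₂ k m 0 0) (fun e => sectionTerm Q₁ Q₂ k m 0 0 (e.1, e.2.1, e.2.2.1 + 10 * (K * 4 ^ k), e.2.2.2))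
    (sectionBox m (K * 4 ^ k) K) (sectionBox m (11 * K * 4 ^ k) (11 * K)) hsub
    (fun e he => by
      refine ⟨(e.1, e.2.1, e.2.2.1 + 10 * (K * 4 ^ k), e.2.2.2), ?_, rfl⟩
      rw [mem_sectionBox] at he ⊢
      have h1 : 11 * K * 4 ^ k = 11 * (K * 4 ^ k) := by ring
      simp only at he ⊢
      omega)
    (one_le_pow₀ hE1) (fun e he i => (hE k m _ _ 0 0 hmpos e he).abs_coord_le i) hpos hgrow
  have hne' : sectionSum Q₁ Q₂ (x Q₁ Q₂) (x' Q₁ Q₂) (z₁ Q₁ Q₂) (z₂ Q₁ Q₂) k m b c 0 0 ≠ 0 := by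
    rw [sectionSum]
    simp only [sectionTerm] at hne
    exact hne
  have h0 := form_ne_zero (Q₁ := Q₁) (Q₂ := Q₂) k
  have hT : ∀ l l', x Q₁ Q₂ ^ (10 * (K * 4 ^ k)) *
      sectionSum Q₁ Q₂ (x Q₁ Q₂) (x' Q₁ Q₂) (z₁ Q₁ Q₂) (z₂ Q₁ Q₂) k m b c l l' =
      sectionSum Q₁ Q₂ (x Q₁ Q₂) (x' Q₁ Q₂) (z₁ Q₁ Q₂) (z₂ Q₁ Q₂) k m b c' l l' := by
    refine x_pow_mul_sectionSum (onSurface₁ Q₁ Q₂) (onSurface₂ Q₁ Q₂) h0.1 h0.2 hbI ?_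
    rw [x_pow_mul_sectionSum_eq, sectionSum]
    simp only [sectionTerm] at hrel
    exact hrel
  refine ⟨K, sectionSum Q₁ Q₂ (x Q₁ Q₂) (x' Q₁ Q₂) (z₁ Q₁ Q₂) (z₂ Q₁ Q₂) k m b c, hnK, hKm, hne', ?_,
    fun l' r => sectionSum_swap₁ (onSurface₁ Q₁ Q₂) hbI c l' r,
    fun l r => sectionSum_swap₂ (onSurface₂ Q₁ Q₂) hbI c l r⟩
  intro l l' ρ ρ' hρ hρ'
  have h1 := surfaceSeminorm_x_pow_mul hρ hρ' (10 * (K * 4 ^ k))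
    (sectionSum Q₁ Q₂ (x Q₁ Q₂) (x' Q₁ Q₂) (z₁ Q₁ Q₂) (z₂ Q₁ Q₂) k m b c l l')
  rw [hT] at h1
  have h2 := seminorm_sectionSum_le (surfaceSeminorm_one (Q₁ := Q₁) (Q₂ := Q₂) hρ hρ').le
    (fun e he => (hbd e he).2)
    (fun e he => hE k m (K * 4 ^ k) K l l' hmpos e (hbI he) ρ ρ' hρ hρ')
  rw [h1] at h2
  have h3 := relation_size_le hE1 (hbcard.trans_le hup) hmN
  have hρ0 : 0 < ρ ^ (K * 4 ^ k) := by positivity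
  refine le_of_mul_le_mul_left ?_ hρ0
  calc ρ ^ (K * 4 ^ k) * (ρ ^ (9 * (K * 4 ^ k)) * surfaceSeminorm Q₁ Q₂ hρ hρ'
        (sectionSum Q₁ Q₂ (x Q₁ Q₂) (x' Q₁ Q₂) (z₁ Q₁ Q₂) (z₂ Q₁ Q₂) k m b c l l'))
      = ρ ^ (10 * (K * 4 ^ k)) * surfaceSeminorm Q₁ Q₂ hρ hρ'
        (sectionSum Q₁ Q₂ (x Q₁ Q₂) (x' Q₁ Q₂) (z₁ Q₁ Q₂) (z₂ Q₁ Q₂) k m b c l l') := by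
        rw [← mul_assoc, ← pow_add]; congr 2; ring
    _ ≤ _ := h2
    _ = ((b.card : ℝ) * ((2 * b.card * E ^ (m * 4 ^ k)) ^ 3 * E ^ (m * 4 ^ k))) *
        (ρ ^ (16 * (m * 4 ^ k) + K * 4 ^ k + 4) * ρ' ^ (16 * m + K + 4)) := by ring
    _ ≤ (8 * 1936 ^ 4 * 2 ^ 8 * E ^ 4) ^ (m * 4 ^ k) *
        (ρ ^ (16 * (m * 4 ^ k) + K * 4 ^ k + 4) * ρ' ^ (16 * m + K + 4)) :=
        mul_le_mul_of_nonneg_right h3 (by positivity)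
    _ = _ := by rw [add_right_comm, pow_add ρ _ (K * 4 ^ k)]; ring

end Auxiliary

end SurfaceRing

end

section

open Polynomial Module IntermediateField
open scoped PowerSeries

section TruncSeminorm

variable {R : Type*} [CommRing R]

theorem polySeminorm_trunc_le {N : RingSeminorm R} {r : ℝ} {hr : 0 ≤ r} (n : ℕ) (p : R[X]) :
    polySeminorm N r hr (PowerSeries.trunc n (p : R⟦X⟧)) ≤ polySeminorm N r hr p := by
  have hs : (PowerSeries.trunc n (p : R⟦X⟧)).support ⊆ p.support := by
    intro i hi
    rw [Polynomial.mem_support_iff, PowerSeries.coeff_trunc, coeff_coe] at hi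
    rw [Polynomial.mem_support_iff]
    intro h
    simp [h] at hi
  rw [polySeminorm_eq_sum _ hs, polySeminorm_eq_sum p (Finset.Subset.refl _)]
  refine Finset.sum_le_sum fun i _ => mul_le_mul_of_nonneg_right ?_ (by positivity)
  rw [PowerSeries.coeff_trunc, coeff_coe]
  split_ifs
  · exact le_rfl
  · rw [map_zero]; exact apply_nonneg _ _

/-- The weighted `ℓ¹` seminorm of the part of degree at most `n` of a power series. -/
noncomputable def truncSeminorm (N : RingSeminorm R) (r : ℝ) (hr : 0 ≤ r) (n : ℕ) :
    RingSeminorm R⟦X⟧ where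
  toFun f := polySeminorm N r hr (PowerSeries.trunc (n + 1) f)
  map_zero' := by simp
  add_le' f g := by rw [map_add]; exact map_add_le_add _ _ _
  neg' f := by rw [map_neg, map_neg_eq_map]
  mul_le' f g := by
    rw [← PowerSeries.trunc_trunc_mul_trunc, ← Polynomial.coe_mul]
    exact (polySeminorm_trunc_le _ _).trans (map_mul_le_mul _ _ _)

variable {N : RingSeminorm R} {r : ℝ} {hr : 0 ≤ r} {n : ℕ}

theorem le_truncSeminorm (f : R⟦X⟧) {i : ℕ} (hi : i ≤ n) :
    N (PowerSeries.coeff i f) * r ^ i ≤ truncSeminorm N r hr n f := by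
  have := le_polySeminorm (N := N) (hρ := hr) (PowerSeries.trunc (n + 1) f) i
  rwa [PowerSeries.coeff_trunc, if_pos (by omega)] at this

theorem truncSeminorm_C (a : R) : truncSeminorm N r hr n (PowerSeries.C a) = N a := by
  change polySeminorm N r hr (PowerSeries.trunc (n + 1) (PowerSeries.C a)) = N a
  rw [PowerSeries.trunc_C, polySeminorm_C]

theorem truncSeminorm_one : truncSeminorm N r hr n 1 = N 1 := by
  rw [← map_one PowerSeries.C, truncSeminorm_C]

theorem truncSeminorm_X_le : truncSeminorm N r hr n PowerSeries.X ≤ N 1 * r := by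
  rw [← Polynomial.coe_X]
  refine (polySeminorm_trunc_le (hr := hr) (n + 1) (X : R[X])).trans_eq ?_
  rw [← pow_one (X : R[X]), polySeminorm_X_pow, pow_one]

theorem truncSeminorm_map_C_le {S : Type*} [CommRing S] {N' : RingSeminorm S} {φ : S →+* R}
    (h : ∀ s, N (φ s) ≤ N' s) (f : S⟦X⟧) :
    truncSeminorm N r hr n (PowerSeries.map φ f) ≤ truncSeminorm N' r hr n f := by
  change polySeminorm N r hr (PowerSeries.trunc (n + 1) (PowerSeries.map φ f)) ≤
    polySeminorm N' r hr (PowerSeries.trunc (n + 1) f)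
  rw [PowerSeries.trunc_map, polySeminorm_eq_sum _ (support_map_subset _ _),
    polySeminorm_eq_sum _ (Finset.Subset.refl _)]
  refine Finset.sum_le_sum fun i _ => mul_le_mul_of_nonneg_right ?_ (by positivity)
  rw [coeff_map]
  exact h _

theorem exists_eq_add_sq {v : ℤ⟦X⟧} (hv : PowerSeries.constantCoeff v = 0) :
    ∃ W : ℤ⟦X⟧, PowerSeries.constantCoeff W = 0 ∧ W = v + W ^ 2 := by
  have ha := PowerSeries.HasSubst.of_constantCoeff_zero' hv
  let φ : ℤ⟦X⟧ →ₐ[ℤ] ℤ⟦X⟧ := PowerSeries.substAlgHom ha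
  have hX : φ PowerSeries.X = v := PowerSeries.substAlgHom_X ha
  have h := congrArg (fun c => φ (PowerSeries.map (Nat.castRingHom ℤ) c))
    PowerSeries.catalanSeries_sq_mul_X_add_one
  simp only [map_add, map_mul, map_pow, PowerSeries.map_X, map_one, hX] at h
  refine ⟨v * φ (PowerSeries.map (Nat.castRingHom ℤ) PowerSeries.catalanSeries), ?_, ?_⟩
  · rw [map_mul, hv, zero_mul]
  · linear_combination (-v) * h

theorem truncSeminorm_le_half {v W : R⟦X⟧} (hW0 : PowerSeries.constantCoeff W = 0)
    (hW : W = v + W ^ 2) (hv : truncSeminorm N r hr n v ≤ 1 / 4) :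
    truncSeminorm N r hr n W ≤ 1 / 2 := by
  let g : ℕ → R⟦X⟧ := fun k => Nat.rec 0 (fun _ f => v + f ^ 2) k
  have hg : ∀ k, g (k + 1) = v + g k ^ 2 := fun k => rfl
  have hv0 : PowerSeries.constantCoeff v = 0 := by
    have := congrArg PowerSeries.constantCoeff hW
    rw [map_add, map_pow, hW0] at this
    simpa using this.symm
  have hb : ∀ k, truncSeminorm N r hr n (g k) ≤ 1 / 2 := by
    intro k
    induction k with
    | zero => change truncSeminorm N r hr n 0 ≤ 1 / 2; rw [map_zero]; norm_num
    | succ k ih =>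
      rw [hg, pow_two]
      refine (seminorm_add_le_of_le hv (seminorm_mul_le_of_le ih ih)).trans ?_
      norm_num
  have hd : ∀ k, PowerSeries.constantCoeff (g k) = 0 ∧ (PowerSeries.X : R⟦X⟧) ^ k ∣ W - g k := by
    intro k
    induction k with
    | zero => exact ⟨map_zero _, by simp⟩
    | succ k ih =>
      refine ⟨by rw [hg, map_add, map_pow, hv0, ih.1]; simp, ?_⟩
      have h1 : W - g (k + 1) = (W - g k) * (W + g k) := by
        rw [hg]; linear_combination hW
      rw [h1, pow_succ]
      refine mul_dvd_mul ih.2 (PowerSeries.X_dvd_iff.mpr ?_)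
      rw [map_add, hW0, ih.1, add_zero]
  have heq : PowerSeries.trunc (n + 1) W = PowerSeries.trunc (n + 1) (g (n + 1)) := by
    rw [← sub_eq_zero, ← map_sub]
    ext i
    rw [PowerSeries.coeff_trunc]
    split_ifs with hi
    · rw [PowerSeries.X_pow_dvd_iff.mp (hd (n + 1)).2 i hi, coeff_zero]
    · rfl
  change polySeminorm N r hr (PowerSeries.trunc (n + 1) W) ≤ 1 / 2
  rw [heq]
  exact hb (n + 1)

end TruncSeminorm

section LocalExpansion

/-- The parameter series `4 Y² Y'² t`. -/
noncomputable def paramSeries (Y Y' : ℤ) : ℤ⟦X⟧ := ((4 * Y ^ 2 * Y' ^ 2 : ℤ) : ℤ⟦X⟧) * PowerSeries.X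

theorem QuadPair.exists_sqrt_series (Q : QuadPair) : ∃ C : ℝ, 1 ≤ C ∧ ∀ (p q Y Y' : ℤ) (H : ℝ), 1 ≤ H →
    |(p : ℝ)| ≤ H → |(q : ℝ)| ≤ H →
    Y ^ 2 = ((p - Q.a * q) ^ 2 + Q.c * q ^ 2) * ((p - Q.a' * q) ^ 2 + Q.c' * q ^ 2) →
    ((Y : ℝ) ^ 2 ≤ (C * H ^ 2) ^ 2) ∧ ∃ Z : ℤ⟦X⟧, PowerSeries.constantCoeff Z = Y ∧
      Z ^ 2 = ((p - Q.a * q + paramSeries Y Y') ^ 2 + Q.c * q ^ 2) *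
        ((p - Q.a' * q + paramSeries Y Y') ^ 2 + Q.c' * q ^ 2) ∧
      ∀ (r : ℝ) (hr : 0 ≤ r) (n : ℕ), 4 * (Y : ℝ) ^ 2 * (Y' : ℝ) ^ 2 * r ≤ 1 →
        C * H ^ 3 * (Y' : ℝ) ^ 2 * r ≤ 1 / 4 →
        truncSeminorm (normRingSeminorm ℤ) r hr n Z ≤ 2 * |(Y : ℝ)| := by
  set D : ℝ := 1 + |(Q.a : ℝ)| + |(Q.c : ℝ)| + |(Q.a' : ℝ)| + |(Q.c' : ℝ)| with hD
  have n1 := abs_nonneg (Q.a : ℝ)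
  have n2 := abs_nonneg (Q.c : ℝ)
  have n3 := abs_nonneg (Q.a' : ℝ)
  have n4 := abs_nonneg (Q.c' : ℝ)
  have hD1 : 1 ≤ D := by linarith
  refine ⟨21 * D ^ 3, by have := one_le_pow₀ hD1 (n := 3); linarith, ?_⟩
  intro p q Y Y' H hH hp hq hY
  have hβ : ∀ a : ℤ, |(a : ℝ)| ≤ D - 1 → |((p - a * q : ℤ) : ℝ)| ≤ D * H := by
    intro a ha
    push_cast
    have h1 : |(a : ℝ) * q| ≤ (D - 1) * H := by
      rw [abs_mul]; exact mul_le_mul ha hq (abs_nonneg _) (by linarith)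
    have := abs_sub (p : ℝ) (a * q)
    linarith
  have hα : ∀ a c : ℤ, |(a : ℝ)| ≤ D - 1 → |(c : ℝ)| ≤ D →
      |(((p - a * q) ^ 2 + c * q ^ 2 : ℤ) : ℝ)| ≤ 2 * D ^ 2 * H ^ 2 := by
    intro a c ha hc
    have h1 := hβ a ha
    have h2 : |((p - a * q : ℤ) : ℝ)| ^ 2 ≤ (D * H) ^ 2 := pow_le_pow_left₀ (abs_nonneg _) h1 2
    have h3 : |(c : ℝ)| * |(q : ℝ)| ^ 2 ≤ D * H ^ 2 :=
      mul_le_mul hc (pow_le_pow_left₀ (abs_nonneg _) hq 2) (by positivity) (by linarith)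
    have h4 : |(((p - a * q) ^ 2 + c * q ^ 2 : ℤ) : ℝ)| ≤
        |((p - a * q : ℤ) : ℝ)| ^ 2 + |(c : ℝ)| * |(q : ℝ)| ^ 2 := by
      rw [← abs_pow, ← abs_pow, ← abs_mul]
      push_cast
      exact abs_add_le _ _
    have h5 : D * H ^ 2 ≤ D ^ 2 * H ^ 2 :=
      mul_le_mul_of_nonneg_right (le_self_pow₀ hD1 (by norm_num)) (by positivity)
    nlinarith
  have ha1 := hα Q.a Q.c (by linarith) (by linarith)
  have ha2 := hα Q.a' Q.c' (by linarith) (by linarith)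
  have hb1 := hβ Q.a (by linarith)
  have hb2 := hβ Q.a' (by linarith)
  have hYb : (Y : ℝ) ^ 2 ≤ (2 * D ^ 2 * H ^ 2) ^ 2 := by
    have h1 : (Y : ℝ) ^ 2 = |((Y ^ 2 : ℤ) : ℝ)| := by push_cast; rw [abs_of_nonneg (by positivity)]
    rw [h1, hY, Int.cast_mul, abs_mul]
    exact (mul_le_mul ha1 ha2 (abs_nonneg _) (by positivity)).trans_eq (by ring)
  refine ⟨hYb.trans (pow_le_pow_left₀ (by positivity) ?_ 2), ?_⟩
  · refine mul_le_mul_of_nonneg_right ?_ (by positivity)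
    nlinarith [pow_le_pow_right₀ hD1 (show 2 ≤ 3 by norm_num), one_le_pow₀ hD1 (n := 2)]
  generalize hα1 : (p - Q.a * q) ^ 2 + Q.c * q ^ 2 = α at *
  generalize hα2 : (p - Q.a' * q) ^ 2 + Q.c' * q ^ 2 = α' at *
  generalize hβ1 : p - Q.a * q = β at *
  generalize hβ2 : p - Q.a' * q = β' at *
  set θ := paramSeries Y Y' with hθ
  let br : ℤ⟦X⟧ := (2 * β + θ) * (α' + 2 * β' * θ + θ ^ 2) + α * (2 * β' + θ)
  let v : ℤ⟦X⟧ := -(((Y' ^ 2 : ℤ) : ℤ⟦X⟧) * (PowerSeries.X * br))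
  obtain ⟨W, hW0, hW⟩ := exists_eq_add_sq (v := v) (by simp [v])
  have hc1 : ((α : ℤ) : ℤ⟦X⟧) = β ^ 2 + Q.c * q ^ 2 := by rw [← hα1]; push_cast; rfl
  have hc2 : ((α' : ℤ) : ℤ⟦X⟧) = β' ^ 2 + Q.c' * q ^ 2 := by rw [← hα2]; push_cast; rfl
  have hYc : ((Y : ℤ) : ℤ⟦X⟧) ^ 2 = α * α' := by rw [← Int.cast_pow, hY, Int.cast_mul]
  have hb1' : ((p : ℤ) : ℤ⟦X⟧) - Q.a * q = β := by rw [← hβ1]; push_cast; rfl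
  have hb2' : ((p : ℤ) : ℤ⟦X⟧) - Q.a' * q = β' := by rw [← hβ2]; push_cast; rfl
  have hθ' : θ = 4 * (Y : ℤ⟦X⟧) ^ 2 * (Y' : ℤ⟦X⟧) ^ 2 * PowerSeries.X := by
    rw [hθ, paramSeries]; push_cast; rfl
  refine ⟨Y * (1 - 2 * W), ?_, ?_, ?_⟩
  · simp [hW0]
  · have e1 : ((Y : ℤ⟦X⟧) * (1 - 2 * W)) ^ 2 = (Y : ℤ⟦X⟧) ^ 2 * (1 - 4 * v) := by
      linear_combination (-4 * (Y : ℤ⟦X⟧) ^ 2) * hW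
    have e2 : (Y : ℤ⟦X⟧) ^ 2 * (1 - 4 * v) = α * α' + θ * br := by
      have hv : v = -((Y' : ℤ⟦X⟧) ^ 2 * (PowerSeries.X * br)) := by simp [v]
      rw [hv]
      linear_combination hYc - br * hθ'
    rw [e1, e2, hb1', hb2']
    simp only [br]
    linear_combination (α' + 2 * β' * θ + θ ^ 2) * hc1 +
      ((β + θ) ^ 2 + Q.c * (q : ℤ⟦X⟧) ^ 2) * hc2
  · intro r hr n h1 h2
    set ν := truncSeminorm (normRingSeminorm ℤ) r hr n with hν
    have hν1 : ν 1 ≤ 1 := by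
      rw [hν, truncSeminorm_one, normRingSeminorm_int_apply]; simp
    have hνX : ν PowerSeries.X ≤ r := by
      refine truncSeminorm_X_le.trans_eq ?_
      rw [normRingSeminorm_int_apply]; simp
    have hcst := fun z : ℤ => seminorm_intCast_le hν1 z
    have h2' := seminorm_ofNat_le hν1 2
    have hDH : 1 ≤ D * H := one_le_mul_of_one_le_of_one_le hD1 hH
    have hνθ : ν θ ≤ D * H := by
      refine le_trans (seminorm_mul_le_of_le (hcst _) hνX) (le_trans (le_of_eq_of_le ?_ h1) hDH)
      push_cast
      rw [abs_of_nonneg (by positivity)]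
    have hbr : ν br ≤ 21 * D ^ 3 * H ^ 3 := by
      refine (seminorm_add_le_of_le (seminorm_mul_le_of_le (seminorm_add_le_of_le
        (seminorm_mul_le_of_le h2' ((hcst _).trans hb1)) hνθ) (seminorm_add_le_of_le
          (seminorm_add_le_of_le ((hcst _).trans ha2) (seminorm_mul_le_of_le
            (seminorm_mul_le_of_le h2' ((hcst _).trans hb2)) hνθ)) (seminorm_pow_le hν1 hνθ 2)))
        (seminorm_mul_le_of_le ((hcst _).trans ha1) (seminorm_add_le_of_le
          (seminorm_mul_le_of_le h2' ((hcst _).trans hb2)) hνθ))).trans_eq ?_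
      ring
    have hνv : ν v ≤ 1 / 4 := by
      rw [map_neg_eq_map]
      refine (seminorm_mul_le_of_le (hcst _) (seminorm_mul_le_of_le hνX hbr)).trans
        (le_of_eq_of_le ?_ h2)
      push_cast
      rw [abs_of_nonneg (by positivity)]
      ring
    have hνW := truncSeminorm_le_half hW0 hW hνv
    refine (seminorm_mul_le_of_le (hcst Y) (seminorm_sub_le_of_le hν1
      (seminorm_mul_le_of_le h2' hνW))).trans_eq ?_
    ring

end LocalExpansion

end

section

open Polynomial Module IntermediateField

namespace SurfaceRing

section Homogenize

variable {Q₁ Q₂ : QuadPair} {A B : Type*} [CommRing A] [CommRing B]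

theorem evalPoly_eq_sum (x x' : A) {p : ℤ[X][X]} {D D' : ℕ}
    (h : ∀ a b, D < a ∨ D' < b → (p.coeff b).coeff a = 0) :
    evalPoly x x' p = ∑ a ∈ Finset.range (D + 1), ∑ b ∈ Finset.range (D' + 1),
      (((p.coeff b).coeff a : ℤ) : A) * (x ^ a * x' ^ b) := by
  have h1 : p.natDegree < D' + 1 := by
    refine Nat.lt_succ_of_le (natDegree_le_iff_coeff_eq_zero.mpr fun b hb => ?_)
    ext a
    rw [h a b (Or.inr hb), coeff_zero]
  have h2 : ∀ b, (p.coeff b).natDegree < D + 1 := fun b =>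
    Nat.lt_succ_of_le (natDegree_le_iff_coeff_eq_zero.mpr fun a ha => h a b (Or.inl ha))
  rw [Finset.sum_comm]
  change eval₂ _ _ p = _
  rw [eval₂_eq_sum_range' _ h1]
  refine Finset.sum_congr rfl fun b _ => ?_
  change aeval x (p.coeff b) * _ = _
  rw [aeval_eq_sum_range' (h2 b), Finset.sum_mul]
  refine Finset.sum_congr rfl fun a _ => ?_
  rw [zsmul_eq_mul]
  ring

theorem eval_eq_sum {x x' z₁ z₂ : A} (h₁ : Q₁.OnSurface x x' z₁) (h₂ : Q₂.OnSurface x x' z₂)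
    {s : SurfaceRing Q₁ Q₂} {D D' : ℕ} (h : ∀ e, D < e.1 ∨ D' < e.2.1 → coord s e = 0) :
    eval h₁ h₂ s = ∑ a ∈ Finset.range (D + 1), ∑ b ∈ Finset.range (D' + 1), ∑ w : Fin 2 × Fin 2,
      ((coord s (a, b, w) : ℤ) : A) * (x ^ a * x' ^ b * (z₁ ^ (w.1 : ℕ) * z₂ ^ (w.2 : ℕ))) := by
  have e1 : eval h₁ h₂ s = (evalPoly x x' s.re.re + evalPoly x x' s.re.im * z₁) +
    (evalPoly x x' s.im.re + evalPoly x x' s.im.im * z₁) * z₂ := rfl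
  rw [e1, evalPoly_eq_sum x x' (fun a b hab => h (a, b, 0, 0) hab),
    evalPoly_eq_sum x x' (fun a b hab => h (a, b, 1, 0) hab),
    evalPoly_eq_sum x x' (fun a b hab => h (a, b, 0, 1) hab),
    evalPoly_eq_sum x x' (fun a b hab => h (a, b, 1, 1) hab)]
  simp only [Finset.sum_mul, ← Finset.sum_add_distrib]
  refine Finset.sum_congr rfl fun a _ => Finset.sum_congr rfl fun b _ => ?_
  rw [Fintype.sum_prod_type, Fin.sum_univ_two, Fin.sum_univ_two, Fin.sum_univ_two]
  have c1 : coord s (a, b, 0, 0) = (s.re.re.coeff b).coeff a := rfl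
  have c2 : coord s (a, b, 1, 0) = (s.re.im.coeff b).coeff a := rfl
  have c3 : coord s (a, b, 0, 1) = (s.im.re.coeff b).coeff a := rfl
  have c4 : coord s (a, b, 1, 1) = (s.im.im.coeff b).coeff a := rfl
  rw [c1, c2, c3, c4]
  simp only [Fin.val_zero, Fin.val_one, pow_zero, pow_one]
  ring

/-- An element of bounded degree takes integral values after multiplication by the appropriate
powers of the denominators, of controlled size. -/
theorem exists_homogenize {φ : A →+* B} {μ : RingSeminorm A} (hμ : μ 1 ≤ 1) {q q' X X' Z₁ Z₂ : A}
    {x x' z₁ z₂ : B} (hX : φ X = φ q * x) (hX' : φ X' = φ q' * x')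
    (hZ₁ : φ Z₁ = φ q ^ 2 * φ q' ^ 2 * z₁) (hZ₂ : φ Z₂ = φ q ^ 2 * φ q' ^ 2 * z₂)
    {H H' g : ℝ} (hH : 0 ≤ H) (hH' : 0 ≤ H') (hg : 1 ≤ g) (nX : μ X ≤ H) (nq : μ q ≤ H)
    (nX' : μ X' ≤ H') (nq' : μ q' ≤ H') (nZ₁ : μ Z₁ ≤ g * (H ^ 2 * H' ^ 2))
    (nZ₂ : μ Z₂ ≤ g * (H ^ 2 * H' ^ 2)) (h₁ : Q₁.OnSurface x x' z₁) (h₂ : Q₂.OnSurface x x' z₂)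
    {s : SurfaceRing Q₁ Q₂} {M : ℝ} {D D' : ℕ} (hs : s.IsBounded M D D') :
    ∃ a : A, φ a = φ q ^ D * φ q' ^ D' * eval h₁ h₂ s ∧
      μ a ≤ (D + 1) * ((D' + 1) * 4) * (M * g ^ 2 * (H ^ D * H' ^ D')) := by
  refine ⟨∑ a ∈ Finset.range (D + 1), ∑ b ∈ Finset.range (D' + 1), ∑ w : Fin 2 × Fin 2,
      ((coord s (a, b, w) : ℤ) : A) * ((X ^ a * q ^ (D - 2 * (w.1 + w.2) - a)) *
        (X' ^ b * q' ^ (D' - 2 * (w.1 + w.2) - b)) * (Z₁ ^ (w.1 : ℕ) * Z₂ ^ (w.2 : ℕ))), ?_, ?_⟩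
  · rw [eval_eq_sum h₁ h₂ (D := D) (D' := D') (fun e he => hs.coord_eq_zero (by omega))]
    simp only [map_sum, Finset.mul_sum]
    refine Finset.sum_congr rfl fun a _ => Finset.sum_congr rfl fun b _ =>
      Finset.sum_congr rfl fun w _ => ?_
    by_cases h0 : coord s (a, b, w) = 0
    · simp [h0]
    obtain ⟨k, hk⟩ := Nat.le.dest (not_lt.mp fun h => h0 (hs.coord_eq_zero (Or.inl h)))
    obtain ⟨k', hk'⟩ := Nat.le.dest (not_lt.mp fun h => h0 (hs.coord_eq_zero (Or.inr h)))
    dsimp only at hk hk'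
    have e1 : D - 2 * ((w.1 : ℕ) + w.2) - a = k := by omega
    have e2 : D' - 2 * ((w.1 : ℕ) + w.2) - b = k' := by omega
    rw [e1, e2, ← hk, ← hk']
    simp only [map_mul, map_pow, map_intCast, hX, hX', hZ₁, hZ₂]
    ring
  · have hM : 0 ≤ M := (abs_nonneg _).trans (hs.abs_coord_le (0, 0, 0, 0))
    have key : ∀ a b (w : Fin 2 × Fin 2), μ (((coord s (a, b, w) : ℤ) : A) *
        ((X ^ a * q ^ (D - 2 * (w.1 + w.2) - a)) *
        (X' ^ b * q' ^ (D' - 2 * (w.1 + w.2) - b)) * (Z₁ ^ (w.1 : ℕ) * Z₂ ^ (w.2 : ℕ)))) ≤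
        M * g ^ 2 * (H ^ D * H' ^ D') := by
      intro a b w
      by_cases h0 : coord s (a, b, w) = 0
      · simp only [h0, Int.cast_zero, zero_mul, map_zero]; positivity
      obtain ⟨k, hk⟩ := Nat.le.dest (not_lt.mp fun h => h0 (hs.coord_eq_zero (Or.inl h)))
      obtain ⟨k', hk'⟩ := Nat.le.dest (not_lt.mp fun h => h0 (hs.coord_eq_zero (Or.inr h)))
      dsimp only at hk hk'
      have e1 : D - 2 * ((w.1 : ℕ) + w.2) - a = k := by omega
      have e2 : D' - 2 * ((w.1 : ℕ) + w.2) - b = k' := by omega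
      rw [e1, e2]
      refine (seminorm_mul_le_of_le ((seminorm_intCast_le hμ _).trans (hs.abs_coord_le _))
        (seminorm_mul_le_of_le (seminorm_mul_le_of_le
          (seminorm_mul_le_of_le (seminorm_pow_le hμ nX a) (seminorm_pow_le hμ nq k))
          (seminorm_mul_le_of_le (seminorm_pow_le hμ nX' b) (seminorm_pow_le hμ nq' k')))
          (seminorm_mul_le_of_le (seminorm_pow_le hμ nZ₁ w.1) (seminorm_pow_le hμ nZ₂ w.2)))).trans ?_
      have e3 : M * (H ^ a * H ^ k * (H' ^ b * H' ^ k') * ((g * (H ^ 2 * H' ^ 2)) ^ (w.1 : ℕ) *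
          (g * (H ^ 2 * H' ^ 2)) ^ (w.2 : ℕ))) = M * g ^ ((w.1 : ℕ) + w.2) * (H ^ D * H' ^ D') := by
        rw [← hk, ← hk']; ring
      rw [e3]
      have hw : (w.1 : ℕ) + w.2 ≤ 2 := by omega
      have := pow_le_pow_right₀ hg hw
      gcongr
    have hsum : ∀ {ι : Type} (t : Finset ι) (f : ι → A) (c : ℝ), (∀ i, μ (f i) ≤ c) →
        μ (∑ i ∈ t, f i) ≤ t.card * c := fun t f c h =>
      (seminorm_sum_le t f).trans ((Finset.sum_le_card_nsmul t _ c fun i _ => h i).trans_eq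
        (nsmul_eq_mul _ _))
    refine (hsum _ _ _ fun a => hsum _ _ _ fun b => hsum _ _ _ fun w => key a b w).trans_eq ?_
    simp only [Finset.card_range, Finset.card_univ, Fintype.card_prod, Fintype.card_fin]
    push_cast
    ring

end Homogenize

end SurfaceRing

end

section

open Polynomial Module IntermediateField Height
open scoped PowerSeries

theorem QuadPair.aeval_poly (Q : QuadPair) {R : Type*} [CommRing R] (x : R) :
    aeval x Q.poly = ((x - Q.a) ^ 2 + Q.c) * ((x - Q.a') ^ 2 + Q.c') := by
  simp [poly, quad]

/-- Power series solutions of `ζᵢ² = fᵢ(ξ)` through a rational point, together with integral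
multiples of controlled size. -/
structure LocalExpansion (Q₁ Q₂ : QuadPair) (M : ℝ) (x y₁ y₂ : ℚ) where
  /-- The first coordinate. -/
  ξ : ℚ⟦X⟧
  /-- The first square root. -/
  ζ₁ : ℚ⟦X⟧
  /-- The second square root. -/
  ζ₂ : ℚ⟦X⟧
  /-- The integral multiple of the first coordinate. -/
  X : ℤ⟦X⟧
  /-- The integral multiple of the first square root. -/
  Z₁ : ℤ⟦X⟧
  /-- The integral multiple of the second square root. -/
  Z₂ : ℤ⟦X⟧
  /-- The denominator. -/
  q : ℤ
  /-- The scale of the parameter. -/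
  scale : ℚ
  q_ne_zero : q ≠ 0
  scale_ne_zero : scale ≠ 0
  ξ_eq : ξ = PowerSeries.C x + PowerSeries.C scale * PowerSeries.X
  constantCoeff_ζ₁ : PowerSeries.constantCoeff ζ₁ = y₁
  constantCoeff_ζ₂ : PowerSeries.constantCoeff ζ₂ = y₂
  ζ₁_sq : ζ₁ ^ 2 = ((ξ - Q₁.a) ^ 2 + Q₁.c) * ((ξ - Q₁.a') ^ 2 + Q₁.c')
  ζ₂_sq : ζ₂ ^ 2 = ((ξ - Q₂.a) ^ 2 + Q₂.c) * ((ξ - Q₂.a') ^ 2 + Q₂.c')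
  map_X : PowerSeries.map (Int.castRingHom ℚ) X = q * ξ
  map_Z₁ : PowerSeries.map (Int.castRingHom ℚ) Z₁ = q ^ 2 * ζ₁
  map_Z₂ : PowerSeries.map (Int.castRingHom ℚ) Z₂ = q ^ 2 * ζ₂
  abs_q_le : |(q : ℝ)| ≤ mulHeight₁ x
  seminorm_le : ∀ (r : ℝ) (hr : 0 ≤ r) (n : ℕ), M * mulHeight₁ x ^ 8 * r ≤ 1 →
    truncSeminorm (normRingSeminorm ℤ) r hr n X ≤ 2 * mulHeight₁ x ∧
    truncSeminorm (normRingSeminorm ℤ) r hr n Z₁ ≤ M * mulHeight₁ x ^ 2 ∧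
    truncSeminorm (normRingSeminorm ℤ) r hr n Z₂ ≤ M * mulHeight₁ x ^ 2

theorem QuadPair.exists_int_eq (Q : QuadPair) {x y : ℚ} (h : y ^ 2 = aeval x Q.poly) :
    ∃ Y : ℤ, (Y : ℚ) = x.den ^ 2 * y ∧ Y ≠ 0 ∧ Y ^ 2 = ((x.num - Q.a * x.den) ^ 2 + Q.c * x.den ^ 2) *
      ((x.num - Q.a' * x.den) ^ 2 + Q.c' * x.den ^ 2) := by
  rw [Q.aeval_poly] at h
  have hd : (x.den : ℚ) ≠ 0 := by exact_mod_cast x.den_ne_zero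
  have hn : (x.num : ℚ) = x * x.den := (Rat.mul_den_eq_num x).symm
  set z : ℤ := ((x.num - Q.a * x.den) ^ 2 + Q.c * x.den ^ 2) *
      ((x.num - Q.a' * x.den) ^ 2 + Q.c' * x.den ^ 2) with hz
  have hzq : (z : ℚ) = (x.den ^ 2 * y) ^ 2 := by
    rw [hz]; push_cast; rw [hn]; linear_combination (-(x.den : ℚ) ^ 4) * h
  have hy : y ≠ 0 := by
    rintro rfl
    have h1 : (0 : ℚ) < Q.c := by exact_mod_cast Q.hc
    have h2 : (0 : ℚ) < Q.c' := by exact_mod_cast Q.hc'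
    have : 0 < ((x - Q.a) ^ 2 + Q.c) * ((x - Q.a') ^ 2 + Q.c') := by positivity
    rw [← h] at this
    norm_num at this
  obtain ⟨Y, hY⟩ : IsSquare z := by
    rw [← Rat.isSquare_intCast_iff, hzq]; exact ⟨_, pow_two _⟩
  have key : ∀ Y : ℤ, (Y : ℚ) = x.den ^ 2 * y → Y ≠ 0 ∧ Y ^ 2 = z := by
    intro Y h
    refine ⟨?_, ?_⟩
    · rintro rfl
      rw [Int.cast_zero] at h
      exact mul_ne_zero (pow_ne_zero 2 hd) hy h.symm
    · have : ((Y ^ 2 : ℤ) : ℚ) = z := by push_cast; rw [h, hzq]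
      exact_mod_cast this
  have : ((Y : ℚ)) ^ 2 = (x.den ^ 2 * y) ^ 2 := by rw [← hzq, hY]; push_cast; ring
  rcases sq_eq_sq_iff_eq_or_eq_neg.mp this with h | h
  · exact ⟨Y, h, key Y h⟩
  · have h' : ((-Y : ℤ) : ℚ) = x.den ^ 2 * y := by push_cast; rw [h, neg_neg]
    exact ⟨-Y, h', key _ h'⟩

theorem exists_localExpansion (Q₁ Q₂ : QuadPair) : ∃ M : ℝ, 1 ≤ M ∧ ∀ x y₁ y₂ : ℚ,
    y₁ ^ 2 = aeval x Q₁.poly → y₂ ^ 2 = aeval x Q₂.poly →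
    Nonempty (LocalExpansion Q₁ Q₂ M x y₁ y₂) := by
  obtain ⟨C₁, hC₁, h₁⟩ := Q₁.exists_sqrt_series
  obtain ⟨C₂, hC₂, h₂⟩ := Q₂.exists_sqrt_series
  set D := max C₁ C₂
  have hD₁ : C₁ ≤ D := le_max_left _ _
  have hD₂ : C₂ ≤ D := le_max_right _ _
  have hD : 1 ≤ D := hC₁.trans hD₁
  refine ⟨4 * D ^ 4, by have := one_le_pow₀ hD (n := 4); linarith, fun x y₁ y₂ hy₁ hy₂ => ?_⟩
  obtain ⟨Y₁, hY₁, hY₁0, hY₁s⟩ := Q₁.exists_int_eq hy₁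
  obtain ⟨Y₂, hY₂, hY₂0, hY₂s⟩ := Q₂.exists_int_eq hy₂
  set H := mulHeight₁ x with hH
  have hHm : H = max (x.num.natAbs : ℝ) x.den := by rw [hH, Rat.mulHeight₁_eq_max]; push_cast; rfl
  have hH1 : 1 ≤ H := one_le_mulHeight₁ x
  have hp : |(x.num : ℝ)| ≤ H := by
    rw [hHm]; refine le_trans (le_of_eq ?_) (le_max_left _ _); rw [Nat.cast_natAbs, Int.cast_abs]
  have hq : |((x.den : ℤ) : ℝ)| ≤ H := by
    rw [hHm]; refine le_trans (le_of_eq ?_) (le_max_right _ _); simp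
  obtain ⟨hb₁, Z₁, hZ₁0, hZ₁, hZ₁b⟩ := h₁ x.num x.den Y₁ Y₂ H hH1 hp hq hY₁s
  obtain ⟨hb₂, Z₂, hZ₂0, hZ₂, hZ₂b⟩ := h₂ x.num x.den Y₂ Y₁ H hH1 hp hq hY₂s
  have hθ : paramSeries Y₂ Y₁ = paramSeries Y₁ Y₂ := by
    simp only [paramSeries]; congr 2; ring
  rw [hθ] at hZ₂
  have hd : (x.den : ℚ) ≠ 0 := by exact_mod_cast x.den_ne_zero
  have hB : ∀ {c : ℝ} {Y : ℤ}, 1 ≤ c → c ≤ D → (Y : ℝ) ^ 2 ≤ (c * H ^ 2) ^ 2 →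
      (Y : ℝ) ^ 2 ≤ D ^ 2 * H ^ 4 ∧ |(Y : ℝ)| ≤ D * H ^ 2 := by
    intro c Y h0 h1 h2
    have h3 : (Y : ℝ) ^ 2 ≤ (D * H ^ 2) ^ 2 :=
      h2.trans (pow_le_pow_left₀ (by positivity) (by gcongr) 2)
    exact ⟨h3.trans_eq (by ring), abs_le_of_sq_le_sq h3 (by positivity)⟩
  obtain ⟨hb₁, hb₁'⟩ := hB hC₁ hD₁ hb₁
  obtain ⟨hb₂, hb₂'⟩ := hB hC₂ hD₂ hb₂
  have hprod : 4 * (Y₁ : ℝ) ^ 2 * (Y₂ : ℝ) ^ 2 ≤ 4 * D ^ 4 * H ^ 8 := by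
    have := mul_le_mul hb₁ hb₂ (by positivity) (by positivity)
    nlinarith
  let u : ℚ⟦X⟧ := PowerSeries.C ((x.den : ℚ)⁻¹)
  have hu : u * ((x.den : ℤ) : ℚ⟦X⟧) = 1 := by
    have : ((x.den : ℤ) : ℚ⟦X⟧) = PowerSeries.C (x.den : ℚ) := by simp
    rw [this, ← map_mul, inv_mul_cancel₀ hd, map_one]
  have hcast : ∀ n : ℤ, PowerSeries.map (Int.castRingHom ℚ) (n : ℤ⟦X⟧) = n := fun n => map_intCast _ n
  set φ : ℤ⟦X⟧ →+* ℚ⟦X⟧ := PowerSeries.map (Int.castRingHom ℚ)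
  set P : ℤ⟦X⟧ := x.num + paramSeries Y₁ Y₂
  set d : ℚ⟦X⟧ := ((x.den : ℤ) : ℚ⟦X⟧)
  have hroot : ∀ (Q : QuadPair) (Z : ℤ⟦X⟧), Z ^ 2 =
      ((x.num - Q.a * (x.den : ℤ) + paramSeries Y₁ Y₂) ^ 2 + Q.c * (x.den : ℤ) ^ 2) *
        ((x.num - Q.a' * (x.den : ℤ) + paramSeries Y₁ Y₂) ^ 2 + Q.c' * (x.den : ℤ) ^ 2) →
      (u ^ 2 * φ Z) ^ 2 = ((u * φ P - Q.a) ^ 2 + Q.c) * ((u * φ P - Q.a') ^ 2 + Q.c') := by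
    intro Q Z h
    have h' := congrArg φ h
    simp only [map_mul, map_add, map_sub, map_pow, hcast] at h'
    have hP : φ P = x.num + φ (paramSeries Y₁ Y₂) := by rw [map_add, hcast]
    have hfac : ∀ a c : ℤ, u ^ 2 * (((x.num : ℚ⟦X⟧) - a * d + φ (paramSeries Y₁ Y₂)) ^ 2 +
        c * d ^ 2) = (u * φ P - a) ^ 2 + c := by
      intro a c
      rw [hP]
      linear_combination (-2 * u * (x.num + φ (paramSeries Y₁ Y₂)) * a + a ^ 2 * (u * d + 1) +
        c * (u * d + 1)) * hu
    rw [mul_pow, h', ← hfac, ← hfac]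
    ring
  have hφ0 : ∀ f, PowerSeries.constantCoeff (φ f) = Int.castRingHom ℚ (PowerSeries.constantCoeff f) :=
    fun f => by rw [← PowerSeries.coeff_zero_eq_constantCoeff_apply, PowerSeries.coeff_map,
      PowerSeries.coeff_zero_eq_constantCoeff_apply]
  refine ⟨⟨u * φ P, u ^ 2 * φ Z₁, u ^ 2 * φ Z₂, P, Z₁, Z₂, x.den,
    (4 * Y₁ ^ 2 * Y₂ ^ 2 : ℤ) * (x.den : ℚ)⁻¹, by exact_mod_cast x.den_ne_zero, ?_, ?_, ?_, ?_,
    hroot Q₁ Z₁ hZ₁, hroot Q₂ Z₂ hZ₂, ?_, ?_, ?_, hq, ?_⟩⟩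
  · refine mul_ne_zero ?_ (inv_ne_zero hd)
    exact_mod_cast mul_ne_zero (mul_ne_zero four_ne_zero (pow_ne_zero 2 hY₁0)) (pow_ne_zero 2 hY₂0)
  · have h1 : (x.num : ℚ⟦X⟧) = PowerSeries.C (x.num : ℚ) := by simp
    have h2 : φ (paramSeries Y₁ Y₂) = PowerSeries.C ((4 * Y₁ ^ 2 * Y₂ ^ 2 : ℤ) : ℚ) * PowerSeries.X := by
      rw [paramSeries, map_mul, hcast, PowerSeries.map_X, map_intCast]
    rw [map_add, hcast, h1, h2, mul_add, ← mul_assoc, ← map_mul, ← map_mul]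
    congr 2
    · rw [mul_comm, ← div_eq_mul_inv, Rat.num_div_den]
    · rw [mul_comm]
  · rw [map_mul, map_pow, PowerSeries.constantCoeff_C, hφ0, hZ₁0, eq_intCast, hY₁]
    field_simp
  · rw [map_mul, map_pow, PowerSeries.constantCoeff_C, hφ0, hZ₂0, eq_intCast, hY₂]
    field_simp
  · linear_combination (-φ P) * hu
  · linear_combination (-φ Z₁ * (u * d + 1)) * hu
  · linear_combination (-φ Z₂ * (u * d + 1)) * hu
  · intro r hr n hrn
    have hle : ∀ t : ℝ, t ≤ 4 * D ^ 4 * H ^ 8 → t * r ≤ 1 := fun t ht =>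
      (mul_le_mul_of_nonneg_right ht hr).trans hrn
    have hθr := hle _ hprod
    have hsm : ∀ {c : ℝ} {Y : ℤ}, 1 ≤ c → c ≤ D → (Y : ℝ) ^ 2 ≤ D ^ 2 * H ^ 4 →
        c * H ^ 3 * (Y : ℝ) ^ 2 * r ≤ 1 / 4 := by
      intro c Y h0 hc hY
      have h1 : c * H ^ 3 * (Y : ℝ) ^ 2 ≤ D * H ^ 3 * (D ^ 2 * H ^ 4) := by gcongr
      have h2 : D ^ 3 * H ^ 7 ≤ D ^ 4 * H ^ 8 := by
        gcongr <;> first | assumption | norm_num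
      have := hle (4 * (c * H ^ 3 * (Y : ℝ) ^ 2)) (by nlinarith)
      linarith
    have h4 : 2 * (D * H ^ 2) ≤ 4 * D ^ 4 * H ^ 2 := by
      have : D ≤ D ^ 4 := le_self_pow₀ hD (by norm_num)
      have := mul_le_mul_of_nonneg_right this (by positivity : 0 ≤ H ^ 2)
      have : 0 ≤ D ^ 4 * H ^ 2 := by positivity
      linarith
    refine ⟨?_, ?_, ?_⟩
    · have hν1 : truncSeminorm (normRingSeminorm ℤ) r hr n 1 ≤ 1 := by
        rw [truncSeminorm_one, normRingSeminorm_int_apply]; simp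
      refine (seminorm_add_le_of_le ((seminorm_intCast_le hν1 _).trans hp) (seminorm_mul_le_of_le
        (seminorm_intCast_le hν1 _) truncSeminorm_X_le)).trans ?_
      rw [normRingSeminorm_int_apply, Int.cast_one, abs_one, one_mul, abs_of_nonneg (by positivity)]
      push_cast
      linarith
    · exact (hZ₁b r hr n hθr (hsm hC₁ hD₁ hb₂)).trans (by linarith)
    · exact (hZ₂b r hr n (by linarith) (hsm hC₂ hD₂ hb₁)).trans (by linarith)

section BiCoeff

variable {R S : Type*} [CommRing R] [CommRing S]

/-- The coefficient of `t ^ i t' ^ j`. -/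
noncomputable def biCoeff (i j : ℕ) (f : R⟦X⟧⟦X⟧) : R :=
  PowerSeries.coeff i (PowerSeries.coeff j f)

theorem biCoeff_mul (i j : ℕ) (f g : R⟦X⟧⟦X⟧) : biCoeff i j (f * g) =
    ∑ b ∈ Finset.HasAntidiagonal.antidiagonal j, ∑ a ∈ Finset.HasAntidiagonal.antidiagonal i, biCoeff a.1 b.1 f * biCoeff a.2 b.2 g := by
  simp only [biCoeff, PowerSeries.coeff_mul, map_sum]

/-- All coefficients of `f` at positions below `(i, j)` vanish. -/
def VanishesBelow (i j : ℕ) (f : R⟦X⟧⟦X⟧) : Prop :=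
  ∀ a b, a ≤ i → b ≤ j → a + b < i + j → biCoeff a b f = 0

theorem VanishesBelow.biCoeff_mul {i j : ℕ} {f : R⟦X⟧⟦X⟧} (hf : VanishesBelow i j f)
    (g : R⟦X⟧⟦X⟧) : biCoeff i j (f * g) = biCoeff i j f * biCoeff 0 0 g := by
  rw [_root_.biCoeff_mul, Finset.sum_eq_single (j, 0), Finset.sum_eq_single (i, 0)]
  · rintro ⟨a, a'⟩ ha hne
    rw [Finset.HasAntidiagonal.mem_antidiagonal] at ha
    dsimp only at ha ⊢
    rw [hf a j (by omega) le_rfl (by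
      have : a ≠ i := fun h => hne (by ext <;> simp <;> omega)
      omega), zero_mul]
  · intro h; simp at h
  · rintro ⟨b, b'⟩ hb hne
    rw [Finset.HasAntidiagonal.mem_antidiagonal] at hb
    refine Finset.sum_eq_zero fun a ha => ?_
    rw [Finset.HasAntidiagonal.mem_antidiagonal] at ha
    dsimp only at hb ⊢
    rw [hf a.1 b (by omega) (by omega) (by
      have : b ≠ j := fun h => hne (by ext <;> simp <;> omega)
      omega), zero_mul]
  · intro h; simp at h

theorem exists_vanishesBelow {i j : ℕ} {f g : R⟦X⟧⟦X⟧} (h : biCoeff i j (f * g) ≠ 0) :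
    ∃ a b, a ≤ i ∧ b ≤ j ∧ biCoeff a b f ≠ 0 ∧ VanishesBelow a b f := by
  classical
  have hex : ∃ n a b, a + b = n ∧ a ≤ i ∧ b ≤ j ∧ biCoeff a b f ≠ 0 := by
    by_contra! hcon
    refine h ?_
    rw [biCoeff_mul]
    refine Finset.sum_eq_zero fun b hb => Finset.sum_eq_zero fun a ha => ?_
    rw [Finset.HasAntidiagonal.mem_antidiagonal] at ha hb
    rw [hcon _ a.1 b.1 rfl (by omega) (by omega), zero_mul]
  obtain ⟨a, b, hab, ha, hb, hne⟩ := Nat.find_spec hex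
  refine ⟨a, b, ha, hb, hne, fun a' b' ha' hb' hlt => ?_⟩
  by_contra h0
  exact Nat.find_min hex (hab ▸ hlt) ⟨a', b', rfl, ha'.trans ha, hb'.trans hb, h0⟩

theorem VanishesBelow.mono {i j i' j' : ℕ} {f : R⟦X⟧⟦X⟧} (hf : VanishesBelow i j f)
    (hi : i' ≤ i) (hj : j' ≤ j) : VanishesBelow i' j' f := fun a b ha hb h =>
  hf a b (by omega) (by omega) (by omega)

theorem VanishesBelow.of_mul_eq {K : Type*} [Field K] {i j : ℕ} {f g u v : K⟦X⟧⟦X⟧}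
    (hf : VanishesBelow i j f) (h : g * u = f * v) (hu : biCoeff 0 0 u ≠ 0) :
    VanishesBelow i j g ∧ biCoeff i j g = biCoeff i j f * (biCoeff 0 0 v / biCoeff 0 0 u) := by
  have hg : ∀ n a b, a + b = n → a ≤ i → b ≤ j → VanishesBelow a b g := by
    intro n
    induction n using Nat.strong_induction_on with
    | _ n ih =>
      intro a b hab ha hb a' b' ha' hb' hlt
      have h1 := (ih _ (by omega) a' b' rfl (by omega) (by omega)).biCoeff_mul u
      rw [h, (hf.mono (by omega) (by omega)).biCoeff_mul, hf a' b' (by omega) (by omega) (by omega),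
        zero_mul] at h1
      exact (mul_eq_zero.mp h1.symm).resolve_right hu
  have hg := hg _ i j rfl le_rfl le_rfl
  refine ⟨hg, ?_⟩
  have h1 := hg.biCoeff_mul u
  rw [h, hf.biCoeff_mul] at h1
  field_simp
  exact h1.symm

theorem biCoeff_map (φ : R →+* S) (i j : ℕ) (f : R⟦X⟧⟦X⟧) :
    biCoeff i j (PowerSeries.map (PowerSeries.map φ) f) = φ (biCoeff i j f) := by
  simp [biCoeff]

theorem map_map_C (φ : R →+* S) (f : R⟦X⟧) :
    PowerSeries.map (PowerSeries.map φ) (PowerSeries.map PowerSeries.C f) =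
      PowerSeries.map PowerSeries.C (PowerSeries.map φ f) := by
  ext; simp

theorem biCoeff_int_mul (n : ℤ) (i j : ℕ) (f : R⟦X⟧⟦X⟧) :
    biCoeff i j ((n : R⟦X⟧⟦X⟧) * f) = n * biCoeff i j f := by
  rw [← zsmul_eq_mul, biCoeff, map_zsmul, map_zsmul, zsmul_eq_mul]; rfl

theorem biCoeff_evalPoly (x x' l l' : ℚ) (F : ℤ[X][X]) (i j : ℕ) :
    biCoeff i j (SurfaceRing.evalPoly
      (PowerSeries.C (PowerSeries.C x + PowerSeries.C l * PowerSeries.X))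
      (PowerSeries.map PowerSeries.C (PowerSeries.C x' + PowerSeries.C l' * PowerSeries.X)) F) =
    l ^ i * l' ^ j * (hasseDeriv i ((hasseDeriv j
      (F.map (mapRingHom (Int.castRingHom ℚ)))).eval (C x'))).eval x := by
  let θ : ℚ[X] →+* ℚ⟦X⟧ := (PowerSeries.rescale l).comp
    ((coeToPowerSeries.ringHom (R := ℚ)).comp (taylorAlgHom x).toRingHom)
  have hθ : ∀ p n, PowerSeries.coeff n (θ p) = l ^ n * (hasseDeriv n p).eval x := by
    intro p n
    change PowerSeries.coeff n (PowerSeries.rescale l ((taylor x p : ℚ[X]) : ℚ⟦X⟧)) = _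
    rw [PowerSeries.coeff_rescale, coeff_coe, taylor_coeff]
  have hθC : ∀ c, θ (C c) = PowerSeries.C c := by
    intro c
    change PowerSeries.rescale l ((taylor x (C c) : ℚ[X]) : ℚ⟦X⟧) = _
    rw [taylor_C, coe_C]; ext n; rw [PowerSeries.coeff_rescale, PowerSeries.coeff_C]; split_ifs with h <;> simp [h]
  have hθX : θ X = PowerSeries.C x + PowerSeries.C l * PowerSeries.X := by
    change PowerSeries.rescale l ((taylor x X : ℚ[X]) : ℚ⟦X⟧) = _
    rw [taylor_X, coe_add, coe_X, coe_C]
    ext n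
    rw [PowerSeries.coeff_rescale]
    rcases n with _ | _ | n <;> simp [PowerSeries.coeff_X, PowerSeries.coeff_C]
  let ψ : ℤ[X][X] →+* ℚ⟦X⟧⟦X⟧ := (PowerSeries.map θ).comp
    ((PowerSeries.rescale (C l')).comp ((coeToPowerSeries.ringHom (R := ℚ[X])).comp
      ((taylorAlgHom (C x')).toRingHom.comp (mapRingHom (mapRingHom (Int.castRingHom ℚ))))))
  have hψ' : ∀ F, ψ F = PowerSeries.map θ (PowerSeries.rescale (C l')
      ((taylor (C x') (F.map (mapRingHom (Int.castRingHom ℚ))) : ℚ[X][X]) : ℚ[X]⟦X⟧)) :=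
    fun F => rfl
  have hψ : biCoeff i j (ψ F) = l ^ i * l' ^ j * (hasseDeriv i ((hasseDeriv j
      (F.map (mapRingHom (Int.castRingHom ℚ)))).eval (C x'))).eval x := by
    rw [hψ', biCoeff, PowerSeries.coeff_map, PowerSeries.coeff_rescale, coeff_coe, taylor_coeff,
      ← C_pow, map_mul, hθC, PowerSeries.coeff_C_mul, hθ]
    ring
  rw [← hψ, SurfaceRing.eq_evalPoly ψ]
  congr 3
  · rw [hψ', map_C, coe_mapRingHom, map_X, taylor_C, coe_C, ← hθX]
    ext n : 1
    rw [PowerSeries.coeff_map, PowerSeries.coeff_rescale, PowerSeries.coeff_C, PowerSeries.coeff_C]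
    split_ifs with h <;> simp [h]
  · rw [hψ', map_X, taylor_X, coe_add, coe_X, coe_C]
    ext n : 1
    rw [PowerSeries.coeff_map, PowerSeries.coeff_map, PowerSeries.coeff_rescale]
    rcases n with _ | _ | n <;> simp [PowerSeries.coeff_X, PowerSeries.coeff_C, hθC]

end BiCoeff

theorem exists_eq_mul_pow {a b : ℤ} {η : ℚ} {m : ℕ} (ha : a ≠ 0) (h : (b : ℚ) = a * η ^ m) :
    ∃ e : ℤ, e ≠ 0 ∧ a = e * η.den ^ m ∧ b = e * η.num ^ m := by
  have hd : (η.den : ℚ) ≠ 0 := by exact_mod_cast η.den_ne_zero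
  have h1 : b * (η.den : ℤ) ^ m = a * η.num ^ m := by
    have : (b : ℚ) * (η.den : ℚ) ^ m = a * (η.num : ℚ) ^ m := by
      rw [h, mul_assoc, ← mul_pow, Rat.mul_den_eq_num]
    exact_mod_cast this
  have hco : IsCoprime ((η.den : ℤ) ^ m) (η.num ^ m) :=
    (Int.isCoprime_iff_gcd_eq_one.mpr (by
      rw [Int.gcd_comm]; exact η.reduced)).pow
  obtain ⟨e, he⟩ := hco.dvd_of_dvd_mul_right ⟨b, by rw [← h1]; ring⟩
  refine ⟨e, ?_, by rw [he]; ring, ?_⟩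
  · rintro rfl; exact ha (by rw [he, mul_zero])
  · have hd' : ((η.den : ℤ)) ^ m ≠ 0 := pow_ne_zero _ (by exact_mod_cast η.den_ne_zero)
    refine mul_right_cancel₀ hd' ?_
    rw [h1, he]; ring

theorem height_pow_mul_height_pow_le {a : Fin 2 → Fin 2 → ℤ} {η₁ η₂ : ℚ} {m : ℕ} {U : ℝ}
    (h0 : a 0 0 ≠ 0) (h1 : ∀ l, (a 1 l : ℚ) = a 0 l * η₁ ^ m) (h2 : (a 0 1 : ℚ) = a 0 0 * η₂ ^ m)
    (hU : ∀ l l', |(a l l' : ℝ)| ≤ U) :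
    mulHeight₁ η₁ ^ m * mulHeight₁ η₂ ^ m ≤ U := by
  obtain ⟨b, hb0, hb, hb'⟩ := exists_eq_mul_pow h0 (h1 0)
  have hd₁ : (η₁.den : ℤ) ^ m ≠ 0 := pow_ne_zero _ (by exact_mod_cast η₁.den_ne_zero)
  obtain ⟨c, hc, hc'⟩ : ∃ c : ℤ, a 0 1 = c * η₁.den ^ m ∧ a 1 1 = c * η₁.num ^ m := by
    by_cases h : a 0 1 = 0
    · refine ⟨0, by simp [h], ?_⟩
      have := h1 1
      rw [h] at this
      simpa using this
    · obtain ⟨c, -, hc⟩ := exists_eq_mul_pow h (h1 1)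
      exact ⟨c, hc⟩
  have hcb : (c : ℚ) = b * η₂ ^ m := by
    rw [hb, hc] at h2
    push_cast at h2
    have hd : (η₁.den : ℚ) ^ m ≠ 0 := pow_ne_zero _ (by exact_mod_cast η₁.den_ne_zero)
    refine mul_right_cancel₀ hd ?_
    rw [h2]; ring
  obtain ⟨e, he0, he, he'⟩ := exists_eq_mul_pow hb0 hcb
  have he1 : (1 : ℝ) ≤ |(e : ℝ)| := by exact_mod_cast Int.one_le_abs he0
  have key : ∀ n n' : ℤ, |((e * n ^ m * n' ^ m : ℤ) : ℝ)| ≤ U → |(n' : ℝ)| ^ m * |(n : ℝ)| ^ m ≤ U := by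
    intro n n' h
    push_cast at h
    rw [abs_mul, abs_mul, abs_pow, abs_pow] at h
    refine le_trans ?_ h
    have : 0 ≤ |(n : ℝ)| ^ m * |(n' : ℝ)| ^ m := by positivity
    nlinarith
  have hH : ∀ η : ℚ, mulHeight₁ η = |(η.num : ℝ)| ∨ mulHeight₁ η = |((η.den : ℤ) : ℝ)| := by
    intro η
    rw [Rat.mulHeight₁_eq_max]
    rcases max_choice η.num.natAbs η.den with h | h
    · left; rw [h, Nat.cast_natAbs, Int.cast_abs]
    · right; rw [h]; simp
  rcases hH η₁ with h | h <;> rcases hH η₂ with h' | h' <;> rw [h, h'] <;> apply key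
  · rw [← he', ← hc']; exact hU _ _
  · rw [← he, ← hb']; exact hU _ _
  · rw [← he', ← hc]; exact hU _ _
  · rw [← he, ← hb]; exact hU _ _

theorem seminorm_norm_le {R : Type*} [CommRing R] {N : RingSeminorm R} {a : R} {w : ℝ} {hw : 0 ≤ w}
    {ha : N a ≤ w ^ 2} (z : QuadraticAlgebra R a 0) :
    N (QuadraticAlgebra.norm z) ≤ quadraticSeminorm N w hw ha z ^ 2 := by
  have h : QuadraticAlgebra.norm z = z.re * z.re - a * (z.im * z.im) := by
    rw [QuadraticAlgebra.norm_def]; ring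
  rw [h, quadraticSeminorm_apply]
  refine (seminorm_sub_le_of_le (map_mul_le_mul N _ _) (seminorm_mul_le_of_le ha
    (map_mul_le_mul N _ _))).trans ?_
  have := mul_nonneg (apply_nonneg N z.re) (mul_nonneg hw (apply_nonneg N z.im))
  nlinarith

theorem norm_norm_ne_zero {R : Type*} [CommRing R] {a : R} {b : QuadraticAlgebra R a 0}
    [IsDomain (QuadraticAlgebra (QuadraticAlgebra R a 0) b 0)]
    {s : QuadraticAlgebra (QuadraticAlgebra R a 0) b 0} (hs : s ≠ 0) :
    QuadraticAlgebra.norm (QuadraticAlgebra.norm s) ≠ 0 ∧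
    ∃ t, algebraMap R _ (QuadraticAlgebra.norm (QuadraticAlgebra.norm s)) = s * t := by
  have h1 := QuadraticAlgebra.algebraMap_norm_eq_mul_star s
  generalize QuadraticAlgebra.norm s = n at h1
  have h2 := QuadraticAlgebra.algebraMap_norm_eq_mul_star n
  generalize QuadraticAlgebra.norm n = F at h2
  have hne : ∀ u : QuadraticAlgebra R a 0, u ≠ 0 →
      algebraMap _ (QuadraticAlgebra (QuadraticAlgebra R a 0) b 0) u ≠ 0 := fun u hu h =>
    hu (by simpa using congrArg QuadraticAlgebra.re h)
  have hn : n ≠ 0 := by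
    rintro rfl
    rw [map_zero] at h1
    exact mul_ne_zero hs (star_ne_zero.mpr hs) h1.symm
  have h3 : algebraMap R (QuadraticAlgebra (QuadraticAlgebra R a 0) b 0) F =
      algebraMap _ _ n * algebraMap _ _ (star n) := by
    rw [← map_mul, ← h2]; rfl
  refine ⟨?_, star s * algebraMap _ _ (star n), by rw [h3, h1, mul_assoc]⟩
  rintro rfl
  rw [map_zero] at h3
  exact mul_ne_zero (hne n hn) (hne _ (star_ne_zero.mpr hn)) h3.symm

namespace SurfaceRing

variable {Q₁ Q₂ : QuadPair}

theorem exists_norm [IsDomain (SurfaceRing Q₁ Q₂)] {s : SurfaceRing Q₁ Q₂} (h0 : s ≠ 0) {M : ℝ}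
    {D D' : ℕ} (hs : s.IsBounded M D D') : ∃ (F : ℤ[X][X]) (t : SurfaceRing Q₁ Q₂), F ≠ 0 ∧
      algebraMap ℤ[X][X] (SurfaceRing Q₁ Q₂) F = s * t ∧ F.natDegree ≤ 4 * D' ∧
      (∀ j, (F.coeff j).natDegree ≤ 4 * D) ∧ ∀ i j, |((F.coeff j).coeff i : ℝ)| ≤ M ^ 4 := by
  obtain ⟨hF0, t, ht⟩ := norm_norm_ne_zero h0
  generalize hF : QuadraticAlgebra.norm (QuadraticAlgebra.norm s) = F at hF0 ht
  have hb : (algebraMap ℤ[X][X] (SurfaceRing Q₁ Q₂) F).IsBounded (M ^ 4) (4 * D) (4 * D') := by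
    intro ρ ρ' hρ hρ'
    rw [surfaceSeminorm_algebraMap, ← hF]
    refine (seminorm_norm_le (ha := polySeminorm₂_symPoly₁_le Q₁ Q₂ hρ hρ')
      (hw := surfaceWeight_nonneg Q₁ Q₂ ρ ρ') _).trans
      ((pow_le_pow_left₀ (apply_nonneg _ _) ((seminorm_norm_le s).trans
      (pow_le_pow_left₀ (apply_nonneg _ _) (hs ρ ρ' hρ hρ') 2)) 2).trans_eq ?_)
    ring
  have hco : ∀ i j, coord (algebraMap ℤ[X][X] (SurfaceRing Q₁ Q₂) F) (i, j, 0, 0) =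
    (F.coeff j).coeff i := fun i j => rfl
  refine ⟨F, t, hF0, ht, ?_, ?_, ?_⟩
  · refine natDegree_le_iff_coeff_eq_zero.mpr fun j hj => ?_
    ext i
    rw [← hco]
    exact hb.coord_eq_zero (Or.inr (by simpa using hj))
  · refine fun j => natDegree_le_iff_coeff_eq_zero.mpr fun i hi => ?_
    rw [← hco]
    exact hb.coord_eq_zero (Or.inl (by simpa using hi))
  · intro i j
    rw [← hco]
    exact hb.abs_coord_le _

end SurfaceRing

namespace LocalExpansion

variable {Q₁ Q₂ : QuadPair} {M : ℝ} {x y₁ y₂ x' y₁' y₂' : ℚ}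
  (E : LocalExpansion Q₁ Q₂ M x y₁ y₂) (E' : LocalExpansion Q₁ Q₂ M x' y₁' y₂')

theorem onSurface_C_map {R : Type*} [CommRing R] (Q : QuadPair) {ξ ζ ξ' ζ' : R⟦X⟧}
    (h : ζ ^ 2 = ((ξ - Q.a) ^ 2 + Q.c) * ((ξ - Q.a') ^ 2 + Q.c'))
    (h' : ζ' ^ 2 = ((ξ' - Q.a) ^ 2 + Q.c) * ((ξ' - Q.a') ^ 2 + Q.c')) :
    Q.OnSurface (PowerSeries.C ξ) (PowerSeries.map PowerSeries.C ξ')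
      (PowerSeries.C ζ * PowerSeries.map PowerSeries.C ζ') := by
  rw [QuadPair.OnSurface, Q.aeval_poly, Q.aeval_poly, mul_pow, ← map_pow, ← map_pow, h, h']
  simp only [map_mul, map_add, map_sub, map_pow, map_intCast]

/-- Evaluation on the product of two expansions. -/
noncomputable def eval : SurfaceRing Q₁ Q₂ →+* ℚ⟦X⟧⟦X⟧ :=
  SurfaceRing.eval (onSurface_C_map Q₁ E.ζ₁_sq E'.ζ₁_sq) (onSurface_C_map Q₂ E.ζ₂_sq E'.ζ₂_sq)

theorem constantCoeff_ξ : PowerSeries.constantCoeff E.ξ = x := by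
  rw [E.ξ_eq]; simp

theorem biCoeff_form {R : Type*} [CommRing R] (Q : QuadPair) (k : ℕ) (ξ ξ' ζ ζ' : R⟦X⟧)
    (r l : Fin 2) : biCoeff 0 0 (Q.form k (PowerSeries.C ξ) (PowerSeries.map PowerSeries.C ξ')
      (PowerSeries.C ζ * PowerSeries.map PowerSeries.C ζ') r l) =
    Q.form k (PowerSeries.constantCoeff ξ) (PowerSeries.constantCoeff ξ')
      (PowerSeries.constantCoeff ζ * PowerSeries.constantCoeff ζ') r l := by
  have h : ∀ f : R⟦X⟧⟦X⟧, biCoeff 0 0 f =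
    (PowerSeries.constantCoeff (R := R)).comp PowerSeries.constantCoeff f := fun f => by simp [biCoeff]
  have hm : ∀ f : R⟦X⟧, (PowerSeries.constantCoeff (R := R)).comp PowerSeries.constantCoeff
      (PowerSeries.map PowerSeries.C f) = PowerSeries.constantCoeff f := fun f => by
    rw [← h, biCoeff, PowerSeries.coeff_map]; simp
  rw [h, Q.map_form, map_mul, hm, hm]
  simp

theorem biCoeff_eval_form₁ (k : ℕ) (r l : Fin 2) :
    biCoeff 0 0 (E.eval E' (Q₁.form k (SurfaceRing.x Q₁ Q₂) (SurfaceRing.x' Q₁ Q₂)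
      (SurfaceRing.z₁ Q₁ Q₂) r l)) = Q₁.form k x x' (y₁ * y₁') r l := by
  rw [eval, Q₁.map_form, SurfaceRing.eval_x, SurfaceRing.eval_x', SurfaceRing.eval_z₁, biCoeff_form,
    E.constantCoeff_ξ, E'.constantCoeff_ξ, E.constantCoeff_ζ₁, E'.constantCoeff_ζ₁]

theorem biCoeff_eval_form₂ (k : ℕ) (r l : Fin 2) :
    biCoeff 0 0 (E.eval E' (Q₂.form k (SurfaceRing.x Q₁ Q₂) (SurfaceRing.x' Q₁ Q₂)
      (SurfaceRing.z₂ Q₁ Q₂) r l)) = Q₂.form k x x' (y₂ * y₂') r l := by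
  rw [eval, Q₂.map_form, SurfaceRing.eval_x, SurfaceRing.eval_x', SurfaceRing.eval_z₂, biCoeff_form,
    E.constantCoeff_ξ, E'.constantCoeff_ξ, E.constantCoeff_ζ₂, E'.constantCoeff_ζ₂]

theorem biCoeff_eval_algebraMap (F : ℤ[X][X]) (i j : ℕ) :
    biCoeff i j (E.eval E' (algebraMap _ _ F)) = E.scale ^ i * E'.scale ^ j * (hasseDeriv i ((hasseDeriv j
      (F.map (mapRingHom (Int.castRingHom ℚ)))).eval (C x'))).eval x := by
  rw [eval, SurfaceRing.eval_algebraMap, E.ξ_eq, E'.ξ_eq, biCoeff_evalPoly]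

theorem exists_int_eq_biCoeff (hM : 1 ≤ M) {s : SurfaceRing Q₁ Q₂} {A : ℝ} {D D' : ℕ}
    (hs : s.IsBounded A D D') (i j : ℕ) : ∃ a : ℤ,
      (a : ℚ) = ((E.q ^ D * E'.q ^ D' : ℤ) : ℚ) * biCoeff i j (E.eval E' s) ∧
      |(a : ℝ)| ≤ (D + 1) * ((D' + 1) * 4) * (A * (M ^ 2) ^ 2 *
        ((2 * mulHeight₁ x) ^ D * (2 * mulHeight₁ x') ^ D')) *
        (M * mulHeight₁ x ^ 8) ^ i * (M * mulHeight₁ x' ^ 8) ^ j := by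
  have hH := one_le_mulHeight₁ x
  have hH' := one_le_mulHeight₁ x'
  set H := mulHeight₁ x
  set H' := mulHeight₁ x'
  have hw : 0 < M * H ^ 8 := by positivity
  have hw' : 0 < M * H' ^ 8 := by positivity
  set r := (M * H ^ 8)⁻¹ with hrd
  set r' := (M * H' ^ 8)⁻¹ with hrd'
  have hr : 0 ≤ r := by positivity
  have hr' : 0 ≤ r' := by positivity
  obtain ⟨bX, b₁, b₂⟩ := E.seminorm_le r hr i (mul_inv_cancel₀ hw.ne').le
  obtain ⟨bX', b₁', b₂'⟩ := E'.seminorm_le r' hr' j (mul_inv_cancel₀ hw'.ne').le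
  set ν := truncSeminorm (normRingSeminorm ℤ) r hr i with hν
  have hν1 : ν 1 ≤ 1 := by rw [hν, truncSeminorm_one, normRingSeminorm_int_apply]; simp
  set μ := truncSeminorm ν r' hr' j with hμ
  have hμ1 : μ 1 ≤ 1 := by rw [hμ, truncSeminorm_one]; exact hν1
  have hmap : ∀ f, μ (PowerSeries.map PowerSeries.C f) ≤ truncSeminorm (normRingSeminorm ℤ) r' hr' j f :=
    fun f => truncSeminorm_map_C_le (fun s => (truncSeminorm_C s).le) f
  have hC : ∀ f, μ (PowerSeries.C f) = ν f := fun f => truncSeminorm_C f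
  have hZ : ∀ {f f' : ℤ⟦X⟧}, ν f ≤ M * H ^ 2 →
      truncSeminorm (normRingSeminorm ℤ) r' hr' j f' ≤ M * H' ^ 2 →
      μ (PowerSeries.C f * PowerSeries.map PowerSeries.C f') ≤ M ^ 2 * ((2 * H) ^ 2 * (2 * H') ^ 2) := by
    intro f f' h h'
    refine (seminorm_mul_le_of_le ((hC f).trans_le h) ((hmap f').trans h')).trans ?_
    have : 0 ≤ M ^ 2 * (H ^ 2 * H' ^ 2) := by positivity
    nlinarith
  let φ : ℤ⟦X⟧⟦X⟧ →+* ℚ⟦X⟧⟦X⟧ :=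
    PowerSeries.map (PowerSeries.map (Int.castRingHom ℚ))
  have hφC : ∀ f, φ (PowerSeries.C f) = PowerSeries.C (PowerSeries.map (Int.castRingHom ℚ) f) :=
    fun f => PowerSeries.map_C _ _
  have hφm : ∀ f, φ (PowerSeries.map PowerSeries.C f) = PowerSeries.map PowerSeries.C
    (PowerSeries.map (Int.castRingHom ℚ) f) := fun f => map_map_C _ _
  obtain ⟨a, ha, hab⟩ := SurfaceRing.exists_homogenize (φ := φ) hμ1 (q := (E.q : ℤ⟦X⟧⟦X⟧))
    (q' := (E'.q : ℤ⟦X⟧⟦X⟧)) (X := PowerSeries.C E.X)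
    (X' := PowerSeries.map PowerSeries.C E'.X) (Z₁ := PowerSeries.C E.Z₁ * PowerSeries.map PowerSeries.C E'.Z₁)
    (Z₂ := PowerSeries.C E.Z₂ * PowerSeries.map PowerSeries.C E'.Z₂)
    (by rw [hφC, E.map_X, map_mul, map_intCast, map_intCast])
    (by rw [hφm, E'.map_X, map_mul, map_intCast, map_intCast])
    (by rw [map_mul, hφC, hφm, E.map_Z₁, E'.map_Z₁]; simp only [map_mul, map_pow, map_intCast]; ring)
    (by rw [map_mul, hφC, hφm, E.map_Z₂, E'.map_Z₂]; simp only [map_mul, map_pow, map_intCast]; ring)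
    (H := 2 * H) (H' := 2 * H') (by positivity) (by positivity) (one_le_pow₀ hM (n := 2))
    ((hC _).trans_le bX) ((seminorm_intCast_le hμ1 _).trans (E.abs_q_le.trans (by linarith)))
    ((hmap _).trans bX') ((seminorm_intCast_le hμ1 _).trans (E'.abs_q_le.trans (by linarith)))
    (hZ b₁ b₁') (hZ b₂ b₂') (onSurface_C_map Q₁ E.ζ₁_sq E'.ζ₁_sq)
    (onSurface_C_map Q₂ E.ζ₂_sq E'.ζ₂_sq) hs
  refine ⟨biCoeff i j a, ?_, ?_⟩
  · rw [map_intCast, map_intCast, ← Int.cast_pow, ← Int.cast_pow, ← Int.cast_mul] at ha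
    rw [eval, ← biCoeff_int_mul, ← ha, biCoeff_map]
    rfl
  · have h1 : |((biCoeff i j a : ℤ) : ℝ)| * r ^ i * r' ^ j ≤ μ a :=
      (mul_le_mul_of_nonneg_right (le_truncSeminorm (N := normRingSeminorm ℤ) (hr := hr)
        (PowerSeries.coeff j a) le_rfl) (by positivity)).trans (le_truncSeminorm (hr := hr') a le_rfl)
    have h2 := h1.trans hab
    rw [hrd, hrd', inv_pow, inv_pow, ← div_eq_mul_inv, ← div_eq_mul_inv,
      div_le_iff₀ (by positivity), div_le_iff₀ (by positivity)] at h2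
    refine h2.trans_eq ?_
    ring

end LocalExpansion

theorem biCoeff_zero_pow {R : Type*} [CommRing R] (f : R⟦X⟧⟦X⟧) (m : ℕ) :
    biCoeff 0 0 (f ^ m) = biCoeff 0 0 f ^ m := by
  simp [biCoeff]

namespace LocalExpansion

variable {Q₁ Q₂ : QuadPair} {M : ℝ} {x y₁ y₂ x' y₁' y₂' : ℚ}
  (E : LocalExpansion Q₁ Q₂ M x y₁ y₂) (E' : LocalExpansion Q₁ Q₂ M x' y₁' y₂')

theorem exists_poly_height_le [IsDomain (SurfaceRing Q₁ Q₂)] (hM : 1 ≤ M)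
    {T : Fin 2 → Fin 2 → SurfaceRing Q₁ Q₂} {Φ₁ Φ₂ : Fin 2 → SurfaceRing Q₁ Q₂} {A : ℝ} {D D' m : ℕ}
    {a a' b b' : ℚ} (h0 : T 0 0 ≠ 0) (hT : ∀ l l', (T l l').IsBounded A D D')
    (hΦ₁ : ∀ l, T 1 l * Φ₁ 0 ^ m = T 0 l * Φ₁ 1 ^ m) (hΦ₂ : ∀ l, T l 1 * Φ₂ 0 ^ m = T l 0 * Φ₂ 1 ^ m)
    (ha : biCoeff 0 0 (E.eval E' (Φ₁ 0)) = a) (ha' : biCoeff 0 0 (E.eval E' (Φ₁ 1)) = a')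
    (hb : biCoeff 0 0 (E.eval E' (Φ₂ 0)) = b) (hb' : biCoeff 0 0 (E.eval E' (Φ₂ 1)) = b')
    (ha0 : a ≠ 0) (hb0 : b ≠ 0) : ∃ F : ℤ[X][X], F ≠ 0 ∧ F.natDegree ≤ 4 * D' ∧
      (∀ j, (F.coeff j).natDegree ≤ 4 * D) ∧ (∀ i j, |((F.coeff j).coeff i : ℝ)| ≤ A ^ 4) ∧
      ∀ i j, (hasseDeriv i ((hasseDeriv j
        (F.map (mapRingHom (Int.castRingHom ℚ)))).eval (C x'))).eval x ≠ 0 →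
      mulHeight₁ (a' / a) ^ m * mulHeight₁ (b' / b) ^ m ≤
        (D + 1) * ((D' + 1) * 4) * (A * (M ^ 2) ^ 2 *
        ((2 * mulHeight₁ x) ^ D * (2 * mulHeight₁ x') ^ D')) *
        (M * mulHeight₁ x ^ 8) ^ i * (M * mulHeight₁ x' ^ 8) ^ j := by
  obtain ⟨F, t, hF0, hF, hd', hd, hc⟩ := SurfaceRing.exists_norm h0 (hT 0 0)
  refine ⟨F, hF0, hd', hd, hc, fun i j hij => ?_⟩
  have hne : biCoeff i j (E.eval E' (T 0 0) * E.eval E' t) ≠ 0 := by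
    rw [← map_mul, ← hF, biCoeff_eval_algebraMap]
    exact mul_ne_zero (mul_ne_zero (pow_ne_zero _ E.scale_ne_zero) (pow_ne_zero _ E'.scale_ne_zero)) hij
  obtain ⟨i', j', hi', hj', hcoef, hvan⟩ := exists_vanishesBelow hne
  have rel : ∀ {s s' u u' : SurfaceRing Q₁ Q₂} {c c' : ℚ}, s' * u ^ m = s * u' ^ m →
      biCoeff 0 0 (E.eval E' u) = c → biCoeff 0 0 (E.eval E' u') = c' → c ≠ 0 →
      VanishesBelow i' j' (E.eval E' s) → VanishesBelow i' j' (E.eval E' s') ∧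
      biCoeff i' j' (E.eval E' s') = biCoeff i' j' (E.eval E' s) * (c' / c) ^ m := by
    intro s s' u u' c c' h hc hc' hc0 hs
    have h' := congrArg (E.eval E') h
    rw [map_mul, map_mul, map_pow, map_pow] at h'
    have := hs.of_mul_eq h' (by rw [biCoeff_zero_pow, hc]; exact pow_ne_zero _ hc0)
    rwa [biCoeff_zero_pow, biCoeff_zero_pow, hc, hc', ← div_pow] at this
  obtain ⟨-, r10⟩ := rel (hΦ₁ 0) ha ha' ha0 hvan
  obtain ⟨v01, r01⟩ := rel (hΦ₂ 0) hb hb' hb0 hvan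
  obtain ⟨-, r11⟩ := rel (hΦ₁ 1) ha ha' ha0 v01
  choose g hg hgb using fun l l' => E.exists_int_eq_biCoeff E' hM (hT l l') i' j'
  have hq : ((E.q ^ D * E'.q ^ D' : ℤ) : ℚ) ≠ 0 := by
    exact_mod_cast mul_ne_zero (pow_ne_zero _ E.q_ne_zero) (pow_ne_zero _ E'.q_ne_zero)
  have hA : 0 ≤ A := (abs_nonneg _).trans ((hT 0 0).abs_coord_le (0, 0, 0, 0))
  have hH := one_le_mulHeight₁ x
  have hH' := one_le_mulHeight₁ x'
  refine height_pow_mul_height_pow_le (a := g) ?_ ?_ ?_ fun l l' => (hgb l l').trans ?_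
  · intro h
    have h1 := hg 0 0
    rw [h, Int.cast_zero] at h1
    exact mul_ne_zero hq hcoef h1.symm
  · intro l
    rw [hg 1 l, hg 0 l]
    fin_cases l
    · change _ * biCoeff i' j' (E.eval E' (T 1 0)) = _
      rw [r10]; exact (mul_assoc _ _ _).symm
    · change _ * biCoeff i' j' (E.eval E' (T 1 1)) = _
      rw [r11]; exact (mul_assoc _ _ _).symm
  · rw [hg 0 1, hg 0 0, r01, mul_assoc]
  · have h1 : 1 ≤ M * mulHeight₁ x ^ 8 := one_le_mul_of_one_le_of_one_le hM (one_le_pow₀ hH)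
    have h2 : 1 ≤ M * mulHeight₁ x' ^ 8 := one_le_mul_of_one_le_of_one_le hM (one_le_pow₀ hH')
    have h3 := pow_le_pow_right₀ h1 hi'
    have h4 := pow_le_pow_right₀ h2 hj'
    gcongr

end LocalExpansion

end

section

open Polynomial Module IntermediateField Real

theorem heights_not_aligned {μ n m N K D D' i j h h' ε Θ lA lM : ℝ} (hμ : 1 ≤ μ) (hn : 2 ≤ n)
    (hm : m = μ * n) (hN : 1 ≤ N) (hK : n ≤ K) (hK' : 11 * K ≤ m) (hA : 0 ≤ lA) (hM : 0 ≤ lM)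
    (hh : (86 + lA + 172 * lM) * μ ≤ h) (hh' : h' ≤ (1 + ε) * (N * h))
    (hε : ε = 1 / (20 * μ)) (hΘ : Θ = 1 / (2016 * μ)) (hD : D + 9 * (K * N) = 16 * (m * N) + 4)
    (hD' : D' = 16 * m + K + 4) (hi : i ≤ Θ * (84 * (m * N))) (hj0 : 0 ≤ j)
    (hj : j ≤ Θ * (84 * m))
    (hle : 2 * m * ((16 - ε) * (N * h)) ≤ D + (D' + 4) + (m * N * lA + 4 * lM) +
      (D * (1 + h) + D' * (1 + h')) + i * (lM + 8 * h) + j * (lM + 8 * h')) : False := by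
  have e1 : ε * m = n / 20 := by rw [hε, hm]; field_simp
  have e2 : Θ * m = n / 2016 := by rw [hΘ, hm]; field_simp
  have hε0 : 0 ≤ ε := by rw [hε]; positivity
  have hh1 : 86 ≤ h := by nlinarith
  have hY : 0 < N * h := by positivity
  have hhY : h ≤ N * h := le_mul_of_one_le_left (by linarith) hN
  have hmN : m ≤ m * N := le_mul_of_one_le_right (by linarith) hN
  have hnN : n ≤ n * N := le_mul_of_one_le_right (by linarith) hN
  have hnm : n * N ≤ m * N := by gcongr; linarith
  have hi' : i ≤ n * N / 24 := hi.trans_eq (by linear_combination 84 * N * e2)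
  have hj' : j ≤ n / 24 := hj.trans_eq (by linear_combination 84 * e2)
  have hKN : 0 ≤ K * N := mul_nonneg (by linarith) (by linarith)
  have hjunk : 2 * D + 2 * D' + 4 + m * N * lA + 4 * lM + (i + j) * lM ≤ n * (N * h) := by
    have h1 : (i + j) * lM ≤ 168 * (m * N) * lM := by gcongr; linarith
    have h2 : 4 * lM ≤ 4 * (m * N) * lM := by gcongr; linarith
    have h3 : m * N * (86 + lA + 172 * lM) ≤ n * (N * h) := by
      have := mul_le_mul_of_nonneg_left hh (by positivity : 0 ≤ n * N)
      rw [hm]; linarith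
    linarith
  have hDh : D * h = (16 * (m * N) + 4 - 9 * (K * N)) * h := by rw [← hD]; ring
  have hDh' : D' * h' ≤ (16 * m + K + 4 + 9 / 10 * n) * (N * h) := by
    have h0 : 0 ≤ D' := by linarith
    have h1 : ε * D' ≤ 9 / 10 * n := by
      have : ε * D' ≤ ε * (18 * m) := by gcongr; linarith
      linarith
    calc D' * h' ≤ D' * ((1 + ε) * (N * h)) := by gcongr
      _ = (D' + ε * D') * (N * h) := by ring
      _ ≤ (16 * m + K + 4 + 9 / 10 * n) * (N * h) := by gcongr; linarith
  have hih : i * h ≤ n / 24 * (N * h) := by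
    have := mul_le_mul_of_nonneg_right hi' (by linarith : 0 ≤ h)
    linarith
  have hε1 : ε ≤ 1 := by
    rw [hε, div_le_one (by linarith)]; linarith
  have hjh : j * h' ≤ n / 12 * (N * h) := by
    calc j * h' ≤ j * ((1 + ε) * (N * h)) := by gcongr
      _ ≤ n / 24 * (2 * (N * h)) := by gcongr; linarith
      _ = n / 12 * (N * h) := by ring
  have hl : 2 * m * ((16 - ε) * (N * h)) = (32 * m - n / 10) * (N * h) := by
    linear_combination (-2 * (N * h)) * e1
  have hKn : n * (N * h) ≤ K * (N * h) := by gcongr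
  have hn2 : 2 * (N * h) ≤ n * (N * h) := by gcongr
  rw [hl] at hle
  nlinarith

theorem log_bound_eq {D D' A M H H' : ℝ} {d d' i j m : ℕ} (hD : 0 < D) (hD' : 0 < D') (hA : 0 < A)
    (hM : 0 < M) (hH : 0 < H) (hH' : 0 < H') :
    log (D * (D' * 4) * (A ^ m * (M ^ 2) ^ 2 * ((2 * H) ^ d * (2 * H') ^ d')) *
        (M * H ^ 8) ^ i * (M * H' ^ 8) ^ j) =
      log D + (log D' + log 4) + (m * log A + 4 * log M) +
      (d * (log 2 + log H) + d' * (log 2 + log H')) +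
      i * (log M + 8 * log H) + j * (log M + 8 * log H') := by
  rw [log_mul (by positivity) (by positivity), log_mul (by positivity) (by positivity),
    log_mul (by positivity) (by positivity), log_mul (by positivity) (by positivity),
    log_mul (by positivity) (by positivity), log_mul (by positivity) (by positivity),
    log_mul (by positivity) (by positivity), log_mul (by positivity) (by positivity),
    log_pow, log_pow, log_pow, log_pow, log_pow, log_pow, log_pow,
    log_mul (by positivity) (by positivity), log_mul (by positivity) (by positivity),
    log_mul (by positivity) (by positivity), log_mul (by positivity) (by positivity),
    log_pow, log_pow]
  push_cast
  ring

end

section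

open Polynomial Module IntermediateField Height Real

theorem exists_aligned_bound (Q₁ Q₂ : QuadPair) [IsDomain (SurfaceRing Q₁ Q₂)] :
    ∃ (ε : ℝ) (B : ℕ), 0 < ε ∧ ε ≤ 1 ∧ 1 ≤ B ∧ ∀ (x x' y₁ y₂ y₁' y₂' : ℚ) (k : ℕ) (r₁ r₂ : Fin 2),
      B ≤ k → B ≤ logHeight₁ x →
      |4 ^ k * logHeight₁ x - logHeight₁ x'| ≤ ε * (4 ^ k * logHeight₁ x) →
      y₁ ^ 2 = aeval x Q₁.poly → y₂ ^ 2 = aeval x Q₂.poly →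
      y₁' ^ 2 = aeval x' Q₁.poly → y₂' ^ 2 = aeval x' Q₂.poly →
      Q₁.form k x x' (y₁ * y₁') r₁ 0 ≠ 0 → Q₂.form k x x' (y₂ * y₂') r₂ 0 ≠ 0 →
      (16 - ε) * (4 ^ k * logHeight₁ x) ≤ logHeight₁
        (Q₁.form k x x' (y₁ * y₁') r₁ 1 / Q₁.form k x x' (y₁ * y₁') r₁ 0) →
      (16 - ε) * (4 ^ k * logHeight₁ x) ≤ logHeight₁
        (Q₂.form k x x' (y₂ * y₂') r₂ 1 / Q₂.form k x x' (y₂ * y₂') r₂ 0) → False := by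
  obtain ⟨A, hA, hsec⟩ := SurfaceRing.exists_auxiliary_section Q₁ Q₂
  obtain ⟨M, hM, hexp⟩ := exists_localExpansion Q₁ Q₂
  obtain ⟨c, hc⟩ : ∃ c : ℕ, c = 11 ^ 23 := ⟨_, rfl⟩
  rw [← hc] at hsec
  have hc1 : (1 : ℝ) ≤ c := by exact_mod_cast hc ▸ Nat.one_le_pow _ _ (by norm_num)
  clear hc
  have lA : 0 ≤ log A := log_nonneg hA
  have lM : 0 ≤ log M := log_nonneg hM
  obtain ⟨Θ, hΘ⟩ : ∃ Θ : ℝ, Θ = 1 / (2016 * c) := ⟨_, rfl⟩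
  obtain ⟨ε, hε⟩ : ∃ ε : ℝ, ε = 1 / (20 * c) := ⟨_, rfl⟩
  have hΘ0 : 0 < Θ := by rw [hΘ]; positivity
  have hΘ1 : Θ ≤ 1 := by rw [hΘ, div_le_one (by positivity)]; linarith
  have hε0 : 0 < ε := by rw [hε]; positivity
  have hε1 : ε ≤ 1 / 2 := by rw [hε, div_le_div_iff₀ (by positivity) (by positivity)]; linarith
  obtain ⟨σ, hσ⟩ : ∃ σ : ℝ, σ = Θ ^ 2 / 25 := ⟨_, rfl⟩
  have hσ0 : 0 < σ := by rw [hσ]; positivity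
  obtain ⟨B, hB⟩ := exists_nat_ge ((86 + log A + 172 * log M) * c +
    (6 + 2 * log A) / σ + 1 / σ + 1)
  have p1 : 0 ≤ (86 + log A + 172 * log M) * c := by positivity
  have p2 : 0 ≤ (6 + 2 * log A) / σ := by positivity
  have p3 : 0 ≤ 1 / σ := by positivity
  refine ⟨ε, B, hε0, by linarith, by exact_mod_cast (by linarith : (1 : ℝ) ≤ B), ?_⟩
  intro x x' y₁ y₂ y₁' y₂' k r₁ r₂ hk hx hxx hy₁ hy₂ hy₁' hy₂' hf₁ hf₂ hl₁ hl₂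
  obtain ⟨E⟩ := hexp x y₁ y₂ hy₁ hy₂
  obtain ⟨E'⟩ := hexp x' y₁' y₂' hy₁' hy₂'
  obtain ⟨n₀, hn₀⟩ := hsec k
  obtain ⟨n, hn⟩ : ∃ n, n = max n₀ 2 := ⟨_, rfl⟩
  have hn2 : 2 ≤ n := hn ▸ le_max_right _ _
  obtain ⟨m, hm⟩ : ∃ m, m = c * n := ⟨_, rfl⟩
  obtain ⟨K, T, hnK, hKm, hT0, hT, hT₁, hT₂⟩ := hn₀ n (hn ▸ le_max_left _ _) (by omega) m hm
  have hN1 : 1 ≤ 4 ^ k := Nat.one_le_pow _ _ (by norm_num)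
  have hNk : (B : ℝ) ≤ ((4 ^ k : ℕ) : ℝ) := by
    exact_mod_cast hk.trans (Nat.lt_pow_self (by norm_num)).le
  have hNcast : ((4 ^ k : ℕ) : ℝ) = 4 ^ k := by push_cast; rfl
  rw [← hNcast] at hxx hl₁ hl₂
  generalize 4 ^ k = N at *
  have hN1' : (1 : ℝ) ≤ N := by exact_mod_cast hN1
  have hKN : 9 * (K * N) ≤ 16 * (m * N) + 4 := by nlinarith
  obtain ⟨D, hD⟩ : ∃ D, D + 9 * (K * N) = 16 * (m * N) + 4 := ⟨_, Nat.sub_add_cancel hKN⟩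
  obtain ⟨D', hD'⟩ : ∃ D', D' = 16 * m + K + 4 := ⟨_, rfl⟩
  have hTb : ∀ l l', (T l l').IsBounded (A ^ (m * N)) D D' := by
    intro l l' ρ ρ' hρ hρ'
    have h := hT l l' ρ ρ' hρ hρ'
    rw [← hD, ← hD'] at h
    have hp : 0 < ρ ^ (9 * (K * N)) := by positivity
    refine le_of_mul_le_mul_left (h.trans_eq ?_) hp
    rw [pow_add]; ring
  obtain ⟨F, hF0, hFy, hFx, hFc, hF⟩ := E.exists_poly_height_le E' hM hT0 hTb
    (Φ₁ := Q₁.form k _ _ _ r₁) (Φ₂ := Q₂.form k _ _ _ r₂)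
    (fun l => hT₁ l r₁) (fun l => hT₂ l r₂) (E.biCoeff_eval_form₁ E' k r₁ 0)
    (E.biCoeff_eval_form₁ E' k r₁ 1) (E.biCoeff_eval_form₂ E' k r₂ 0) (E.biCoeff_eval_form₂ E' k r₂ 1)
    hf₁ hf₂
  have hx1 : (1 : ℝ) ≤ logHeight₁ x := by linarith
  obtain ⟨hab1, hab2⟩ := abs_le.mp hxx
  have hm22 : 22 ≤ m := by omega
  have hmN : m ≤ m * N := Nat.le_mul_of_pos_right _ hN1
  have hKNm : K * N ≤ m * N := Nat.mul_le_mul_right _ (by omega)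
  have hNh : (N : ℝ) * logHeight₁ x / 2 ≤ logHeight₁ x' := by
    have : ε * (N * logHeight₁ x) ≤ 1 / 2 * (N * logHeight₁ x) := by gcongr
    linarith
  have hlogle : ∀ t : ℕ, log (t + 1) ≤ t := fun t =>
    (log_le_sub_one_of_pos (by positivity)).trans (by linarith)
  have hlog2 : log 2 ≤ 1 := (log_two_lt_d9.trans (by norm_num)).le
  have hlog4 : log 4 ≤ 4 := (log_le_sub_one_of_pos (by norm_num)).trans (by norm_num)
  have hmNr : (m : ℝ) ≤ m * N := by exact_mod_cast hmN
  have hlogM : log ((A ^ (m * N)) ^ 4) ≤ 84 * (m * N) * log A := by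
    rw [log_pow, log_pow]
    push_cast
    have : 0 ≤ (m : ℝ) * N * log A := by positivity
    linarith
  have hσh : 6 + 2 * log A ≤ σ * logHeight₁ x := by
    have := (div_le_iff₀' hσ0).mp (by linarith : (6 + 2 * log A) / σ ≤ logHeight₁ x)
    exact this
  obtain ⟨i, j, hij, hne⟩ := exists_index_lt hF0 (r₁ := 84 * (m * N)) (r₂ := 84 * m) (by omega) (by omega)
    (by omega) (fun j => (hFx j).trans (by omega)) (one_le_pow₀ (one_le_pow₀ hA)) hFc
    (x := x) (y := x') (σ := σ) hΘ0 hΘ1 (by rw [hσ]; nlinarith) (by linarith)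
    (lt_of_lt_of_le (by positivity) hNh)
    (by
      have h1 := hlogle (84 * m)
      have h2 := hlogle (84 * (m * N))
      push_cast at h1 h2 ⊢
      have h3 : 84 * ((m : ℝ) * N) * log 2 ≤ 84 * (m * N) * 1 := by gcongr
      have h4 : 84 * ((m : ℝ) * N) * (6 + 2 * log A) ≤
        84 * (m * N) * (σ * logHeight₁ x) := by gcongr
      have : 0 ≤ (m : ℝ) * N * log A := by positivity
      have : 0 ≤ (m : ℝ) * N := by positivity
      linarith)
    (by
      have h1 := hlogle (84 * m)
      push_cast at h1 ⊢
      have h3 : 84 * (m : ℝ) * log 2 ≤ 84 * m * 1 := by gcongr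
      have h4 : 84 * ((m : ℝ) * N) * (6 + 2 * log A) ≤
        84 * (m * N) * (σ * logHeight₁ x) := by gcongr
      have h5 : σ * (84 * m) * (N * logHeight₁ x / 2) ≤ σ * (84 * m) * logHeight₁ x' := by
        gcongr
      have : 0 ≤ (m : ℝ) * N * log A := by positivity
      linarith)
    (by
      push_cast
      have h1 : 1 ≤ σ * N := (div_le_iff₀' hσ0).mp (by linarith)
      have := mul_le_mul_of_nonneg_left h1 (by positivity : 0 ≤ 84 * (m : ℝ))
      linarith)
  have hU := hF i j hne
  have hHx := one_le_mulHeight₁ x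
  have hHx' := one_le_mulHeight₁ x'
  have hlogU := log_le_log (mul_pos (pow_pos (zero_lt_one.trans_le (one_le_mulHeight₁ _)) _)
    (pow_pos (zero_lt_one.trans_le (one_le_mulHeight₁ _)) _)) hU
  rw [log_bound_eq (by positivity) (by positivity) (by positivity) (by positivity) (by positivity)
    (by positivity), log_mul (pow_ne_zero _ (zero_lt_one.trans_le (one_le_mulHeight₁ _)).ne')
    (pow_ne_zero _ (zero_lt_one.trans_le (one_le_mulHeight₁ _)).ne'), log_pow, log_pow]
    at hlogU
  simp only [← logHeight₁_eq_log_mulHeight₁] at hlogU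
  have hr1 : (0 : ℝ) < ((84 * (m * N) : ℕ) : ℝ) := by exact_mod_cast (by omega)
  have hr2 : (0 : ℝ) < ((84 * m : ℕ) : ℝ) := by exact_mod_cast (by omega)
  have hi : (i : ℝ) ≤ Θ * (84 * (m * N)) := by
    have : (i : ℝ) / ((84 * (m * N) : ℕ) : ℝ) ≤ Θ := by
      have : 0 ≤ (j : ℝ) / ((84 * m : ℕ) : ℝ) := by positivity
      linarith
    have := (div_le_iff₀ hr1).mp this
    push_cast at this
    exact this
  have hj : (j : ℝ) ≤ Θ * (84 * m) := by
    have : (j : ℝ) / ((84 * m : ℕ) : ℝ) ≤ Θ := by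
      have : 0 ≤ (i : ℝ) / ((84 * (m * N) : ℕ) : ℝ) := by positivity
      linarith
    have := (div_le_iff₀ hr2).mp this
    push_cast at this
    exact this
  refine heights_not_aligned (n := n) (m := m) (N := N) (K := K) (D := D) (D' := D') (i := i) (j := j)
    hc1 (by exact_mod_cast hn2) (by exact_mod_cast hm) hN1' (by exact_mod_cast hnK)
    (by exact_mod_cast hKm) lA lM (by linarith : _ ≤ logHeight₁ x)
    (by linarith : logHeight₁ x' ≤ _) hε hΘ (by exact_mod_cast hD) (by exact_mod_cast hD') hi
    (by positivity) hj ?_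
  have g1 : (m : ℝ) * ((16 - ε) * (N * logHeight₁ x)) ≤ m * logHeight₁
      (Q₁.form k x x' (y₁ * y₁') r₁ 1 / Q₁.form k x x' (y₁ * y₁') r₁ 0) := by gcongr
  have g2 : (m : ℝ) * ((16 - ε) * (N * logHeight₁ x)) ≤ m * logHeight₁
      (Q₂.form k x x' (y₂ * y₂') r₂ 1 / Q₂.form k x x' (y₂ * y₂') r₂ 0) := by gcongr
  have g3 := hlogle D
  have g4 := hlogle D'
  have g5 : (D : ℝ) * log 2 ≤ D * 1 := by gcongr
  have g6 : (D' : ℝ) * log 2 ≤ D' * 1 := by gcongr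
  push_cast at hlogU
  linarith

end

section

open Polynomial Module IntermediateField

theorem QuadPair.form_mul_eq_quadSegre (Q : QuadPair) (k : ℕ) (x y x' y' : ℚ) :
    Q.form k x x' (y * y') = quadSegre Q.a Q.c Q.a' Q.c' k x y x' y' := by
  have h : ∀ p q : ℚ, p * q * (y * y') = y * p * (y' * q) := fun p q => by ring
  rw [form, quadSegre, h]
  rfl

theorem finite_setOf_three_quad_isSquare (a c : Fin 3 → ℤ) (hc : ∀ i, 0 < c i)
    (hsq : ∀ i j, IsSquare (c i * c j)) (hne : Function.Injective fun i => (a i, c i)) :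
    {x : ℚ | ∀ i, IsSquare (aeval x (quad (a i) (c i)))}.Finite := by
  by_contra hinf
  let Q : Fin 2 → QuadPair := fun j => ⟨a 0, c 0, a j.succ, c j.succ, hc 0, hc j.succ,
    fun h => Fin.succ_ne_zero j (hne h).symm⟩
  have : IsDomain (SurfaceRing (Q 0) (Q 1)) := SurfaceRing.isDomain rfl rfl fun h =>
    absurd (hne h) (by decide)
  obtain ⟨ε, B, hε, hε1, hB, h⟩ := exists_aligned_bound (Q 0) (Q 1)
  obtain ⟨x, x', k, y, y', hk, hx, hxx, hy⟩ := exists_aligned_points a c hc hsq hne hinf ε hε hε1 B hB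
  obtain ⟨h1, h1', r₁, hr₁, hl₁⟩ := hy 0
  obtain ⟨h2, h2', r₂, hr₂, hl₂⟩ := hy 1
  refine h x x' (y 0) (y 1) (y' 0) (y' 1) k r₁ r₂ hk hx hxx h1 h2 h1' h2' ?_ ?_ ?_ ?_ <;>
    simpa only [QuadPair.form_mul_eq_quadSegre]

/-- Three distinct quadratics `(x - aᵢ)² + cᵢ`, with positive `cᵢ` in one square class, are
simultaneously squares for finitely many rational `x` only. -/
theorem finite_setOf_three_quadratics_isSquare (a c : Fin 3 → ℚ) (hc : ∀ i, 0 < c i)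
    (hcc : ∀ i j, IsSquare (c i * c j)) (hne : Function.Injective fun i => (a i, c i)) :
    {x : ℚ | ∀ i, IsSquare ((x - a i) ^ 2 + c i)}.Finite := by
  obtain ⟨d, hd⟩ := IsLocalization.exist_integer_multiples_of_finset (nonZeroDivisors ℤ)
    (Finset.univ.image a ∪ Finset.univ.image c)
  have hd0 : (d : ℤ) ≠ 0 := nonZeroDivisors.coe_ne_zero d
  have hdq : ((d : ℤ) : ℚ) ≠ 0 := by exact_mod_cast hd0
  have hcst : ∀ t : ℚ, t ∈ Finset.univ.image a ∪ Finset.univ.image c → ∃ z : ℤ, (z : ℚ) = (d : ℤ) * t := by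
    intro t ht
    obtain ⟨z, hz⟩ := hd t ht
    refine ⟨z, ?_⟩
    rw [← zsmul_eq_mul]
    exact hz
  choose a' ha' using fun i => hcst (a i) (Finset.mem_union_left _ (Finset.mem_image_of_mem a (Finset.mem_univ i)))
  choose c' hc' using fun i => hcst (c i) (Finset.mem_union_right _ (Finset.mem_image_of_mem c (Finset.mem_univ i)))
  have hc'' : ∀ i, (((d : ℤ) * c' i : ℤ) : ℚ) = (d : ℤ) ^ 2 * c i := fun i => by
    push_cast; rw [hc']; ring
  have hfin := finite_setOf_three_quad_isSquare a' (fun i => d * c' i) (fun i => by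
      have : (0 : ℚ) < (d : ℤ) ^ 2 * c i := mul_pos (by positivity) (hc i)
      rw [← hc''] at this
      exact_mod_cast this)
    (fun i j => by
      rw [← Rat.isSquare_intCast_iff, Int.cast_mul, hc'', hc'']
      obtain ⟨r, hr⟩ := hcc i j
      exact ⟨(d : ℤ) ^ 2 * r, by linear_combination ((d : ℤ) : ℚ) ^ 4 * hr⟩)
    (fun i j h => by
      have h1 : a' i = a' j := congrArg Prod.fst h
      have h2 : (d : ℤ) * c' i = d * c' j := congrArg Prod.snd h
      refine hne (Prod.ext ?_ ?_)
      · have := ha' i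
        rw [h1, ha' j] at this
        exact (mul_left_cancel₀ hdq this).symm
      · have := hc'' i
        rw [h2, hc'' j] at this
        exact (mul_left_cancel₀ (pow_ne_zero 2 hdq) this).symm)
  refine Set.Finite.of_finite_image (f := fun x : ℚ => ((d : ℤ) : ℚ) * x) (hfin.subset ?_)
    ((mul_right_injective₀ hdq).injOn)
  rintro _ ⟨x, hx, rfl⟩ i
  obtain ⟨r, hr⟩ := hx i
  have h1 : aeval (((d : ℤ) : ℚ) * x) (quad (a' i) (d * c' i)) =
      ((d : ℤ) * x - a' i) ^ 2 + ((d * c' i : ℤ) : ℚ) := by simp [quad]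
  refine ⟨(d : ℤ) * r, ?_⟩
  rw [h1, hc'', ha']
  linear_combination ((d : ℤ) : ℚ) ^ 2 * hr

end

/-- A point is determined up to two choices by its abscissa and the square of its ordinate. -/
theorem card_le_two_mul_card_image_sq {α : Type*} [DecidableEq α] (s : Finset α) (X Y : α → ℝ)
    (hinj : ∀ p ∈ s, ∀ q ∈ s, X p = X q → Y p = Y q → p = q) :
    s.card ≤ 2 * (s.image fun p => (X p, Y p ^ 2)).card := by
  refine Finset.card_le_mul_card_image s 2 fun z hz => ?_
  by_contra! h
  obtain ⟨p, q, r, hp, hq, hr, hpq, hpr, hqr⟩ := Finset.two_lt_card_iff.mp h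
  simp only [Finset.mem_filter] at hp hq hr
  obtain ⟨hp, hp'⟩ := hp
  obtain ⟨hq, hq'⟩ := hq
  obtain ⟨hr, hr'⟩ := hr
  have e1 := Prod.ext_iff.mp (hp'.trans hq'.symm)
  have e2 := Prod.ext_iff.mp (hp'.trans hr'.symm)
  have e3 := Prod.ext_iff.mp (hq'.trans hr'.symm)
  simp only at e1 e2 e3
  rcases sq_eq_sq_iff_eq_or_eq_neg.mp e1.2 with h1 | h1
  · exact hpq (hinj p hp q hq e1.1 h1)
  rcases sq_eq_sq_iff_eq_or_eq_neg.mp e2.2 with h2 | h2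
  · exact hpr (hinj p hp r hr e2.1 h2)
  · exact hqr (hinj q hq r hr e3.1 (by linarith))

theorem rationalSet_line (S : Set (EuclideanSpace ℝ (Fin 2)))
    (hS : ∀ p ∈ S, ∀ q ∈ S, ∃ d : ℚ, dist p q = (d : ℝ))
    (a b c : ℝ) (hab : (a, b) ≠ (0, 0))
    (L : Set (EuclideanSpace ℝ (Fin 2)))
    (hL : L = {p : EuclideanSpace ℝ (Fin 2) | a * p 0 + b * p 1 + c = 0})
    (hinf : (S ∩ L).Infinite) :
    (S \ L).Finite ∧ (S \ L).ncard ≤ 4 := by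
  classical
  have hdist : ∀ p q : EuclideanSpace ℝ (Fin 2),
      dist p q ^ 2 = (p 0 - q 0) ^ 2 + (p 1 - q 1) ^ 2 := by
    intro p q
    rw [EuclideanSpace.dist_eq, Real.sq_sqrt (by positivity), Fin.sum_univ_two, Real.dist_eq,
      Real.dist_eq, sq_abs, sq_abs]
  obtain ⟨A, hA⟩ := hinf.nonempty
  obtain ⟨B, hB, hBA⟩ := hinf.exists_notMem_finset {A}
  simp only [Finset.mem_singleton] at hBA
  obtain ⟨d, hd⟩ := hS A hA.1 B hB.1
  have hd0 : (0 : ℝ) < d := by rw [← hd]; exact dist_pos.mpr (Ne.symm hBA)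
  have hdd := hdist A B
  rw [hd] at hdd
  have hAL : a * A 0 + b * A 1 + c = 0 := by have := hA.2; rwa [hL] at this
  have hBL : a * B 0 + b * B 1 + c = 0 := by have := hB.2; rwa [hL] at this
  obtain ⟨e, he⟩ : ∃ e : ℝ, e = (B 0 - A 0) / d := ⟨_, rfl⟩
  obtain ⟨f, hf⟩ : ∃ f : ℝ, f = (B 1 - A 1) / d := ⟨_, rfl⟩
  have he' : B 0 - A 0 = d * e := by rw [he]; field_simp
  have hf' : B 1 - A 1 = d * f := by rw [hf]; field_simp
  have hef : e ^ 2 + f ^ 2 = 1 := by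
    have : (d : ℝ) ^ 2 * (e ^ 2 + f ^ 2) = d ^ 2 * 1 := by
      linear_combination (-(B 0 - A 0) - d * e) * he' - (B 1 - A 1 + d * f) * hf' - hdd
    exact mul_left_cancel₀ (by positivity) this
  have hperp : a * e + b * f = 0 := by
    have : (d : ℝ) * (a * e + b * f) = d * 0 := by
      linear_combination hBL - hAL - a * he' - b * hf'
    exact mul_left_cancel₀ hd0.ne' this
  let X : EuclideanSpace ℝ (Fin 2) → ℝ := fun p => (p 0 - A 0) * e + (p 1 - A 1) * f
  let Y : EuclideanSpace ℝ (Fin 2) → ℝ := fun p => (p 1 - A 1) * e - (p 0 - A 0) * f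
  have hXY : ∀ p q, dist p q ^ 2 = (X p - X q) ^ 2 + (Y p - Y q) ^ 2 := by
    intro p q
    rw [hdist]
    simp only [X, Y]
    linear_combination (-(p 0 - q 0) ^ 2 - (p 1 - q 1) ^ 2) * hef
  have hinj : ∀ p q, X p = X q → Y p = Y q → p = q := by
    intro p q h1 h2
    have := hXY p q
    rw [h1, h2] at this
    exact dist_eq_zero.mp (by simpa using this)
  have hXA : X A = 0 := by simp [X]
  have hYA : Y A = 0 := by simp [Y]
  have hXB : X B = d := by
    simp only [X, he', hf']; linear_combination (d : ℝ) * hef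
  have hYB : Y B = 0 := by simp only [Y, he', hf']; ring
  have hYL : ∀ p, p ∈ L ↔ Y p = 0 := by
    intro p
    have key : a * p 0 + b * p 1 + c = (b * e - a * f) * Y p := by
      simp only [Y]
      linear_combination hAL - (a * (p 0 - A 0) + b * (p 1 - A 1)) * hef +
        ((p 0 - A 0) * e + (p 1 - A 1) * f) * hperp
    have hne : b * e - a * f ≠ 0 := by
      intro h0
      apply hab
      have ha : a = 0 := by linear_combination -a * hef + e * hperp - f * h0
      have hb : b = 0 := by linear_combination -b * hef + f * hperp + e * h0
      rw [ha, hb]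
    rw [hL, Set.mem_ofPred_eq, key, mul_eq_zero, or_iff_right hne]
  have hXrat : ∀ p ∈ S, ∃ x : ℚ, X p = x := by
    intro p hp
    obtain ⟨r, hr⟩ := hS p hp A hA.1
    obtain ⟨s, hs⟩ := hS p hp B hB.1
    have h1 := hXY p A
    have h2 := hXY p B
    rw [hr, hXA, hYA] at h1
    rw [hs, hXB, hYB] at h2
    refine ⟨(r ^ 2 - s ^ 2 + d ^ 2) / (2 * d), ?_⟩
    push_cast
    rw [eq_div_iff (by positivity)]
    linear_combination h2 - h1
  have hYrat : ∀ p ∈ S, ∀ q ∈ S, ∃ y : ℚ, Y p * Y q = y := by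
    intro p hp q hq
    obtain ⟨x, hx⟩ := hXrat p hp
    obtain ⟨x', hx'⟩ := hXrat q hq
    obtain ⟨r, hr⟩ := hS p hp A hA.1
    obtain ⟨s, hs⟩ := hS q hq A hA.1
    obtain ⟨t, ht⟩ := hS p hp q hq
    have h1 := hXY p A
    have h2 := hXY q A
    have h3 := hXY p q
    rw [hr, hXA, hYA, hx] at h1
    rw [hs, hXA, hYA, hx'] at h2
    rw [ht, hx, hx'] at h3
    refine ⟨(r ^ 2 - x ^ 2 + (s ^ 2 - x' ^ 2) + (x - x') ^ 2 - t ^ 2) / 2, ?_⟩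
    push_cast
    linear_combination (h3 - h1 - h2) / 2
  choose! x hx using hXrat
  choose! y hy using hYrat
  suffices h : (S \ L).encard ≤ 4 by
    have hfin : (S \ L).Finite := Set.finite_of_encard_le_coe h
    refine ⟨hfin, ?_⟩
    rw [← hfin.cast_ncard_eq] at h
    exact_mod_cast h
  by_contra! hcard
  obtain ⟨T, hTS, hT⟩ := Set.exists_subset_encard_eq (Order.add_one_le_of_lt hcard)
  have hTfin : T.Finite := Set.finite_of_encard_eq_coe (k := 5) (by rw [hT]; norm_num)
  lift T to Finset (EuclideanSpace ℝ (Fin 2)) using hTfin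
  have hT5 : T.card = 5 := by
    rw [Set.encard_coe_eq_coe_finsetCard] at hT
    have : ((T.card : ℕ) : ℕ∞) = ((5 : ℕ) : ℕ∞) := by rw [hT]; norm_num
    exact_mod_cast this
  have himg := card_le_two_mul_card_image_sq T X Y fun p _ q _ => hinj p q
  obtain ⟨z₁, z₂, z₃, hz₁, hz₂, hz₃, h12, h13, h23⟩ :=
    Finset.two_lt_card_iff.mp (show 2 < (T.image fun p => (X p, Y p ^ 2)).card by omega)
  simp only [Finset.mem_image] at hz₁ hz₂ hz₃
  obtain ⟨p₁, hp₁, rfl⟩ := hz₁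
  obtain ⟨p₂, hp₂, rfl⟩ := hz₂
  obtain ⟨p₃, hp₃, rfl⟩ := hz₃
  let P : Fin 3 → EuclideanSpace ℝ (Fin 2) := ![p₁, p₂, p₃]
  have hPT : ∀ i, P i ∈ S \ L := by
    intro i
    fin_cases i
    exacts [hTS hp₁, hTS hp₂, hTS hp₃]
  have hPS : ∀ i, P i ∈ S := fun i => (hPT i).1
  have hY0 : ∀ i, Y (P i) ≠ 0 := fun i h0 => (hPT i).2 ((hYL _).mpr h0)
  have hPinj : Function.Injective fun i => (X (P i), Y (P i) ^ 2) := by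
    intro i j hij
    fin_cases i <;> fin_cases j <;> first | rfl | exfalso
    exacts [h12 hij, h13 hij, h12 hij.symm, h23 hij, h13 hij.symm, h23 hij.symm]
  have hfinite := finite_setOf_three_quadratics_isSquare (fun i => x (P i))
    (fun i => y (P i) (P i)) ?_ ?_ ?_
  · refine (hinf.image (f := x) ?_) (hfinite.subset ?_)
    · intro p hp q hq hpq
      refine hinj p q ?_ ?_
      · rw [hx p hp.1, hx q hq.1, hpq]
      · rw [(hYL p).mp hp.2, (hYL q).mp hq.2]
    · rintro _ ⟨p, hp, rfl⟩ i
      obtain ⟨r, hr⟩ := hS p hp.1 (P i) (hPS i)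
      have h1 := hXY p (P i)
      rw [hr, hx p hp.1, hx _ (hPS i), (hYL p).mp hp.2] at h1
      have h2 := hy _ (hPS i) _ (hPS i)
      refine ⟨r, ?_⟩
      have : (((x p - x (P i)) ^ 2 + y (P i) (P i) : ℚ) : ℝ) = ((r * r : ℚ) : ℝ) := by
        push_cast
        linear_combination -h1 - h2
      exact_mod_cast this
  · intro i
    have h2 := hy _ (hPS i) _ (hPS i)
    have : (0 : ℝ) < y (P i) (P i) := by rw [← h2]; exact mul_self_pos.mpr (hY0 i)
    exact_mod_cast this
  · intro i j
    refine ⟨y (P i) (P j), ?_⟩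
    have h1 := hy _ (hPS i) _ (hPS i)
    have h2 := hy _ (hPS j) _ (hPS j)
    have h3 := hy _ (hPS i) _ (hPS j)
    have : ((y (P i) (P i) * y (P j) (P j) : ℚ) : ℝ) = ((y (P i) (P j) * y (P i) (P j) : ℚ) : ℝ) := by
      push_cast
      rw [← h1, ← h2, ← h3]; ring
    exact_mod_cast this
  · intro i j hij
    apply hPinj
    simp only [Prod.mk.injEq] at hij ⊢
    rw [hx _ (hPS i), hx _ (hPS j), hij.1, sq, sq, hy _ (hPS i) _ (hPS i), hy _ (hPS j) _ (hPS j),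
      hij.2]
    exact ⟨rfl, rfl⟩
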